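/- Let f ∈ ℤ[x] be a monic polynomial irreducible over ℚ. There exist a constant c(f) > 1 and infinitely many pairs of distinct primes p₁, p₂ such that |p₁ − p₂| ≤ c(f) and f mod p₁ and f mod p₂ have the same factorization type. -/

import Mathlib

/-- The factorization type of a polynomial `f ∈ ℤ[x]` modulo a prime `p`: the multiset of the
degrees of the irreducible factors of `f mod p`. -/
noncomputable def factorizationType (f : Polynomial ℤ) (p : ℕ) (hp : p.Prime) : Multiset ℕ :=
  letI : Fact p.Prime := ⟨hp⟩
  (UniqueFactorizationMonoid.normalizedFactors
    (f.map (Int.castRingHom (ZMod p)))).map Polynomial.natDegree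

namespace BG
open Finset

lemma abel_id (f g : ℕ → ℂ) (a b : ℕ) (hab : a ≤ b) :
    ∑ k ∈ Ico a b, g k * f k = g b * ∑ k ∈ Ico a b, f k +
      ∑ k ∈ Ico a b, (g k - g (k+1)) * ∑ j ∈ Ico a (k+1), f j := by
  induction b, hab using Nat.le_induction with
  | base => simp
  | succ n hn ih =>
    rw [sum_Ico_succ_top hn, ih, sum_Ico_succ_top hn, sum_Ico_succ_top hn]
    rw [sum_Ico_succ_top hn (f := fun k => f k)]
    ring

lemma abel_bound (f g : ℕ → ℂ) (a b : ℕ) (hab : a ≤ b) (K : ℝ)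
    (hK : ∀ n, ‖∑ k ∈ Ico a n, f k‖ ≤ K) :
    ‖∑ k ∈ Ico a b, g k * f k‖ ≤ K * (‖g b‖ + ∑ k ∈ Ico a b, ‖g k - g (k+1)‖) := by
  rw [abel_id f g a b hab]
  refine (norm_add_le _ _).trans ?_
  rw [mul_add, norm_mul, mul_comm]
  refine add_le_add (mul_le_mul_of_nonneg_right (hK b) (norm_nonneg _)) ?_
  rw [mul_sum]
  refine (norm_sum_le _ _).trans (sum_le_sum fun k _ => ?_)
  rw [norm_mul, mul_comm]
  exact mul_le_mul_of_nonneg_right (hK _) (norm_nonneg _)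

/-- Abel summation with a real antitone nonnegative weight. -/
lemma abel_antitone (f : ℕ → ℂ) (g : ℕ → ℝ) (a b : ℕ) (hab : a ≤ b) (K : ℝ)
    (hK : ∀ n, ‖∑ k ∈ Ico a n, f k‖ ≤ K) (hg : ∀ k, a ≤ k → g (k+1) ≤ g k) (h0 : ∀ k, a ≤ k → 0 ≤ g k) :
    ‖∑ k ∈ Ico a b, (g k : ℂ) * f k‖ ≤ K * g a := by
  refine (abel_bound f (fun k => (g k : ℂ)) a b hab K hK).trans (le_of_eq ?_)
  congr 1
  have h1 : ∀ k ∈ Ico a b, ‖((g k : ℂ)) - (g (k+1) : ℂ)‖ = g k - g (k+1) := by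
    intro k hk
    rw [← Complex.ofReal_sub, Complex.norm_real, Real.norm_of_nonneg]
    linarith [hg k (mem_Ico.1 hk).1]
  rw [sum_congr rfl h1, Complex.norm_real, Real.norm_of_nonneg (h0 b hab)]
  have h2 : ∑ k ∈ Ico a b, (g k - g (k+1)) = g a - g b := by
    have : ∑ k ∈ Ico a b, (g k - g (k+1)) = - ∑ k ∈ Ico a b, (g (k+1) - g k) := by
      rw [← sum_neg_distrib]; exact sum_congr rfl fun _ _ => by ring
    rw [this, sum_Ico_sub g hab]; ring
  rw [h2]; ring

/-- Interval sums of a nonprincipal character. -/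
lemma char_sum_bound {r : ℕ} [NeZero r] (χ : DirichletCharacter ℂ r) (hχ : χ ≠ 1) (a n : ℕ) :
    ‖∑ k ∈ Ico a n, χ k‖ ≤ r := by
  -- complete blocks vanish
  have hper : ∀ b : ℕ, ∑ k ∈ Ico b (b + r), χ k = 0 := by
    intro b
    have h0 : ∑ x : ZMod r, χ x = 0 := MulChar.sum_eq_zero_of_ne_one hχ
    rw [← h0]
    refine sum_bij (fun k _ => (k : ZMod r)) (fun _ _ => mem_univ _) ?_ ?_ (fun _ _ => rfl)
    · intro x hx y hy h
      rw [mem_Ico] at hx hy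
      rw [ZMod.natCast_eq_natCast_iff] at h
      have h1 := (Nat.modEq_iff_dvd.1 h)
      obtain ⟨c, hc⟩ := h1
      have hr : (0:ℤ) < r := by exact_mod_cast Nat.pos_of_ne_zero (NeZero.ne r)
      have : c = 0 := by
        by_contra hne
        rcases lt_or_gt_of_ne hne with h2 | h2
        · have : (r:ℤ) * c ≤ r * (-1) := by apply mul_le_mul_of_nonneg_left <;> omega
          omega
        · have : (r:ℤ) * 1 ≤ r * c := by apply mul_le_mul_of_nonneg_left <;> omega
          omega
      rw [this] at hc; omega
    · intro x _
      refine ⟨b + (x - (b : ZMod r)).val, ?_, ?_⟩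
      · rw [mem_Ico]; have := ZMod.val_lt (x - (b : ZMod r)); omega
      · simp
  have hstep : ∀ m a' n' : ℕ, n' - a' = m → ‖∑ k ∈ Ico a' n', χ k‖ ≤ r := by
    intro m
    induction m using Nat.strong_induction_on with
    | _ m ih =>
      intro a' n' hm
      by_cases h : n' ≤ a' + r
      · refine (norm_sum_le _ _).trans ?_
        calc ∑ k ∈ Ico a' n', ‖χ k‖ ≤ ∑ k ∈ Ico a' n', (1:ℝ) := sum_le_sum fun k _ => χ.norm_le_one _
          _ = ((n' - a' : ℕ) : ℝ) := by simp
          _ ≤ r := by exact_mod_cast (by omega)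
      · push Not at h
        have hr : 0 < r := Nat.pos_of_ne_zero (NeZero.ne r)
        rw [← sum_Ico_consecutive _ (show a' ≤ a' + r by omega) h.le, hper, zero_add]
        exact ih (n' - (a' + r)) (by omega) _ _ rfl
  exact hstep _ a n rfl

end BG

namespace BG
open Finset Complex

lemma cpow_diff_bound (n : ℕ) (hn : 1 ≤ n) (s : ℂ) (hs : 0 < s.re) :
    ‖(n:ℂ)^(-s) - ((n+1 : ℕ):ℂ)^(-s)‖ ≤ ‖s‖ * (n:ℝ)^(-s.re-1) := by
  have hn0 : (0:ℝ) < n := by exact_mod_cast hn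
  have hs0 : s ≠ 0 := by rintro rfl; simp at hs
  have h1 : ∀ x ∈ Set.Icc (n:ℝ) (n+1), HasDerivWithinAt (fun y : ℝ => (y:ℂ)^(-s)) (-s * (x:ℂ)^(-s-1)) (Set.Icc (n:ℝ) (n+1)) x := by
    intro x hx
    have hx0 : 0 < x := lt_of_lt_of_le hn0 hx.1
    exact (hasDerivAt_ofReal_cpow_const hx0.ne' (neg_ne_zero.2 hs0)).hasDerivWithinAt
  have h2 : ∀ x ∈ Set.Ico (n:ℝ) (n+1), ‖-s * (x:ℂ)^(-s-1)‖ ≤ ‖s‖ * (n:ℝ)^(-s.re-1) := by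
    intro x hx
    have hx0 : 0 < x := lt_of_lt_of_le hn0 hx.1
    rw [norm_mul, norm_neg, norm_cpow_eq_rpow_re_of_pos hx0]
    refine mul_le_mul_of_nonneg_left ?_ (norm_nonneg _)
    simp only [sub_re, neg_re, one_re]
    exact Real.rpow_le_rpow_of_nonpos hn0 hx.1 (by linarith)
  have h3 := norm_image_sub_le_of_norm_deriv_le_segment' h1 h2 (n+1) ⟨by linarith, le_refl _⟩
  simp only [add_sub_cancel_left, mul_one] at h3
  rw [norm_sub_rev]
  push_cast
  simpa using h3

lemma min_interp (n r : ℕ) (hn : 1 ≤ n) (hr : 1 ≤ r) (e : ℝ) (h0 : 0 ≤ e) (h1 : e ≤ 1) (x : ℝ) (hx0 : 0 ≤ x)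
    (hxn : x ≤ n) (hxr : x ≤ r) : x ≤ (n:ℝ)^(1-e) * (r:ℝ)^e := by
  rcases hx0.eq_or_lt with rfl | hx
  · positivity
  calc x = x^(1-e) * x^e := by rw [← Real.rpow_add hx]; simp
    _ ≤ (n:ℝ)^(1-e) * (r:ℝ)^e := by gcongr

/-- Abel-summed terms of the Dirichlet series. -/
noncomputable def Lterm {r : ℕ} (χ : DirichletCharacter ℂ r) (n : ℕ) (s : ℂ) : ℂ :=
  (((n+1 : ℕ):ℂ)^(-s) - ((n+1+1 : ℕ):ℂ)^(-s)) * ∑ k ∈ Ico 1 (n+1+1), χ k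

lemma Lterm_bound {r : ℕ} [NeZero r] (χ : DirichletCharacter ℂ r) (hχ : χ ≠ 1) (η : ℝ) (h0 : 0 < η) (h1 : η ≤ 1/4)
    (n : ℕ) (s : ℂ) (hs : 1 - η ≤ s.re) (hs3 : ‖s‖ ≤ 3) :
    ‖Lterm χ n s‖ ≤ 3 * (r:ℝ)^(2*η) * ((n+1 : ℕ):ℝ)^(-(1+η)) := by
  have hr : 1 ≤ r := Nat.pos_of_ne_zero (NeZero.ne r)
  have hS : ‖∑ k ∈ Ico 1 (n+1+1), χ k‖ ≤ ((n+1 : ℕ):ℝ)^(1-2*η) * (r:ℝ)^(2*η) := by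
    refine min_interp (n+1) r (by omega) hr (2*η) (by linarith) (by linarith) _ (norm_nonneg _) ?_ (char_sum_bound χ hχ _ _)
    refine (norm_sum_le _ _).trans ?_
    calc ∑ k ∈ Ico 1 (n+1+1), ‖χ k‖ ≤ ∑ k ∈ Ico 1 (n+1+1), (1:ℝ) := sum_le_sum fun k _ => χ.norm_le_one _
      _ = _ := by simp
  have hd := cpow_diff_bound (n+1) (by omega) s (by linarith)
  have hn1 : (1:ℝ) ≤ ((n+1:ℕ):ℝ) := by push_cast; linarith [(Nat.cast_nonneg n : (0:ℝ) ≤ n)]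
  unfold Lterm
  rw [norm_mul]
  calc _ ≤ (‖s‖ * ((n+1:ℕ):ℝ)^(-s.re-1)) * (((n+1 : ℕ):ℝ)^(1-2*η) * (r:ℝ)^(2*η)) := by gcongr
    _ ≤ (3 * ((n+1:ℕ):ℝ)^(-(1-η)-1)) * (((n+1 : ℕ):ℝ)^(1-2*η) * (r:ℝ)^(2*η)) := by
        gcongr
    _ = 3 * (r:ℝ)^(2*η) * (((n+1:ℕ):ℝ)^(-(1-η)-1) * ((n+1 : ℕ):ℝ)^(1-2*η)) := by ring
    _ = _ := by rw [← Real.rpow_add (by linarith)]; ring_nf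

lemma summable_eta (η : ℝ) (h0 : 0 < η) : Summable (fun n : ℕ => ((n+1 : ℕ):ℝ)^(-(1+η))) := by
  rw [summable_nat_add_iff 1 (f := fun n : ℕ => (n:ℝ)^(-(1+η)))]
  exact Real.summable_nat_rpow.2 (by linarith)

lemma LFunction_eq_Lterm {r : ℕ} [NeZero r] (χ : DirichletCharacter ℂ r) (hχ : χ ≠ 1) (s : ℂ) (hs : 1 < s.re) (hs3 : ‖s‖ ≤ 3) :
    χ.LFunction s = ∑' n, Lterm χ n s := by
  have hsum := χ.LSeriesSummable_of_one_lt_re hs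
  have hL : HasSum (fun n : ℕ => LSeries.term (fun n => χ n) s n) (χ.LFunction s) := by
    rw [χ.LFunction_eq_LSeries hs]; exact hsum.LSeriesHasSum
  have hG : Summable (fun n => Lterm χ n s) := by
    refine Summable.of_norm_bounded ((summable_eta (1/4) (by norm_num)).mul_left (3 * (r:ℝ)^(2*(1/4:ℝ)))) fun n => ?_
    exact Lterm_bound χ hχ (1/4) (by norm_num) le_rfl n s (by linarith) hs3
  have hL1 := hL.tendsto_sum_nat.comp (Filter.tendsto_add_atTop_nat 1)
  have hG1 := hG.hasSum.tendsto_sum_nat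
  have hz : Filter.Tendsto (fun N : ℕ => ((N+1 : ℕ):ℂ)^(-s) * ∑ k ∈ Ico 1 (N+1), χ k) Filter.atTop (nhds 0) := by
    have h1 : Filter.Tendsto (fun N : ℕ => ((N+1 : ℕ):ℝ)^(-s.re) * (r:ℝ)) Filter.atTop (nhds 0) := by
      have := (tendsto_rpow_neg_atTop (y := s.re) (by linarith)).comp (tendsto_natCast_atTop_atTop (R := ℝ))
      have := (this.comp (Filter.tendsto_add_atTop_nat 1)).mul_const (r:ℝ)
      simpa [Function.comp_def] using this
    refine squeeze_zero_norm (fun N => ?_) h1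
    rw [norm_mul]
    refine mul_le_mul ?_ (char_sum_bound χ hχ _ _) (norm_nonneg _) (by positivity)
    rw [norm_natCast_cpow_of_pos (by omega)]; simp
  have heq : ∀ N : ℕ, ∑ k ∈ range (N+1), LSeries.term (fun n => χ n) s k =
      ((N+1 : ℕ):ℂ)^(-s) * ∑ k ∈ Ico 1 (N+1), χ k + ∑ k ∈ range N, Lterm χ k s := by
    intro N
    have := abel_id (fun k => χ k) (fun k : ℕ => (k:ℂ)^(-s)) 1 (N+1) (by omega)
    have h2 : ∑ k ∈ Ico 1 (N+1), (k:ℂ)^(-s) * χ k = ∑ k ∈ range (N+1), LSeries.term (fun n => χ n) s k := by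
      rw [range_eq_Ico, sum_eq_sum_Ico_succ_bot (a := 0) (b := N+1) (by omega) (fun k => LSeries.term (fun n => χ n) s k), LSeries.term_zero, zero_add]
      refine sum_congr rfl fun k hk => ?_
      rw [LSeries.term_of_ne_zero (by have := (mem_Ico.1 hk).1; omega), cpow_neg, div_eq_mul_inv, mul_comm]
    rw [← h2, this]
    congr 1
    rw [sum_Ico_eq_sum_range]
    simp only [Nat.add_sub_cancel]
    refine sum_congr rfl fun k hk => ?_
    unfold Lterm
    rw [show 1 + k = k + 1 by ring]
  have h3 := hz.add hG1
  rw [zero_add] at h3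
  refine tendsto_nhds_unique (f := fun N : ℕ => ∑ k ∈ range (N+1), LSeries.term (fun n => χ n) s k) hL1 ?_
  exact h3.congr fun N => (heq N).symm

lemma LFunction_bound (η : ℝ) (h0 : 0 < η) (h1 : η ≤ 1/4) : ∃ C : ℝ, 1 ≤ C ∧ ∀ (r : ℕ) [NeZero r]
    (χ : DirichletCharacter ℂ r), χ ≠ 1 → ∀ s : ℂ, 1 - η < s.re → ‖s‖ < 3 → ‖χ.LFunction s‖ ≤ C * (r:ℝ)^(2*η) := by
  refine ⟨1 + 3 * ∑' n : ℕ, ((n+1 : ℕ):ℝ)^(-(1+η)), ?_, ?_⟩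
  · have : 0 ≤ ∑' n : ℕ, ((n+1 : ℕ):ℝ)^(-(1+η)) := tsum_nonneg fun n => by positivity
    linarith
  intro r _ χ hχ s hs hs3
  set U : Set ℂ := {s | 1 - η < s.re} ∩ Metric.ball 0 3 with hU
  have hUo : IsOpen U := (isOpen_lt continuous_const continuous_re).inter Metric.isOpen_ball
  have hUc : IsPreconnected U := by
    refine ((convex_halfSpace_re_gt _).inter (convex_ball _ _)).isPreconnected
  have hsu := (summable_eta η h0).mul_left (3 * (r:ℝ)^(2*η))
  have hb : ∀ n, ∀ z ∈ U, ‖Lterm χ n z‖ ≤ 3 * (r:ℝ)^(2*η) * ((n+1 : ℕ):ℝ)^(-(1+η)) := fun n z hz =>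
    Lterm_bound χ hχ η h0 h1 n z (le_of_lt hz.1) (by have := hz.2; rw [mem_ball_zero_iff] at this; exact this.le)
  have hdiff : DifferentiableOn ℂ (fun z => ∑' n, Lterm χ n z) U := by
    refine differentiableOn_tsum_of_summable_norm hsu (fun n => ?_) hUo hb
    unfold Lterm
    intro z hz
    have e1 : ((n+1:ℕ):ℂ) ≠ 0 := Nat.cast_ne_zero.2 (by omega)
    have e2 : ((n+1+1:ℕ):ℂ) ≠ 0 := Nat.cast_ne_zero.2 (by omega)
    exact (((differentiableAt_id.neg.const_cpow (Or.inl e1)).sub (differentiableAt_id.neg.const_cpow (Or.inl e2))).mul_const _).differentiableWithinAt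
  have hLd : DifferentiableOn ℂ χ.LFunction U := (DirichletCharacter.differentiable_LFunction hχ).differentiableOn
  have h2 : (2:ℂ) ∈ U := ⟨by simp; linarith, by simp; norm_num⟩
  have heq : Set.EqOn χ.LFunction (fun z => ∑' n, Lterm χ n z) U := by
    refine (hLd.analyticOnNhd hUo).eqOn_of_preconnected_of_eventuallyEq (hdiff.analyticOnNhd hUo) hUc h2 ?_
    have : {z : ℂ | 1 < z.re} ∩ Metric.ball 0 3 ∈ nhds (2:ℂ) :=
      ((isOpen_lt continuous_const continuous_re).inter Metric.isOpen_ball).mem_nhds ⟨by simp, by simp; norm_num⟩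
    filter_upwards [this] with z hz
    exact LFunction_eq_Lterm χ hχ z hz.1 (by have := hz.2; rw [mem_ball_zero_iff] at this; exact this.le)
  have hsU : s ∈ U := ⟨hs, by simpa using hs3⟩
  rw [heq hsU]
  refine (tsum_of_norm_bounded hsu.hasSum (fun n => hb n s hsU)).trans ?_
  rw [tsum_mul_left]
  have : 0 ≤ (r:ℝ)^(2*η) := by positivity
  nlinarith
end BG

namespace BG
open Finset Complex
open scoped ComplexConjugate

/-- A Dirichlet character of some level. -/
abbrev Ch := Σ r : ℕ, DirichletCharacter ℂ r

/-- The character `χ₁ · conj χ₂` modulo `r₁ r₂`. -/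
noncomputable def prodChar {r₁ r₂ : ℕ} (χ₁ : DirichletCharacter ℂ r₁) (χ₂ : DirichletCharacter ℂ r₂) :
    DirichletCharacter ℂ (r₁ * r₂) :=
  DirichletCharacter.changeLevel (dvd_mul_right r₁ r₂) χ₁ *
    (DirichletCharacter.changeLevel (dvd_mul_left r₂ r₁) χ₂)⁻¹

lemma changeLevel_nat {r m : ℕ} (h : r ∣ m) (χ : DirichletCharacter ℂ r) (n : ℕ) (hn : IsUnit (n : ZMod m)) :
    DirichletCharacter.changeLevel h χ n = χ n := by
  have := DirichletCharacter.changeLevel_eq_cast_of_dvd χ h hn.unit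
  rw [IsUnit.unit_spec] at this
  rw [this, ZMod.cast_natCast h]

lemma char_zero_of_not_coprime {r : ℕ} (χ : DirichletCharacter ℂ r) (n : ℕ) (hn : ¬ n.Coprime r) : χ n = 0 :=
  χ.map_nonunit (by rwa [ZMod.isUnit_iff_coprime])

lemma prodChar_apply {r₁ r₂ : ℕ} [NeZero r₁] [NeZero r₂] (χ₁ : DirichletCharacter ℂ r₁) (χ₂ : DirichletCharacter ℂ r₂) (n : ℕ) :
    prodChar χ₁ χ₂ n = χ₁ n * conj (χ₂ n) := by
  have : NeZero (r₁ * r₂) := ⟨mul_ne_zero (NeZero.ne _) (NeZero.ne _)⟩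
  by_cases hn : IsUnit (n : ZMod (r₁ * r₂))
  · unfold prodChar
    rw [MulChar.mul_apply, ← MulChar.star_eq_inv, MulChar.star_apply, changeLevel_nat _ _ _ hn, changeLevel_nat _ _ _ hn]
    rfl
  · rw [MulChar.map_nonunit _ hn]
    rw [ZMod.isUnit_iff_coprime, Nat.coprime_mul_iff_right, not_and_or] at hn
    rcases hn with h | h
    · rw [char_zero_of_not_coprime χ₁ n h, zero_mul]
    · rw [char_zero_of_not_coprime χ₂ n h]; simp

lemma prodChar_ne_one {r₁ r₂ : ℕ} [NeZero r₁] [NeZero r₂] (χ₁ : DirichletCharacter ℂ r₁) (χ₂ : DirichletCharacter ℂ r₂)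
    (h₁ : χ₁.IsPrimitive) (h₂ : χ₂.IsPrimitive) (hne : (⟨r₁, χ₁⟩ : Ch) ≠ ⟨r₂, χ₂⟩) : prodChar χ₁ χ₂ ≠ 1 := by
  have : NeZero (r₁ * r₂) := ⟨mul_ne_zero (NeZero.ne _) (NeZero.ne _)⟩
  intro h
  unfold prodChar at h
  rw [mul_inv_eq_one] at h
  have hc := congrArg DirichletCharacter.conductor h
  rw [DirichletCharacter.conductor_changeLevel, DirichletCharacter.conductor_changeLevel, h₁, h₂] at hc
  subst hc
  have := DirichletCharacter.changeLevel_injective (R := ℂ) (dvd_mul_right r₁ r₁) h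
  exact hne (by rw [this])

lemma pos_comb {a : ℝ} (ha₀ : 0 ≤ a) (ha₁ : a < 1) {z₁ z₂ : ℂ} (h₁ : ‖z₁‖ ≤ 1) (h₂ : ‖z₂‖ ≤ 1) :
      0 ≤ 3 * (-log (1 - a)).re + 2 * (-log (1 - z₁ * a)).re + 2 * (-log (1 - z₂ * a)).re
        + 2 * (-log (1 - z₁ * conj z₂ * a)).re := by
  have hac₀ : ‖(a : ℂ)‖ < 1 := by simp only [Complex.norm_of_nonneg ha₀, ha₁]
  have hac : ∀ z : ℂ, ‖z‖ ≤ 1 → ‖z * a‖ < 1 := fun z hz => by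
    rw [norm_mul]; nlinarith [norm_nonneg z, norm_nonneg (a:ℂ)]
  have h₃ : ‖z₁ * conj z₂‖ ≤ 1 := by
    rw [norm_mul, norm_conj]; exact mul_le_one₀ h₁ (norm_nonneg _) h₂
  rw [← (((hasSum_re <| hasSum_taylorSeries_neg_log hac₀).mul_left 3).add
    ((hasSum_re <| hasSum_taylorSeries_neg_log (hac z₁ h₁)).mul_left 2) |>.add
    ((hasSum_re <| hasSum_taylorSeries_neg_log (hac z₂ h₂)).mul_left 2) |>.add
    ((hasSum_re <| hasSum_taylorSeries_neg_log (hac _ h₃)).mul_left 2)) |>.tsum_eq]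
  refine tsum_nonneg fun n ↦ ?_
  have hw₁ : ‖z₁ ^ n‖ ≤ 1 := by rw [norm_pow]; exact pow_le_one₀ (norm_nonneg _) h₁
  have hw₂ : ‖z₂ ^ n‖ ≤ 1 := by rw [norm_pow]; exact pow_le_one₀ (norm_nonneg _) h₂
  simp only [← ofReal_pow, div_natCast_re, mul_pow, re_mul_ofReal, ofReal_re, ← map_pow]
  have hq : 0 ≤ 3 + 2 * (z₁^n).re + 2 * (z₂^n).re + 2 * (z₁^n * conj (z₂^n)).re := by
    have e1 : (z₁^n).re^2 + (z₁^n).im^2 ≤ 1 := by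
      have := Complex.sq_norm (z₁^n); rw [normSq_apply] at this; nlinarith [norm_nonneg (z₁^n)]
    have e2 : (z₂^n).re^2 + (z₂^n).im^2 ≤ 1 := by
      have := Complex.sq_norm (z₂^n); rw [normSq_apply] at this; nlinarith [norm_nonneg (z₂^n)]
    simp only [mul_re, conj_re, conj_im]
    nlinarith [sq_nonneg (1 + (z₁^n).re + (z₂^n).re), sq_nonneg ((z₁^n).im + (z₂^n).im)]
  have : 3 * (a^n / n) + 2 * ((z₁^n).re * a^n / n) + 2 * ((z₂^n).re * a^n / n) + 2 * ((z₁^n * conj (z₂^n)).re * a^n / n)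
     = (3 + 2 * (z₁^n).re + 2 * (z₂^n).re + 2 * (z₁^n * conj (z₂^n)).re) * (a^n / n) := by ring
  rw [this]
  positivity

lemma zeta_bound (σ : ℝ) (hσ : 1 < σ) : ∑' n : ℕ, 1 / ((n:ℝ) + 1) ^ σ ≤ 1 + 1 / (σ - 1) := by
  have h := ZetaAsymptotics.zeta_limit_aux1 hσ
  have : 0 ≤ ZetaAsymptotics.termTSum σ := tsum_nonneg fun n => ZetaAsymptotics.term_nonneg _ _
  nlinarith

lemma char_series_bound {r : ℕ} (f : ℕ → ℂ) (hf : ∀ n, ‖f n‖ ≤ 1) (s : ℂ) (hs : 1 < s.re) :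
    ‖LSeries f s‖ ≤ 1 + 1 / (s.re - 1) := by
  refine le_trans ?_ (zeta_bound s.re hs)
  have hsum : Summable (fun n : ℕ => 1 / ((n:ℝ)+1)^s.re) := by
    have := (summable_nat_add_iff 1).2 (Real.summable_one_div_nat_rpow.2 hs)
    simpa using this
  have h1 : Summable (fun n : ℕ => ‖LSeries.term f s n‖) := by
    refine (summable_nat_add_iff 1).1 (hsum.of_nonneg_of_le (fun _ => norm_nonneg _) fun n => ?_)
    rw [LSeries.norm_term_eq]; simp only [Nat.add_eq_zero_iff, one_ne_zero, and_false, if_false]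
    push_cast
    gcongr; exact hf _
  unfold LSeries
  refine (norm_tsum_le_tsum_norm h1).trans ?_
  rw [h1.tsum_eq_zero_add]
  simp only [LSeries.term_zero, norm_zero, zero_add]
  refine Summable.tsum_le_tsum (fun n => ?_) ((summable_nat_add_iff 1).2 h1) hsum
  rw [LSeries.norm_term_eq]; simp only [Nat.add_eq_zero_iff, one_ne_zero, and_false, if_false]
  push_cast
  gcongr; exact hf _

lemma product_ge_one {r₁ r₂ : ℕ} [NeZero r₁] [NeZero r₂] (χ₁ : DirichletCharacter ℂ r₁) (χ₂ : DirichletCharacter ℂ r₂)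
    (x : ℝ) (hx : 0 < x) :
    1 ≤ (1 + 1/x)^3 * ‖χ₁.LFunction (1 + x)‖^2 * ‖χ₂.LFunction (1+x)‖^2 * ‖(prodChar χ₁ χ₂).LFunction (1 + x)‖^2 := by
  have : NeZero (r₁ * r₂) := ⟨mul_ne_zero (NeZero.ne _) (NeZero.ne _)⟩
  have h₀ : 1 < (1 + x : ℂ).re := by simp [hx]
  have H₀ := DirichletCharacter.summable_neg_log_one_sub_mul_prime_cpow (N := 1) 1 h₀
  have H₁ := DirichletCharacter.summable_neg_log_one_sub_mul_prime_cpow χ₁ h₀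
  have H₂ := DirichletCharacter.summable_neg_log_one_sub_mul_prime_cpow χ₂ h₀
  have H₃ := DirichletCharacter.summable_neg_log_one_sub_mul_prime_cpow (prodChar χ₁ χ₂) h₀
  have s₀ := (hasSum_re H₀.hasSum).summable.mul_left 3
  have s₁ := (hasSum_re H₁.hasSum).summable.mul_left 2
  have s₂ := (hasSum_re H₂.hasSum).summable.mul_left 2
  have s₃ := (hasSum_re H₃.hasSum).summable.mul_left 2
  have hz := char_series_bound (r := 1) (fun n => (1 : DirichletCharacter ℂ 1) n) (fun n => DirichletCharacter.norm_le_one _ _) (1+x) h₀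
  have hre : (1 + x : ℂ).re - 1 = x := by simp
  rw [hre] at hz
  have key : 1 ≤ ‖LSeries (fun n => (1 : DirichletCharacter ℂ 1) n) (1 + x)‖ ^ 3 *
     ‖χ₁.LFunction (1 + x)‖^2 * ‖χ₂.LFunction (1+x)‖^2 * ‖(prodChar χ₁ χ₂).LFunction (1 + x)‖^2 := by
    rw [DirichletCharacter.LFunction_eq_LSeries _ h₀, DirichletCharacter.LFunction_eq_LSeries _ h₀, DirichletCharacter.LFunction_eq_LSeries _ h₀,
      ← DirichletCharacter.LSeries_eulerProduct_exp_log _ h₀, ← DirichletCharacter.LSeries_eulerProduct_exp_log _ h₀,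
      ← DirichletCharacter.LSeries_eulerProduct_exp_log _ h₀, ← DirichletCharacter.LSeries_eulerProduct_exp_log _ h₀]
    simp only [norm_exp, ← Real.exp_nat_mul, ← Real.exp_add, Real.one_le_exp_iff, Nat.cast_ofNat]
    rw [re_tsum H₀, re_tsum H₁, re_tsum H₂, re_tsum H₃, ← tsum_mul_left, ← tsum_mul_left, ← tsum_mul_left, ← tsum_mul_left,
      ← s₀.tsum_add s₁, ← (s₀.add s₁).tsum_add s₂, ← ((s₀.add s₁).add s₂).tsum_add s₃]
    refine tsum_nonneg fun p => ?_
    have hp : ((p:ℕ):ℝ) ^ (-(1+x)) < 1 := by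
      rw [Real.rpow_neg (Nat.cast_nonneg _), inv_lt_one_iff₀]
      exact .inr <| Real.one_lt_rpow (mod_cast p.2.one_lt) <| by linarith
    have := pos_comb (a := ((p:ℕ):ℝ) ^ (-(1+x))) (by positivity) hp (χ₁.norm_le_one p) (χ₂.norm_le_one p)
    rw [ofReal_cpow (Nat.cast_nonneg _)] at this
    push_cast at this
    rw [prodChar_apply, MulChar.one_apply (isUnit_of_subsingleton _), one_mul]
    exact this
  refine key.trans ?_
  gcongr
end BG

namespace BG
open Finset Complex

lemma LFunction_near_zero (η : ℝ) (h0 : 0 < η) (h1 : η ≤ 1/4) : ∃ C : ℝ, 1 ≤ C ∧ ∀ (r : ℕ) [NeZero r]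
    (χ : DirichletCharacter ℂ r), χ ≠ 1 →
    (∀ s : ℂ, ‖s - 1‖ < η → ‖χ.LFunction s‖ ≤ C * (r:ℝ)^(2*η)) ∧
    (∀ (δ : ℝ) (ρ : ℂ), 0 < δ → δ ≤ η/4 → ‖ρ - 1‖ ≤ δ → χ.LFunction ρ = 0 →
      ‖χ.LFunction (1 + δ)‖ ≤ 8 * C / η * (r:ℝ)^(2*η) * δ) := by
  obtain ⟨C, hC1, hC⟩ := LFunction_bound η h0 h1
  refine ⟨C, hC1, ?_⟩
  intro r _ χ hχ
  have hb : ∀ s : ℂ, ‖s - 1‖ < η → ‖χ.LFunction s‖ ≤ C * (r:ℝ)^(2*η) := by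
    intro s hs
    refine hC r χ hχ s ?_ ?_
    · have := (abs_le.1 (abs_re_le_norm (s-1))).1
      simp at this; linarith
    · have : ‖s‖ ≤ ‖s - 1‖ + ‖(1:ℂ)‖ := by simpa using norm_add_le (s-1) 1
      simp at this; linarith
  refine ⟨hb, ?_⟩
  intro δ ρ hδ0 hδ hρ hz
  have hd := DirichletCharacter.differentiable_LFunction hχ
  have hder : ∀ s ∈ Metric.ball (1:ℂ) (η/2), ‖deriv χ.LFunction s‖ ≤ C * (r:ℝ)^(2*η) / (η/4) := by
    intro s hs
    refine Complex.norm_deriv_le_of_forall_mem_sphere_norm_le (by linarith) hd.diffContOnCl fun z hz => hb z ?_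
    rw [mem_ball_iff_norm] at hs; rw [mem_sphere_iff_norm] at hz
    calc ‖z - 1‖ ≤ ‖z - s‖ + ‖s - 1‖ := norm_sub_le_norm_sub_add_norm_sub _ _ _
      _ < η := by linarith
  have hx : ρ ∈ Metric.ball (1:ℂ) (η/2) := by rw [mem_ball_iff_norm]; linarith
  have hy : (1 + δ : ℂ) ∈ Metric.ball (1:ℂ) (η/2) := by
    rw [mem_ball_iff_norm]; simp [abs_of_pos hδ0]; linarith
  have := Convex.norm_image_sub_le_of_norm_deriv_le (fun x _ => hd x) hder (convex_ball _ _) hx hy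
  rw [hz, sub_zero] at this
  refine this.trans ?_
  have h2 : ‖(1 + δ : ℂ) - ρ‖ ≤ 2 * δ := by
    have : (1 + δ : ℂ) - ρ = δ - (ρ - 1) := by ring
    rw [this]; refine (norm_sub_le _ _).trans ?_
    rw [Complex.norm_real, Real.norm_of_nonneg hδ0.le]; linarith
  have hr0 : 0 ≤ (r:ℝ)^(2*η) := by positivity
  calc _ ≤ C * (r:ℝ)^(2*η) / (η/4) * (2*δ) := by gcongr
    _ = _ := by field_simp; ring

lemma repulsion (η : ℝ) (h0 : 0 < η) (h1 : η ≤ 1/4) : ∃ C : ℝ, 0 < C ∧ ∀ (r₁ r₂ : ℕ) [NeZero r₁] [NeZero r₂]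
    (χ₁ : DirichletCharacter ℂ r₁) (χ₂ : DirichletCharacter ℂ r₂), χ₁ ≠ 1 → χ₂ ≠ 1 →
    χ₁.IsPrimitive → χ₂.IsPrimitive → (⟨r₁, χ₁⟩ : Ch) ≠ ⟨r₂, χ₂⟩ → ∀ X δ : ℝ, (r₁:ℝ) ≤ X → (r₂:ℝ) ≤ X →
    0 < δ → δ ≤ η / 4 → ∀ ρ₁ ρ₂ : ℂ, ‖ρ₁ - 1‖ ≤ δ → ‖ρ₂ - 1‖ ≤ δ → χ₁.LFunction ρ₁ = 0 → χ₂.LFunction ρ₂ = 0 →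
    1 ≤ C * δ * X^(16*η) := by
  obtain ⟨C, hC1, hC⟩ := LFunction_near_zero η h0 h1
  refine ⟨8 * (8*C/η)^4 * C^2, by positivity, ?_⟩
  intro r₁ r₂ _ _ χ₁ χ₂ hχ₁ hχ₂ p₁ p₂ hne X δ hX₁ hX₂ hδ0 hδ ρ₁ ρ₂ d₁ d₂ z₁ z₂
  have : NeZero (r₁ * r₂) := ⟨mul_ne_zero (NeZero.ne _) (NeZero.ne _)⟩
  have hX : 0 < X := lt_of_lt_of_le (by exact_mod_cast Nat.pos_of_ne_zero (NeZero.ne r₁)) hX₁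
  have b₁ := (hC r₁ χ₁ hχ₁).2 δ ρ₁ hδ0 hδ d₁ z₁
  have b₂ := (hC r₂ χ₂ hχ₂).2 δ ρ₂ hδ0 hδ d₂ z₂
  have b₃ := (hC _ (prodChar χ₁ χ₂) (prodChar_ne_one χ₁ χ₂ p₁ p₂ hne)).1 (1 + δ) (by simp [abs_of_pos hδ0]; linarith)
  have hprod := product_ge_one χ₁ χ₂ δ hδ0
  have c₁ : ‖χ₁.LFunction (1 + δ)‖ ≤ 8 * C / η * X^(2*η) * δ := b₁.trans (by gcongr)
  have c₂ : ‖χ₂.LFunction (1 + δ)‖ ≤ 8 * C / η * X^(2*η) * δ := b₂.trans (by gcongr)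
  have c₃ : ‖(prodChar χ₁ χ₂).LFunction (1 + δ)‖ ≤ C * X^(4*η) := by
    refine b₃.trans ?_
    gcongr
    rw [show 4*η = 2*η + 2*η by ring, Real.rpow_add hX]
    push_cast
    rw [Real.mul_rpow (by positivity) (by positivity)]
    gcongr
  have hδ1 : 1 + 1/δ ≤ 2/δ := by
    rw [add_div' _ _ _ hδ0.ne', div_le_div_iff_of_pos_right hδ0]; linarith
  calc (1:ℝ) ≤ _ := hprod
    _ ≤ (2/δ)^3 * (8 * C / η * X^(2*η) * δ)^2 * (8 * C / η * X^(2*η) * δ)^2 * (C * X^(4*η))^2 := by gcongr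
    _ = 8 * (8*C/η)^4 * C^2 * δ * ((X^(2*η))^4 * (X^(4*η))^2) := by field_simp; ring
    _ = _ := by
      rw [← Real.rpow_mul_natCast hX.le, ← Real.rpow_mul_natCast hX.le, ← Real.rpow_add hX]
      congr 2; push_cast; ring

/-- The character `c` has a zero close to `1` at scale `ℓ`. -/
def BadCh (B : ℕ) (ℓ : ℝ) (c : Ch) : Prop :=
  1 < c.1 ∧ c.2.IsPrimitive ∧ (c.1:ℝ) ≤ ℓ^B ∧ ∃ _ : NeZero c.1, ∃ ρ : ℂ, ‖ρ - 1‖ ≤ ℓ^(-(1/2:ℝ)) ∧ c.2.LFunction ρ = 0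

lemma ne_one_of_primitive {r : ℕ} (hr : 1 < r) (χ : DirichletCharacter ℂ r) (h : χ.IsPrimitive) : χ ≠ 1 := by
  rintro rfl
  have : NeZero r := ⟨by omega⟩
  unfold DirichletCharacter.IsPrimitive at h
  rw [DirichletCharacter.conductor_one] at h
  omega

lemma exists_good (B : ℕ) (hB : 1 ≤ B) (L0 : ℝ) : ∃ ℓ ≥ L0, ∀ c : Ch, ¬ BadCh B ℓ c := by
  have hBr : (1:ℝ) ≤ B := by exact_mod_cast hB
  set η : ℝ := 1 / (64 * B) with hη
  have hη0 : 0 < η := by positivity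
  have hη1 : η ≤ 1/4 := by
    rw [hη, div_le_div_iff₀ (by positivity) (by norm_num)]; linarith
  obtain ⟨C, hC0, hC⟩ := repulsion η hη0 hη1
  -- largeness
  have hlim : Filter.Tendsto (fun ℓ : ℝ => C * 2 * ℓ^(-(1/4:ℝ))) Filter.atTop (nhds 0) := by
    simpa using (tendsto_rpow_neg_atTop (y := 1/4) (by norm_num)).const_mul (C*2)
  have hlim2 : Filter.Tendsto (fun ℓ : ℝ => ℓ^(-(1/2:ℝ))) Filter.atTop (nhds 0) :=
    tendsto_rpow_neg_atTop (y := 1/2) (by norm_num)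
  obtain ⟨L1, hL1⟩ := Filter.eventually_atTop.1 ((hlim.eventually (gt_mem_nhds one_pos)).and
    ((hlim2.eventually (gt_mem_nhds (show 0 < η/4 by positivity))).and (Filter.eventually_ge_atTop (1:ℝ))))
  by_contra hcon
  push Not at hcon
  set L := max L0 L1 with hL
  have hLge : L1 ≤ L := le_max_right _ _
  have hLpos : 1 ≤ L := (hL1 L hLge).2.2
  obtain ⟨c, hc⟩ := hcon L (le_max_left _ _)
  have hpow : ∀ j : ℕ, L ≤ L * 2^j := fun j => le_mul_of_one_le_right (by linarith) (one_le_pow₀ (by norm_num))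
  have hex : ∃ j : ℕ, ¬ BadCh B (L * 2^j) c := by
    obtain ⟨h1, hp, hr, hnz, -⟩ := hc
    have hχ := ne_one_of_primitive h1 c.2 hp
    have hcont := (DirichletCharacter.differentiable_LFunction hχ).continuous.continuousAt (x := 1)
    have hne : c.2.LFunction 1 ≠ 0 := DirichletCharacter.LFunction_apply_one_ne_zero hχ
    obtain ⟨ε, hε, hball⟩ := Metric.eventually_nhds_iff.1 (hcont.eventually_ne hne)
    have ht : Filter.Tendsto (fun j : ℕ => L * 2^j) Filter.atTop Filter.atTop :=
      (tendsto_pow_atTop_atTop_of_one_lt (by norm_num : (1:ℝ) < 2)).const_mul_atTop (by linarith)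
    obtain ⟨j, hj⟩ := ((hlim2.comp ht).eventually (gt_mem_nhds hε)).exists
    refine ⟨j, ?_⟩
    rintro ⟨-, -, -, _, ρ, hρ, hz⟩
    exact hball (y := ρ) (by rw [dist_eq_norm]; exact hρ.trans_lt hj) hz
  classical
  have hj := Nat.find_spec hex
  set j := Nat.find hex with hjdef
  have hj0 : j ≠ 0 := by
    intro h; rw [h] at hj; simp at hj; exact hj hc
  obtain ⟨i, hi⟩ := Nat.exists_eq_succ_of_ne_zero hj0
  have hbad : BadCh B (L * 2^i) c := by
    have := Nat.find_min hex (m := i) (by omega)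
    simpa using this
  set ℓ := L * 2^i with hℓ
  have hℓL : L ≤ ℓ := hpow i
  have h2ℓ : L * 2^j = 2 * ℓ := by rw [hi, hℓ, pow_succ]; ring
  rw [h2ℓ] at hj
  obtain ⟨c', hc'⟩ := hcon (2*ℓ) (by have := le_max_left L0 L1; linarith)
  have hne : c ≠ c' := by rintro rfl; exact hj hc'
  obtain ⟨h1, hp, hr, hnz, ρ, hρ, hz⟩ := hbad
  obtain ⟨h1', hp', hr', hnz', ρ', hρ', hz'⟩ := hc'
  have hℓ0 : 0 < ℓ := by linarith
  obtain ⟨q1, q2, q3⟩ := hL1 ℓ (by linarith)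
  have hmain := hC c.1 c'.1 c.2 c'.2 (ne_one_of_primitive h1 c.2 hp) (ne_one_of_primitive h1' c'.2 hp') hp hp' hne
    ((2*ℓ)^B) (ℓ^(-(1/2:ℝ))) (hr.trans (by gcongr; linarith)) hr' (by positivity) q2.le ρ ρ' hρ
    (hρ'.trans (Real.rpow_le_rpow_of_nonpos hℓ0 (by linarith) (by norm_num))) hz hz'
  have e1 : (((2*ℓ)^B : ℝ))^(16*η) = (2*ℓ)^(1/4:ℝ) := by
    rw [← Real.rpow_natCast_mul (by positivity)]
    congr 1; rw [hη]; field_simp; norm_num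
  rw [e1, Real.mul_rpow (by norm_num) hℓ0.le] at hmain
  have e2 : (2:ℝ)^(1/4:ℝ) ≤ 2 := by
    calc (2:ℝ)^(1/4:ℝ) ≤ 2^(1:ℝ) := Real.rpow_le_rpow_of_exponent_le (by norm_num) (by norm_num)
      _ = 2 := by simp
  have e3 : ℓ^(-(1/2:ℝ)) * ℓ^(1/4:ℝ) = ℓ^(-(1/4:ℝ)) := by rw [← Real.rpow_add hℓ0]; norm_num
  have : C * ℓ^(-(1/2:ℝ)) * (2^(1/4:ℝ) * ℓ^(1/4:ℝ)) = C * 2^(1/4:ℝ) * ℓ^(-(1/4:ℝ)) := by rw [← e3]; ring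
  rw [this] at hmain
  have : C * 2^(1/4:ℝ) * ℓ^(-(1/4:ℝ)) ≤ C * 2 * ℓ^(-(1/4:ℝ)) := by gcongr
  linarith
end BG

namespace BG
open Finset Complex
open scoped FourierTransform

lemma fourier_pkg (g : ℝ → ℂ) (hg : ContDiff ℝ (⊤:ℕ∞) g) (hc : HasCompactSupport g) :
    ∃ h : ℝ → ℂ, Continuous h ∧ (∀ m : ℕ, MeasureTheory.Integrable (fun ξ : ℝ => |ξ|^m * ‖h ξ‖)) ∧
     ∀ v : ℝ, g v = ∫ ξ : ℝ, h ξ * Complex.exp (2 * Real.pi * ξ * v * Complex.I) := by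
  let G := hc.toSchwartzMap hg
  let H : SchwartzMap ℝ ℂ := 𝓕 G
  refine ⟨H, H.continuous, fun m => ?_, fun v => ?_⟩
  · simpa using H.integrable_pow_mul MeasureTheory.volume m
  · have h1 : 𝓕⁻ (𝓕 G) = G := FourierTransform.fourierInv_fourier_eq (E := SchwartzMap ℝ ℂ) (F := SchwartzMap ℝ ℂ) G
    have h2 : G v = g v := rfl
    rw [← h2, ← h1, SchwartzMap.fourierInv_coe, Real.fourierInv_eq']
    refine MeasureTheory.integral_congr_ae (Filter.Eventually.of_forall fun ξ => ?_)
    simp only [smul_eq_mul]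
    rw [mul_comm]
    congr 2
    simp
    ring_nf

lemma logDeriv_bound (L : ℂ → ℂ) (hL : Differentiable ℂ L) (s₀ : ℂ) (δ M : ℝ) (hδ : 0 < δ) (hM : 0 < M)
    (hz : ∀ s ∈ Metric.ball s₀ δ, L s ≠ 0)
    (hb : ∀ s ∈ Metric.ball s₀ δ, ‖L s‖ ≤ Real.exp M * ‖L s₀‖) (J : ℕ) (s : ℂ) (hs : ‖s - s₀‖ ≤ δ/4) :
    ‖iteratedDeriv J (fun z => deriv L z / L z) s‖ ≤ (J+1).factorial * (2*M) / (δ/8)^(J+1) := by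
  have hd : DifferentiableOn ℂ (fun z => deriv L z / L z) (Metric.ball s₀ δ) :=
    (hL.deriv.differentiableOn).div hL.differentiableOn hz
  obtain ⟨h, h0, hh⟩ := hd.isExactOn_ball.with_val_at s₀ 0
  have hs0 : s₀ ∈ Metric.ball s₀ δ := Metric.mem_ball_self hδ
  have hhd : DifferentiableOn ℂ h (Metric.ball s₀ δ) := fun z hz' => (hh z hz').differentiableAt.differentiableWithinAt
  -- exp h * L s0 = L
  have hexp : ∀ z ∈ Metric.ball s₀ δ, L z = L s₀ * exp (h z) := by
    have key : ∀ z ∈ Metric.ball s₀ δ, L z * exp (- h z) = L s₀ * exp (- h s₀) := by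
      intro z hz'
      have hder : ∀ w ∈ Metric.ball s₀ δ, HasDerivAt (fun w => L w * exp (- h w)) 0 w := by
        intro w hw
        have := (hL w).hasDerivAt.mul ((hh w hw).neg.cexp)
        refine this.congr_deriv ?_
        have := hz w hw
        simp only [Pi.neg_apply]
        field_simp
        ring
      refine Metric.isOpen_ball.is_const_of_deriv_eq_zero (convex_ball _ _).isPreconnected
        (fun w hw => (hder w hw).differentiableAt.differentiableWithinAt) (fun w hw => (hder w hw).deriv) hz' hs0
    intro z hz'
    have := key z hz'
    rw [h0] at this
    simp at this
    rw [← this, mul_assoc, ← Complex.exp_add]; simp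
  have hre : ∀ z ∈ Metric.ball s₀ δ, (h z).re ≤ M := by
    intro z hz'
    have h1 := hb z hz'
    rw [hexp z hz', norm_mul, Complex.norm_exp, mul_comm] at h1
    have h2 : 0 < ‖L s₀‖ := norm_pos_iff.2 (hz _ hs0)
    exact Real.exp_le_exp.1 (le_of_mul_le_mul_right h1 h2)
  have hbc : ∀ z, ‖z - s₀‖ ≤ δ/2 → ‖h z‖ ≤ 2 * M := by
    intro z hz'
    have := Complex.borelCaratheodory_zero (f := fun w => h (s₀ + w)) (M := M) (R := δ) (z := z - s₀) hM ?_ ?_ hδ ?_ ?_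
    · simp only [add_sub_cancel] at this
      refine this.trans ?_
      have : 0 < δ - ‖z - s₀‖ := by linarith
      rw [div_le_iff₀ this]
      gcongr
      linarith
    · refine hhd.comp (by fun_prop) ?_
      intro w hw
      simpa using hw
    · intro w hw
      exact hre _ (by simpa using hw)
    · simp; linarith
    · simp [h0]
  have hsb : s ∈ Metric.ball s₀ δ := by rw [mem_ball_iff_norm]; linarith
  have e1 : iteratedDeriv J (fun z => deriv L z / L z) s = iteratedDeriv (J+1) h s := by
    rw [iteratedDeriv_succ']
    refine Filter.EventuallyEq.iteratedDeriv_eq _ ?_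
    filter_upwards [Metric.isOpen_ball.mem_nhds hsb] with w hw
    exact (hh w hw).deriv.symm
  rw [e1]
  refine Complex.norm_iteratedDeriv_le_of_forall_mem_sphere_norm_le (J+1) (by linarith) ?_ ?_
  · refine (hhd.mono ?_).diffContOnCl
    refine (Metric.closure_ball_subset_closedBall).trans ?_
    intro w hw
    rw [mem_closedBall_iff_norm] at hw
    rw [mem_ball_iff_norm]
    linarith [norm_sub_le_norm_sub_add_norm_sub w s s₀]
  · intro w hw
    rw [mem_sphere_iff_norm] at hw
    refine hbc w ?_
    linarith [norm_sub_le_norm_sub_add_norm_sub w s s₀]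

/-- coefficients `(log n)^J Λ(n) χ(n)` -/
noncomputable def FJ {r : ℕ} (χ : DirichletCharacter ℂ r) (J : ℕ) (n : ℕ) : ℂ :=
  ((Real.log n)^J * ArithmeticFunction.vonMangoldt n : ℝ) * χ n

lemma FJ_eq {r : ℕ} (χ : DirichletCharacter ℂ r) (J : ℕ) :
    LSeries.logMul^[J] ((fun n : ℕ => χ n) * (fun n : ℕ => (ArithmeticFunction.vonMangoldt n : ℂ))) = FJ χ J := by
  induction J with
  | zero => ext n; simp [FJ, mul_comm]
  | succ J ih =>
    rw [Function.iterate_succ_apply', ih]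
    ext n
    simp only [LSeries.logMul, FJ]
    rw [← Complex.natCast_log]
    push_cast; ring

lemma FJ_norm {r : ℕ} (χ : DirichletCharacter ℂ r) (J : ℕ) (n : ℕ) : ‖FJ χ J n‖ ≤ (Real.log n)^(J+1) := by
  unfold FJ
  have h0 : 0 ≤ Real.log n := Real.log_natCast_nonneg n
  have h1 : 0 ≤ ArithmeticFunction.vonMangoldt n := ArithmeticFunction.vonMangoldt_nonneg
  rw [norm_mul, Complex.norm_real, Real.norm_of_nonneg (by positivity)]
  calc _ ≤ (Real.log n)^J * Real.log n * 1 := by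
        gcongr
        · exact ArithmeticFunction.vonMangoldt_le_log
        · exact χ.norm_le_one _
    _ = _ := by ring

lemma log_pow_le (J : ℕ) (ℓ : ℝ) (hℓ : 0 < ℓ) (n : ℕ) (hn : n ≠ 0) :
    (Real.log n)^J ≤ J.factorial * (2*ℓ)^J * (n:ℝ)^(1/(2*ℓ)) := by
  have h0 : 0 ≤ Real.log n := Real.log_natCast_nonneg n
  have := Real.pow_div_factorial_le_exp (Real.log n / (2*ℓ)) (by positivity) J
  have hn' : (0:ℝ) < n := by exact_mod_cast Nat.pos_of_ne_zero hn
  rw [Real.rpow_def_of_pos hn', mul_one_div]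
  rw [div_le_iff₀ (by positivity), div_pow, div_le_iff₀ (by positivity)] at this
  calc _ ≤ _ := this
    _ = _ := by ring

lemma summable_nat_pow (σ : ℝ) (h : 1 < σ) : Summable (fun n : ℕ => (n:ℝ)^(-σ)) := by
  exact Real.summable_nat_rpow.2 (by linarith)

lemma tsum_nat_pow (σ : ℝ) (h : 1 < σ) : ∑' n : ℕ, (n:ℝ)^(-σ) ≤ 1 + 1/(σ-1) := by
  rw [(summable_nat_pow σ h).tsum_eq_zero_add]
  have : ((0:ℕ):ℝ)^(-σ) = 0 := by rw [Nat.cast_zero, Real.zero_rpow (by linarith)]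
  rw [this, zero_add]
  refine le_trans (le_of_eq ?_) (zeta_bound σ h)
  refine tsum_congr fun n => ?_
  rw [Real.rpow_neg (by positivity)]; push_cast; rw [one_div]

lemma FJ_term_norm {r : ℕ} (χ : DirichletCharacter ℂ r) (J : ℕ) (ℓ : ℝ) (hℓ : 0 < ℓ) (s : ℂ) (hs : s.re = 1 + 1/ℓ) (n : ℕ) :
    ‖LSeries.term (FJ χ J) s n‖ ≤ ((J+1).factorial * (2*ℓ)^(J+1)) * (n:ℝ)^(-(1+1/(2*ℓ))) := by
  rcases eq_or_ne n 0 with rfl | hn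
  · simp; positivity
  have hn' : (0:ℝ) < n := by exact_mod_cast Nat.pos_of_ne_zero hn
  rw [LSeries.term_of_ne_zero hn, norm_div, Complex.norm_natCast_cpow_of_pos (Nat.pos_of_ne_zero hn), hs]
  rw [div_le_iff₀ (by positivity)]
  refine (FJ_norm χ J n).trans ((log_pow_le (J+1) ℓ hℓ n hn).trans (le_of_eq ?_))
  rw [mul_assoc, mul_assoc, mul_assoc]
  congr 2
  rw [← Real.rpow_add hn']
  congr 1
  field_simp; ring

lemma FJ_bound {r : ℕ} (χ : DirichletCharacter ℂ r) (J : ℕ) (ℓ : ℝ) (hℓ : 0 < ℓ) (s : ℂ) (hs : s.re = 1 + 1/ℓ) :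
    ‖LSeries (FJ χ J) s‖ ≤ ((J+1).factorial * (2*ℓ)^(J+1)) * (1 + 2*ℓ) := by
  have h1 : 1 < 1 + 1/(2*ℓ) := by have : 0 < 1/(2*ℓ) := by positivity
                                  linarith
  have hsum := (summable_nat_pow _ h1).mul_left ((J+1).factorial * (2*ℓ)^(J+1))
  have hb := FJ_term_norm χ J ℓ hℓ s hs
  have := tsum_of_norm_bounded hsum.hasSum hb
  unfold LSeries
  refine this.trans ?_
  rw [tsum_mul_left]
  gcongr
  refine (tsum_nat_pow _ h1).trans (le_of_eq ?_)
  congr 1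
  field_simp; ring

lemma FJ_eq_deriv {r : ℕ} [NeZero r] (χ : DirichletCharacter ℂ r) (J : ℕ) (s : ℂ) (hs : 1 < s.re) :
    ‖LSeries (FJ χ J) s‖ = ‖iteratedDeriv J (fun z => deriv χ.LFunction z / χ.LFunction z) s‖ := by
  have habs : LSeries.abscissaOfAbsConv ((fun n : ℕ => χ n) * (fun n : ℕ => (ArithmeticFunction.vonMangoldt n : ℂ))) < s.re := by
    refine lt_of_le_of_lt (b := ((1:ℝ):EReal)) ?_ (by exact_mod_cast hs)
    refine LSeries.abscissaOfAbsConv_le_of_forall_lt_LSeriesSummable' fun y hy => ?_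
    exact DirichletCharacter.LSeriesSummable_twist_vonMangoldt χ (by simpa using (EReal.coe_lt_coe_iff.1 hy))
  have h1 := LSeries_iteratedDeriv J habs
  rw [FJ_eq] at h1
  have h2 : iteratedDeriv J (LSeries ((fun n : ℕ => χ n) * (fun n : ℕ => (ArithmeticFunction.vonMangoldt n : ℂ)))) s
      = iteratedDeriv J (fun z => - (deriv χ.LFunction z / χ.LFunction z)) s := by
    refine Filter.EventuallyEq.iteratedDeriv_eq _ ?_
    filter_upwards [(isOpen_lt continuous_const Complex.continuous_re).mem_nhds hs] with z hz
    rw [DirichletCharacter.LSeries_twist_vonMangoldt_eq χ hz, χ.deriv_LFunction_eq_deriv_LSeries hz, χ.LFunction_eq_LSeries hz]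
    ring
  rw [h2] at h1
  have h3 := congrArg norm h1
  rw [norm_mul, norm_pow, norm_neg, norm_one, one_pow, one_mul] at h3
  rw [← h3]
  have : (fun z => - (deriv χ.LFunction z / χ.LFunction z)) = -(fun z => (deriv χ.LFunction z / χ.LFunction z)) := rfl
  rw [this, iteratedDeriv_neg, norm_neg]

lemma LFunction_lower {r : ℕ} [NeZero r] (χ : DirichletCharacter ℂ r) (ℓ : ℝ) (hℓ : 0 < ℓ) (s : ℂ) (hs : s.re = 1 + 1/ℓ) :
    1 ≤ (1 + ℓ) * ‖χ.LFunction s‖ := by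
  have h1 : 1 < s.re := by rw [hs]; have : 0 < 1/ℓ := by positivity
                           linarith
  have := DirichletCharacter.LSeries.mul_mu_eq_one χ h1
  rw [← χ.LFunction_eq_LSeries h1] at this
  have h2 := congrArg norm this
  rw [norm_mul, norm_one] at h2
  refine h2.symm.le.trans ?_
  rw [mul_comm]
  gcongr
  refine (char_series_bound (r := 1) _ ?_ s h1).trans (le_of_eq ?_)
  · intro n
    simp only [Pi.mul_apply, norm_mul]
    have a1 := χ.norm_le_one n
    have a2 : ‖((ArithmeticFunction.moebius n : ℤ) : ℂ)‖ ≤ 1 := by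
      rw [Complex.norm_intCast]
      exact_mod_cast ArithmeticFunction.abs_moebius_le_one
    calc _ ≤ (1:ℝ) * 1 := by gcongr
      _ = 1 := by ring
  · rw [hs]; field_simp; ring
end BG

namespace BG
open Finset Complex

/-- The basic bump function. -/
noncomputable def bmp : ContDiffBump (3/4:ℝ) := ⟨1/16, 1/8, by norm_num, by norm_num⟩

/-- The weight `β(log n/ℓ)/n`. -/
noncomputable def uu (ℓ : ℝ) (n : ℕ) : ℝ := bmp (Real.log n / ℓ) / n

noncomputable def NL (ℓ : ℝ) : ℕ := ⌊Real.exp ℓ⌋₊ + 1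

noncomputable def psi (ℓ : ℝ) {r : ℕ} (χ : DirichletCharacter ℂ r) : ℂ :=
  ∑ n ∈ range (NL ℓ), (ArithmeticFunction.vonMangoldt n : ℂ) * χ n * uu ℓ n

lemma bmp_zero_left {v : ℝ} (h : v ≤ 5/8) : bmp v = 0 := by
  refine bmp.zero_of_le_dist ?_
  rw [Real.dist_eq, abs_of_nonpos (by linarith)]
  show (1/8:ℝ) ≤ _
  linarith
lemma bmp_zero_right {v : ℝ} (h : 7/8 ≤ v) : bmp v = 0 := by
  refine bmp.zero_of_le_dist ?_
  rw [Real.dist_eq, abs_of_nonneg (by linarith)]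
  show (1/8:ℝ) ≤ _
  linarith

lemma NL_le_log {ℓ : ℝ} {n : ℕ} (h : NL ℓ ≤ n) : ℓ ≤ Real.log n := by
  have h1 : Real.exp ℓ < n := by
    have := Nat.lt_floor_add_one (Real.exp ℓ)
    have h2 : ((NL ℓ : ℕ):ℝ) ≤ n := by exact_mod_cast h
    unfold NL at h2; push_cast at h2; linarith
  have h0 := Real.exp_pos ℓ
  exact ((Real.lt_log_iff_exp_lt (by linarith)).2 h1).le

lemma uu_zero_of_ge {ℓ : ℝ} (hℓ : 0 < ℓ) {n : ℕ} (h : NL ℓ ≤ n) : uu ℓ n = 0 := by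
  unfold uu
  rw [bmp_zero_right, zero_div]
  have := NL_le_log h
  rw [le_div_iff₀ hℓ]; linarith

lemma uu_nonneg (ℓ : ℝ) (n : ℕ) : 0 ≤ uu ℓ n := div_nonneg bmp.nonneg (Nat.cast_nonneg _)

lemma FJ_good (B m : ℕ) : ∃ C L0 : ℝ, 0 ≤ C ∧ 1 ≤ L0 ∧ ∀ ℓ ≥ L0, (∀ c : Ch, ¬ BadCh B ℓ c) →
    ∀ (r : ℕ) (χ : DirichletCharacter ℂ r), 1 < r → χ.IsPrimitive → (r:ℝ) ≤ ℓ^B → ∀ ξ : ℝ,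
    ‖LSeries (FJ χ (2*m)) (1 + 1/ℓ - 2 * Real.pi * ξ / ℓ * I)‖ ≤ C * ℓ^(m+2) * (1 + |ξ|^(2*m)) := by
  obtain ⟨C1, hC1, hC⟩ := LFunction_bound (1/4) (by norm_num) (by norm_num)
  have hev : ∀ᶠ ℓ : ℝ in Filter.atTop, C1 * ℓ^B * (1+ℓ) ≤ Real.exp ℓ := by
    have h1 : Filter.Tendsto (fun ℓ : ℝ => C1 * (ℓ^B / Real.exp ℓ) + C1 * (ℓ^(B+1)/Real.exp ℓ)) Filter.atTop (nhds 0) := by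
      have e := fun n : ℕ => Real.tendsto_pow_mul_exp_neg_atTop_nhds_zero n
      have e' : ∀ n : ℕ, Filter.Tendsto (fun ℓ : ℝ => ℓ^n / Real.exp ℓ) Filter.atTop (nhds 0) := by
        intro n; refine (e n).congr fun x => ?_
        rw [Real.exp_neg, div_eq_mul_inv]
      simpa using ((e' B).const_mul C1).add ((e' (B+1)).const_mul C1)
    filter_upwards [h1.eventually (gt_mem_nhds one_pos)] with ℓ hℓ
    have h0 := Real.exp_pos ℓ
    have : C1 * ℓ^B * (1+ℓ) = (C1 * (ℓ^B / Real.exp ℓ) + C1 * (ℓ^(B+1)/Real.exp ℓ)) * Real.exp ℓ := by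
      field_simp; ring
    rw [this]
    nlinarith
  obtain ⟨L1, hL1⟩ := Filter.eventually_atTop.1 hev
  refine ⟨((2*m+1).factorial * 2^(2*m+1) * 3) * (16*4)^(2*m) + (2*m+1).factorial * 2 * 16^(2*m+1),
    max L1 8, by positivity, le_trans (by norm_num) (le_max_right _ _), ?_⟩
  intro ℓ hℓ hgood r χ hr hp hrB ξ
  have hℓ1 : L1 ≤ ℓ := (le_max_left _ _).trans hℓ
  have hℓ8 : 8 ≤ ℓ := (le_max_right _ _).trans hℓ
  have hℓ0 : 0 < ℓ := by linarith
  have : NeZero r := ⟨by omega⟩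
  set s₀ : ℂ := 1 + 1/ℓ with hs₀
  have hs₀' : s₀ = ((1 + 1/ℓ : ℝ) : ℂ) := by rw [hs₀]; push_cast; rfl
  set s : ℂ := s₀ - 2 * Real.pi * ξ / ℓ * I with hs
  have hs' : s = s₀ - ((2 * Real.pi * ξ / ℓ : ℝ) : ℂ) * I := by rw [hs]; push_cast; rfl
  have hre0 : s₀.re = 1 + 1/ℓ := by rw [hs₀']; simp
  have hre : s.re = 1 + 1/ℓ := by rw [hs', sub_re, hre0]; simp
  have hns : ‖s - s₀‖ = 2 * Real.pi * |ξ| / ℓ := by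
    rw [hs', sub_sub_cancel_left, norm_neg, norm_mul, Complex.norm_real, norm_I, mul_one, Real.norm_eq_abs, abs_div,
      abs_mul, abs_of_pos hℓ0, abs_of_pos (by positivity)]
  have hinv : 0 < 1/ℓ := by positivity
  set q := Real.sqrt ℓ with hq
  have hq0 : 0 < q := Real.sqrt_pos.2 hℓ0
  have hqq : q * q = ℓ := Real.mul_self_sqrt hℓ0.le
  have hq2 : 2 ≤ q := by nlinarith
  have hqm : q^(2*m) = ℓ^m := by rw [pow_mul, pow_two, hqq]
  have hpos : 0 ≤ |ξ|^(2*m) := by positivity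
  have hℓm : 0 ≤ ℓ^(m+2) := by positivity
  rw [← sub_nonneg]
  by_cases hcase : ‖s - s₀‖ ≤ (1/(2*q))/4
  · -- near
    have hbad : ∀ z : ℂ, ‖z - s₀‖ < 1/(2*q) → χ.LFunction z ≠ 0 := by
      intro z hz h0
      refine hgood ⟨r, χ⟩ ⟨hr, hp, hrB, ‹_›, z, ?_, h0⟩
      have e1 : ℓ^(-(1/2:ℝ)) = 1/q := by
        rw [Real.rpow_neg hℓ0.le, ← Real.sqrt_eq_rpow, one_div]
      rw [e1]
      have e2 : ‖s₀ - 1‖ = 1/ℓ := by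
        rw [hs₀, add_sub_cancel_left, ← Complex.ofReal_one, ← Complex.ofReal_div, Complex.norm_real, Real.norm_of_nonneg hinv.le]
      have e3 : 1/ℓ ≤ 1/(2*q) := by
        rw [← hqq]; gcongr
      have e4 : 1/q = 1/(2*q) + 1/(2*q) := by field_simp; norm_num
      linarith [norm_sub_le_norm_sub_add_norm_sub z s₀ 1]
    have hM : ∀ z ∈ Metric.ball s₀ (1/(2*q)), ‖χ.LFunction z‖ ≤ Real.exp ℓ * ‖χ.LFunction s₀‖ := by
      intro z hz
      rw [mem_ball_iff_norm] at hz
      have hq4 : 1/(2*q) ≤ 1/4 := by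
        rw [div_le_div_iff₀ (by positivity) (by norm_num)]; linarith
      have r1 : 1 - 1/4 < z.re := by
        have := (abs_le.1 (abs_re_le_norm (z - s₀))).1
        rw [sub_re, hre0] at this; linarith
      have r2 : ‖z‖ < 3 := by
        have h1 : ‖z‖ ≤ ‖z - s₀‖ + ‖s₀‖ := by simpa using norm_add_le (z - s₀) s₀
        have h2 : ‖s₀‖ = 1 + 1/ℓ := by rw [hs₀', Complex.norm_real, Real.norm_of_nonneg (by positivity)]
        have h3 : 1/ℓ ≤ 1 := by rw [div_le_one hℓ0]; linarith
        linarith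
      have h1 := hC r χ (ne_one_of_primitive hr χ hp) z r1 r2
      have h2 : ((r:ℝ))^(2*(1/4:ℝ)) ≤ ℓ^B := by
        refine le_trans ?_ hrB
        have hr1 : (1:ℝ) ≤ r := by exact_mod_cast hr.le
        calc ((r:ℝ))^(2*(1/4:ℝ)) ≤ (r:ℝ)^(1:ℝ) := Real.rpow_le_rpow_of_exponent_le hr1 (by norm_num)
          _ = r := Real.rpow_one _
      have h3 := LFunction_lower χ ℓ hℓ0 s₀ hre0
      have h4 := hL1 ℓ hℓ1
      calc _ ≤ C1 * ℓ^B := h1.trans (by gcongr)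
        _ ≤ C1 * ℓ^B * ((1+ℓ) * ‖χ.LFunction s₀‖) := le_mul_of_one_le_right (by positivity) h3
        _ = (C1 * ℓ^B * (1+ℓ)) * ‖χ.LFunction s₀‖ := by ring
        _ ≤ _ := by gcongr
    have hmain := logDeriv_bound χ.LFunction (DirichletCharacter.differentiable_LFunction (ne_one_of_primitive hr χ hp))
      s₀ (1/(2*q)) ℓ (by positivity) hℓ0 (fun z hz => hbad z (by rwa [mem_ball_iff_norm] at hz)) hM (2*m) s hcase
    rw [FJ_eq_deriv χ (2*m) s (by rw [hre]; linarith)]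
    have e5 : ((2*m+1).factorial * (2*ℓ) / (1/(2*q)/8)^(2*m+1) : ℝ) = (2*m+1).factorial * 2 * 16^(2*m+1) * (ℓ * ℓ^m * q) := by
      rw [← hqm, show (1/(2*q)/8 : ℝ) = (16*q)⁻¹ by field_simp; norm_num, inv_pow, div_inv_eq_mul, mul_pow, ← hqq]; ring
    rw [e5] at hmain
    have e6 : ℓ * ℓ^m * q ≤ ℓ^(m+2) := by
      have : q ≤ ℓ := by nlinarith
      calc ℓ * ℓ^m * q ≤ ℓ * ℓ^m * ℓ := by gcongr
        _ = _ := by ring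
    rw [sub_nonneg]
    calc _ ≤ _ := hmain
      _ ≤ (2*m+1).factorial * 2 * 16^(2*m+1) * ℓ^(m+2) := by gcongr
      _ ≤ (2*m+1).factorial * 2 * 16^(2*m+1) * ℓ^(m+2) * (1 + |ξ|^(2*m)) :=
          le_mul_of_one_le_right (by positivity) (by linarith)
      _ ≤ _ := by
          gcongr
          have : (0:ℝ) ≤ ((2*m+1).factorial * 2^(2*m+1) * 3) * (16*4)^(2*m) := by positivity
          linarith
  · -- far
    push Not at hcase
    rw [hns] at hcase
    have hξ : 1 ≤ (16*4) * |ξ| / q := by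
      rw [div_div, div_lt_div_iff₀ (by positivity) hℓ0, one_mul] at hcase
      rw [le_div_iff₀ hq0, one_mul]
      have hpi := Real.pi_lt_four
      have h1 : ℓ < 64 * |ξ| * q := by
        calc ℓ < 2 * Real.pi * |ξ| * (2*q*4) := hcase
          _ ≤ 2 * 4 * |ξ| * (2*q*4) := by gcongr
          _ = _ := by ring
      rw [← hqq] at h1
      have := lt_of_mul_lt_mul_right h1 hq0.le
      linarith
    have hξ2 : 1 ≤ (16*4)^(2*m) * |ξ|^(2*m) / ℓ^m := by
      rw [← hqm, ← mul_pow, ← div_pow]; exact one_le_pow₀ hξ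
    have hb := FJ_bound χ (2*m) ℓ hℓ0 s hre
    rw [sub_nonneg]
    calc _ ≤ _ := hb
      _ ≤ ((2*m+1).factorial * (2*ℓ)^(2*m+1)) * (3*ℓ) := by gcongr; linarith
      _ = ((2*m+1).factorial * 2^(2*m+1) * 3) * (ℓ^(m+2) * ℓ^m) * 1 := by rw [mul_pow]; ring
      _ ≤ ((2*m+1).factorial * 2^(2*m+1) * 3) * (ℓ^(m+2) * ℓ^m) * ((16*4)^(2*m) * |ξ|^(2*m) / ℓ^m) := by gcongr
      _ = (((2*m+1).factorial * 2^(2*m+1) * 3) * (16*4)^(2*m)) * ℓ^(m+2) * |ξ|^(2*m) := by field_simp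
      _ ≤ _ := by
          gcongr
          · have : (0:ℝ) ≤ (2*m+1).factorial * 2 * 16^(2*m+1) := by positivity
            linarith
          · linarith

lemma term_shift (f : ℕ → ℂ) (s : ℂ) (ℓ ξ : ℝ) (n : ℕ) :
    LSeries.term f (s - 2 * Real.pi * ξ / ℓ * I) n
      = LSeries.term f s n * exp (2 * Real.pi * ξ * ((Real.log n / ℓ : ℝ) : ℂ) * I) := by
  rcases eq_or_ne n 0 with rfl | hn
  · simp
  have hn' : (n:ℂ) ≠ 0 := by exact_mod_cast hn
  have he : (n:ℂ)^(2 * Real.pi * ξ / ℓ * I) = exp (2 * Real.pi * ξ * ((Real.log n / ℓ : ℝ) : ℂ) * I) := by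
    rw [Complex.cpow_def_of_ne_zero hn', ← Complex.natCast_log]
    congr 1; push_cast; ring
  rw [LSeries.term_of_ne_zero hn, LSeries.term_of_ne_zero hn, Complex.cpow_sub _ _ hn', he, div_div_eq_mul_div, div_mul_eq_mul_div]

lemma gJ_smooth (J : ℕ) : ContDiff ℝ (⊤:ℕ∞) (fun v : ℝ => ((bmp v * Real.exp v / v^J : ℝ) : ℂ)) := by
  refine Complex.ofRealCLM.contDiff.comp ?_
  rw [contDiff_iff_contDiffAt]
  intro v
  by_cases hv : v = 0
  · refine (contDiffAt_const (c := (0:ℝ))).congr_of_eventuallyEq ?_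
    have : Set.Iio (5/8:ℝ) ∈ nhds v := Iio_mem_nhds (by rw [hv]; norm_num)
    filter_upwards [this] with w hw
    rw [bmp_zero_left (le_of_lt hw), zero_mul]; exact zero_div _
  · exact ((bmp.contDiff.contDiffAt).mul Real.contDiff_exp.contDiffAt).div (contDiffAt_id.pow J) (pow_ne_zero _ hv)

lemma gJ_supp (J : ℕ) : HasCompactSupport (fun v : ℝ => ((bmp v * Real.exp v / v^J : ℝ) : ℂ)) := by
  refine HasCompactSupport.intro (K := Set.Icc (5/8) (7/8)) isCompact_Icc fun v hv => ?_
  have : bmp v = 0 := by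
    simp only [Set.mem_Icc, not_and_or, not_le] at hv
    rcases hv with h | h
    · exact bmp_zero_left h.le
    · exact bmp_zero_right h.le
  rw [this]; simp

lemma psi_integral (ℓ : ℝ) (hℓ : 0 < ℓ) {r : ℕ} (χ : DirichletCharacter ℂ r) (J : ℕ) (h : ℝ → ℂ) (hcont : Continuous h)
    (hIntg : MeasureTheory.Integrable (fun ξ : ℝ => ‖h ξ‖))
    (hg : ∀ v : ℝ, ((bmp v * Real.exp v / v^J : ℝ) : ℂ) = ∫ ξ : ℝ, h ξ * Complex.exp (2 * Real.pi * ξ * v * Complex.I)) :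
    psi ℓ χ * ℓ^J = ∫ ξ : ℝ, h ξ * LSeries (FJ χ J) (1 + 1/ℓ - 2 * Real.pi * ξ / ℓ * I) := by
  have hhi : MeasureTheory.Integrable h := (MeasureTheory.integrable_norm_iff hcont.aestronglyMeasurable).1 hIntg
  set F : ℕ → ℝ → ℂ := fun n ξ => LSeries.term (FJ χ J) (1 + 1/ℓ) n *
    (h ξ * exp (2 * Real.pi * ξ * ((Real.log n / ℓ : ℝ) : ℂ) * I)) with hF
  have hnexp : ∀ (n : ℕ) (ξ : ℝ), ‖exp (2 * Real.pi * ξ * ((Real.log n / ℓ : ℝ) : ℂ) * I)‖ = 1 := by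
    intro n ξ
    have : (2 * Real.pi * ξ * ((Real.log n / ℓ : ℝ) : ℂ) * I) = ((2 * Real.pi * ξ * (Real.log n / ℓ) : ℝ) : ℂ) * I := by
      push_cast; ring
    rw [this, Complex.norm_exp_ofReal_mul_I]
  have hFn : ∀ n ξ, ‖F n ξ‖ = ‖LSeries.term (FJ χ J) (1 + 1/ℓ) n‖ * ‖h ξ‖ := by
    intro n ξ
    rw [hF]; simp only [norm_mul]; rw [hnexp, mul_one]
  have hFi : ∀ n, MeasureTheory.Integrable (F n) := by
    intro n
    refine (hIntg.const_mul ‖LSeries.term (FJ χ J) (1 + 1/ℓ) n‖).mono' ?_ (Filter.Eventually.of_forall fun ξ => (hFn n ξ).le)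
    refine Continuous.aestronglyMeasurable ?_
    rw [hF]; fun_prop
  have hre : (1 + 1/(ℓ:ℂ)).re = 1 + 1/ℓ := by
    have : (1 + 1/(ℓ:ℂ)) = ((1 + 1/ℓ : ℝ) : ℂ) := by push_cast; rfl
    rw [this]; simp
  have hsum : Summable fun n => ∫ ξ, ‖F n ξ‖ := by
    simp_rw [hFn, MeasureTheory.integral_const_mul]
    refine Summable.mul_right _ ?_
    have h1 : 1 < 1 + 1/(2*ℓ) := by have : 0 < 1/(2*ℓ) := by positivity
                                    linarith
    exact Summable.of_nonneg_of_le (fun _ => norm_nonneg _) (FJ_term_norm χ J ℓ hℓ _ hre)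
      ((summable_nat_pow _ h1).mul_left _)
  have hs := (MeasureTheory.hasSum_integral_of_summable_integral_norm hFi hsum).tsum_eq
  have e1 : ∀ ξ : ℝ, ∑' n, F n ξ = h ξ * LSeries (FJ χ J) (1 + 1/ℓ - 2 * Real.pi * ξ / ℓ * I) := by
    intro ξ
    unfold LSeries
    rw [← tsum_mul_left]
    refine tsum_congr fun n => ?_
    rw [term_shift, hF]; ring
  simp_rw [e1] at hs
  rw [← hs]
  have e2 : ∀ n : ℕ, ∫ ξ, F n ξ = (ArithmeticFunction.vonMangoldt n : ℂ) * χ n * uu ℓ n * ℓ^J := by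
    intro n
    rw [hF]; simp only
    rw [MeasureTheory.integral_const_mul, ← hg]
    rcases eq_or_ne n 0 with rfl | hn
    · simp
    rw [LSeries.term_of_ne_zero hn]
    unfold uu
    by_cases hb : bmp (Real.log n / ℓ) = 0
    · rw [hb]; simp
    have hv : 0 < Real.log n := by
      by_contra hcon
      exact hb (bmp_zero_left ((div_nonpos_of_nonpos_of_nonneg (not_lt.1 hcon) hℓ.le).trans (by norm_num)))
    have hn' : (n:ℂ) ≠ 0 := by exact_mod_cast hn
    have hexp : (n:ℂ)^(1 + 1/(ℓ:ℂ)) = n * exp (((Real.log n / ℓ : ℝ) : ℂ)) := by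
      rw [Complex.cpow_add _ _ hn', Complex.cpow_one, Complex.cpow_def_of_ne_zero hn', ← Complex.natCast_log]
      congr 2; push_cast; ring
    rw [hexp]
    unfold FJ
    have hv' : ((Real.log n : ℝ) : ℂ) ≠ 0 := by exact_mod_cast hv.ne'
    have hℓ' : (ℓ : ℂ) ≠ 0 := by exact_mod_cast hℓ.ne'
    have he := Complex.exp_ne_zero (((Real.log n / ℓ : ℝ) : ℂ))
    push_cast at *
    field_simp
    rw [div_pow]; field_simp
  simp_rw [e2]
  rw [tsum_eq_sum (s := range (NL ℓ)) ?_]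
  · unfold psi; rw [Finset.sum_mul]
  · intro n hn
    rw [uu_zero_of_ge hℓ (by simpa using hn)]; simp

lemma psi_small (A B : ℕ) : ∃ C L0 : ℝ, 0 ≤ C ∧ 1 ≤ L0 ∧ ∀ ℓ ≥ L0, (∀ c : Ch, ¬ BadCh B ℓ c) →
    ∀ (r : ℕ) (χ : DirichletCharacter ℂ r), 1 < r → χ.IsPrimitive → (r:ℝ) ≤ ℓ^B → ‖psi ℓ χ‖ * ℓ^A ≤ C := by
  obtain ⟨C, L0, hC0, hL0, hC⟩ := FJ_good B (A+2)
  obtain ⟨h, hcont, hIntg, hg⟩ := fourier_pkg _ (gJ_smooth (2*(A+2))) (gJ_supp (2*(A+2)))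
  have hint0 : MeasureTheory.Integrable (fun ξ : ℝ => ‖h ξ‖) := by simpa using hIntg 0
  have hint1 : MeasureTheory.Integrable (fun ξ : ℝ => ‖h ξ‖ + |ξ|^(2*(A+2)) * ‖h ξ‖) := hint0.add (hIntg _)
  refine ⟨C * ∫ ξ : ℝ, (‖h ξ‖ + |ξ|^(2*(A+2)) * ‖h ξ‖), L0, ?_, hL0, ?_⟩
  · refine mul_nonneg hC0 (MeasureTheory.integral_nonneg fun ξ => by positivity)
  intro ℓ hℓ hgood r χ hr hp hrB
  have hℓ0 : 0 < ℓ := by linarith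
  have key := psi_integral ℓ hℓ0 χ (2*(A+2)) h hcont hint0 hg
  have hb : ‖psi ℓ χ * ℓ^(2*(A+2))‖ ≤ ∫ ξ : ℝ, (C * ℓ^(A+2+2)) * (‖h ξ‖ + |ξ|^(2*(A+2)) * ‖h ξ‖) := by
    rw [key]
    refine MeasureTheory.norm_integral_le_of_norm_le (hint1.const_mul _) (Filter.Eventually.of_forall fun ξ => ?_)
    rw [norm_mul]
    calc _ ≤ ‖h ξ‖ * (C * ℓ^(A+2+2) * (1 + |ξ|^(2*(A+2)))) := by
          gcongr; exact hC ℓ hℓ hgood r χ hr hp hrB ξ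
      _ = _ := by ring
  rw [MeasureTheory.integral_const_mul, norm_mul, norm_pow, Complex.norm_real, Real.norm_of_nonneg hℓ0.le] at hb
  have hp : 0 < ℓ^(A+2+2) := by positivity
  refine le_of_mul_le_mul_right ?_ hp
  calc _ = ‖psi ℓ χ‖ * ℓ^(2*(A+2)) := by ring
    _ ≤ _ := hb
    _ = _ := by ring
end BG

namespace BG
open Finset Complex
open scoped ComplexConjugate

/-- A finite family of nontrivial primitive characters of conductor at most `Q`. -/
def Fam (Q : ℝ) (X : Finset Ch) : Prop := ∀ c ∈ X, 1 < c.1 ∧ c.2.IsPrimitive ∧ (c.1:ℝ) ≤ Q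

lemma sum_inv_le (a N : ℕ) (ha : 1 ≤ a) : ∑ n ∈ Ico a N, 1/(n:ℝ) ≤ 1 + Real.log N := by
  have h := harmonic_le_one_add_log N
  refine le_trans ?_ h
  rw [harmonic_eq_sum_Icc]
  push_cast
  simp_rw [one_div]
  refine Finset.sum_le_sum_of_subset_of_nonneg ?_ (fun i _ _ => by positivity)
  intro i hi
  simp only [mem_Ico, mem_Icc] at *; omega

lemma offdiag (c c' : Ch) (h : 1 < c.1) (h' : 1 < c'.1) (hp : c.2.IsPrimitive) (hp' : c'.2.IsPrimitive) (hne : c ≠ c')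
    (Q : ℝ) (hQ : (c.1:ℝ) ≤ Q) (hQ' : (c'.1:ℝ) ≤ Q) (U N : ℕ) (hU : 1 ≤ U) (hN : U ≤ N) :
    ‖∑ n ∈ Ico U N, (1/(n:ℝ) : ℝ) * (c.2 n * conj (c'.2 n))‖ ≤ Q^2/U := by
  have : NeZero c.1 := ⟨by omega⟩
  have : NeZero c'.1 := ⟨by omega⟩
  have : NeZero (c.1 * c'.1) := ⟨mul_ne_zero (NeZero.ne _) (NeZero.ne _)⟩
  have h1 : ∀ n : ℕ, ‖∑ k ∈ Ico U n, c.2 k * conj (c'.2 k)‖ ≤ Q^2 := by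
    intro n
    have := char_sum_bound (prodChar c.2 c'.2) (prodChar_ne_one c.2 c'.2 hp hp' hne) U n
    simp_rw [prodChar_apply] at this
    refine this.trans ?_
    have hQ0 : 0 ≤ Q := le_trans (Nat.cast_nonneg _) hQ
    push_cast; rw [pow_two]; gcongr
  refine (abel_antitone _ (fun n => 1/(n:ℝ)) U N hN _ h1 ?_ ?_).trans (le_of_eq ?_)
  · intro k hk
    have : (0:ℝ) < k := by exact_mod_cast (by omega : 0 < k)
    push_cast; gcongr; linarith
  · intro k hk; positivity
  · ring

lemma dual_bound (Q : ℝ) (X : Finset Ch) (hX : Fam Q X) (b : Ch → ℂ) (U N : ℕ) (hU : 1 ≤ U) (hN : U ≤ N) :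
    ∑ n ∈ Ico U N, 1/(n:ℝ) * ‖∑ c ∈ X, b c * c.2 n‖^2 ≤
      (∑ c ∈ X, ‖b c‖^2) * (1 + Real.log N + X.card * (Q^2/U)) := by
  classical
  have hexp : ((∑ n ∈ Ico U N, 1/(n:ℝ) * ‖∑ c ∈ X, b c * c.2 n‖^2 : ℝ) : ℂ) =
      ∑ c ∈ X, ∑ c' ∈ X, b c * conj (b c') * ∑ n ∈ Ico U N, (1/(n:ℝ) : ℝ) * (c.2 n * conj (c'.2 n)) := by
    push_cast
    simp_rw [← Complex.mul_conj', map_sum, Finset.sum_mul_sum, Finset.mul_sum]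
    rw [Finset.sum_comm]
    refine Finset.sum_congr rfl fun c _ => ?_
    rw [Finset.sum_comm]
    refine Finset.sum_congr rfl fun c' _ => Finset.sum_congr rfl fun n _ => ?_
    rw [map_mul]; ring
  have hD : 0 ≤ Q^2/U := by positivity
  have hlog : 0 ≤ 1 + Real.log N := by have := Real.log_natCast_nonneg N; linarith
  have hterm : ∀ c ∈ X, ∀ c' ∈ X, ‖b c * conj (b c') * ∑ n ∈ Ico U N, (1/(n:ℝ) : ℝ) * (c.2 n * conj (c'.2 n))‖ ≤
      (if c = c' then ‖b c‖^2 * (1 + Real.log N) else 0) + (‖b c‖^2 + ‖b c'‖^2)/2 * (Q^2/U) := by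
    intro c hc c' hc'
    rw [norm_mul, norm_mul, RCLike.norm_conj]
    have hsq : ‖b c‖ * ‖b c'‖ ≤ (‖b c‖^2 + ‖b c'‖^2)/2 := by nlinarith [sq_nonneg (‖b c‖ - ‖b c'‖)]
    by_cases h : c = c'
    · subst h
      rw [if_pos rfl]
      have : ‖∑ n ∈ Ico U N, (1/(n:ℝ) : ℝ) * (c.2 n * conj (c.2 n))‖ ≤ 1 + Real.log N := by
        refine le_trans (norm_sum_le _ _) (le_trans (Finset.sum_le_sum fun n _ => ?_) (sum_inv_le U N hU))
        rw [norm_mul, norm_mul, RCLike.norm_conj, Complex.norm_real, Real.norm_of_nonneg (by positivity)]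
        have := c.2.norm_le_one n
        have h2 : ‖c.2 n‖ * ‖c.2 n‖ ≤ 1 := by nlinarith [norm_nonneg (c.2 n)]
        exact mul_le_of_le_one_right (by positivity) h2
      calc _ ≤ ‖b c‖ * ‖b c‖ * (1 + Real.log N) := by gcongr
        _ = ‖b c‖^2 * (1 + Real.log N) := by ring
        _ ≤ _ := le_add_of_nonneg_right (by positivity)
    · rw [if_neg h, zero_add]
      have := offdiag c c' (hX c hc).1 (hX c' hc').1 (hX c hc).2.1 (hX c' hc').2.1 h Q (hX c hc).2.2 (hX c' hc').2.2 U N hU hN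
      gcongr
  have h0 : 0 ≤ ∑ n ∈ Ico U N, 1/(n:ℝ) * ‖∑ c ∈ X, b c * c.2 n‖^2 := Finset.sum_nonneg fun n _ => by positivity
  rw [← Real.norm_of_nonneg h0, ← Complex.norm_real, hexp]
  calc _ ≤ ∑ c ∈ X, ∑ c' ∈ X, ((if c = c' then ‖b c‖^2 * (1 + Real.log N) else 0) + (‖b c‖^2 + ‖b c'‖^2)/2 * (Q^2/U)) := by
        refine (norm_sum_le _ _).trans (Finset.sum_le_sum fun c hc => ?_)
        exact (norm_sum_le _ _).trans (Finset.sum_le_sum fun c' hc' => hterm c hc c' hc')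
    _ = _ := by
        simp_rw [Finset.sum_add_distrib]
        have e1 : ∑ c ∈ X, ∑ c' ∈ X, (if c = c' then ‖b c‖^2 * (1 + Real.log N) else 0) = (∑ c ∈ X, ‖b c‖^2) * (1 + Real.log N) := by
          rw [Finset.sum_mul]
          refine Finset.sum_congr rfl fun c hc => ?_
          rw [Finset.sum_ite_eq]; simp [hc]
        rw [e1]
        simp_rw [← Finset.sum_mul, ← Finset.sum_div, Finset.sum_add_distrib]
        simp only [Finset.sum_const, nsmul_eq_mul]
        rw [← Finset.mul_sum]
        ring

lemma large_sieve (Q : ℝ) (X : Finset Ch) (hX : Fam Q X) (a : ℕ → ℂ) (U N : ℕ) (hU : 1 ≤ U) (hN : U ≤ N) :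
    ∑ c ∈ X, ‖∑ n ∈ Ico U N, (1/(n:ℝ) : ℝ) * (a n * c.2 n)‖^2 ≤
      (∑ n ∈ Ico U N, 1/(n:ℝ) * ‖a n‖^2) * (1 + Real.log N + X.card * (Q^2/U)) := by
  set S : Ch → ℂ := fun c => ∑ n ∈ Ico U N, (1/(n:ℝ) : ℝ) * (a n * c.2 n) with hS
  set T : ℝ := ∑ c ∈ X, ‖S c‖^2 with hT
  set D := 1 + Real.log N + X.card * (Q^2/U) with hD
  set A := ∑ n ∈ Ico U N, 1/(n:ℝ) * ‖a n‖^2 with hA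
  have hlog : 0 ≤ 1 + Real.log N := by have := Real.log_natCast_nonneg N; linarith
  have hD0 : 0 ≤ D := by positivity
  have hA0 : 0 ≤ A := Finset.sum_nonneg fun n _ => by positivity
  have hT0 : 0 ≤ T := Finset.sum_nonneg fun n _ => by positivity
  have hd := dual_bound Q X hX (fun c => conj (S c)) U N hU hN
  simp only [RCLike.norm_conj] at hd
  have e1 : (T : ℂ) = ∑ n ∈ Ico U N, (1/(n:ℝ) : ℝ) * (a n * ∑ c ∈ X, conj (S c) * c.2 n) := by
    rw [hT]; push_cast
    simp_rw [← Complex.conj_mul', Finset.mul_sum]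
    rw [Finset.sum_comm]
    refine Finset.sum_congr rfl fun c _ => ?_
    show conj (S c) * (∑ n ∈ Ico U N, (1/(n:ℝ) : ℝ) * (a n * c.2 n)) = _
    rw [Finset.mul_sum]
    refine Finset.sum_congr rfl fun n _ => ?_
    push_cast; ring
  have e2 : T ≤ ∑ n ∈ Ico U N, (Real.sqrt (1/(n:ℝ)) * ‖a n‖) * (Real.sqrt (1/(n:ℝ)) * ‖∑ c ∈ X, conj (S c) * c.2 n‖) := by
    rw [← Real.norm_of_nonneg hT0, ← Complex.norm_real, e1]
    refine (norm_sum_le _ _).trans (le_of_eq (Finset.sum_congr rfl fun n _ => ?_))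
    rw [norm_mul, norm_mul, Complex.norm_real, Real.norm_of_nonneg (by positivity)]
    have := Real.mul_self_sqrt (show 0 ≤ 1/(n:ℝ) by positivity)
    conv_lhs => rw [← this]
    ring
  have e3 := Finset.sum_mul_sq_le_sq_mul_sq (Ico U N) (fun n : ℕ => Real.sqrt (1/(n:ℝ)) * ‖a n‖)
    (fun n : ℕ => Real.sqrt (1/(n:ℝ)) * ‖∑ c ∈ X, conj (S c) * c.2 n‖)
  have e4 : ∀ (n : ℕ) (y : ℝ), (Real.sqrt (1/(n:ℝ)) * y)^2 = 1/(n:ℝ) * y^2 := by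
    intro n y; rw [mul_pow, Real.sq_sqrt (by positivity)]
  simp_rw [e4] at e3
  have e5 : T^2 ≤ A * (T * D) :=
    calc T^2 ≤ _ := pow_le_pow_left₀ hT0 e2 2
      _ ≤ _ := e3
      _ ≤ A * (T * D) := by gcongr
  show T ≤ A * D
  rcases hT0.eq_or_lt with h | h
  · rw [← h]; positivity
  · nlinarith

lemma fam_card (Q : ℝ) (X : Finset Ch) (hX : Fam Q X) : (X.card : ℝ) ≤ Q^2 := by
  classical
  rcases X.eq_empty_or_nonempty with rfl | hne
  · simp; positivity
  have hQ0 : 0 ≤ Q := by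
    obtain ⟨c, hc⟩ := hne
    exact le_trans (Nat.cast_nonneg _) (hX c hc).2.2
  have h1 : X.card = ∑ r ∈ Icc 1 ⌊Q⌋₊, (X.filter (fun c => c.1 = r)).card := by
    refine Finset.card_eq_sum_card_fiberwise fun c hc => ?_
    have := hX c hc
    simp only [coe_Icc, Set.mem_Icc]
    exact ⟨by omega, Nat.le_floor this.2.2⟩
  have h2 : ∀ r ∈ Icc 1 ⌊Q⌋₊, (X.filter (fun c => c.1 = r)).card ≤ ⌊Q⌋₊ := by
    intro r hr
    rw [mem_Icc] at hr
    have : NeZero r := ⟨by omega⟩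
    have hfin : Nat.card (DirichletCharacter ℂ r) = r.totient := DirichletCharacter.card_eq_totient_of_hasEnoughRootsOfUnity ℂ r
    have : Finite (DirichletCharacter ℂ r) := Nat.finite_of_card_ne_zero (by rw [hfin]; exact (Nat.totient_pos.2 (by omega)).ne')
    have := Fintype.ofFinite (DirichletCharacter ℂ r)
    have hsub : X.filter (fun c => c.1 = r) ⊆ (Finset.univ : Finset (DirichletCharacter ℂ r)).image (fun χ => (⟨r, χ⟩ : Ch)) := by
      rintro ⟨r', χ⟩ hc
      simp only [mem_filter] at hc
      obtain ⟨_, rfl⟩ := hc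
      simp
    calc _ ≤ _ := Finset.card_le_card hsub
      _ ≤ _ := Finset.card_image_le
      _ = r.totient := by rw [Finset.card_univ, ← Nat.card_eq_fintype_card, hfin]
      _ ≤ r := Nat.totient_le r
      _ ≤ _ := hr.2
  have h3 : X.card ≤ ⌊Q⌋₊ * ⌊Q⌋₊ := by
    rw [h1]; refine (Finset.sum_le_sum h2).trans ?_
    simp
  have h4 : (⌊Q⌋₊ : ℝ) ≤ Q := Nat.floor_le hQ0
  calc (X.card : ℝ) ≤ ((⌊Q⌋₊ * ⌊Q⌋₊ : ℕ) : ℝ) := by exact_mod_cast h3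
    _ = (⌊Q⌋₊ : ℝ) * ⌊Q⌋₊ := by push_cast; ring
    _ ≤ Q * Q := by gcongr
    _ = Q^2 := by ring
end BG

namespace BG
open Finset Complex

lemma conv_sum_gen {M : Type*} [AddCommMonoid M] (N : ℕ) (f : ℕ → ℕ → M) (h0 : ∀ k m, k * m = 0 → f k m = 0)
    (hN : ∀ k m, N ≤ k * m → f k m = 0) :
    ∑ n ∈ range N, ∑ x ∈ n.divisorsAntidiagonal, f x.1 x.2 = ∑ k ∈ range N, ∑ m ∈ range N, f k m := by
  classical
  rw [← Finset.sum_product' (range N) (range N) f]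
  have h1 : ∑ x ∈ range N ×ˢ range N, f x.1 x.2 =
      ∑ x ∈ (range N ×ˢ range N).filter (fun x => x.1 * x.2 < N ∧ x.1 * x.2 ≠ 0), f x.1 x.2 := by
    symm
    refine Finset.sum_filter_of_ne fun x _ hx => ⟨?_, ?_⟩
    · by_contra h; exact hx (hN _ _ (not_lt.1 h))
    · intro h; exact hx (h0 _ _ h)
  rw [h1, ← Finset.sum_fiberwise_of_maps_to (t := range N) (g := fun x : ℕ × ℕ => x.1 * x.2)]
  · refine Finset.sum_congr rfl fun n hn => Finset.sum_congr ?_ fun _ _ => rfl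
    ext ⟨k, m⟩
    simp only [Nat.mem_divisorsAntidiagonal, mem_filter, mem_product, mem_range] at *
    constructor
    · rintro ⟨rfl, h⟩
      have hk : 0 < k := Nat.pos_of_ne_zero (left_ne_zero_of_mul h)
      have hm : 0 < m := Nat.pos_of_ne_zero (right_ne_zero_of_mul h)
      exact ⟨⟨⟨lt_of_le_of_lt (Nat.le_mul_of_pos_right k hm) hn, lt_of_le_of_lt (Nat.le_mul_of_pos_left m hk) hn⟩, hn, h⟩, rfl⟩
    · rintro ⟨⟨_, _, h⟩, rfl⟩
      exact ⟨rfl, h⟩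
  · intro x hx
    simp only [mem_filter, mem_range] at *
    exact hx.2.1

lemma conv_sum (N : ℕ) (F G : ArithmeticFunction ℝ) (w : ℕ → ℂ) (hw : ∀ n, N ≤ n → w n = 0) :
    ∑ n ∈ range N, (((F * G) n : ℝ) : ℂ) * w n = ∑ k ∈ range N, ∑ m ∈ range N, (F k : ℂ) * (G m : ℂ) * w (k * m) := by
  rw [← conv_sum_gen N (fun k m => (F k : ℂ) * (G m : ℂ) * w (k * m))]
  · refine Finset.sum_congr rfl fun n _ => ?_
    rw [ArithmeticFunction.mul_apply]
    push_cast
    rw [Finset.sum_mul]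
    refine Finset.sum_congr rfl fun x hx => ?_
    rw [(Nat.mem_divisorsAntidiagonal.1 hx).1]
  · intro k m h
    rcases Nat.mul_eq_zero.1 h with rfl | rfl <;> simp
  · intro k m h
    rw [hw _ h, mul_zero]

lemma conv_sum_le (N : ℕ) (f g : ℕ → ℝ) (hf : ∀ n, 0 ≤ f n) (hg : ∀ n, 0 ≤ g n) :
    ∑ n ∈ range N, ∑ x ∈ n.divisorsAntidiagonal, f x.1 * g x.2 ≤ (∑ n ∈ Ico 1 N, f n) * ∑ n ∈ Ico 1 N, g n := by
  classical
  have h := conv_sum_gen N (fun k m => if k * m = 0 ∨ N ≤ k * m then 0 else f k * g m)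
    (fun k m h => if_pos (Or.inl h)) (fun k m h => if_pos (Or.inr h))
  have e1 : ∑ n ∈ range N, ∑ x ∈ n.divisorsAntidiagonal, f x.1 * g x.2 =
      ∑ n ∈ range N, ∑ x ∈ n.divisorsAntidiagonal, (if x.1 * x.2 = 0 ∨ N ≤ x.1 * x.2 then 0 else f x.1 * g x.2) := by
    refine Finset.sum_congr rfl fun n hn => Finset.sum_congr rfl fun x hx => ?_
    rw [Nat.mem_divisorsAntidiagonal] at hx
    rw [mem_range] at hn
    rw [if_neg]
    rw [hx.1]; push Not; exact ⟨hx.2, hn⟩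
  rw [e1, h, Finset.sum_mul_sum]
  have hsub : Ico 1 N ⊆ range N := by intro i; simp
  calc _ ≤ ∑ k ∈ Ico 1 N, ∑ m ∈ range N, (if k * m = 0 ∨ N ≤ k * m then 0 else f k * g m) := by
        refine le_of_eq (Finset.sum_subset hsub ?_).symm
        intro k hk hk'
        have : k = 0 := by simp at hk hk'; omega
        subst this; simp
    _ ≤ _ := by
        refine Finset.sum_le_sum fun k _ => ?_
        rw [← Finset.sum_subset hsub]
        · refine Finset.sum_le_sum fun m _ => ?_
          split_ifs
          · exact mul_nonneg (hf _) (hg _)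
          · exact le_rfl
        · intro m hm hm'
          have : m = 0 := by simp at hm hm'; omega
          subst this; simp

lemma card_dA (n : ℕ) : n.divisorsAntidiagonal.card = n.divisors.card := by
  have := Nat.sum_divisorsAntidiagonal (n := n) (fun _ _ => 1)
  simpa using this

lemma tau_sum (N : ℕ) : ∑ n ∈ range N, (n.divisors.card : ℝ) / n ≤ (1 + Real.log N)^2 := by
  have h := conv_sum_le N (fun n => 1/(n:ℝ)) (fun n => 1/(n:ℝ)) (fun n => by positivity) (fun n => by positivity)
  have hb := sum_inv_le 1 N le_rfl
  have h0 : 0 ≤ ∑ n ∈ Ico 1 N, 1/(n:ℝ) := Finset.sum_nonneg fun n _ => by positivity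
  calc _ = ∑ n ∈ range N, ∑ x ∈ n.divisorsAntidiagonal, 1/(x.1:ℝ) * (1/(x.2:ℝ)) := by
        refine Finset.sum_congr rfl fun n _ => ?_
        have : ∀ x ∈ n.divisorsAntidiagonal, 1/(x.1:ℝ) * (1/(x.2:ℝ)) = 1/(n:ℝ) := by
          intro x hx
          rw [← (Nat.mem_divisorsAntidiagonal.1 hx).1]; push_cast; rw [one_div_mul_one_div]
        rw [Finset.sum_congr rfl this, Finset.sum_const, nsmul_eq_mul, card_dA]
        ring
    _ ≤ _ := h
    _ ≤ (1 + Real.log N) * (1 + Real.log N) := by gcongr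
    _ = _ := by ring

lemma tau_mul_le (a b : ℕ) : (a * b).divisors.card ≤ a.divisors.card * b.divisors.card := by
  classical
  rw [Nat.divisors_mul]; exact Finset.card_mul_le

lemma tau_sq_sum (N : ℕ) : ∑ n ∈ range N, (n.divisors.card : ℝ)^2 / n ≤ (1 + Real.log N)^4 := by
  have h := conv_sum_le N (fun n => (n.divisors.card:ℝ)/(n:ℝ)) (fun n => (n.divisors.card:ℝ)/(n:ℝ)) (fun n => by positivity) (fun n => by positivity)
  have hb : ∑ n ∈ Ico 1 N, (n.divisors.card:ℝ)/(n:ℝ) ≤ (1 + Real.log N)^2 := by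
    refine le_trans (Finset.sum_le_sum_of_subset_of_nonneg ?_ fun n _ _ => by positivity) (tau_sum N)
    intro i; simp
  have h0 : 0 ≤ ∑ n ∈ Ico 1 N, (n.divisors.card:ℝ)/(n:ℝ) := Finset.sum_nonneg fun n _ => by positivity
  calc _ ≤ ∑ n ∈ range N, ∑ x ∈ n.divisorsAntidiagonal, (x.1.divisors.card:ℝ)/(x.1:ℝ) * ((x.2.divisors.card:ℝ)/(x.2:ℝ)) := by
        refine Finset.sum_le_sum fun n _ => ?_
        have : ∀ x ∈ n.divisorsAntidiagonal, (n.divisors.card:ℝ)/n ≤ (x.1.divisors.card:ℝ)/(x.1:ℝ) * ((x.2.divisors.card:ℝ)/(x.2:ℝ)) := by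
          intro x hx
          rw [← (Nat.mem_divisorsAntidiagonal.1 hx).1, div_mul_div_comm]
          push_cast
          gcongr
          exact_mod_cast tau_mul_le x.1 x.2
        have h2 := Finset.card_nsmul_le_sum _ _ _ this
        rw [nsmul_eq_mul, card_dA] at h2
        refine le_trans (le_of_eq ?_) h2
        ring
    _ ≤ _ := h
    _ ≤ (1 + Real.log N)^2 * (1 + Real.log N)^2 := by gcongr
    _ = _ := by ring

lemma log_NL (ℓ : ℝ) (hℓ : 0 ≤ ℓ) : Real.log (NL ℓ) ≤ ℓ + 1 := by
  have h0 : (0:ℝ) < NL ℓ := by unfold NL; positivity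
  rw [Real.log_le_iff_le_exp h0]
  have h1 : (⌊Real.exp ℓ⌋₊ : ℝ) ≤ Real.exp ℓ := Nat.floor_le (Real.exp_pos _).le
  have h2 : 1 ≤ Real.exp ℓ := Real.one_le_exp hℓ
  have h3 : 2 ≤ Real.exp 1 := by have := Real.add_one_le_exp 1; linarith
  unfold NL; push_cast
  rw [Real.exp_add]
  nlinarith

lemma bmp_lip : ∃ K : ℝ, 0 ≤ K ∧ ∀ x y : ℝ, |bmp x - bmp y| ≤ K * |x - y| := by
  obtain ⟨C, hC⟩ := ContDiff.lipschitzWith_of_hasCompactSupport (𝕂 := ℝ) (n := 1) bmp.hasCompactSupport bmp.contDiff (by norm_num)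
  exact ⟨C, C.2, fun x y => by simpa [Real.dist_eq] using hC.dist_le_mul x y⟩

lemma typeI_core (K : ℝ) (hK0 : 0 ≤ K) (hK : ∀ x y : ℝ, |bmp x - bmp y| ≤ K * |x - y|)
    (ℓ : ℝ) (hℓ : 1 ≤ ℓ) {r : ℕ} [NeZero r] (χ : DirichletCharacter ℂ r) (hχ : χ ≠ 1) (k a : ℕ) (hk : 1 ≤ k) (ha : 1 ≤ a)
    (g : ℕ → ℝ) (hg : ∀ m, a ≤ m → g (m+1) ≤ g m) (hg0 : ∀ m, a ≤ m → 0 ≤ g m)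
    (hz : ∀ m < a, bmp (Real.log (k * m : ℕ) / ℓ) = 0) :
    ‖∑ m ∈ range (NL ℓ), (bmp (Real.log (k * m : ℕ) / ℓ) : ℂ) * (g m * χ m)‖ ≤ r * g a * (1 + 2 * K) := by
  have hga := hg0 a le_rfl
  rcases le_or_gt (NL ℓ) a with h | h
  · rw [Finset.sum_eq_zero]
    · rw [norm_zero]; positivity
    · intro m hm
      rw [hz m (by simp at hm; omega)]; simp
  · have e1 : ∑ m ∈ range (NL ℓ), (bmp (Real.log (k * m : ℕ) / ℓ) : ℂ) * (g m * χ m) =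
        ∑ m ∈ Ico a (NL ℓ), (bmp (Real.log (k * m : ℕ) / ℓ) : ℂ) * (g m * χ m) := by
      symm
      refine Finset.sum_subset (by intro m; simp) ?_
      intro m hm hm'
      rw [hz m (by simp at hm hm'; omega)]; simp
    rw [e1]
    have hpart : ∀ n, ‖∑ m ∈ Ico a n, (g m * χ m : ℂ)‖ ≤ r * g a := by
      intro n
      rcases le_or_gt a n with h | h
      · exact abel_antitone (fun m => χ m) g a n h r (fun n => char_sum_bound χ hχ a n) hg hg0
      · rw [Finset.Ico_eq_empty (by omega)]; simp; positivity
    refine (abel_bound (fun m => (g m * χ m : ℂ)) (fun m => (bmp (Real.log (k * m : ℕ) / ℓ) : ℂ)) a (NL ℓ) h.le _ hpart).trans ?_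
    gcongr
    · rw [Complex.norm_real, Real.norm_of_nonneg bmp.nonneg]; exact bmp.le_one
    · have hstep : ∀ m ∈ Ico a (NL ℓ), ‖((bmp (Real.log (k * m : ℕ) / ℓ) : ℝ) : ℂ) - ((bmp (Real.log (k * (m+1) : ℕ) / ℓ) : ℝ) : ℂ)‖ ≤
          K / ℓ * (Real.log ((m+1 : ℕ):ℝ) - Real.log m) := by
        intro m hm
        rw [mem_Ico] at hm
        have hm0 : (0:ℝ) < m := by exact_mod_cast (by omega : 0 < m)
        have hk0 : (0:ℝ) < k := by exact_mod_cast (by omega : 0 < k)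
        rw [← Complex.ofReal_sub, Complex.norm_real, Real.norm_eq_abs]
        refine (hK _ _).trans (le_of_eq ?_)
        have hmono : Real.log m ≤ Real.log ((m+1:ℕ):ℝ) := Real.log_le_log hm0 (by push_cast; linarith)
        have : Real.log (k * m : ℕ) / ℓ - Real.log (k * (m+1) : ℕ) / ℓ = - ((Real.log ((m+1 : ℕ):ℝ) - Real.log m) / ℓ) := by
          push_cast
          rw [Real.log_mul hk0.ne' hm0.ne', Real.log_mul hk0.ne' (by positivity)]
          ring
        rw [this, abs_neg, abs_of_nonneg (div_nonneg (by linarith) (by linarith))]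
        ring
      refine (Finset.sum_le_sum hstep).trans ?_
      rw [← Finset.mul_sum, Finset.sum_Ico_sub (fun m : ℕ => Real.log (m:ℝ)) h.le]
      have h1 := log_NL ℓ (by linarith)
      have h2 := Real.log_natCast_nonneg a
      calc K / ℓ * (Real.log (NL ℓ) - Real.log a) ≤ K / ℓ * (2 * ℓ) := by gcongr; linarith
        _ = 2 * K := by field_simp

lemma typeI (K : ℝ) (hK0 : 0 ≤ K) (hK : ∀ x y : ℝ, |bmp x - bmp y| ≤ K * |x - y|)
    (ℓ : ℝ) (hℓ : 10 ≤ ℓ) {r : ℕ} [NeZero r] (χ : DirichletCharacter ℂ r) (hχ : χ ≠ 1) (k : ℕ) (hk : 1 ≤ k)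
    (hk2 : (k:ℝ) ≤ Real.exp (2*ℓ/5)) :
    ‖∑ m ∈ range (NL ℓ), χ m * uu ℓ (k*m)‖ ≤ r * (ℓ+1) * Real.exp (-(5*ℓ/8)) * (1 + 2*K) ∧
    ‖∑ m ∈ range (NL ℓ), (Real.log m : ℂ) * χ m * uu ℓ (k*m)‖ ≤ r * (ℓ+1) * Real.exp (-(5*ℓ/8)) * (1 + 2*K) := by
  have hk0 : (0:ℝ) < k := by exact_mod_cast (by omega : 0 < k)
  set a := ⌈Real.exp (5*ℓ/8) / k⌉₊ with ha
  have hale : Real.exp (5*ℓ/8) / k ≤ a := Nat.le_ceil _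
  have he3 : Real.exp 1 ≤ Real.exp (5*ℓ/8) / k := by
    rw [le_div_iff₀ hk0]
    calc Real.exp 1 * k ≤ Real.exp 1 * Real.exp (2*ℓ/5) := by gcongr
      _ = Real.exp (1 + 2*ℓ/5) := by rw [Real.exp_add]
      _ ≤ _ := Real.exp_le_exp.2 (by linarith)
  have hea : Real.exp 1 ≤ a := he3.trans hale
  have ha0 : (0:ℝ) < a := lt_of_lt_of_le (Real.exp_pos 1) hea
  have ha1 : 1 ≤ a := by exact_mod_cast ha0
  have haN : a ≤ NL ℓ := by
    rw [ha]
    refine Nat.ceil_le.2 ?_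
    have h1 : Real.exp ℓ < NL ℓ := by unfold NL; push_cast; exact Nat.lt_floor_add_one _
    refine le_trans ?_ h1.le
    calc Real.exp (5*ℓ/8) / k ≤ Real.exp (5*ℓ/8) / 1 := by gcongr; exact_mod_cast hk
      _ = Real.exp (5*ℓ/8) := div_one _
      _ ≤ _ := Real.exp_le_exp.2 (by linarith)
  have hlogN := log_NL ℓ (by linarith)
  have hloga : Real.log a ≤ ℓ + 1 := (Real.log_le_log ha0 (by exact_mod_cast haN)).trans hlogN
  have hz : ∀ m < a, bmp (Real.log (k * m : ℕ) / ℓ) = 0 := by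
    intro m hm
    refine bmp_zero_left ?_
    rw [div_le_iff₀ (by linarith)]
    rcases eq_or_ne m 0 with rfl | hm0
    · simp; linarith
    have hm' : (0:ℝ) < m := by exact_mod_cast Nat.pos_of_ne_zero hm0
    have h1 : (m:ℝ) < Real.exp (5*ℓ/8) / k := Nat.lt_ceil.1 hm
    rw [lt_div_iff₀ hk0] at h1
    rw [Real.log_le_iff_le_exp (by push_cast; positivity)]
    push_cast
    calc (k:ℝ) * m ≤ Real.exp (5*ℓ/8) := by linarith
      _ = _ := by congr 1; ring
  have hinv : 1/(k:ℝ) * (1/a) ≤ Real.exp (-(5*ℓ/8)) := by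
    rw [one_div_mul_one_div, Real.exp_neg, one_div]
    gcongr
    rw [div_le_iff₀ hk0] at hale
    linarith
  have hu : ∀ m : ℕ, uu ℓ (k*m) = bmp (Real.log (k * m : ℕ) / ℓ) * (1/(k:ℝ) * (1/m)) := by
    intro m; unfold uu; push_cast; rw [one_div_mul_one_div, mul_one_div]
  constructor
  · have h := typeI_core K hK0 hK ℓ (by linarith) χ hχ k a hk ha1 (fun m => 1/(k:ℝ) * (1/m)) ?_ ?_ hz
    · refine le_trans (le_of_eq ?_) (h.trans ?_)
      · congr 1
        refine Finset.sum_congr rfl fun m _ => ?_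
        rw [hu]; push_cast; ring
      · rw [mul_assoc (r:ℝ) (ℓ+1)]
        refine mul_le_mul_of_nonneg_right (mul_le_mul_of_nonneg_left ?_ (by positivity)) (by positivity)
        refine hinv.trans ?_
        exact le_mul_of_one_le_left (Real.exp_pos _).le (by linarith)
    · intro m hm
      have : (0:ℝ) < m := by exact_mod_cast (by omega : 0 < m)
      push_cast; gcongr; linarith
    · intro m hm; positivity
  · have h := typeI_core K hK0 hK ℓ (by linarith) χ hχ k a hk ha1 (fun m => 1/(k:ℝ) * (Real.log m/m)) ?_ ?_ hz
    · refine le_trans (le_of_eq ?_) (h.trans ?_)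
      · congr 1
        refine Finset.sum_congr rfl fun m _ => ?_
        rw [hu]; push_cast; ring
      · rw [mul_assoc (r:ℝ) (ℓ+1)]
        refine mul_le_mul_of_nonneg_right (mul_le_mul_of_nonneg_left ?_ (by positivity)) (by positivity)
        calc 1/(k:ℝ) * (Real.log a / a) = Real.log a * (1/(k:ℝ) * (1/a)) := by ring
          _ ≤ (ℓ+1) * Real.exp (-(5*ℓ/8)) := by gcongr
    · intro m hm
      have hm' : (a:ℝ) ≤ m := by exact_mod_cast hm
      have := Real.log_div_self_antitoneOn (a := (m:ℝ)) (b := ((m+1:ℕ):ℝ)) (by simp; linarith) (by simp; linarith) (by push_cast; linarith)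
      simp only at this
      gcongr
    · intro m hm
      have := Real.log_natCast_nonneg m
      positivity
end BG

namespace BG
open Finset Complex MeasureTheory

noncomputable def cut (U : ℕ) (F : ArithmeticFunction ℝ) : ArithmeticFunction ℝ :=
  ⟨fun n => if n ≤ U then F n else 0, by simp⟩

lemma cut_apply (U : ℕ) (F : ArithmeticFunction ℝ) (n : ℕ) : cut U F n = if n ≤ U then F n else 0 := rfl

noncomputable def muR : ArithmeticFunction ℝ := (ArithmeticFunction.moebius : ArithmeticFunction ℝ)
noncomputable def zeR : ArithmeticFunction ℝ := (ArithmeticFunction.zeta : ArithmeticFunction ℝ)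

lemma vaughan (U : ℕ) :
    ArithmeticFunction.vonMangoldt = cut U ArithmeticFunction.vonMangoldt + cut U muR * ArithmeticFunction.log
      - (cut U ArithmeticFunction.vonMangoldt * cut U muR) * zeR
      + (ArithmeticFunction.vonMangoldt - cut U ArithmeticFunction.vonMangoldt) * ((muR - cut U muR) * zeR) := by
  have h1 : ArithmeticFunction.vonMangoldt * zeR = ArithmeticFunction.log := ArithmeticFunction.vonMangoldt_mul_zeta
  have h2 : muR * zeR = 1 := ArithmeticFunction.coe_moebius_mul_coe_zeta
  rw [← h1]
  linear_combination (-ArithmeticFunction.vonMangoldt + cut U ArithmeticFunction.vonMangoldt) * h2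

lemma muR_abs (n : ℕ) : |muR n| ≤ 1 := by
  unfold muR
  rw [ArithmeticFunction.intCoe_apply]
  have := ArithmeticFunction.abs_moebius_le_one (n := n)
  exact_mod_cast this

lemma zeR_apply (n : ℕ) (h : n ≠ 0) : zeR n = 1 := by
  unfold zeR
  rw [ArithmeticFunction.natCoe_apply, ArithmeticFunction.zeta_apply_ne h]; simp

lemma T_typeI (ℓ : ℝ) (hℓ : 1 ≤ ℓ) {r : ℕ} (χ : DirichletCharacter ℂ r) (F G : ArithmeticFunction ℝ) (V : ℕ) (M b : ℝ)
    (hM : 0 ≤ M) (hb : 0 ≤ b)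
    (hF : ∀ k < NL ℓ, |F k| ≤ M) (hV : ∀ k, V < k → F k = 0)
    (hG : ∀ k, 1 ≤ k → k ≤ V → ‖∑ m ∈ range (NL ℓ), (G m : ℂ) * χ m * uu ℓ (k*m)‖ ≤ b) :
    ‖∑ n ∈ range (NL ℓ), (((F * G) n : ℝ) : ℂ) * (χ n * uu ℓ n)‖ ≤ V * (M * b) := by
  rw [conv_sum (NL ℓ) F G (fun n => χ n * uu ℓ n) (fun n hn => by rw [uu_zero_of_ge (by linarith) hn]; simp)]
  have e : ∀ k ∈ range (NL ℓ), ‖∑ m ∈ range (NL ℓ), (F k : ℂ) * (G m : ℂ) * (χ (k * m : ℕ) * uu ℓ (k * m))‖ ≤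
      if k ∈ Icc 1 V then M * b else 0 := by
    intro k hk
    have : ∑ m ∈ range (NL ℓ), (F k : ℂ) * (G m : ℂ) * (χ (k * m : ℕ) * uu ℓ (k * m)) =
        (F k : ℂ) * χ k * ∑ m ∈ range (NL ℓ), (G m : ℂ) * χ m * uu ℓ (k*m) := by
      rw [Finset.mul_sum]
      refine Finset.sum_congr rfl fun m _ => ?_
      push_cast; rw [map_mul]; ring
    rw [this, norm_mul, norm_mul, Complex.norm_real, Real.norm_eq_abs]
    split_ifs with h
    · rw [mem_Icc] at h
      have h1 := hF k (by simpa using hk)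
      have h2 := χ.norm_le_one k
      have h3 := hG k h.1 h.2
      calc _ ≤ M * 1 * b := by gcongr
        _ = _ := by ring
    · have : F k = 0 := by
        rw [mem_Icc] at h
        rcases Nat.eq_zero_or_pos k with rfl | h0
        · simp
        · exact hV k (by omega)
      rw [this]; simp
  refine (norm_sum_le _ _).trans ((Finset.sum_le_sum e).trans ?_)
  rw [Finset.sum_ite_mem]
  rw [Finset.sum_const, nsmul_eq_mul]
  have : ((range (NL ℓ) ∩ Icc 1 V).card : ℝ) ≤ V := by
    have := Finset.card_le_card (Finset.inter_subset_right (s₁ := range (NL ℓ)) (s₂ := Icc 1 V))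
    simp only [Nat.card_Icc, Nat.add_sub_cancel] at this
    exact_mod_cast this
  have : 0 ≤ M * b := by positivity
  gcongr

/-- type II sums -/
lemma typeII (h : ℝ → ℂ) (hi : Integrable h)
    (hh : ∀ v : ℝ, ((bmp v : ℝ) : ℂ) = ∫ ξ : ℝ, h ξ * Complex.exp (2*Real.pi*ξ*v*I))
    (ℓ : ℝ) (Q : ℝ) (X : Finset Ch) (hX : Fam Q X) (V N : ℕ) (hV : 1 ≤ V) (hVN : V ≤ N) (α β : ℕ → ℝ) :
    ∑ c ∈ X, ‖∑ k ∈ Ico V N, ∑ m ∈ Ico V N, (α k : ℂ) * (β m : ℂ) * (c.2 (k * m : ℕ) * uu ℓ (k * m))‖ ≤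
     (∫ ξ, ‖h ξ‖) * (((∑ n ∈ Ico V N, 1/(n:ℝ) * α n^2) + (∑ n ∈ Ico V N, 1/(n:ℝ) * β n^2)) * (1 + Real.log N + X.card * (Q^2/V))) := by
  set ee : ℝ → ℕ → ℂ := fun ξ n => Complex.exp (2*Real.pi*ξ*(Real.log n/ℓ : ℝ)*I) with hee
  have heen : ∀ ξ n, ‖ee ξ n‖ = 1 := by
    intro ξ n
    rw [hee]; simp only
    rw [show (2*Real.pi*ξ*(Real.log n/ℓ : ℝ)*I : ℂ) = ((2*Real.pi*ξ*(Real.log n/ℓ) : ℝ) : ℂ) * I by push_cast; ring]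
    exact Complex.norm_exp_ofReal_mul_I _
  have heec : ∀ n, Continuous fun ξ => ee ξ n := by intro n; rw [hee]; fun_prop
  set S : (ℕ → ℝ) → ℝ → Ch → ℂ := fun α ξ c => ∑ n ∈ Ico V N, ((1/(n:ℝ):ℝ):ℂ) * ((α n * ee ξ n) * c.2 n) with hS
  have hSc : ∀ α c, Continuous fun ξ => S α ξ c := by intro α c; rw [hS]; fun_prop
  have hSb : ∀ α, ∃ C, ∀ ξ c, ‖S α ξ c‖ ≤ C := by
    intro α
    refine ⟨∑ n ∈ Ico V N, 1/(n:ℝ) * |α n|, fun ξ c => ?_⟩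
    refine (norm_sum_le _ _).trans (Finset.sum_le_sum fun n _ => ?_)
    rw [norm_mul, norm_mul, norm_mul, heen, Complex.norm_real, Complex.norm_real, Real.norm_of_nonneg (by positivity), Real.norm_eq_abs, mul_one]
    have := c.2.norm_le_one n
    gcongr
    exact mul_le_of_le_one_right (abs_nonneg _) this
  have hIntg : ∀ c, Integrable fun ξ => h ξ * (S α ξ c * S β ξ c) := by
    intro c
    obtain ⟨C1, h1⟩ := hSb α
    obtain ⟨C2, h2⟩ := hSb β
    refine hi.mul_bdd (c := C1 * C2) ((hSc α c).mul (hSc β c)).aestronglyMeasurable (Filter.Eventually.of_forall fun ξ => ?_)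
    rw [norm_mul]
    have := (norm_nonneg _).trans (h1 ξ c)
    exact mul_le_mul (h1 ξ c) (h2 ξ c) (norm_nonneg _) this
  have key : ∀ c, ∑ k ∈ Ico V N, ∑ m ∈ Ico V N, (α k : ℂ) * (β m : ℂ) * (c.2 (k * m : ℕ) * uu ℓ (k * m)) =
      ∫ ξ, h ξ * (S α ξ c * S β ξ c) := by
    intro c
    have e1 : ∀ ξ, h ξ * (S α ξ c * S β ξ c) = ∑ k ∈ Ico V N, ∑ m ∈ Ico V N, ((α k : ℂ) * (β m : ℂ) * (c.2 (k * m : ℕ)) * ((1/(k:ℝ):ℝ):ℂ) * ((1/(m:ℝ):ℝ):ℂ)) * (h ξ * (ee ξ k * ee ξ m)) := by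
      intro ξ
      rw [hS]; simp only
      rw [Finset.sum_mul_sum, Finset.mul_sum]
      refine Finset.sum_congr rfl fun k _ => ?_
      rw [Finset.mul_sum]
      refine Finset.sum_congr rfl fun m _ => ?_
      push_cast; rw [map_mul]; ring
    have hint2 : ∀ k m, Integrable fun ξ => h ξ * (ee ξ k * ee ξ m) := by
      intro k m
      refine hi.mul_bdd (c := 1) ((heec k).mul (heec m)).aestronglyMeasurable (Filter.Eventually.of_forall fun ξ => ?_)
      rw [norm_mul, heen, heen, one_mul]
    simp_rw [e1]
    rw [integral_finsetSum _ (fun k _ => integrable_finsetSum _ fun m _ => (hint2 k m).const_mul _)]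
    refine Finset.sum_congr rfl fun k hk => ?_
    rw [integral_finsetSum _ (fun m _ => (hint2 k m).const_mul _)]
    refine Finset.sum_congr rfl fun m hm => ?_
    rw [integral_const_mul]
    have hk0 : (k:ℝ) ≠ 0 := by rw [mem_Ico] at hk; exact_mod_cast (by omega : k ≠ 0)
    have hm0 : (m:ℝ) ≠ 0 := by rw [mem_Ico] at hm; exact_mod_cast (by omega : m ≠ 0)
    have e2 : ∀ ξ : ℝ, h ξ * (ee ξ k * ee ξ m) = h ξ * Complex.exp (2*Real.pi*ξ*(Real.log (k*m:ℕ)/ℓ : ℝ)*I) := by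
      intro ξ
      rw [hee]; simp only
      rw [← Complex.exp_add]
      congr 2
      push_cast
      rw [show Real.log ((k:ℝ) * m) = Real.log k + Real.log m from Real.log_mul hk0 hm0]
      push_cast; ring
    simp_rw [e2]
    rw [← hh]
    unfold uu
    push_cast
    ring
  calc _ = ∑ c ∈ X, ‖∫ ξ, h ξ * (S α ξ c * S β ξ c)‖ := by
        refine Finset.sum_congr rfl fun c _ => by rw [key]
    _ ≤ ∑ c ∈ X, ∫ ξ, ‖h ξ * (S α ξ c * S β ξ c)‖ := Finset.sum_le_sum fun c _ => norm_integral_le_integral_norm _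
    _ = ∫ ξ, ∑ c ∈ X, ‖h ξ * (S α ξ c * S β ξ c)‖ := (integral_finsetSum _ fun c _ => (hIntg c).norm).symm
    _ ≤ ∫ ξ, ‖h ξ‖ * (((∑ n ∈ Ico V N, 1/(n:ℝ) * α n^2) + (∑ n ∈ Ico V N, 1/(n:ℝ) * β n^2)) * (1 + Real.log N + X.card * (Q^2/V))) := by
        refine integral_mono (integrable_finsetSum _ fun c _ => (hIntg c).norm) (hi.norm.mul_const _) fun ξ => ?_
        simp only
        simp_rw [norm_mul]
        rw [← Finset.mul_sum]
        refine mul_le_mul_of_nonneg_left ?_ (norm_nonneg _)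
        have hl : ∀ α : ℕ → ℝ, ∑ c ∈ X, ‖S α ξ c‖^2 ≤ (∑ n ∈ Ico V N, 1/(n:ℝ) * α n^2) * (1 + Real.log N + X.card * (Q^2/V)) := by
          intro α
          have := large_sieve Q X hX (fun n => α n * ee ξ n) V N hV hVN
          refine this.trans (le_of_eq ?_)
          congr 1
          refine Finset.sum_congr rfl fun n _ => ?_
          rw [norm_mul, heen, Complex.norm_real, mul_one, Real.norm_eq_abs, sq_abs]
        calc ∑ c ∈ X, ‖S α ξ c‖ * ‖S β ξ c‖ ≤ ∑ c ∈ X, (‖S α ξ c‖^2 + ‖S β ξ c‖^2) := by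
              refine Finset.sum_le_sum fun c _ => ?_
              nlinarith [sq_nonneg (‖S α ξ c‖ - ‖S β ξ c‖), sq_nonneg (‖S α ξ c‖), sq_nonneg (‖S β ξ c‖)]
          _ ≤ _ := by rw [Finset.sum_add_distrib, add_mul]; exact add_le_add (hl α) (hl β)
    _ = _ := integral_mul_const _ _
end BG

namespace BG
open Finset Complex MeasureTheory

lemma af_sub (F G : ArithmeticFunction ℝ) (n : ℕ) : (F - G) n = F n - G n := by
  have h : F - G + G = F := sub_add_cancel F G
  have h2 : (F - G) n + G n = F n := by rw [← ArithmeticFunction.add_apply, h]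
  linarith

lemma cut_conv_bound (U k : ℕ) : |(cut U ArithmeticFunction.vonMangoldt * cut U muR) k| ≤ Real.log k := by
  rw [ArithmeticFunction.mul_apply]
  refine (Finset.abs_sum_le_sum_abs _ _).trans ?_
  calc _ ≤ ∑ x ∈ k.divisorsAntidiagonal, ArithmeticFunction.vonMangoldt x.1 := by
        refine Finset.sum_le_sum fun x _ => ?_
        rw [abs_mul, cut_apply, cut_apply]
        have h1 := muR_abs x.2
        have h2 := ArithmeticFunction.vonMangoldt_nonneg (n := x.1)
        have h3 : |if x.2 ≤ U then muR x.2 else 0| ≤ 1 := by split_ifs <;> simp [h1]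
        have h4 : |if x.1 ≤ U then ArithmeticFunction.vonMangoldt x.1 else 0| ≤ ArithmeticFunction.vonMangoldt x.1 := by
          split_ifs
          · rw [abs_of_nonneg h2]
          · simpa using h2
        calc _ ≤ ArithmeticFunction.vonMangoldt x.1 * 1 := by gcongr
          _ = _ := mul_one _
    _ = ∑ d ∈ k.divisors, ArithmeticFunction.vonMangoldt d :=
        Nat.sum_divisorsAntidiagonal (n := k) (fun d _ => ArithmeticFunction.vonMangoldt d)
    _ = _ := ArithmeticFunction.vonMangoldt_sum

lemma cut_conv_zero (U k : ℕ) (hk : U*U < k) : (cut U ArithmeticFunction.vonMangoldt * cut U muR) k = 0 := by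
  rw [ArithmeticFunction.mul_apply]
  refine Finset.sum_eq_zero fun x hx => ?_
  rw [cut_apply, cut_apply]
  rw [Nat.mem_divisorsAntidiagonal] at hx
  split_ifs with h1 h2
  · have := Nat.mul_le_mul h1 h2
    omega
  all_goals simp

lemma b_zero (U m : ℕ) (hm : m ≤ U) : ((muR - cut U muR) * zeR) m = 0 := by
  rw [ArithmeticFunction.mul_apply]
  refine Finset.sum_eq_zero fun x hx => ?_
  rw [Nat.mem_divisorsAntidiagonal] at hx
  have h1 : x.1 ≤ m := by
    rw [← hx.1]; exact Nat.le_mul_of_pos_right _ (Nat.pos_of_ne_zero (by rintro h; rw [h] at hx; omega))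
  have : (muR - cut U muR) x.1 = 0 := by
    rw [af_sub, cut_apply, if_pos (h1.trans hm), sub_self]
  rw [this, zero_mul]

lemma b_bound (U m : ℕ) : |((muR - cut U muR) * zeR) m| ≤ m.divisors.card := by
  rw [ArithmeticFunction.mul_apply]
  refine (Finset.abs_sum_le_sum_abs _ _).trans ?_
  rw [← card_dA, ← nsmul_one]
  refine Finset.sum_le_card_nsmul _ _ _ fun x hx => ?_
  rw [Nat.mem_divisorsAntidiagonal] at hx
  rw [zeR_apply _ (by rintro h; rw [h] at hx; omega), mul_one, af_sub, cut_apply]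
  split_ifs
  · simp
  · simpa using muR_abs x.1

set_option maxHeartbeats 1000000 in
lemma psi_large : ∃ C : ℝ, 0 ≤ C ∧ ∀ ℓ : ℝ, 20 ≤ ℓ → ∀ X : Finset Ch, Fam (Real.exp (ℓ/20)) X →
    ∑ c ∈ X, ‖psi ℓ c.2‖ ≤ C * ℓ^5 := by
  obtain ⟨K, hK0, hK⟩ := bmp_lip
  obtain ⟨h, hcont, hIntg, hh⟩ := fourier_pkg (fun v => ((bmp v : ℝ) : ℂ))
    (Complex.ofRealCLM.contDiff.comp bmp.contDiff) (bmp.hasCompactSupport.comp_left (g := fun x : ℝ => (x:ℂ)) Complex.ofReal_zero)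
  have hi : Integrable h := by
    have := hIntg 0
    simp only [pow_zero, one_mul] at this
    exact (integrable_norm_iff hcont.aestronglyMeasurable).1 this
  have hH : 0 ≤ ∫ ξ, ‖h ξ‖ := integral_nonneg fun _ => norm_nonneg _
  refine ⟨8 * (1+2*K) + 64 * (∫ ξ, ‖h ξ‖), by positivity, fun ℓ hℓ X hX => ?_⟩
  set U := ⌊Real.exp (ℓ/5)⌋₊ with hU
  have hUle : (U:ℝ) ≤ Real.exp (ℓ/5) := Nat.floor_le (Real.exp_pos _).le
  have hUge : Real.exp (ℓ/5) ≤ ((U+1:ℕ):ℝ) := by push_cast; exact (Nat.lt_floor_add_one _).le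
  have hU1 : 1 ≤ U := Nat.le_floor (by simpa using Real.one_le_exp (by positivity))
  have hU2 : ((U*U:ℕ):ℝ) ≤ Real.exp (2*ℓ/5) := by
    push_cast
    calc (U:ℝ)*U ≤ Real.exp (ℓ/5) * Real.exp (ℓ/5) := by gcongr
      _ = _ := by rw [← Real.exp_add]; congr 1; ring
  have hlogN := log_NL ℓ (by linarith)
  have hN0 : (1:ℝ) ≤ NL ℓ := by unfold NL; push_cast; linarith [Nat.cast_nonneg (α := ℝ) ⌊Real.exp ℓ⌋₊]
  have hlogN0 : 0 ≤ Real.log (NL ℓ) := Real.log_nonneg hN0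
  have hUN : U + 1 ≤ NL ℓ := by
    unfold NL; rw [hU]
    exact Nat.add_le_add_right (Nat.floor_le_floor (Real.exp_le_exp.2 (by linarith))) 1
  have hlogk : ∀ k < NL ℓ, Real.log k ≤ ℓ + 1 := by
    intro k hk
    rcases Nat.eq_zero_or_pos k with rfl | h0
    · simp; linarith
    · exact (Real.log_le_log (by exact_mod_cast h0) (by exact_mod_cast hk.le)).trans hlogN
  set E := Real.exp (2*ℓ/5) * ((ℓ+1) * (Real.exp (ℓ/20) * (ℓ+1) * Real.exp (-(5*ℓ/8)) * (1 + 2*K))) with hE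
  set α : ℕ → ℝ := fun n => (ArithmeticFunction.vonMangoldt - cut U ArithmeticFunction.vonMangoldt) n with hα
  set β : ℕ → ℝ := fun n => ((muR - cut U muR) * zeR) n with hβ
  have hαz : ∀ k ≤ U, α k = 0 := by
    intro k hk
    rw [hα]; simp only
    rw [af_sub, cut_apply, if_pos hk, sub_self]
  have hαb : ∀ k, |α k| ≤ Real.log k := by
    intro k
    rw [hα]; simp only
    rw [af_sub, cut_apply]
    have h1 := ArithmeticFunction.vonMangoldt_nonneg (n := k)
    have h2 := ArithmeticFunction.vonMangoldt_le_log (n := k)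
    split_ifs
    · simp; linarith
    · rw [sub_zero, abs_of_nonneg h1]; exact h2
  have each : ∀ c ∈ X, ‖psi ℓ c.2‖ ≤ 2 * E + ‖∑ k ∈ Ico (U+1) (NL ℓ), ∑ m ∈ Ico (U+1) (NL ℓ), (α k : ℂ) * (β m : ℂ) * (c.2 (k * m : ℕ) * uu ℓ (k * m))‖ := by
    intro c hc
    obtain ⟨hc1, hc2, hc3⟩ := hX c hc
    haveI : NeZero c.1 := ⟨by omega⟩
    have hne := ne_one_of_primitive hc1 c.2 hc2
    set b := (c.1:ℝ) * (ℓ+1) * Real.exp (-(5*ℓ/8)) * (1 + 2*K) with hb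
    have hb0 : 0 ≤ b := by positivity
    have hbb : b ≤ Real.exp (ℓ/20) * (ℓ+1) * Real.exp (-(5*ℓ/8)) * (1 + 2*K) := by rw [hb]; gcongr
    have hw0 : ∀ n, NL ℓ ≤ n → c.2 n * (uu ℓ n : ℂ) = 0 := fun n hn => by rw [uu_zero_of_ge (by linarith) hn]; simp
    have e : psi ℓ c.2 = ∑ n ∈ range (NL ℓ), ((cut U ArithmeticFunction.vonMangoldt n : ℝ) : ℂ) * (c.2 n * uu ℓ n)
        + ∑ n ∈ range (NL ℓ), (((cut U muR * ArithmeticFunction.log) n : ℝ) : ℂ) * (c.2 n * uu ℓ n)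
        - ∑ n ∈ range (NL ℓ), ((((cut U ArithmeticFunction.vonMangoldt * cut U muR) * zeR) n : ℝ) : ℂ) * (c.2 n * uu ℓ n)
        + ∑ n ∈ range (NL ℓ), ((((ArithmeticFunction.vonMangoldt - cut U ArithmeticFunction.vonMangoldt) * ((muR - cut U muR) * zeR)) n : ℝ) : ℂ) * (c.2 n * uu ℓ n) := by
      unfold psi
      rw [← Finset.sum_add_distrib, ← Finset.sum_sub_distrib, ← Finset.sum_add_distrib]
      refine Finset.sum_congr rfl fun n _ => ?_
      conv_lhs => rw [vaughan U]
      rw [ArithmeticFunction.add_apply, af_sub, ArithmeticFunction.add_apply]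
      push_cast; ring
    have t1 : ∑ n ∈ range (NL ℓ), ((cut U ArithmeticFunction.vonMangoldt n : ℝ) : ℂ) * (c.2 n * uu ℓ n) = 0 := by
      refine Finset.sum_eq_zero fun n _ => ?_
      rw [cut_apply]
      split_ifs with hn
      · have : uu ℓ n = 0 := by
          unfold uu
          rw [bmp_zero_left, zero_div]
          rw [div_le_iff₀ (by linarith)]
          rcases Nat.eq_zero_or_pos n with rfl | h0
          · simp; linarith
          rw [Real.log_le_iff_le_exp (by exact_mod_cast h0)]
          calc (n:ℝ) ≤ U := by exact_mod_cast hn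
            _ ≤ _ := hUle
            _ ≤ _ := Real.exp_le_exp.2 (by linarith)
        rw [this]; simp
      · simp
    have t2 : ‖∑ n ∈ range (NL ℓ), (((cut U muR * ArithmeticFunction.log) n : ℝ) : ℂ) * (c.2 n * uu ℓ n)‖ ≤ E := by
      have := T_typeI ℓ (by linarith) c.2 (cut U muR) ArithmeticFunction.log U 1 b (by norm_num) hb0 ?_ ?_ ?_
      · refine this.trans ?_
        rw [hE]
        have h1 : (U:ℝ) ≤ Real.exp (2*ℓ/5) := hUle.trans (Real.exp_le_exp.2 (by linarith))
        gcongr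
        linarith
      · intro k _
        rw [cut_apply]
        split_ifs
        · exact muR_abs k
        · simp
      · intro k hk
        rw [cut_apply, if_neg (by omega)]
      · intro k hk1 hk2
        refine (typeI K hK0 hK ℓ (by linarith) c.2 hne k hk1 ?_).2
        calc (k:ℝ) ≤ U := by exact_mod_cast hk2
            _ ≤ _ := hUle
            _ ≤ _ := Real.exp_le_exp.2 (by linarith)
    have t3 : ‖∑ n ∈ range (NL ℓ), ((((cut U ArithmeticFunction.vonMangoldt * cut U muR) * zeR) n : ℝ) : ℂ) * (c.2 n * uu ℓ n)‖ ≤ E := by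
      have := T_typeI ℓ (by linarith) c.2 (cut U ArithmeticFunction.vonMangoldt * cut U muR) zeR (U*U) (ℓ+1) b (by linarith) hb0 ?_ ?_ ?_
      · refine this.trans ?_
        rw [hE]
        gcongr
      · intro k hk
        rcases Nat.eq_zero_or_pos k with rfl | h0
        · simp; linarith
        · exact (cut_conv_bound U k).trans (hlogk k hk)
      · intro k hk
        exact cut_conv_zero U k hk
      · intro k hk1 hk2
        have hh1 := (typeI K hK0 hK ℓ (by linarith) c.2 hne k hk1 (le_trans (by exact_mod_cast hk2) hU2)).1
        refine le_trans (le_of_eq ?_) hh1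
        congr 1
        refine Finset.sum_congr rfl fun m _ => ?_
        rcases Nat.eq_zero_or_pos m with rfl | h0
        · simp [uu]
        · rw [zeR_apply m (by omega)]; simp
    have t4 : ∑ n ∈ range (NL ℓ), ((((ArithmeticFunction.vonMangoldt - cut U ArithmeticFunction.vonMangoldt) * ((muR - cut U muR) * zeR)) n : ℝ) : ℂ) * (c.2 n * uu ℓ n) =
        ∑ k ∈ Ico (U+1) (NL ℓ), ∑ m ∈ Ico (U+1) (NL ℓ), (α k : ℂ) * (β m : ℂ) * (c.2 (k * m : ℕ) * uu ℓ (k * m)) := by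
      rw [conv_sum (NL ℓ) _ _ (fun n => c.2 n * uu ℓ n) hw0]
      have hsub : Ico (U+1) (NL ℓ) ⊆ range (NL ℓ) := by intro i; simp
      rw [← Finset.sum_subset hsub]
      · refine Finset.sum_congr rfl fun k _ => ?_
        rw [← Finset.sum_subset hsub]
        intro m hm hm'
        have : β m = 0 := b_zero U m (by simp at hm hm'; omega)
        rw [hβ] at this; simp only at this
        rw [this]; simp
      · intro k hk hk'
        refine Finset.sum_eq_zero fun m _ => ?_
        have := hαz k (by simp at hk hk'; omega)
        rw [hα] at this; simp only at this
        rw [this]; simp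
    rw [e, t1, t4, zero_add]
    refine (norm_add_le _ _).trans ?_
    gcongr
    refine (norm_sub_le _ _).trans ?_
    linarith
  have hcard := fam_card _ X hX
  have hII := typeII h hi hh ℓ (Real.exp (ℓ/20)) X hX (U+1) (NL ℓ) (by omega) hUN α β
  have hsq : Real.exp (ℓ/20)^2 = Real.exp (ℓ/10) := by rw [← Real.exp_nat_mul]; congr 1; push_cast; ring
  rw [hsq] at hcard hII
  have hEE : Real.exp (ℓ/10) * (2 * E) ≤ 8 * (1+2*K) * ℓ^5 := by
    have : Real.exp (ℓ/10) * (2 * E) = 2 * (ℓ+1)^2 * (1+2*K) * Real.exp (ℓ/10 + 2*ℓ/5 + ℓ/20 - 5*ℓ/8) := by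
      rw [hE, Real.exp_sub, Real.exp_add, Real.exp_add, Real.exp_neg]; field_simp
    rw [this]
    have h1 : Real.exp (ℓ/10 + 2*ℓ/5 + ℓ/20 - 5*ℓ/8) ≤ 1 := Real.exp_le_one_iff.2 (by linarith)
    have h2 : (ℓ+1)^2 ≤ (2*ℓ)^2 := by gcongr; linarith
    have h3 : ℓ^2 ≤ ℓ^5 := pow_le_pow_right₀ (by linarith) (by norm_num)
    calc _ ≤ 2 * (2*ℓ)^2 * (1+2*K) * 1 := by gcongr
      _ = 8 * (1+2*K) * ℓ^2 := by ring
      _ ≤ _ := by gcongr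
  have hA : ∑ n ∈ Ico (U+1) (NL ℓ), 1/(n:ℝ) * α n^2 ≤ (ℓ+3)^4 := by
    calc _ ≤ ∑ n ∈ Ico (U+1) (NL ℓ), 1/(n:ℝ) * (ℓ+1)^2 := by
          refine Finset.sum_le_sum fun n hn => ?_
          have : |α n| ≤ ℓ+1 := (hαb n).trans (hlogk n (by simp at hn; omega))
          rw [← sq_abs]
          gcongr
      _ ≤ (1 + Real.log (NL ℓ)) * (ℓ+1)^2 := by
          rw [← Finset.sum_mul]; gcongr; exact sum_inv_le _ _ (by omega)
      _ ≤ (ℓ+3) * (ℓ+3)^2 := mul_le_mul (by linarith) (by gcongr; norm_num) (by positivity) (by positivity)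
      _ = (ℓ+3)^3 := by ring
      _ ≤ _ := pow_le_pow_right₀ (by linarith) (by norm_num)
  have hB : ∑ n ∈ Ico (U+1) (NL ℓ), 1/(n:ℝ) * β n^2 ≤ (ℓ+3)^4 := by
    calc _ ≤ ∑ n ∈ range (NL ℓ), (n.divisors.card : ℝ)^2 / n := by
          refine (Finset.sum_le_sum fun n hn => ?_).trans (Finset.sum_le_sum_of_subset_of_nonneg (s := Ico (U+1) (NL ℓ)) (by intro i; simp) fun n _ _ => by positivity)
          rw [← sq_abs, one_div, inv_mul_eq_div]
          have := b_bound U n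
          gcongr
      _ ≤ _ := tau_sq_sum _
      _ ≤ _ := pow_le_pow_left₀ (by positivity) (by linarith) 4
  have hL : 1 + Real.log (NL ℓ) + X.card * (Real.exp (ℓ/10) / ((U+1:ℕ):ℝ)) ≤ ℓ + 3 := by
    have : X.card * (Real.exp (ℓ/10) / ((U+1:ℕ):ℝ)) ≤ 1 := by
      rw [← mul_div_assoc, div_le_one (by positivity)]
      calc X.card * Real.exp (ℓ/10) ≤ Real.exp (ℓ/10) * Real.exp (ℓ/10) := by gcongr
        _ = Real.exp (ℓ/5) := by rw [← Real.exp_add]; congr 1; ring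
        _ ≤ _ := hUge
    linarith
  calc ∑ c ∈ X, ‖psi ℓ c.2‖ ≤ X.card * (2 * E) + (∫ ξ, ‖h ξ‖) * (((ℓ+3)^4 + (ℓ+3)^4) * (ℓ+3)) := by
        refine (Finset.sum_le_sum each).trans ?_
        rw [Finset.sum_add_distrib, Finset.sum_const, nsmul_eq_mul]
        gcongr
        refine hII.trans ?_
        gcongr
    _ ≤ 8 * (1+2*K) * ℓ^5 + (∫ ξ, ‖h ξ‖) * (2 * (2*ℓ)^5) := by
        refine add_le_add (le_trans (by gcongr) hEE) (mul_le_mul_of_nonneg_left ?_ hH)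
        · calc _ = 2 * (ℓ+3)^5 := by ring
            _ ≤ _ := by gcongr; linarith
    _ = _ := by ring
end BG

namespace BG
open Finset Complex MeasureTheory

lemma BV (A : ℕ) (L0 : ℝ) : ∃ ℓ ≥ L0, 20 ≤ ℓ ∧ ∀ X : Finset Ch, Fam (Real.exp (ℓ/20)) X →
    (∑ c ∈ X, ‖psi ℓ c.2‖ / Real.sqrt c.1) * ℓ^A ≤ 1 := by
  classical
  set B := 2 * (A+7) with hB
  obtain ⟨C1, L1, hC1, hL1, h1⟩ := psi_small (A + 2*B + 1) B
  obtain ⟨C2, hC2, h2⟩ := psi_large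
  obtain ⟨ℓ, hℓ, hgood⟩ := exists_good B (by omega) (max (max L0 L1) (max 20 (max (2*C1) (2*C2))))
  simp only [ge_iff_le, max_le_iff] at hℓ
  obtain ⟨⟨hl0, hl1⟩, hl20, hlC1, hlC2⟩ := hℓ
  refine ⟨ℓ, hl0, hl20, fun X hX => ?_⟩
  have hp : 0 < ℓ := by linarith
  rw [← Finset.sum_filter_add_sum_filter_not X (fun c => (c.1:ℝ) ≤ ℓ^B), add_mul]
  have hs : (∑ c ∈ X.filter (fun c => (c.1:ℝ) ≤ ℓ^B), ‖psi ℓ c.2‖ / Real.sqrt c.1) * ℓ^A ≤ 1/2 := by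
    have hf : Fam (ℓ^B) (X.filter (fun c => (c.1:ℝ) ≤ ℓ^B)) := by
      intro c hc
      rw [mem_filter] at hc
      exact ⟨(hX c hc.1).1, (hX c hc.1).2.1, hc.2⟩
    have hcard := fam_card _ _ hf
    have each : ∀ c ∈ X.filter (fun c => (c.1:ℝ) ≤ ℓ^B), ‖psi ℓ c.2‖ / Real.sqrt c.1 ≤ C1 / ℓ^(A + 2*B + 1) := by
      intro c hc
      obtain ⟨a1, a2, a3⟩ := hf c hc
      have := h1 ℓ hl1 hgood c.1 c.2 a1 a2 a3
      have hr : 1 ≤ Real.sqrt c.1 := by rw [Real.one_le_sqrt]; exact_mod_cast a1.le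
      calc _ ≤ ‖psi ℓ c.2‖ := div_le_self (norm_nonneg _) hr
        _ ≤ _ := by rw [le_div_iff₀ (by positivity)]; exact this
    calc _ ≤ ((ℓ^B)^2 * (C1 / ℓ^(A + 2*B + 1))) * ℓ^A := by
          gcongr
          refine (Finset.sum_le_card_nsmul _ _ _ each).trans ?_
          rw [nsmul_eq_mul]; gcongr
      _ = C1 / ℓ := by field_simp; ring
      _ ≤ 1/2 := by rw [div_le_iff₀ hp]; linarith
  have hb : (∑ c ∈ X.filter (fun c => ¬ (c.1:ℝ) ≤ ℓ^B), ‖psi ℓ c.2‖ / Real.sqrt c.1) * ℓ^A ≤ 1/2 := by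
    have each : ∀ c ∈ X.filter (fun c => ¬ (c.1:ℝ) ≤ ℓ^B), ‖psi ℓ c.2‖ / Real.sqrt c.1 ≤ ‖psi ℓ c.2‖ / ℓ^(A+7) := by
      intro c hc
      rw [mem_filter, not_le] at hc
      gcongr
      rw [Real.le_sqrt (by positivity) (by positivity), ← pow_mul, show (A+7)*2 = B by omega]
      exact hc.2.le
    calc _ ≤ ((C2 * ℓ^5) / ℓ^(A+7)) * ℓ^A := by
          gcongr
          refine (Finset.sum_le_sum each).trans ?_
          rw [← Finset.sum_div]
          gcongr
          refine le_trans (Finset.sum_le_sum_of_subset_of_nonneg (Finset.filter_subset _ _) fun _ _ _ => norm_nonneg _) (h2 ℓ hl20 X hX)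
      _ = C2 / ℓ / ℓ := by field_simp; ring
      _ ≤ (1/2) / ℓ := div_le_div_of_nonneg_right (by rw [div_le_iff₀ hp]; linarith) hp.le
      _ ≤ 1/2 := div_le_self (by norm_num) (by linarith)
  linarith
end BG

namespace BG
open Finset Complex MeasureTheory

noncomputable def th (n : ℕ) : ℝ := if n.Prime then Real.log n else 0

lemma th_nonneg (n : ℕ) : 0 ≤ th n := by
  unfold th; split_ifs
  · exact Real.log_natCast_nonneg n
  · exact le_rfl

noncomputable def dl (ℓ : ℝ) : ℝ := ∑ n ∈ range (NL ℓ), (ArithmeticFunction.vonMangoldt n - th n) * uu ℓ n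

noncomputable def ML (ℓ : ℝ) : ℝ := ∑ n ∈ range (NL ℓ), th n * uu ℓ n

lemma uu_ne_zero_log {ℓ : ℝ} (hℓ : 0 < ℓ) {n : ℕ} (h : uu ℓ n ≠ 0) : 5*ℓ/8 < Real.log n ∧ Real.log n < 7*ℓ/8 := by
  unfold uu at h
  constructor
  · by_contra h2
    rw [bmp_zero_left] at h
    · simp at h
    · rw [div_le_iff₀ hℓ]; linarith
  · by_contra h2
    rw [bmp_zero_right] at h
    · simp at h
    · rw [le_div_iff₀ hℓ]; linarith

lemma uu_ne_zero_exp {ℓ : ℝ} (hℓ : 0 < ℓ) {n : ℕ} (h : uu ℓ n ≠ 0) : Real.exp (5*ℓ/8) < n ∧ (n:ℝ) < Real.exp (7*ℓ/8) := by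
  obtain ⟨h1, h2⟩ := uu_ne_zero_log hℓ h
  have h0 : (0:ℝ) < n := by
    rcases Nat.eq_zero_or_pos n with rfl | h0
    · simp at h1; linarith
    · exact_mod_cast h0
  exact ⟨(Real.lt_log_iff_exp_lt h0).1 h1, (Real.log_lt_iff_lt_exp h0).1 h2⟩

lemma th_le (n : ℕ) : 0 ≤ ArithmeticFunction.vonMangoldt n - th n := by
  unfold th; split_ifs with h
  · rw [ArithmeticFunction.vonMangoldt_apply_prime h]; simp
  · simpa using ArithmeticFunction.vonMangoldt_nonneg

lemma dl_nonneg (ℓ : ℝ) : 0 ≤ dl ℓ := Finset.sum_nonneg fun n _ => mul_nonneg (th_le n) (uu_nonneg _ _)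

lemma dl_le (ℓ : ℝ) (hℓ : 20 ≤ ℓ) : dl ℓ ≤ 2 * ℓ * Real.exp (-(ℓ/8)) := by
  have h1 := Chebyshev.psi_sub_theta_le (x := Real.exp ℓ) (Real.one_le_exp (by linarith))
  rw [Chebyshev.psi_sub_theta_eq_sum_not_prime, Real.log_exp] at h1
  have hs : Real.sqrt (Real.exp ℓ) = Real.exp (ℓ/2) := by rw [Real.exp_half]
  rw [hs] at h1
  have h2 : dl ℓ ≤ Real.exp (-(5*ℓ/8)) * ∑ n ∈ (Ioc 0 ⌊Real.exp ℓ⌋₊).filter (fun n => ¬ n.Prime), ArithmeticFunction.vonMangoldt n := by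
    unfold dl
    rw [Finset.mul_sum]
    have hsub : (Ioc 0 ⌊Real.exp ℓ⌋₊).filter (fun n => ¬ n.Prime) ⊆ range (NL ℓ) := by
      intro n hn
      simp only [mem_filter, mem_Ioc] at hn
      simp only [mem_range, NL]; omega
    rw [← Finset.sum_subset hsub]
    · refine Finset.sum_le_sum fun n hn => ?_
      have hnp := (mem_filter.1 hn).2
      have : th n = 0 := if_neg hnp
      rw [this, sub_zero, mul_comm]
      refine mul_le_mul_of_nonneg_right ?_ ArithmeticFunction.vonMangoldt_nonneg
      rcases eq_or_ne (uu ℓ n) 0 with h | h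
      · rw [h]; positivity
      · have h3 := (uu_ne_zero_exp (by linarith) h).1
        rw [Real.exp_neg]
        calc uu ℓ n ≤ 1 / n := by unfold uu; gcongr; exact bmp.le_one
          _ ≤ _ := by rw [one_div]; gcongr
    · intro n hn hn'
      simp only [mem_filter, mem_Ioc, not_and, not_not, mem_range, NL] at hn hn'
      rcases Nat.eq_zero_or_pos n with rfl | h0
      · simp [th]
      · have hp := hn' ⟨h0, by omega⟩
        rw [th, if_pos hp, ArithmeticFunction.vonMangoldt_apply_prime hp]; simp
  calc dl ℓ ≤ _ := h2
    _ ≤ Real.exp (-(5*ℓ/8)) * (2 * Real.exp (ℓ/2) * ℓ) := by gcongr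
    _ = 2 * ℓ * (Real.exp (-(5*ℓ/8)) * Real.exp (ℓ/2)) := by ring
    _ = _ := by rw [← Real.exp_add]; congr 2; ring

lemma exists_Y (q : ℕ) (hq : 0 < q) : ∃ Y : Finset Ch, (∀ c ∈ Y, 1 < c.1 ∧ c.2.IsPrimitive ∧ c.1 ∣ q) ∧
    ∀ ℓ : ℝ, 20 ≤ ℓ → (q:ℝ) ≤ Real.exp (ℓ/2) → ∀ a : ℕ, a.Coprime q →
    |(∑ n ∈ (range (NL ℓ)).filter (fun n => n ≡ a [MOD q]), th n * uu ℓ n) - ML ℓ / q.totient| ≤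
      (1 / (q.totient:ℝ)) * ∑ c ∈ Y, ‖psi ℓ c.2‖ + dl ℓ := by
  classical
  have : NeZero q := ⟨hq.ne'⟩
  let em : DirichletCharacter ℂ q → Ch := fun χ => ⟨χ.conductor, χ.primitiveCharacter⟩
  have em_inj : Function.Injective em := by
    have key : ∀ c : Ch, ∀ χ : DirichletCharacter ℂ q, em χ = c → ∃ h : c.1 ∣ q, DirichletCharacter.changeLevel h c.2 = χ := by
      rintro c χ rfl
      exact ⟨χ.conductor_dvd_level, χ.changeLevel_primitiveCharacter⟩
    intro χ χ' h
    obtain ⟨h1, e1⟩ := key (em χ') χ h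
    obtain ⟨h2, e2⟩ := key (em χ') χ' rfl
    exact e1.symm.trans e2
  refine ⟨(univ.erase 1).image em, ?_, ?_⟩
  · intro c hc
    rw [mem_image] at hc
    obtain ⟨χ, hχ, rfl⟩ := hc
    refine ⟨?_, χ.primitiveCharacter_isPrimitive, χ.conductor_dvd_level⟩
    have h1 : χ.conductor ≠ 0 := χ.conductor_ne_zero
    have h2 : χ.conductor ≠ 1 := fun h => (Finset.ne_of_mem_erase hχ) (χ.eq_one_iff_conductor_eq_one.2 h)
    show 1 < χ.conductor
    omega
  · intro ℓ hℓ hqℓ a ha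
    rw [Finset.sum_image (fun _ _ _ _ h => em_inj h)]
    have hφ : (0:ℝ) < q.totient := by exact_mod_cast Nat.totient_pos.2 hq
    have hau : IsUnit (a : ZMod q) := (ZMod.isUnit_iff_coprime a q).2 ha
    -- support is coprime to q
    have hcop : ∀ n : ℕ, th n * uu ℓ n ≠ 0 → IsUnit (n : ZMod q) := by
      intro n hn
      have h1 := (uu_ne_zero_exp (by linarith) (right_ne_zero_of_mul hn)).1
      have hp : n.Prime := by by_contra h; exact hn (by rw [th, if_neg h, zero_mul])
      rw [ZMod.isUnit_iff_coprime, Nat.Prime.coprime_iff_not_dvd hp]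
      intro hd
      have h2 : (n:ℝ) ≤ q := by exact_mod_cast Nat.le_of_dvd hq hd
      have h3 : Real.exp (ℓ/2) ≤ Real.exp (5*ℓ/8) := Real.exp_le_exp.2 (by linarith)
      linarith
    have main : (((∑ n ∈ (range (NL ℓ)).filter (fun n => n ≡ a [MOD q]), th n * uu ℓ n) - ML ℓ / q.totient : ℝ) : ℂ) =
        (1 / (q.totient:ℂ)) * ∑ χ ∈ univ.erase (1 : DirichletCharacter ℂ q), χ (a:ZMod q)⁻¹ * ∑ n ∈ range (NL ℓ), ((th n * uu ℓ n : ℝ):ℂ) * χ n := by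
      have hφ' : (q.totient:ℂ) ≠ 0 := by exact_mod_cast hφ.ne'
      have e1 : ∑ χ : DirichletCharacter ℂ q, χ (a:ZMod q)⁻¹ * ∑ n ∈ range (NL ℓ), ((th n * uu ℓ n : ℝ):ℂ) * χ n =
          q.totient * ∑ n ∈ (range (NL ℓ)).filter (fun n => n ≡ a [MOD q]), ((th n * uu ℓ n : ℝ):ℂ) := by
        simp_rw [Finset.mul_sum]
        rw [Finset.sum_comm, Finset.sum_filter]
        refine Finset.sum_congr rfl fun n _ => ?_
        have := DirichletCharacter.sum_char_inv_mul_char_eq ℂ hau (n : ZMod q)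
        calc _ = ((th n * uu ℓ n : ℝ):ℂ) * ∑ χ : DirichletCharacter ℂ q, χ (a:ZMod q)⁻¹ * χ n := by
              rw [Finset.mul_sum]; refine Finset.sum_congr rfl fun χ _ => by ring
          _ = _ := by
              rw [this]
              have hiff : ((a:ZMod q) = (n:ZMod q)) ↔ n ≡ a [MOD q] := by
                rw [ZMod.natCast_eq_natCast_iff]; exact ⟨Nat.ModEq.symm, Nat.ModEq.symm⟩
              simp only [hiff]
              split_ifs <;> ring
      rw [← Finset.add_sum_erase _ _ (mem_univ (1 : DirichletCharacter ℂ q))] at e1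
      have e2 : (1 : DirichletCharacter ℂ q) (a:ZMod q)⁻¹ * ∑ n ∈ range (NL ℓ), ((th n * uu ℓ n : ℝ):ℂ) * (1 : DirichletCharacter ℂ q) n = ML ℓ := by
        have hai : IsUnit ((a:ZMod q)⁻¹) := by
          have hh := ZMod.inv_coe_unit hau.unit
          rw [IsUnit.unit_spec] at hh
          rw [hh]
          exact Units.isUnit _
        rw [MulChar.one_apply hai, one_mul, ML]
        push_cast
        refine Finset.sum_congr rfl fun n _ => ?_
        by_cases h : th n * uu ℓ n = 0
        · have : ((th n:ℂ) * uu ℓ n) = 0 := by exact_mod_cast h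
          rw [this]; simp
        · rw [MulChar.one_apply (hcop n h), mul_one]
      rw [e2] at e1
      push_cast at e1 ⊢
      field_simp
      linear_combination -e1
    have hbd : ∀ χ : DirichletCharacter ℂ q, ‖∑ n ∈ range (NL ℓ), ((th n * uu ℓ n : ℝ):ℂ) * χ n‖ ≤ ‖psi ℓ χ.primitiveCharacter‖ + dl ℓ := by
      intro χ
      have e : ∑ n ∈ range (NL ℓ), ((th n * uu ℓ n : ℝ):ℂ) * χ n = psi ℓ χ.primitiveCharacter -
          ∑ n ∈ range (NL ℓ), (((ArithmeticFunction.vonMangoldt n - th n) * uu ℓ n : ℝ):ℂ) * χ.primitiveCharacter n := by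
        unfold psi
        rw [← Finset.sum_sub_distrib]
        refine Finset.sum_congr rfl fun n _ => ?_
        by_cases h : th n * uu ℓ n = 0
        · have h' : ((th n:ℂ) * uu ℓ n) = 0 := by exact_mod_cast h
          rw [h]; push_cast
          linear_combination (-χ.primitiveCharacter n) * h'
        · have h1 := changeLevel_nat χ.conductor_dvd_level χ.primitiveCharacter n (hcop n h)
          rw [χ.changeLevel_primitiveCharacter] at h1
          rw [h1]; push_cast; ring
      rw [e]
      refine (norm_sub_le _ _).trans ?_
      gcongr
      refine (norm_sum_le _ _).trans (Finset.sum_le_sum fun n _ => ?_)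
      have h0 := mul_nonneg (th_le n) (uu_nonneg ℓ n)
      rw [norm_mul, Complex.norm_real, Real.norm_of_nonneg h0]
      exact mul_le_of_le_one_right h0 (DirichletCharacter.norm_le_one _ _)
    rw [← Real.norm_eq_abs, ← Complex.norm_real, main, norm_mul, norm_div, norm_one, Complex.norm_natCast]
    have hc : ((univ.erase (1 : DirichletCharacter ℂ q)).card : ℝ) ≤ q.totient := by
      have h1 := DirichletCharacter.card_eq_totient_of_hasEnoughRootsOfUnity ℂ q
      rw [Nat.card_eq_fintype_card] at h1
      rw [← h1]
      exact_mod_cast (Finset.card_le_univ _)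
    calc _ ≤ 1 / (q.totient:ℝ) * ∑ χ ∈ univ.erase (1 : DirichletCharacter ℂ q), (‖psi ℓ χ.primitiveCharacter‖ + dl ℓ) := by
          gcongr
          refine (norm_sum_le _ _).trans (Finset.sum_le_sum fun χ _ => ?_)
          rw [norm_mul]
          refine (mul_le_of_le_one_left (norm_nonneg _) (DirichletCharacter.norm_le_one _ _)).trans (hbd χ)
      _ ≤ 1 / (q.totient:ℝ) * (∑ χ ∈ univ.erase (1 : DirichletCharacter ℂ q), ‖psi ℓ (em χ).2‖ + q.totient * dl ℓ) := by
          rw [Finset.sum_add_distrib, Finset.sum_const, nsmul_eq_mul]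
          gcongr
          exact dl_nonneg ℓ
      _ = _ := by field_simp
end BG

namespace BG
open Finset Complex MeasureTheory

noncomputable def sub (P : Finset ℕ) (x : ℝ) : Finset (Finset ℕ) := P.powerset.filter (fun A => ((∏ p ∈ A, p : ℕ) : ℝ) ≤ x)

lemma mem_sub {P : Finset ℕ} {x : ℝ} {A : Finset ℕ} : A ∈ sub P x ↔ A ⊆ P ∧ ((∏ p ∈ A, p : ℕ) : ℝ) ≤ x := by
  unfold sub; rw [mem_filter, mem_powerset]

lemma prod_inj {P : Finset ℕ} (hP : ∀ p ∈ P, p.Prime) {A B : Finset ℕ} (hA : A ⊆ P) (hB : B ⊆ P)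
    (h : ∏ p ∈ A, p = ∏ p ∈ B, p) : A = B := by
  rw [← Nat.primeFactors_prod (fun p hp => hP p (hA hp)), ← Nat.primeFactors_prod (fun p hp => hP p (hB hp)), h]

lemma prod_pos' {P : Finset ℕ} (hP : ∀ p ∈ P, p.Prime) {A : Finset ℕ} (hA : A ⊆ P) : 0 < ∏ p ∈ A, p :=
  Finset.prod_pos fun p hp => (hP p (hA hp)).pos

lemma sum_le_inj {ι κ : Type*} (s : Finset ι) (t : Finset κ) (f : ι → ℝ) (g : κ → ℝ) (e : ι → κ)
    (hm : ∀ i ∈ s, e i ∈ t) (hi : ∀ i ∈ s, ∀ j ∈ s, e i = e j → i = j) (hg : ∀ k ∈ t, 0 ≤ g k)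
    (hf : ∀ i ∈ s, f i ≤ g (e i)) : ∑ i ∈ s, f i ≤ ∑ k ∈ t, g k := by
  classical
  calc _ ≤ ∑ i ∈ s, g (e i) := Finset.sum_le_sum hf
    _ = ∑ k ∈ s.image e, g k := (Finset.sum_image (fun i hi' j hj h => hi i hi' j hj h)).symm
    _ ≤ _ := Finset.sum_le_sum_of_subset_of_nonneg (by intro k hk; obtain ⟨i, h1, rfl⟩ := mem_image.1 hk; exact hm i h1) fun k hk _ => hg k hk

lemma sub_inv (P : Finset ℕ) (hP : ∀ p ∈ P, p.Prime) (x : ℝ) (hx : 1 ≤ x) :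
    ∑ A ∈ sub P x, 1 / ((∏ p ∈ A, p : ℕ) : ℝ) ≤ 2 + Real.log x := by
  have h1 := sum_inv_le 1 (⌊x⌋₊ + 1) le_rfl
  have h2 : Real.log ((⌊x⌋₊ + 1 : ℕ):ℝ) ≤ 1 + Real.log x := by
    have : 1 + Real.log x = Real.log (Real.exp 1 * x) := by rw [Real.log_mul (Real.exp_pos _).ne' (by linarith), Real.log_exp]
    rw [this]
    apply Real.log_le_log (by positivity)
    have h3 : (⌊x⌋₊ : ℝ) ≤ x := Nat.floor_le (by linarith)
    have h4 : 2 ≤ Real.exp 1 := by have := Real.add_one_le_exp 1; linarith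
    push_cast
    nlinarith
  refine le_trans (sum_le_inj _ (Ico 1 (⌊x⌋₊ + 1)) _ (fun n => 1/(n:ℝ)) (fun A => ∏ p ∈ A, p) ?_ ?_ ?_ ?_) (h1.trans (by linarith))
  · intro A hA
    rw [mem_sub] at hA
    rw [mem_Ico]
    exact ⟨prod_pos' hP hA.1, Nat.lt_succ_of_le (Nat.le_floor hA.2)⟩
  · intro A hA B hB h
    rw [mem_sub] at hA hB
    exact prod_inj hP hA.1 hB.1 h
  · intro n _; positivity
  · intro A _; exact le_rfl

lemma sub_pow (P : Finset ℕ) (hP : ∀ p ∈ P, p.Prime) (x : ℝ) (hx : 1 ≤ x) (m : ℕ) :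
    ∑ A ∈ sub P x, (m:ℝ)^A.card / ((∏ p ∈ A, p : ℕ) : ℝ) ≤ (2 + Real.log x)^m := by
  classical
  induction m with
  | zero =>
    rw [pow_zero]
    calc _ ≤ ∑ A ∈ sub P x, (if A = ∅ then (1:ℝ) else 0) := by
          refine Finset.sum_le_sum fun A _ => ?_
          split_ifs with h
          · subst h; simp
          · have : A.card ≠ 0 := by simpa using h
            simp [this]
      _ ≤ 1 := by
          rw [Finset.sum_ite_eq']; split_ifs <;> norm_num
  | succ m ih =>
    have h0 : 0 ≤ ∑ A ∈ sub P x, 1 / ((∏ p ∈ A, p : ℕ) : ℝ) := Finset.sum_nonneg fun _ _ => by positivity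
    have hl : 0 ≤ Real.log x := Real.log_nonneg hx
    calc _ = ∑ A ∈ sub P x, ∑ B ∈ A.powerset, (m:ℝ)^B.card / ((∏ p ∈ A, p : ℕ) : ℝ) := by
          refine Finset.sum_congr rfl fun A _ => ?_
          rw [← Finset.sum_div]
          congr 1
          have := Finset.sum_pow_mul_eq_add_pow (m:ℝ) 1 A
          push_cast
          rw [← this]
          refine Finset.sum_congr rfl fun B _ => by rw [one_pow, mul_one]
      _ = ∑ z ∈ (sub P x).sigma (fun A => A.powerset), (m:ℝ)^z.2.card / ((∏ p ∈ z.1, p : ℕ) : ℝ) := by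
          rw [Finset.sum_sigma]
      _ ≤ ∑ z ∈ (sub P x) ×ˢ (sub P x), ((m:ℝ)^z.1.card / ((∏ p ∈ z.1, p : ℕ) : ℝ)) * (1 / ((∏ p ∈ z.2, p : ℕ) : ℝ)) := by
          refine sum_le_inj _ _ _ _ (fun z => (z.2, z.1 \ z.2)) ?_ ?_ ?_ ?_
          · rintro ⟨A, B⟩ hz
            simp only [mem_sigma, mem_powerset, mem_sub, mem_product] at hz ⊢
            obtain ⟨⟨h1, h2⟩, h3⟩ := hz
            have hpos := prod_pos' hP h1
            have e := Finset.prod_sdiff (f := fun p : ℕ => p) h3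
            refine ⟨⟨h3.trans h1, le_trans ?_ h2⟩, Finset.sdiff_subset.trans h1, le_trans ?_ h2⟩
            · exact_mod_cast Nat.le_of_dvd hpos (e ▸ Dvd.intro_left _ rfl)
            · exact_mod_cast Nat.le_of_dvd hpos (e ▸ Dvd.intro _ rfl)
          · rintro ⟨A, B⟩ hz ⟨A', B'⟩ hz' h
            simp only [mem_sigma, mem_powerset, Prod.mk.injEq] at hz hz' h
            obtain ⟨rfl, h2⟩ := h
            have : A = A' := by rw [← Finset.sdiff_union_of_subset hz.2, h2, Finset.sdiff_union_of_subset hz'.2]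
            subst this; rfl
          · intro z _; positivity
          · rintro ⟨A, B⟩ hz
            simp only [mem_sigma, mem_powerset] at hz
            have e := Finset.prod_sdiff (f := fun p : ℕ => p) hz.2
            simp only
            rw [← e, div_mul_div_comm, mul_one]
            push_cast
            rw [mul_comm (∏ p ∈ B, (p:ℝ))]
      _ = (∑ A ∈ sub P x, (m:ℝ)^A.card / ((∏ p ∈ A, p : ℕ) : ℝ)) * ∑ A ∈ sub P x, 1 / ((∏ p ∈ A, p : ℕ) : ℝ) := by
          rw [Finset.sum_mul_sum, Finset.sum_product]
      _ ≤ (2 + Real.log x)^m * (2 + Real.log x) := by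
          gcongr
          exact sub_inv P hP x hx
      _ = _ := (pow_succ _ _).symm

lemma exp_decay (C : ℝ) (n : ℕ) (ε : ℝ) (hε : 0 < ε) : ∃ L : ℝ, ∀ ℓ ≥ L, C * ℓ^n * Real.exp (-(ε*ℓ)) ≤ 1 := by
  have h := isLittleO_pow_exp_pos_mul_atTop (k := n) hε
  have h2 := h.def (c := 1/(|C|+1)) (by positivity)
  obtain ⟨L, hL⟩ := Filter.eventually_atTop.1 h2
  refine ⟨L, fun ℓ hl => ?_⟩
  have h3 := hL ℓ hl
  rw [Real.norm_eq_abs, Real.norm_of_nonneg (Real.exp_pos _).le] at h3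
  rw [Real.exp_neg, ← div_eq_mul_inv, div_le_one (Real.exp_pos _)]
  have h4 : C * ℓ^n ≤ |C| * |ℓ^n| := by rw [← abs_mul]; exact le_abs_self _
  have h5 : (|C|+1) * |ℓ^n| ≤ Real.exp (ε*ℓ) := by
    calc _ ≤ (|C|+1) * (1/(|C|+1) * Real.exp (ε*ℓ)) := by gcongr
      _ = _ := by field_simp
  have := abs_nonneg (ℓ^n)
  linarith
end BG

namespace BG
open Finset Complex MeasureTheory

noncomputable def YY (q : ℕ) : Finset Ch := if h : 0 < q then (exists_Y q h).choose else ∅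

noncomputable def EB (ℓ : ℝ) (q : ℕ) : ℝ := (1/(q.totient:ℝ)) * ∑ c ∈ YY q, ‖psi ℓ c.2‖ + dl ℓ

lemma YY_spec (q : ℕ) (hq : 0 < q) : ∀ c ∈ YY q, 1 < c.1 ∧ c.2.IsPrimitive ∧ c.1 ∣ q := by
  unfold YY; rw [dif_pos hq]; exact (exists_Y q hq).choose_spec.1

lemma EB_spec (q : ℕ) (hq : 0 < q) (ℓ : ℝ) (hℓ : 20 ≤ ℓ) (h : (q:ℝ) ≤ Real.exp (ℓ/2)) (a : ℕ) (ha : a.Coprime q) :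
    |(∑ n ∈ (range (NL ℓ)).filter (fun n => n ≡ a [MOD q]), th n * uu ℓ n) - ML ℓ / q.totient| ≤ EB ℓ q := by
  unfold EB YY; simp only [dif_pos hq]; exact (exists_Y q hq).choose_spec.2 ℓ hℓ h a ha

lemma EB_nonneg (ℓ : ℝ) (q : ℕ) : 0 ≤ EB ℓ q := by
  unfold EB
  have := dl_nonneg ℓ
  have : 0 ≤ ∑ c ∈ YY q, ‖psi ℓ c.2‖ := Finset.sum_nonneg fun _ _ => norm_nonneg _
  positivity

lemma cop_prod {W : ℕ} (A : Finset ℕ) (hA : ∀ p ∈ A, p.Prime ∧ ¬ p ∣ W) (p : ℕ) (hp : p.Prime) (hpW : ¬ p ∣ W) (hpA : p ∉ A) :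
    Nat.Coprime p (W * ∏ q ∈ A, q) := by
  refine Nat.Coprime.mul_right ((Nat.Prime.coprime_iff_not_dvd hp).2 hpW) (Nat.Coprime.prod_right fun q hq => ?_)
  refine (Nat.coprime_primes hp (hA q hq).1).2 ?_
  rintro rfl; exact hpA hq

lemma tot_lower {W : ℕ} (hW : 0 < W) (A : Finset ℕ) (hA : ∀ p ∈ A, p.Prime ∧ ¬ p ∣ W) :
    ((∏ p ∈ A, p : ℕ) : ℝ) ≤ 2^A.card * ((W * ∏ p ∈ A, p).totient : ℝ) := by
  induction A using Finset.induction_on with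
  | empty =>
    simp only [prod_empty, Finset.card_empty, pow_zero, mul_one, one_mul]
    exact_mod_cast Nat.totient_pos.2 hW
  | insert p A hpA ih =>
    have hp := hA p (mem_insert_self _ _)
    have hA' : ∀ p ∈ A, p.Prime ∧ ¬ p ∣ W := fun q hq => hA q (mem_insert_of_mem hq)
    have ih := ih hA'
    rw [prod_insert hpA, Finset.card_insert_of_notMem hpA]
    rw [show W * (p * ∏ q ∈ A, q) = p * (W * ∏ q ∈ A, q) by ring, Nat.totient_mul (cop_prod A hA' p hp.1 hp.2 hpA), Nat.totient_prime hp.1]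
    have h2 : (p:ℝ) ≤ 2 * ((p-1:ℕ):ℝ) := by have := hp.1.two_le; exact_mod_cast (by omega : p ≤ 2*(p-1))
    rw [Nat.cast_mul, Nat.cast_mul, pow_succ]
    calc (p:ℝ) * _ ≤ (2 * ((p-1:ℕ):ℝ)) * (2^A.card * ((W * ∏ p ∈ A, p).totient : ℝ)) := by gcongr
      _ = _ := by ring

lemma core (K D0 W : ℕ) (hK : 1 ≤ K) (hD : 4*K^2 ≤ D0) (hW : 0 < W) (P : Finset ℕ) (hP : ∀ p ∈ P, p.Prime ∧ D0 < p ∧ ¬ p ∣ W)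
    (x : ℝ) (hx : 1 ≤ x) (r : ℕ) (hr : 0 < r) :
    ∑ A ∈ (sub P x).filter (fun A => r ∣ W * ∏ p ∈ A, p), (K:ℝ)^A.card * (1/((W * ∏ p ∈ A, p).totient : ℝ)) ≤
      Real.sqrt W / Real.sqrt r * (2 + Real.log x)^(2*K) := by
  classical
  set Ar := P.filter (fun p => p ∣ r) with hAr
  have hPp : ∀ p ∈ P, p.Prime := fun p hp => (hP p hp).1
  have hsub : ∀ A ∈ (sub P x).filter (fun A => r ∣ W * ∏ p ∈ A, p), Ar ⊆ A := by
    intro A hA p hp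
    rw [mem_filter, mem_sub] at hA
    rw [hAr, mem_filter] at hp
    have h1 : p ∣ W * ∏ p ∈ A, p := hp.2.trans hA.2
    rcases ((hPp p hp.1).dvd_mul).1 h1 with h | h
    · exact absurd h (hP p hp.1).2.2
    · obtain ⟨q, hq, h3⟩ := ((hPp p hp.1).prime.dvd_finsetProd_iff _).1 h
      rw [(Nat.prime_dvd_prime_iff_eq (hPp p hp.1) (hPp q (hA.1.1 hq))).1 h3]; exact hq
  refine le_trans (b := ∑ B ∈ sub P x, Real.sqrt W / Real.sqrt r * (((2*K:ℕ):ℝ)^B.card / ((∏ p ∈ B, p : ℕ) : ℝ))) (sum_le_inj _ (sub P x) _ (fun B => Real.sqrt W / Real.sqrt r * (((2*K:ℕ):ℝ)^B.card / ((∏ p ∈ B, p : ℕ) : ℝ)))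
    (fun A => A \ Ar) ?_ ?_ ?_ ?_) ?_
  · intro A hA
    have hs := hsub A hA
    rw [mem_filter, mem_sub] at hA
    rw [mem_sub]
    refine ⟨Finset.sdiff_subset.trans hA.1.1, le_trans ?_ hA.1.2⟩
    have e := Finset.prod_sdiff (f := fun p : ℕ => p) hs
    exact_mod_cast Nat.le_of_dvd (prod_pos' hPp hA.1.1) (e ▸ Dvd.intro _ rfl)
  · intro A hA B hB h
    rw [← Finset.sdiff_union_of_subset (hsub A hA), h, Finset.sdiff_union_of_subset (hsub B hB)]
  · intro B _; positivity
  · intro A hA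
    have hs := hsub A hA
    rw [mem_filter, mem_sub] at hA
    have hA' : ∀ p ∈ A, p.Prime ∧ ¬ p ∣ W := fun p hp => ⟨hPp p (hA.1.1 hp), (hP p (hA.1.1 hp)).2.2⟩
    have h1 := tot_lower hW A hA'
    have e := Finset.prod_sdiff (f := fun p : ℕ => p) hs
    have hr1 : r ∣ W * ∏ p ∈ Ar, p := by
      have hc : Nat.Coprime r (∏ p ∈ A \ Ar, p) := by
        refine Nat.Coprime.prod_right fun q hq => ?_
        rw [mem_sdiff, hAr, mem_filter] at hq
        refine ((Nat.Prime.coprime_iff_not_dvd (hPp q (hA.1.1 hq.1))).2 fun h => hq.2 ⟨hA.1.1 hq.1, h⟩).symm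
      refine hc.dvd_of_dvd_mul_left ?_
      rw [show (∏ p ∈ A \ Ar, p) * (W * ∏ p ∈ Ar, p) = W * ((∏ p ∈ A \ Ar, p) * ∏ p ∈ Ar, p) by ring, e]
      exact hA.2
    have hArP : Ar ⊆ P := Finset.filter_subset _ _
    have hpos := prod_pos' hPp hArP
    have hposA := prod_pos' hPp hA.1.1
    have hposB := prod_pos' hPp (Finset.sdiff_subset.trans hA.1.1 : A \ Ar ⊆ P)
    have hr2 : (r:ℝ) ≤ W * ((∏ p ∈ Ar, p : ℕ):ℝ) := by exact_mod_cast Nat.le_of_dvd (Nat.mul_pos hW hpos) hr1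
    have hr3 : Real.sqrt r ≤ Real.sqrt W * Real.sqrt ((∏ p ∈ Ar, p : ℕ):ℝ) := by
      rw [← Real.sqrt_mul (by positivity)]; exact Real.sqrt_le_sqrt hr2
    have h4 : ((2*K:ℕ):ℝ)^Ar.card ≤ Real.sqrt ((∏ p ∈ Ar, p : ℕ):ℝ) := by
      apply Real.le_sqrt_of_sq_le
      rw [← pow_mul, mul_comm Ar.card 2, pow_mul]
      rw [← Finset.prod_const]
      push_cast
      refine Finset.prod_le_prod (fun _ _ => by positivity) fun p hp => ?_
      have := (hP p (hArP hp)).2.1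
      have h5 : 4*K^2 ≤ p := by omega
      have : (4*K^2:ℝ) ≤ p := by exact_mod_cast h5
      nlinarith
    have hcard : A.card = (A \ Ar).card + Ar.card := (Finset.card_sdiff_add_card_eq_card hs).symm
    have ht : (0:ℝ) < ((W * ∏ p ∈ A, p).totient : ℝ) := by exact_mod_cast Nat.totient_pos.2 (Nat.mul_pos hW hposA)
    have hposA' : (0:ℝ) < ((∏ p ∈ A, p : ℕ):ℝ) := by exact_mod_cast hposA
    have hposAr' : (0:ℝ) < ((∏ p ∈ Ar, p : ℕ):ℝ) := by exact_mod_cast hpos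
    have hposB' : (0:ℝ) < ((∏ p ∈ A \ Ar, p : ℕ):ℝ) := by exact_mod_cast hposB
    have hr' : (0:ℝ) < Real.sqrt r := Real.sqrt_pos.2 (by exact_mod_cast hr)
    calc (K:ℝ)^A.card * (1/((W * ∏ p ∈ A, p).totient : ℝ)) ≤ (K:ℝ)^A.card * (2^A.card / ((∏ p ∈ A, p : ℕ):ℝ)) := by
          refine mul_le_mul_of_nonneg_left ?_ (by positivity)
          rw [div_le_div_iff₀ ht hposA']; linarith
      _ = ((2*K:ℕ):ℝ)^A.card / ((∏ p ∈ A, p : ℕ):ℝ) := by push_cast; rw [mul_pow]; ring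
      _ = (((2*K:ℕ):ℝ)^Ar.card / ((∏ p ∈ Ar, p : ℕ):ℝ)) * (((2*K:ℕ):ℝ)^(A \ Ar).card / ((∏ p ∈ A \ Ar, p : ℕ) : ℝ)) := by
          rw [hcard, ← e, pow_add, Nat.cast_mul (∏ p ∈ A \ Ar, p), div_mul_div_comm]
          congr 1 <;> ring
      _ ≤ (Real.sqrt W / Real.sqrt r) * (((2*K:ℕ):ℝ)^(A \ Ar).card / ((∏ p ∈ A \ Ar, p : ℕ) : ℝ)) := by
          gcongr ?_ * _
          rw [div_le_div_iff₀ hposAr' hr']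
          calc _ ≤ Real.sqrt ((∏ p ∈ Ar, p : ℕ):ℝ) * (Real.sqrt W * Real.sqrt ((∏ p ∈ Ar, p : ℕ):ℝ)) := by gcongr
            _ = Real.sqrt W * (Real.sqrt ((∏ p ∈ Ar, p : ℕ):ℝ) * Real.sqrt ((∏ p ∈ Ar, p : ℕ):ℝ)) := by ring
            _ = _ := by rw [Real.mul_self_sqrt hposAr'.le]
  · rw [← Finset.mul_sum]
    gcongr
    exact sub_pow P hPp x hx (2*K)

lemma EH (K D0 W : ℕ) (hK : 1 ≤ K) (hD : 4*K^2 ≤ D0) (hW : 0 < W) (a : ℕ) (L0 : ℝ) : ∃ ℓ ≥ L0, 20 ≤ ℓ ∧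
    ∀ P : Finset ℕ, (∀ p ∈ P, p.Prime ∧ D0 < p ∧ ¬ p ∣ W) →
      (∑ A ∈ sub P (Real.exp (ℓ/25)), (K:ℝ)^A.card * EB ℓ (W * ∏ p ∈ A, p)) * ℓ^a ≤ 1 := by
  classical
  obtain ⟨L1, hL1⟩ := exp_decay 8 (a+2) (9/200) (by norm_num)
  obtain ⟨ℓ, hℓ, hℓ20, hBV⟩ := BV (a + 2*K + 1) (max L0 (max L1 (max (100 * W) (2*W))))
  have hl0 : L0 ≤ ℓ := (le_max_left _ _).trans hℓ
  have hl1 : L1 ≤ ℓ := (le_max_left _ _).trans ((le_max_right _ _).trans hℓ)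
  have hl2 : 100 * (W:ℝ) ≤ ℓ := (le_max_left _ _).trans ((le_max_right _ _).trans ((le_max_right _ _).trans hℓ))
  refine ⟨ℓ, hl0, hℓ20, fun P hP => ?_⟩
  set x := Real.exp (ℓ/25) with hx
  have hx1 : 1 ≤ x := Real.one_le_exp (by linarith)
  have hPp : ∀ p ∈ P, p.Prime := fun p hp => (hP p hp).1
  have hW1 : (1:ℝ) ≤ W := by exact_mod_cast hW
  have hlog : Real.log x = ℓ/25 := Real.log_exp _
  have hWx : (W:ℝ) * x ≤ Real.exp (ℓ/20) := by
    rw [show ℓ/20 = ℓ/100 + ℓ/25 by ring, Real.exp_add]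
    gcongr
    have := Real.add_one_le_exp (ℓ/100)
    linarith
  set X := (sub P x).biUnion (fun A => YY (W * ∏ p ∈ A, p)) with hX
  have hq : ∀ A ∈ sub P x, 0 < W * ∏ p ∈ A, p := fun A hA => Nat.mul_pos hW (prod_pos' hPp (mem_sub.1 hA).1)
  have hF : Fam (Real.exp (ℓ/20)) X := by
    intro c hc
    rw [hX, mem_biUnion] at hc
    obtain ⟨A, hA, hc⟩ := hc
    obtain ⟨h1, h2, h3⟩ := YY_spec _ (hq A hA) c hc
    refine ⟨h1, h2, le_trans ?_ hWx⟩
    calc (c.1:ℝ) ≤ ((W * ∏ p ∈ A, p : ℕ):ℝ) := by exact_mod_cast Nat.le_of_dvd (hq A hA) h3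
      _ ≤ W * x := by rw [Nat.cast_mul]; gcongr; exact (mem_sub.1 hA).2
  have hB := hBV X hF
  have main : ∑ A ∈ sub P x, (K:ℝ)^A.card * ((1/((W * ∏ p ∈ A, p).totient:ℝ)) * ∑ c ∈ YY (W * ∏ p ∈ A, p), ‖psi ℓ c.2‖)
      ≤ Real.sqrt W * (2 + Real.log x)^(2*K) * ∑ c ∈ X, ‖psi ℓ c.2‖ / Real.sqrt c.1 := by
    calc _ ≤ ∑ A ∈ sub P x, ∑ c ∈ X, if c.1 ∣ W * ∏ p ∈ A, p then (K:ℝ)^A.card * (1/((W * ∏ p ∈ A, p).totient:ℝ)) * ‖psi ℓ c.2‖ else 0 := by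
          refine Finset.sum_le_sum fun A hA => ?_
          rw [← mul_assoc, Finset.mul_sum, ← Finset.sum_filter]
          refine Finset.sum_le_sum_of_subset_of_nonneg ?_ fun _ _ _ => by positivity
          intro c hc
          rw [mem_filter]
          exact ⟨mem_biUnion.2 ⟨A, hA, hc⟩, (YY_spec _ (hq A hA) c hc).2.2⟩
      _ = ∑ c ∈ X, (∑ A ∈ (sub P x).filter (fun A => c.1 ∣ W * ∏ p ∈ A, p), (K:ℝ)^A.card * (1/((W * ∏ p ∈ A, p).totient:ℝ))) * ‖psi ℓ c.2‖ := by
          rw [Finset.sum_comm]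
          refine Finset.sum_congr rfl fun c _ => ?_
          rw [Finset.sum_mul, ← Finset.sum_filter]
      _ ≤ ∑ c ∈ X, (Real.sqrt W / Real.sqrt c.1 * (2 + Real.log x)^(2*K)) * ‖psi ℓ c.2‖ := by
          refine Finset.sum_le_sum fun c hc => ?_
          gcongr
          exact core K D0 W hK hD hW P hP x hx1 c.1 (by have := (hF c hc).1; omega)
      _ = _ := by
          rw [Finset.mul_sum]
          refine Finset.sum_congr rfl fun c _ => by ring
  have hS0 : 0 ≤ ∑ c ∈ X, ‖psi ℓ c.2‖ / Real.sqrt c.1 := Finset.sum_nonneg fun _ _ => by positivity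
  have hl : (0:ℝ) < ℓ := by linarith
  have main2 : (∑ A ∈ sub P x, (K:ℝ)^A.card * ((1/((W * ∏ p ∈ A, p).totient:ℝ)) * ∑ c ∈ YY (W * ∏ p ∈ A, p), ‖psi ℓ c.2‖)) * ℓ^a ≤ 1/2 := by
    have h1 : Real.sqrt W ≤ W := by
      rw [Real.sqrt_le_left (by positivity)]; nlinarith
    have h0 : 0 ≤ 2 + Real.log x := by rw [hlog]; linarith
    have h2 : (2 + Real.log x)^(2*K) ≤ ℓ^(2*K) := by
      have : 2 + Real.log x ≤ ℓ := by rw [hlog]; linarith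
      gcongr
    calc _ ≤ (Real.sqrt W * (2 + Real.log x)^(2*K) * ∑ c ∈ X, ‖psi ℓ c.2‖ / Real.sqrt c.1) * ℓ^a := by gcongr
      _ ≤ ((ℓ/2) * ℓ^(2*K) * ∑ c ∈ X, ‖psi ℓ c.2‖ / Real.sqrt c.1) * ℓ^a := by
          gcongr
          linarith
      _ = ((∑ c ∈ X, ‖psi ℓ c.2‖ / Real.sqrt c.1) * ℓ^(a+2*K+1)) / 2 := by rw [pow_succ, pow_add]; ring
      _ ≤ 1/2 := by linarith
  have dpart : (∑ A ∈ sub P x, (K:ℝ)^A.card * dl ℓ) * ℓ^a ≤ 1/2 := by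
    have h1 : ∑ A ∈ sub P x, (K:ℝ)^A.card ≤ x^2 * (2 + Real.log x) := by
      refine le_trans (Finset.sum_le_sum (g := fun A => x^2 * (1 / ((∏ p ∈ A, p : ℕ) : ℝ))) fun A hA => ?_) (by rw [← Finset.mul_sum]; gcongr; exact sub_inv P hPp x hx1)
      rw [mem_sub] at hA
      have hpos : (0:ℝ) < ((∏ p ∈ A, p : ℕ):ℝ) := by exact_mod_cast prod_pos' hPp hA.1
      rw [mul_one_div, le_div_iff₀ hpos]
      have h2 : (K:ℝ)^A.card ≤ ((∏ p ∈ A, p : ℕ):ℝ) := by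
        rw [← Finset.prod_const]
        push_cast
        refine Finset.prod_le_prod (fun _ _ => by positivity) fun p hp => ?_
        have := (hP p (hA.1 hp)).2.1
        exact_mod_cast (by nlinarith : K ≤ p)
      have h3 := hA.2
      nlinarith
    have hdl := dl_le ℓ hℓ20
    have hdl0 := dl_nonneg ℓ
    have h5 : 2 + Real.log x ≤ ℓ := by rw [hlog]; linarith
    have hL := hL1 ℓ hl1
    have hex : x^2 * Real.exp (-(ℓ/8)) = Real.exp (-(9/200*ℓ)) := by
      rw [hx, ← Real.exp_nat_mul, ← Real.exp_add]; congr 1; push_cast; ring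
    rw [← Finset.sum_mul]
    calc _ ≤ (x^2 * ℓ) * (2 * ℓ * Real.exp (-(ℓ/8))) * ℓ^a := by
          have : x^2 * (2 + Real.log x) ≤ x^2 * ℓ := by gcongr
          have h6 := h1.trans this
          gcongr
      _ = (8 * ℓ^(a+2) * (x^2 * Real.exp (-(ℓ/8)))) / 4 := by rw [pow_add]; ring
      _ ≤ 1/2 := by rw [hex]; linarith
  have : ∑ A ∈ sub P x, (K:ℝ)^A.card * EB ℓ (W * ∏ p ∈ A, p) = ∑ A ∈ sub P x, (K:ℝ)^A.card * ((1/((W * ∏ p ∈ A, p).totient:ℝ)) * ∑ c ∈ YY (W * ∏ p ∈ A, p), ‖psi ℓ c.2‖) + ∑ A ∈ sub P x, (K:ℝ)^A.card * dl ℓ := by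
    rw [← Finset.sum_add_distrib]
    refine Finset.sum_congr rfl fun A _ => by unfold EB; ring
  rw [this, add_mul]; linarith
end BG

namespace BG
open Finset

lemma tensor {O : Type} [Fintype O] (ι : Type) [Fintype ι] :
    ∀ [DecidableEq ι] (w w' : ι → O → ℝ) (_ : ∀ p o, 0 ≤ w p o) (_ : ∀ p o, 0 ≤ w' p o) (X X' : ι → O → O → ℝ)
    (_ : ∀ p (c : O → ℝ), ∑ ω, w p ω * (∑ o, c o * X p o ω)^2 ≤ ∑ ω, w' p ω * (∑ o, c o * X' p o ω)^2)
    (a : (ι → O) → ℝ) ,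
    ∑ ω : ι → O, (∏ p, w p (ω p)) * (∑ r : ι → O, a r * ∏ p, X p (r p) (ω p))^2 ≤
    ∑ ω : ι → O, (∏ p, w' p (ω p)) * (∑ r : ι → O, a r * ∏ p, X' p (r p) (ω p))^2 := by
  classical
  refine Fintype.induction_empty_option (P := fun ι [Fintype ι] => ∀ [DecidableEq ι] (w w' : ι → O → ℝ) (_ : ∀ p o, 0 ≤ w p o) (_ : ∀ p o, 0 ≤ w' p o) (X X' : ι → O → O → ℝ)
    (_ : ∀ p (c : O → ℝ), ∑ ω, w p ω * (∑ o, c o * X p o ω)^2 ≤ ∑ ω, w' p ω * (∑ o, c o * X' p o ω)^2)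
    (a : (ι → O) → ℝ) ,
    ∑ ω : ι → O, (∏ p, w p (ω p)) * (∑ r : ι → O, a r * ∏ p, X p (r p) (ω p))^2 ≤
    ∑ ω : ι → O, (∏ p, w' p (ω p)) * (∑ r : ι → O, a r * ∏ p, X' p (r p) (ω p))^2) ?_ ?_ ?_ ι
  · intro α β _ e ih _ w w' hw hw' X X' h a
    let _ : Fintype α := Fintype.ofEquiv β e.symm
    have := ih (fun p => w (e p)) (fun p => w' (e p)) (fun p => hw _) (fun p => hw' _) (fun p => X (e p)) (fun p => X' (e p))
      (fun p => h _) (fun r => a (fun b => r (e.symm b)))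
    have key : ∀ (w : β → O → ℝ) (X : β → O → O → ℝ), ∑ ω : α → O, (∏ p, w (e p) (ω p)) * (∑ r : α → O, a (fun b => r (e.symm b)) * ∏ p, X (e p) (r p) (ω p))^2
        = ∑ ω : β → O, (∏ p, w p (ω p)) * (∑ r : β → O, a r * ∏ p, X p (r p) (ω p))^2 := by
      intro w X
      refine Fintype.sum_equiv (Equiv.arrowCongr e (Equiv.refl O)) _ _ fun ω => ?_
      congr 1
      · refine Fintype.prod_equiv e _ _ fun p => by simp
      · congr 1
        refine Fintype.sum_equiv (Equiv.arrowCongr e (Equiv.refl O)) _ _ fun r => ?_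
        congr 1
        refine Fintype.prod_equiv e _ _ fun p => by simp
    rw [key, key] at this
    exact this
  · intro _ w w' hw hw' X X' h a
    simp
  · intro α _ ih dec w w' hw hw' X X' h a
    have key : ∀ (w : Option α → O → ℝ) (X : Option α → O → O → ℝ), ∑ ω : Option α → O, (∏ p, w p (ω p)) * (∑ r : Option α → O, a r * ∏ p, X p (r p) (ω p))^2
       = ∑ x : O × (α → O), (w none x.1 * ∏ p, w (some p) (x.2 p)) * (∑ y : O × (α → O), a ((Equiv.piOptionEquivProd (β := fun _ => O)).symm y) * (X none y.1 x.1 * ∏ p, X (some p) (y.2 p) (x.2 p)))^2 := by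
      intro w X
      refine Fintype.sum_equiv (Equiv.piOptionEquivProd (β := fun _ => O)) _ _ fun ω => ?_
      rw [Fintype.prod_option]
      congr 1
      congr 1
      refine Fintype.sum_equiv (Equiv.piOptionEquivProd (β := fun _ => O)) _ _ fun r => ?_
      rw [Fintype.prod_option, Equiv.symm_apply_apply]
      rfl
    rw [key, key]
    set b := fun y => a ((Equiv.piOptionEquivProd (β := fun _ => O)).symm y) with hb
    have e1 : ∀ (w : Option α → O → ℝ) (X : Option α → O → O → ℝ) (X1 : α → O → O → ℝ) (w1 : α → O → ℝ),
       ∑ x : O × (α → O), (w none x.1 * ∏ p, w1 p (x.2 p)) * (∑ y : O × (α → O), b y * (X none y.1 x.1 * ∏ p, X1 p (y.2 p) (x.2 p)))^2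
       = ∑ x0, w none x0 * ∑ x1 : α → O, (∏ p, w1 p (x1 p)) * (∑ y1 : α → O, (∑ y0, b (y0, y1) * X none y0 x0) * ∏ p, X1 p (y1 p) (x1 p))^2 := by
      intro w X X1 w1
      rw [Fintype.sum_prod_type]
      refine Finset.sum_congr rfl fun x0 _ => ?_
      rw [Finset.mul_sum]
      refine Finset.sum_congr rfl fun x1 _ => ?_
      rw [mul_assoc]
      congr 3
      rw [Fintype.sum_prod_type_right]
      refine Finset.sum_congr rfl fun y1 _ => ?_
      rw [Finset.sum_mul]
      refine Finset.sum_congr rfl fun y0 _ => by ring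
    have e2 : ∀ (w : Option α → O → ℝ) (X : Option α → O → O → ℝ) (X1 : α → O → O → ℝ) (w1 : α → O → ℝ),
       ∑ x : O × (α → O), (w none x.1 * ∏ p, w1 p (x.2 p)) * (∑ y : O × (α → O), b y * (X none y.1 x.1 * ∏ p, X1 p (y.2 p) (x.2 p)))^2
       = ∑ x1 : α → O, (∏ p, w1 p (x1 p)) * ∑ x0, w none x0 * (∑ y0, (∑ y1 : α → O, b (y0, y1) * ∏ p, X1 p (y1 p) (x1 p)) * X none y0 x0)^2 := by
      intro w X X1 w1
      rw [Fintype.sum_prod_type_right]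
      refine Finset.sum_congr rfl fun x1 _ => ?_
      rw [Finset.mul_sum]
      refine Finset.sum_congr rfl fun x0 _ => ?_
      rw [mul_comm (w none x0), mul_assoc]
      congr 3
      rw [Fintype.sum_prod_type]
      refine Finset.sum_congr rfl fun y0 _ => ?_
      rw [Finset.sum_mul]
      refine Finset.sum_congr rfl fun y1 _ => by ring
    calc _ = _ := e1 w X (fun p => X (some p)) (fun p => w (some p))
      _ ≤ _ := Finset.sum_le_sum fun x0 _ => mul_le_mul_of_nonneg_left
          (ih (fun p => w (some p)) (fun p => w' (some p)) (fun p => hw _) (fun p => hw' _) (fun p => X (some p)) (fun p => X' (some p))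
            (fun p => h _) (fun y1 => ∑ y0, b (y0, y1) * X none y0 x0)) (hw _ _)
      _ = _ := (e1 w X (fun p => X' (some p)) (fun p => w' (some p))).symm
      _ = _ := e2 w X (fun p => X' (some p)) (fun p => w' (some p))
      _ ≤ _ := Finset.sum_le_sum fun x1 _ => mul_le_mul_of_nonneg_left (h none _) (Finset.prod_nonneg fun p _ => hw' _ _)
      _ = _ := (e2 w' X' (fun p => X' (some p)) (fun p => w' (some p))).symm

/-- local factors -/
noncomputable def XX {k : ℕ} (p : ℝ) (o ω : Option (Fin k)) : ℝ :=
  match o with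
  | none => 1
  | some i => 1/(p-1) - if ω = some i then 1 else 0

noncomputable def w1 {k : ℕ} (p : ℝ) (ω : Option (Fin k)) : ℝ :=
  match ω with
  | none => 1 - k/p
  | some _ => 1/p

noncomputable def w2 {k : ℕ} (j : Fin k) (p : ℝ) (ω : Option (Fin k)) : ℝ :=
  match ω with
  | none => 1 - (k-1)/(p-1)
  | some i => if i = j then 0 else 1/(p-1)

noncomputable def w1' {k : ℕ} (p : ℝ) (ω : Option (Fin k)) : ℝ :=
  match ω with
  | none => 1 + 1/p^2
  | some _ => (1/p)*(1+3*k/p)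

noncomputable def X1' {k : ℕ} (o ω : Option (Fin k)) : ℝ := if o = ω then 1 else 0

noncomputable def w2' {k : ℕ} (j : Fin k) (p : ℝ) (ω : Option (Fin k)) : ℝ :=
  match ω with
  | none => 1
  | some i => if i = j then 0 else (1/(p-1))*(1-(k-1)/(p-1))

noncomputable def X2' {k : ℕ} (j : Fin k) (p : ℝ) (o ω : Option (Fin k)) : ℝ :=
  match ω with
  | none => if o = none then 1 else if o = some j then 1/(p-1) else 0
  | some i => if o = some i then 1 else 0

lemma inner_XX {k : ℕ} (p : ℝ) (c : Option (Fin k) → ℝ) : 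
    (∑ o, c o * XX p o none) = c none + (∑ i, c (some i))/(p-1) := by
  rw [Fintype.sum_option]
  simp [XX, ← Finset.sum_mul, div_eq_mul_inv]

lemma inner_XX' {k : ℕ} (p : ℝ) (c : Option (Fin k) → ℝ) (i : Fin k) : 
    (∑ o, c o * XX p o (some i)) = c none + (∑ i, c (some i))/(p-1) - c (some i) := by
  rw [Fintype.sum_option]
  simp only [XX, mul_sub, Finset.sum_sub_distrib, mul_ite, mul_one, mul_zero, mul_one_div, Option.some_inj, ← Finset.sum_div]
  rw [Finset.sum_ite_eq]
  simp; ring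

lemma local1 {k : ℕ} (p : ℝ) (hp : 3 ≤ p) (c : Option (Fin k) → ℝ) :
    ∑ ω, w1 p ω * (∑ o, c o * XX p o ω)^2 ≤ ∑ ω, w1' p ω * (∑ o, c o * X1' o ω)^2 := by
  rw [Fintype.sum_option (fun ω => w1 p ω * (∑ o, c o * XX p o ω)^2), Fintype.sum_option (fun ω => w1' p ω * (∑ o, c o * X1' o ω)^2)]
  simp only [inner_XX, inner_XX', w1, w1', X1', mul_ite, mul_one, mul_zero, Finset.sum_ite_eq', Finset.mem_univ, if_true]
  set c0 := c none
  set σ := ∑ i, c (some i) with hσ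
  set T := ∑ i, c (some i)^2 with hT
  have hcs : σ^2 ≤ k * T := by
    have := sq_sum_le_card_mul_sum_sq (s := (univ : Finset (Fin k))) (f := fun i => c (some i))
    simpa using this
  have e1 : ∑ i, 1/p * (c0 + σ/(p-1) - c (some i))^2 = 1/p * (k * (c0+σ/(p-1))^2 - 2 * (c0+σ/(p-1)) * σ + T) := by
    rw [← Finset.mul_sum]
    congr 1
    have : ∀ i, (c0 + σ/(p-1) - c (some i))^2 = (c0+σ/(p-1))^2 - 2 * (c0+σ/(p-1)) * c (some i) + c (some i)^2 := fun i => by ring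
    rw [Finset.sum_congr rfl fun i _ => this i, Finset.sum_add_distrib, Finset.sum_sub_distrib, ← Finset.mul_sum, ← hσ, ← hT]
    simp
  rw [e1, ← Finset.mul_sum, ← hT]
  set s := σ/(p-1) with hs
  have hσs : σ = (p-1)*s := by rw [hs]; field_simp [show p - 1 ≠ 0 by linarith]
  have hp0 : 0 < p := by linarith
  have e2 : (1 - k/p) * (c0+s)^2 + 1/p * (k * (c0+s)^2 - 2*(c0+s)*σ + T) = c0^2 - s^2 + 2/p * c0 * s + 2/p * s^2 + T/p := by
    rw [hσs]; field_simp; ring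
  rw [e2]
  have e3 : 2/p*c0*s ≤ c0^2/p^2 + s^2 := by
    have := sq_nonneg (c0/p - s)
    have e : (c0/p - s)^2 = c0^2/p^2 - 2/p*c0*s + s^2 := by field_simp; ring
    linarith
  have hT0 : 0 ≤ T := Finset.sum_nonneg fun _ _ => sq_nonneg _
  have e4 : 2/p*s^2 ≤ 3*k*T/p^2 := by
    rw [div_mul_eq_mul_div, div_le_div_iff₀ hp0 (by positivity)]
    have h1 : (p-1)^2*s^2 ≤ k*T := by rw [← mul_pow, ← hσs]; exact hcs
    have h2 : 2*p ≤ 3*(p-1)^2 := by nlinarith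
    have h3 : 2*p*s^2 ≤ 3*(k*T) := by nlinarith [sq_nonneg s]
    nlinarith
  have e5 : 1/p*(1+3*k/p)*T = T/p + 3*k*T/p^2 := by field_simp
  have e6 : (1+1/p^2)*c0^2 = c0^2 + c0^2/p^2 := by field_simp
  linarith

lemma local2 {k : ℕ} (j : Fin k) (p : ℝ) (hp : 3 ≤ p) (c : Option (Fin k) → ℝ) :
    ∑ ω, w2' j p ω * (∑ o, c o * X2' j p o ω)^2 ≤ ∑ ω, w2 j p ω * (∑ o, c o * XX p o ω)^2 := by
  rw [Fintype.sum_option (fun ω => w2 j p ω * (∑ o, c o * XX p o ω)^2), Fintype.sum_option (fun ω => w2' j p ω * (∑ o, c o * X2' j p o ω)^2)]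
  have i1 : ∑ o, c o * X2' j p o none = c none + c (some j)/(p-1) := by
    rw [Fintype.sum_option]
    simp [X2', div_eq_mul_inv]
  simp only [inner_XX, inner_XX', w2, w2', i1]
  have i2 : ∀ i, ∑ o, c o * X2' j p o (some i) = c (some i) := by
    intro i; simp [X2']
  simp only [i2]
  set c0 := c none
  set m := p - 1 with hm
  have hm0 : 0 < m := by linarith
  set τ := ∑ i ∈ univ.erase j, c (some i) with hτ
  set T := ∑ i ∈ univ.erase j, c (some i)^2 with hT
  have hσ : ∑ i, c (some i) = c (some j) + τ := (Finset.add_sum_erase _ _ (mem_univ j)).symm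
  have hcard : ((univ.erase j).card : ℝ) = k - 1 := by
    rw [Finset.card_erase_of_mem (mem_univ _), Finset.card_univ, Fintype.card_fin, Nat.cast_sub (by have := j.2; omega)]; simp
  have hcs : τ^2 ≤ (k-1) * T := by
    have := sq_sum_le_card_mul_sum_sq (s := (univ : Finset (Fin k)).erase j) (f := fun i => c (some i))
    rwa [hcard] at this
  rw [hσ]
  set y := c0 + (c (some j) + τ)/m with hy
  have f1 : ∀ (F G : Fin k → ℝ), ∑ i, (if i = j then 0 else F i) * G i = ∑ i ∈ univ.erase j, F i * G i := by
    intro F G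
    rw [← Finset.add_sum_erase _ _ (mem_univ j)]
    rw [if_pos rfl, zero_mul, zero_add]
    exact Finset.sum_congr rfl fun i hi => by rw [if_neg (Finset.ne_of_mem_erase hi)]
  rw [f1 (fun _ => 1/m*(1-(k-1)/m)), f1 (fun _ => 1/m), ← Finset.mul_sum, ← Finset.mul_sum, ← hT]
  have e1 : ∑ i ∈ univ.erase j, (y - c (some i))^2 = (k-1)*y^2 - 2*y*τ + T := by
    have : ∀ i, (y - c (some i))^2 = y^2 - 2 * y * c (some i) + c (some i)^2 := fun i => by ring
    rw [Finset.sum_congr rfl fun i _ => this i, Finset.sum_add_distrib, Finset.sum_sub_distrib, ← Finset.mul_sum, ← hτ, ← hT, Finset.sum_const, nsmul_eq_mul, hcard]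
  rw [e1]
  set b := c0 + c (some j)/m with hb
  have hyb : y = b + τ/m := by rw [hy, hb]; ring
  have e2 : (1 - (k-1)/m)*y^2 + 1/m*((k-1)*y^2 - 2*y*τ+T) = b^2 - τ^2/m^2 + T/m := by
    rw [hyb]; field_simp; ring
  rw [e2]
  have e3 : τ^2/m^2 ≤ (k-1)*T/m^2 := by gcongr
  have e4 : 1/m*(1-(k-1)/m)*T = T/m - (k-1)*T/m^2 := by field_simp
  linarith
end BG

namespace BG
set_option linter.unusedSectionVars false
open Finset

section
variable {ι : Type} [Fintype ι] [DecidableEq ι]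

lemma sup_le (γ : Finset ι → ℝ) (hγ : ∀ A, 0 ≤ γ A) (hanti : ∀ A B, A ⊆ B → γ B ≤ γ A) (f : ι → ℝ) (hf : ∀ p, 0 ≤ f p) (B : Finset ι) :
    ∑ A ∈ univ.filter (fun A => B ⊆ A), γ A * ∏ p ∈ A, f p ≤ (∏ p ∈ B, f p) * ∑ A, γ A * ∏ p ∈ A, f p := by
  have hpr : ∀ A : Finset ι, 0 ≤ ∏ p ∈ A, f p := fun A => Finset.prod_nonneg fun p _ => hf p
  rw [Finset.mul_sum]
  refine sum_le_inj _ univ _ (fun A => (∏ p ∈ B, f p) * (γ A * ∏ p ∈ A, f p)) (fun A => A \ B) (fun _ _ => mem_univ _) ?_ ?_ ?_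
  · intro A hA A' hA' h
    rw [mem_filter] at hA hA'
    rw [← Finset.sdiff_union_of_subset hA.2, h, Finset.sdiff_union_of_subset hA'.2]
  · intro A _; exact mul_nonneg (hpr _) (mul_nonneg (hγ _) (hpr _))
  · intro A hA
    rw [mem_filter] at hA
    rw [← Finset.prod_sdiff hA.2]
    have := hanti (A \ B) A Finset.sdiff_subset
    calc _ ≤ γ (A \ B) * ((∏ p ∈ A \ B, f p) * ∏ p ∈ B, f p) := mul_le_mul_of_nonneg_right this (mul_nonneg (hpr _) (hpr _))
      _ = _ := by ring

lemma absorb (γ : Finset ι → ℝ) (hγ : ∀ A, 0 ≤ γ A) (hanti : ∀ A B, A ⊆ B → γ B ≤ γ A) (f g : ι → ℝ) (hf : ∀ p, 0 ≤ f p) (hg : ∀ p, 0 ≤ g p) :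
    ∑ A, γ A * ∏ p ∈ A, (f p * (1 + g p)) ≤ (∏ p, (1 + f p * g p)) * ∑ A, γ A * ∏ p ∈ A, f p := by
  calc _ = ∑ A : Finset ι, ∑ B : Finset ι, if B ⊆ A then (∏ p ∈ B, g p) * (γ A * ∏ p ∈ A, f p) else 0 := by
        refine Finset.sum_congr rfl fun A _ => ?_
        rw [Finset.prod_mul_distrib, Finset.prod_one_add, ← Finset.sum_filter]
        rw [← mul_assoc, mul_comm, Finset.sum_mul]
        refine Finset.sum_congr ?_ fun _ _ => rfl
        ext B; simp
    _ = ∑ B, (∏ p ∈ B, g p) * ∑ A ∈ univ.filter (fun A => B ⊆ A), γ A * ∏ p ∈ A, f p := by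
        rw [Finset.sum_comm]
        refine Finset.sum_congr rfl fun B _ => ?_
        rw [← Finset.sum_filter, Finset.mul_sum]
    _ ≤ ∑ B, (∏ p ∈ B, g p) * ((∏ p ∈ B, f p) * ∑ A, γ A * ∏ p ∈ A, f p) := by
        refine Finset.sum_le_sum fun B _ => mul_le_mul_of_nonneg_left (sup_le γ hγ hanti f hf B) (Finset.prod_nonneg fun p _ => hg p)
    _ = _ := by
        rw [Finset.prod_one_add, Finset.sum_mul, Finset.powerset_univ]
        refine Finset.sum_congr rfl fun B _ => ?_
        rw [Finset.prod_mul_distrib]; ring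

lemma avoid (γ : Finset ι → ℝ) (hγ : ∀ A, 0 ≤ γ A) (hanti : ∀ A B, A ⊆ B → γ B ≤ γ A) (f : ι → ℝ) (hf : ∀ p, 0 ≤ f p) (t : Finset ι) :
    ∑ A, γ A * ∏ p ∈ A, f p ≤ (∏ p ∈ t, (1 + f p)) * ∑ A ∈ univ.filter (fun A => Disjoint A t), γ A * ∏ p ∈ A, f p := by
  have hpr : ∀ A : Finset ι, 0 ≤ ∏ p ∈ A, f p := fun A => Finset.prod_nonneg fun p _ => hf p
  rw [Finset.prod_one_add, Finset.sum_mul_sum, ← Finset.sum_product']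
  refine sum_le_inj univ _ _ (fun x : Finset ι × Finset ι => (∏ p ∈ x.1, f p) * (γ x.2 * ∏ p ∈ x.2, f p)) (fun A => (A ∩ t, A \ t)) ?_ ?_ ?_ ?_
  · intro A _
    simp only [mem_product, mem_powerset, mem_filter, mem_univ, true_and]
    exact ⟨Finset.inter_subset_right, Finset.sdiff_disjoint⟩
  · intro A _ B _ h
    rw [Prod.mk.injEq] at h
    rw [← Finset.sdiff_union_inter A t, h.1, h.2, Finset.sdiff_union_inter]
  · intro x _; exact mul_nonneg (hpr _) (mul_nonneg (hγ _) (hpr _))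
  · intro A _
    have e : ∏ p ∈ A, f p = (∏ p ∈ A ∩ t, f p) * ∏ p ∈ A \ t, f p := by
      rw [mul_comm, ← Finset.prod_union (Finset.disjoint_sdiff_inter A t), Finset.sdiff_union_inter]
    have := hanti (A \ t) A Finset.sdiff_subset
    simp only
    rw [e]
    calc _ ≤ γ (A \ t) * ((∏ p ∈ A ∩ t, f p) * ∏ p ∈ A \ t, f p) := mul_le_mul_of_nonneg_right this (mul_nonneg (hpr _) (hpr _))
      _ = _ := by ring

lemma sum_tuple (k : ℕ) (F : Fin k → Finset ι → ℝ) : ∑ A : Fin k → Finset ι, ∏ j, F j (A j) = ∏ j, ∑ B, F j B := by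
  rw [Finset.prod_univ_sum, Fintype.piFinset_univ]

def cl {k : ℕ} (r : ι → Option (Fin k)) (j : Fin k) : Finset ι := univ.filter (fun p => r p = some j)

lemma cl_inj {k : ℕ} {r s : ι → Option (Fin k)} (h : ∀ j, cl r j = cl s j) : r = s := by
  funext p
  cases hr : r p with
  | some j =>
    have : p ∈ cl s j := by rw [← h j]; simp [cl, hr]
    simp only [cl, mem_filter, mem_univ, true_and] at this
    exact this.symm
  | none =>
    cases hs : s p with
    | none => rfl
    | some j =>
      have : p ∈ cl r j := by rw [h j]; simp [cl, hs]
      simp only [cl, mem_filter, mem_univ, true_and] at this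
      rw [hr] at this; exact this

lemma prod_cl {k : ℕ} (r : ι → Option (Fin k)) (f : ι → ℝ) :
    ∏ j, ∏ p ∈ cl r j, f p = ∏ p, (if r p = none then 1 else f p) := by
  simp only [cl, Finset.prod_filter]
  rw [Finset.prod_comm]
  refine Finset.prod_congr rfl fun p _ => ?_
  cases h : r p with
  | none => simp
  | some j => simp

lemma diag1 {k : ℕ} (a : (ι → Option (Fin k)) → ℝ) (ω : ι → Option (Fin k)) :
    ∑ r : ι → Option (Fin k), a r * ∏ p, X1' (r p) (ω p) = a ω := by
  rw [Finset.sum_eq_single ω]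
  · simp [X1']
  · intro r _ hr
    obtain ⟨p, hp⟩ := Function.ne_iff.1 hr
    rw [Finset.prod_eq_zero (mem_univ p) (by simp [X1', hp]), mul_zero]
  · simp

lemma E1 (k : ℕ) (q : ι → ℝ) (hq : ∀ p, 0 < q p) (γ : Finset ι → ℝ) (hγ : ∀ A, 0 ≤ γ A) (hanti : ∀ A B, A ⊆ B → γ B ≤ γ A)
    (a : (ι → Option (Fin k)) → ℝ) (ha : ∀ r, |a r| ≤ ∏ j, γ (cl r j)) (δ : ℝ) (hδ : ∑ p, 1/(q p)^2 ≤ δ) :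
    ∑ r : ι → Option (Fin k), (∏ p, w1' (q p) (r p)) * (a r)^2 ≤ Real.exp (δ + 3*k^2*δ) * (∑ A, γ A^2 * ∏ p ∈ A, (1/q p))^k := by
  have hγ2 : ∀ A, 0 ≤ γ A^2 := fun A => sq_nonneg _
  have hanti2 : ∀ A B, A ⊆ B → γ B^2 ≤ γ A^2 := fun A B h => pow_le_pow_left₀ (hγ _) (hanti A B h) 2
  set G : Finset ι → ℝ := fun A => γ A^2 * ∏ p ∈ A, (1/q p * (1 + 3*k/q p)) with hG
  have hG0 : ∀ A, 0 ≤ G A := fun A => mul_nonneg (hγ2 _) (Finset.prod_nonneg fun p _ => by have := hq p; positivity)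
  have h1 : ∀ r : ι → Option (Fin k), (∏ p, w1' (q p) (r p)) * (a r)^2 ≤ (∏ p, (1 + 1/(q p)^2)) * ∏ j, G (cl r j) := by
    intro r
    have hw : ∏ p, w1' (q p) (r p) ≤ (∏ p, (1 + 1/(q p)^2)) * ∏ j, ∏ p ∈ cl r j, (1/q p * (1 + 3*k/q p)) := by
      rw [prod_cl, ← Finset.prod_mul_distrib]
      refine Finset.prod_le_prod (fun p _ => ?_) fun p _ => ?_
      · have := hq p
        cases r p <;> simp only [w1'] <;> positivity
      · have := hq p
        cases h : r p with
        | none => simp [w1']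
        | some j =>
          simp only [w1', reduceCtorEq, if_false]
          refine le_mul_of_one_le_left (by positivity) ?_
          have : 0 < 1/(q p)^2 := by positivity
          linarith
    have h2 : (a r)^2 ≤ ∏ j, γ (cl r j)^2 := by
      rw [← sq_abs, Finset.prod_pow]
      exact pow_le_pow_left₀ (abs_nonneg _) (ha r) 2
    calc _ ≤ ((∏ p, (1 + 1/(q p)^2)) * ∏ j, ∏ p ∈ cl r j, (1/q p * (1 + 3*k/q p))) * ∏ j, γ (cl r j)^2 := by
          refine mul_le_mul hw h2 (sq_nonneg _) ?_
          exact mul_nonneg (Finset.prod_nonneg fun p _ => by have := hq p; positivity) (Finset.prod_nonneg fun j _ => Finset.prod_nonneg fun p _ => by have := hq p; positivity)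
      _ = _ := by
          rw [mul_assoc, ← Finset.prod_mul_distrib]
          congr 1
          exact Finset.prod_congr rfl fun j _ => by rw [hG, mul_comm]
  have hexp : ∀ c : ℝ, 0 ≤ c → ∏ p, (1 + c * (1/(q p)^2)) ≤ Real.exp (c*δ) := by
    intro c hc
    calc _ ≤ ∏ p, Real.exp (c * (1/(q p)^2)) := Finset.prod_le_prod (fun p _ => by have := hq p; positivity) fun p _ => by
            have := Real.add_one_le_exp (c * (1/(q p)^2)); linarith
      _ = Real.exp (c * ∑ p, 1/(q p)^2) := by rw [← Real.exp_sum, Finset.mul_sum]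
      _ ≤ _ := by gcongr
  have hGs : ∑ A, G A ≤ Real.exp (3*k*δ) * ∑ A, γ A^2 * ∏ p ∈ A, (1/q p) := by
    refine (absorb (fun A => γ A^2) hγ2 hanti2 (fun p => 1/q p) (fun p => 3*k/q p) (fun p => by have := hq p; positivity) (fun p => by have := hq p; positivity)).trans ?_
    refine mul_le_mul_of_nonneg_right ?_ (Finset.sum_nonneg fun A _ => mul_nonneg (hγ2 _) (Finset.prod_nonneg fun p _ => by have := hq p; positivity))
    refine le_trans (le_of_eq (Finset.prod_congr rfl fun p _ => ?_)) (hexp (3*k) (by positivity))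
    have := hq p
    field_simp
  have hP0 : 0 ≤ ∏ p, (1 + 1/(q p)^2) := Finset.prod_nonneg fun p _ => by have := hq p; positivity
  calc _ ≤ ∑ r : ι → Option (Fin k), (∏ p, (1 + 1/(q p)^2)) * ∏ j, G (cl r j) := Finset.sum_le_sum fun r _ => h1 r
    _ = (∏ p, (1 + 1/(q p)^2)) * ∑ r : ι → Option (Fin k), ∏ j, G (cl r j) := by rw [Finset.mul_sum]
    _ ≤ (∏ p, (1 + 1/(q p)^2)) * ∑ A : Fin k → Finset ι, ∏ j, G (A j) := by
        refine mul_le_mul_of_nonneg_left ?_ hP0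
        refine sum_le_inj _ _ _ (fun A : Fin k → Finset ι => ∏ j, G (A j)) (fun r => cl r) (fun _ _ => mem_univ _) ?_ ?_ ?_
        · intro r _ s _ h; exact cl_inj fun j => congrFun h j
        · intro A _; exact Finset.prod_nonneg fun j _ => hG0 _
        · intro r _; exact le_rfl
    _ = (∏ p, (1 + 1/(q p)^2)) * (∑ A, G A)^k := by
        rw [sum_tuple k (fun _ => G)]; simp
    _ ≤ Real.exp δ * (Real.exp (3*k*δ) * ∑ A, γ A^2 * ∏ p ∈ A, (1/q p))^k := by
        refine mul_le_mul ?_ (pow_le_pow_left₀ (Finset.sum_nonneg fun A _ => hG0 A) hGs k) (pow_nonneg (Finset.sum_nonneg fun A _ => hG0 A) k) (Real.exp_pos _).le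
        have := hexp 1 zero_le_one
        simpa using this
    _ = _ := by
        rw [mul_pow, ← mul_assoc, ← Real.exp_nat_mul, ← Real.exp_add]
        congr 3; ring
end
end BG

namespace BG
open Finset
set_option linter.unusedSectionVars false

section
variable {ι : Type} [Fintype ι] [DecidableEq ι]

lemma tuple_bound {k : ℕ} (V h : Fin k → Finset ι → ℝ) (c : Fin k → ℝ) (hV : ∀ i A, 0 ≤ V i A) (hh : ∀ i A, 0 ≤ h i A)
    (hb : ∀ i, ∑ A, V i A * h i A ≤ c i * ∑ A, V i A) :
    ∑ A : Fin k → Finset ι, (∏ i, V i (A i)) * ∏ i, h i (A i) ≤ (∏ i, c i) * ∏ i, ∑ A, V i A := by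
  calc _ = ∑ A : Fin k → Finset ι, ∏ i, (V i (A i) * h i (A i)) := Finset.sum_congr rfl fun A _ => Finset.prod_mul_distrib.symm
    _ = ∏ i, ∑ A, V i A * h i A := sum_tuple k (fun i A => V i A * h i A)
    _ ≤ ∏ i, (c i * ∑ A, V i A) := Finset.prod_le_prod (fun i _ => Finset.sum_nonneg fun A _ => mul_nonneg (hV _ _) (hh _ _)) fun i _ => hb i
    _ = _ := Finset.prod_mul_distrib

lemma tuple_one {k : ℕ} (V : Fin k → Finset ι → ℝ) (h : Finset ι → ℝ) (c : ℝ) (hV : ∀ i A, 0 ≤ V i A) (hh : ∀ A, 0 ≤ h A)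
    (hb : ∀ i, ∑ A, V i A * h A ≤ c * ∑ A, V i A) (i : Fin k) :
    ∑ A : Fin k → Finset ι, (∏ i, V i (A i)) * h (A i) ≤ c * ∏ i, ∑ A, V i A := by
  have := tuple_bound V (fun l A => if l = i then h A else 1) (fun l => if l = i then c else 1) hV (fun l A => by split_ifs; exact hh A; exact zero_le_one)
    (fun l => by split_ifs with e; exact hb l; simp)
  simpa [Finset.prod_ite_eq'] using this

lemma tuple_two {k : ℕ} (V : Fin k → Finset ι → ℝ) (h : Finset ι → ℝ) (c : ℝ) (hV : ∀ i A, 0 ≤ V i A) (hh : ∀ A, 0 ≤ h A)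
    (hb : ∀ i, ∑ A, V i A * h A ≤ c * ∑ A, V i A) (i i' : Fin k) (hne : i ≠ i') :
    ∑ A : Fin k → Finset ι, (∏ i, V i (A i)) * (h (A i) * h (A i')) ≤ c^2 * ∏ i, ∑ A, V i A := by
  have := tuple_bound V (fun l A => (if l = i then h A else 1) * (if l = i' then h A else 1)) (fun l => (if l = i then c else 1) * (if l = i' then c else 1)) hV
    (fun l A => by refine mul_nonneg ?_ ?_ <;> split_ifs <;> first | exact hh A | exact zero_le_one)
    (fun l => by
      by_cases e : l = i
      · subst e
        simpa [hne] using hb l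
      · by_cases e' : l = i'
        · subst e'
          simpa [e] using hb l
        · simp [e, e'])
  simp only [Finset.prod_mul_distrib, Finset.prod_ite_eq', mem_univ, if_true] at this
  rwa [pow_two]

lemma one_sub_sum_le (s : Finset ι) (x : ι → ℝ) (h0 : ∀ p, 0 ≤ x p) (h1 : ∀ p, x p ≤ 1) : 1 - ∑ p ∈ s, x p ≤ ∏ p ∈ s, (1 - x p) := by
  induction s using Finset.induction_on with
  | empty => simp
  | insert p s hp ih =>
    rw [Finset.sum_insert hp, Finset.prod_insert hp]
    have hpr : ∏ p ∈ s, (1 - x p) ≤ 1 := Finset.prod_le_one (fun p _ => by linarith [h1 p]) fun p _ => by linarith [h0 p]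
    have := h0 p
    nlinarith

open Classical in
noncomputable def ee {k : ℕ} (A : Fin k → Finset ι) (p : ι) : Option (Fin k) := if h : ∃ i, p ∈ A i then some h.choose else none

lemma ee_some {k : ℕ} (A : Fin k → Finset ι) (hd : ∀ i i', i ≠ i' → Disjoint (A i) (A i')) (p : ι) (i : Fin k) : ee A p = some i ↔ p ∈ A i := by
  unfold ee
  constructor
  · intro h
    split_ifs at h with h1
    rw [Option.some_inj] at h
    rw [← h]; exact h1.choose_spec
  · intro h
    have h1 : ∃ i, p ∈ A i := ⟨i, h⟩
    rw [dif_pos h1, Option.some_inj]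
    by_contra hne
    exact Finset.disjoint_left.1 (hd _ _ hne) h1.choose_spec h

lemma cl_ee {k : ℕ} (A : Fin k → Finset ι) (hd : ∀ i i', i ≠ i' → Disjoint (A i) (A i')) (i : Fin k) : cl (ee A) i = A i := by
  ext p; simp [cl, ee_some A hd]

lemma sum_cl {k : ℕ} (r : ι → Option (Fin k)) (f : ι → ℝ) :
    ∑ j, ∑ p ∈ cl r j, f p = ∑ p, (if r p = none then 0 else f p) := by
  simp only [cl, Finset.sum_filter]
  rw [Finset.sum_comm]
  refine Finset.sum_congr rfl fun p _ => ?_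
  cases h : r p with
  | none => simp
  | some j => simp

noncomputable def aa {k : ℕ} (q : ι → ℝ) (Λ : ℝ) (γ : Finset ι → ℝ) (r : ι → Option (Fin k)) : ℝ :=
  if ∑ p, (if r p = none then 0 else Real.log (q p)) ≤ Λ then ∏ j, γ (cl r j) else 0

lemma inner2 {k : ℕ} (j : Fin k) (q : ι → ℝ) (hq : ∀ p, 3 ≤ q p) (Λ : ℝ) (γ : Finset ι → ℝ) (hγ : ∀ A, 0 ≤ γ A)
    (hanti : ∀ A B, A ⊆ B → γ B ≤ γ A) (hsupp : ∀ A, γ A ≠ 0 → ∑ p ∈ A, Real.log (q p) ≤ Λ/4)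
    (A : Fin k → Finset ι) (hd : ∀ i i', i ≠ i' → Disjoint (A i) (A i')) (hj : A j = ∅) (hl : ∑ i, ∑ p ∈ A i, Real.log (q p) ≤ 3/4*Λ) :
    (∏ i, if i = j then 1 else γ (A i)) * (∑ B, γ B * ∏ p ∈ B, (1/(q p - 1))) ≤
      (∏ p, if ee A p = none then 1 else (1 + 1/(q p - 1))) * ∑ r : ι → Option (Fin k), aa q Λ γ r * ∏ p, X2' j (q p) (r p) (ee A p) := by
  set U := univ.filter (fun p => ee A p ≠ none) with hU
  have hf : ∀ p, 0 ≤ 1/(q p - 1) := fun p => by have := hq p; exact div_nonneg zero_le_one (by linarith)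
  have hav := avoid γ hγ hanti (fun p => 1/(q p - 1)) hf U
  have hΓ : 0 ≤ ∏ i, if i = j then 1 else γ (A i) := Finset.prod_nonneg fun i _ => by split_ifs; exact zero_le_one; exact hγ _
  have hUp : (∏ p, if ee A p = none then 1 else (1 + 1/(q p - 1))) = ∏ p ∈ U, (1 + 1/(q p - 1)) := by
    rw [hU, Finset.prod_filter]
    refine Finset.prod_congr rfl fun p _ => by by_cases h : ee A p = none <;> simp [h]
  have haa : ∀ r : ι → Option (Fin k), 0 ≤ aa q Λ γ r * ∏ p, X2' j (q p) (r p) (ee A p) := by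
    intro r
    refine mul_nonneg ?_ (Finset.prod_nonneg fun p _ => ?_)
    · unfold aa; split_ifs
      · exact Finset.prod_nonneg fun _ _ => hγ _
      · exact le_rfl
    · unfold X2'
      have := hf p
      cases ee A p <;> simp only <;> split_ifs <;> first | exact zero_le_one | exact le_rfl | exact this
  rw [hUp]
  refine le_trans (mul_le_mul_of_nonneg_left hav hΓ) ?_
  rw [mul_left_comm]
  refine mul_le_mul_of_nonneg_left ?_ (Finset.prod_nonneg fun p _ => by linarith [hf p])
  rw [Finset.mul_sum]
  have hjnone : ∀ p, ee A p ≠ some j := by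
    intro p h
    rw [ee_some A hd, hj] at h; simp at h
  have hrt : ∀ t : Finset ι, Disjoint t U → ∀ i, cl (fun p => if p ∈ t then some j else ee A p) i = if i = j then t else A i := by
    intro t ht i
    ext p
    simp only [cl, mem_filter, mem_univ, true_and]
    by_cases hp : p ∈ t
    · have h1 : ee A p = none := by
        by_contra h
        exact Finset.disjoint_left.1 ht hp (by rw [hU, mem_filter]; exact ⟨mem_univ _, h⟩)
      have h2 : p ∉ A i := by
        intro h; rw [← ee_some A hd, h1] at h; exact absurd h (by simp)
      by_cases hij : i = j
      · simp [hp, hij]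
      · simp [hp, hij, h2, Ne.symm hij]
    · by_cases hij : i = j
      · subst hij; simp [hp, hjnone]
      · simp [hp, hij, ee_some A hd]
  refine sum_le_inj _ univ _ (fun r : ι → Option (Fin k) => aa q Λ γ r * ∏ p, X2' j (q p) (r p) (ee A p)) (fun t p => if p ∈ t then some j else ee A p)
    (fun _ _ => mem_univ _) ?_ (fun r _ => haa r) ?_
  · intro t ht t' ht' h
    rw [mem_filter] at ht ht'
    have h1 := hrt t ht.2 j
    have h2 := hrt t' ht'.2 j
    rw [h, h2] at h1
    simpa using h1.symm
  · intro t ht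
    rw [mem_filter] at ht
    have hr := hrt t ht.2
    by_cases hz : γ t = 0
    · rw [hz, zero_mul, mul_zero]; exact haa _
    have hc : ∑ p, (if (if p ∈ t then some j else ee A p) = none then 0 else Real.log (q p)) ≤ Λ := by
      rw [← sum_cl (fun p => if p ∈ t then some j else ee A p) (fun p => Real.log (q p))]
      simp only [hr]
      have e : ∀ i, ∑ p ∈ (if i = j then t else A i), Real.log (q p) = (if i = j then ∑ p ∈ t, Real.log (q p) else 0) + ∑ p ∈ A i, Real.log (q p) := by
        intro i; split_ifs with h
        · subst h; rw [hj]; simp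
        · simp
      simp only [e, Finset.sum_add_distrib, Finset.sum_ite_eq', mem_univ, if_true]
      have := hsupp t hz
      linarith
    have hX : ∏ p, X2' j (q p) (if p ∈ t then some j else ee A p) (ee A p) = ∏ p ∈ t, (1/(q p - 1)) := by
      rw [← Finset.prod_filter_mul_prod_filter_not univ (fun p => p ∈ t)]
      have e1 : univ.filter (fun p => p ∈ t) = t := by ext; simp
      rw [e1]
      have e2 : ∏ p ∈ univ.filter (fun p => ¬ p ∈ t), X2' j (q p) (if p ∈ t then some j else ee A p) (ee A p) = 1 := by
        refine Finset.prod_eq_one fun p hp => ?_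
        rw [mem_filter] at hp
        rw [if_neg hp.2]
        unfold X2'
        cases ee A p <;> simp
      rw [e2, mul_one]
      refine Finset.prod_congr rfl fun p hp => ?_
      have h1 : ee A p = none := by
        by_contra h
        exact Finset.disjoint_left.1 ht.2 hp (by rw [hU, mem_filter]; exact ⟨mem_univ _, h⟩)
      rw [if_pos hp, h1]
      simp [X2']
    rw [hX]
    unfold aa
    rw [if_pos hc]
    simp only [hr]
    rw [← mul_assoc]
    refine mul_le_mul_of_nonneg_right (le_of_eq ?_) (Finset.prod_nonneg fun p _ => hf p)
    rw [← Finset.mul_prod_erase univ (fun i => γ (if i = j then t else A i)) (mem_univ j), ← Finset.mul_prod_erase univ (fun i => if i = j then 1 else γ (A i)) (mem_univ j)]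
    simp only [if_true, one_mul]
    rw [mul_comm]
    congr 1
    refine Finset.prod_congr rfl fun i hi => by simp [Finset.ne_of_mem_erase hi]
end
end BG

namespace BG
open Finset
set_option linter.unusedSectionVars false

section
variable {ι : Type} [Fintype ι] [DecidableEq ι]

noncomputable def VV {k : ℕ} (j : Fin k) (q : ι → ℝ) (γ : Finset ι → ℝ) (i : Fin k) (A : Finset ι) : ℝ :=
  if i = j then (if A = ∅ then 1 else 0) else γ A^2 * ∏ p ∈ A, (1/q p)

noncomputable def inn (p : ι) (A : Finset ι) : ℝ := if p ∈ A then 1 else 0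

lemma inn_nonneg (p : ι) (A : Finset ι) : 0 ≤ inn p A := by unfold inn; split_ifs <;> norm_num

noncomputable def br {k : ℕ} (q : ι → ℝ) (Λ : ℝ) (A : Fin k → Finset ι) : ℝ :=
  1 - (∑ i, ∑ i', if i ≠ i' then ∑ p, inn p (A i) * inn p (A i') else 0) - (∑ i, ∑ p, inn p (A i) * (k/q p)) -
    (∑ i, ∑ p ∈ A i, Real.log (q p)) / (3/4*Λ)

lemma inn_sum (A : Finset ι) (f : ι → ℝ) : ∑ p, inn p A * f p = ∑ p ∈ A, f p := by
  simp [inn]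

lemma VV_nonneg {k : ℕ} (j : Fin k) (q : ι → ℝ) (hq : ∀ p, 3 ≤ q p) (γ : Finset ι → ℝ) (i : Fin k) (A : Finset ι) : 0 ≤ VV j q γ i A := by
  unfold VV
  split_ifs
  · exact zero_le_one
  · exact le_rfl
  · exact mul_nonneg (sq_nonneg _) (Finset.prod_nonneg fun p _ => by have := hq p; positivity)

lemma VV_sum {k : ℕ} (j : Fin k) (q : ι → ℝ) (γ : Finset ι → ℝ) (i : Fin k) :
    ∑ A, VV j q γ i A = if i = j then 1 else ∑ A, γ A^2 * ∏ p ∈ A, (1/q p) := by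
  unfold VV
  split_ifs <;> simp

lemma VV_lower {k : ℕ} (j : Fin k) (q : ι → ℝ) (hq : ∀ p, 3 ≤ q p) (Λ : ℝ) (hΛ : 0 < Λ) (γ : Finset ι → ℝ) (hγ : ∀ A, 0 ≤ γ A)
    (hanti : ∀ A B, A ⊆ B → γ B ≤ γ A) (δ η : ℝ) (hδ : ∑ p, 1/(q p)^2 ≤ δ) (hη : 0 ≤ η)
    (hS3 : ∑ A, (γ A^2 * ∏ p ∈ A, (1/q p)) * ∑ p ∈ A, Real.log (q p) ≤ η * ∑ A, γ A^2 * ∏ p ∈ A, (1/q p)) :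
    (∑ A, γ A^2 * ∏ p ∈ A, (1/q p))^(k-1) * (1 - 2*k^2*δ - k*η/(3/4*Λ)) ≤ ∑ A : Fin k → Finset ι, (∏ i, VV j q γ i (A i)) * br q Λ A := by
  set S2 := ∑ A, γ A^2 * ∏ p ∈ A, (1/q p) with hS2
  have hq0 : ∀ p, 0 < q p := fun p => by linarith [hq p]
  have hS20 : 0 ≤ S2 := Finset.sum_nonneg fun A _ => mul_nonneg (sq_nonneg _) (Finset.prod_nonneg fun p _ => by have := hq0 p; positivity)
  have hM : ∏ i, ∑ A, VV j q γ i A = S2^(k-1) := by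
    simp only [VV_sum]
    rw [← Finset.mul_prod_erase univ _ (mem_univ j), if_pos rfl, one_mul]
    rw [Finset.prod_congr rfl (fun i hi => if_neg (Finset.ne_of_mem_erase hi)), Finset.prod_const, Finset.card_erase_of_mem (mem_univ _), Finset.card_univ, Fintype.card_fin]
  have hV := VV_nonneg j q hq γ
  have hpin : ∀ p i, ∑ A, VV j q γ i A * inn p A ≤ (1/q p) * ∑ A, VV j q γ i A := by
    intro p i
    by_cases hij : i = j
    · rw [VV_sum, if_pos hij]
      have : ∑ A, VV j q γ i A * inn p A = 0 := by
        refine Finset.sum_eq_zero fun A _ => ?_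
        unfold VV inn; rw [if_pos hij]
        by_cases h : A = ∅ <;> simp [h]
      rw [this]; have := hq0 p; positivity
    · have := sup_le (fun A => γ A^2) (fun A => sq_nonneg _) (fun A B h => pow_le_pow_left₀ (hγ _) (hanti A B h) 2) (fun p => 1/q p)
        (fun p => by have := hq0 p; positivity) {p}
      rw [VV_sum, if_neg hij]
      rw [Finset.prod_singleton] at this
      refine le_trans (le_of_eq ?_) this
      rw [Finset.sum_filter]
      refine Finset.sum_congr rfl fun A _ => ?_
      unfold VV inn; rw [if_neg hij]
      simp
  have e1 : ∑ A : Fin k → Finset ι, (∏ i, VV j q γ i (A i)) * br q Λ A = S2^(k-1)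
      - (∑ i, ∑ i', if i ≠ i' then ∑ p, ∑ A : Fin k → Finset ι, (∏ i, VV j q γ i (A i)) * (inn p (A i) * inn p (A i')) else 0)
      - (∑ i, ∑ p, (∑ A : Fin k → Finset ι, (∏ i, VV j q γ i (A i)) * inn p (A i)) * (k/q p))
      - (∑ i, ∑ A : Fin k → Finset ι, (∏ i, VV j q γ i (A i)) * ∑ p ∈ A i, Real.log (q p))/(3/4*Λ) := by
    unfold br
    simp only [mul_sub, Finset.sum_sub_distrib, mul_one]
    congr 1
    · congr 1
      · congr 1
        · rw [sum_tuple, hM]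
        · simp only [Finset.mul_sum]
          rw [Finset.sum_comm]
          refine Finset.sum_congr rfl fun i _ => ?_
          rw [Finset.sum_comm]
          refine Finset.sum_congr rfl fun i' _ => ?_
          by_cases h : i ≠ i'
          · simp only [if_pos h, Finset.mul_sum]
            rw [Finset.sum_comm]
          · simp only [if_neg h, mul_zero, Finset.sum_const_zero]
      · simp only [Finset.mul_sum]
        rw [Finset.sum_comm]
        refine Finset.sum_congr rfl fun i _ => ?_
        rw [Finset.sum_comm]
        refine Finset.sum_congr rfl fun p _ => ?_
        rw [Finset.sum_mul]
        refine Finset.sum_congr rfl fun A _ => by ring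
    · rw [Finset.sum_comm, Finset.sum_div]
      refine Finset.sum_congr rfl fun A _ => by rw [mul_div_assoc', Finset.mul_sum]
  rw [e1]
  have b1 : (∑ i, ∑ i', if i ≠ i' then ∑ p, ∑ A : Fin k → Finset ι, (∏ i, VV j q γ i (A i)) * (inn p (A i) * inn p (A i')) else 0) ≤ ∑ i : Fin k, ∑ i' : Fin k, δ * S2^(k-1) := by
    refine Finset.sum_le_sum fun i _ => Finset.sum_le_sum fun i' _ => ?_
    have hpos : 0 ≤ S2^(k-1) := by positivity
    have hd0 : 0 ≤ δ := le_trans (Finset.sum_nonneg fun p _ => by have := hq0 p; positivity) hδ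
    split_ifs with h
    · calc _ ≤ ∑ p, (1/q p)^2 * S2^(k-1) := Finset.sum_le_sum fun p _ => by
            rw [← hM]; exact tuple_two (VV j q γ) (inn p) (1/q p) hV (inn_nonneg p) (hpin p) i i' h
        _ = (∑ p, 1/(q p)^2) * S2^(k-1) := by rw [Finset.sum_mul]; exact Finset.sum_congr rfl fun p _ => by rw [one_div_pow]
        _ ≤ _ := by gcongr
    · positivity
  have b2 : (∑ i, ∑ p, (∑ A : Fin k → Finset ι, (∏ i, VV j q γ i (A i)) * inn p (A i)) * (k/q p)) ≤ ∑ i : Fin k, k * (δ * S2^(k-1)) := by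
    refine Finset.sum_le_sum fun i _ => ?_
    calc _ ≤ ∑ p, (1/q p * S2^(k-1)) * (k/q p) := Finset.sum_le_sum fun p _ => by
            rw [← hM]
            refine mul_le_mul_of_nonneg_right (tuple_one (VV j q γ) (inn p) (1/q p) hV (inn_nonneg p) (hpin p) i) ?_
            have := hq0 p; positivity
      _ = k * ((∑ p, 1/(q p)^2) * S2^(k-1)) := by rw [Finset.sum_mul, Finset.mul_sum]; exact Finset.sum_congr rfl fun p _ => by have := hq0 p; field_simp
      _ ≤ _ := by gcongr
  have b3 : (∑ i, ∑ A : Fin k → Finset ι, (∏ i, VV j q γ i (A i)) * ∑ p ∈ A i, Real.log (q p)) ≤ ∑ i : Fin k, η * S2^(k-1) := by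
    refine Finset.sum_le_sum fun i _ => ?_
    rw [← hM]
    refine tuple_one (VV j q γ) (fun A => ∑ p ∈ A, Real.log (q p)) η hV (fun A => Finset.sum_nonneg fun p _ => Real.log_nonneg (by linarith [hq p])) ?_ i
    intro l
    by_cases hlj : l = j
    · rw [VV_sum, if_pos hlj]
      refine le_trans (le_of_eq (Finset.sum_eq_zero fun A _ => ?_)) (by linarith)
      unfold VV; rw [if_pos hlj]
      by_cases h : A = ∅ <;> simp [h]
    · rw [VV_sum, if_neg hlj]
      refine le_trans (le_of_eq (Finset.sum_congr rfl fun A _ => ?_)) hS3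
      unfold VV; rw [if_neg hlj]
  simp only [Finset.sum_const, Finset.card_univ, Fintype.card_fin, nsmul_eq_mul] at b1 b2 b3
  have b3' : (∑ i, ∑ A : Fin k → Finset ι, (∏ i, VV j q γ i (A i)) * ∑ p ∈ A i, Real.log (q p))/(3/4*Λ) ≤ (k * (η * S2^(k-1)))/(3/4*Λ) := by
    gcongr
  have : S2^(k-1) * (1 - 2*k^2*δ - k*η/(3/4*Λ)) = S2^(k-1) - k*(k*(δ * S2^(k-1))) - k*(k*(δ*S2^(k-1))) - (k * (η * S2^(k-1)))/(3/4*Λ) := by ring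
  linarith

lemma E2 {k : ℕ} (j : Fin k) (q : ι → ℝ) (hq : ∀ p, 3 ≤ q p) (hk : ∀ p, (k:ℝ) ≤ q p) (Λ : ℝ) (hΛ : 0 < Λ) (γ : Finset ι → ℝ) (hγ : ∀ A, 0 ≤ γ A)
    (hanti : ∀ A B, A ⊆ B → γ B ≤ γ A) (hsupp : ∀ A, γ A ≠ 0 → ∑ p ∈ A, Real.log (q p) ≤ Λ/4) (δ η : ℝ) (hδ : ∑ p, 1/(q p)^2 ≤ δ) (hη : 0 ≤ η)
    (hS3 : ∑ A, (γ A^2 * ∏ p ∈ A, (1/q p)) * ∑ p ∈ A, Real.log (q p) ≤ η * ∑ A, γ A^2 * ∏ p ∈ A, (1/q p)) :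
    (∑ B, γ B * ∏ p ∈ B, (1/(q p - 1)))^2 * ((∑ A, γ A^2 * ∏ p ∈ A, (1/q p))^(k-1) * (1 - 2*k^2*δ - k*η/(3/4*Λ))) ≤
    ∑ ω : ι → Option (Fin k), (∏ p, w2' j (q p) (ω p)) * (∑ r : ι → Option (Fin k), aa q Λ γ r * ∏ p, X2' j (q p) (r p) (ω p))^2 := by
  classical
  have hq0 : ∀ p, 0 < q p := fun p => by linarith [hq p]
  have hlog : ∀ p, 0 ≤ Real.log (q p) := fun p => Real.log_nonneg (by linarith [hq p])
  have hk1 : (1:ℝ) ≤ k := by exact_mod_cast (by have := j.2; omega : 1 ≤ k)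
  set S1 := ∑ B, γ B * ∏ p ∈ B, (1/(q p - 1)) with hS1
  have hS10 : 0 ≤ S1 := Finset.sum_nonneg fun A _ => mul_nonneg (hγ _) (Finset.prod_nonneg fun p _ => div_nonneg zero_le_one (by linarith [hq p]))
  refine le_trans (mul_le_mul_of_nonneg_left (VV_lower j q hq Λ hΛ γ hγ hanti δ η hδ hη hS3) (sq_nonneg _)) ?_
  have hV := VV_nonneg j q hq γ
  have hVp : ∀ A : Fin k → Finset ι, 0 ≤ ∏ i, VV j q γ i (A i) := fun A => Finset.prod_nonneg fun i _ => hV _ _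
  have hw2 : ∀ p ω, 0 ≤ w2' j (q p) ω := by
    intro p ω
    have h1 : 0 < q p - 1 := by linarith [hq p]
    have h2 : (k-1)/(q p - 1) ≤ 1 := by rw [div_le_one h1]; linarith [hk p]
    cases ω with
    | none => exact zero_le_one
    | some i =>
      simp only [w2']
      split_ifs
      · exact le_rfl
      · exact mul_nonneg (by positivity) (by linarith)
  have hwp : ∀ ω : ι → Option (Fin k), 0 ≤ ∏ p, w2' j (q p) (ω p) := fun ω => Finset.prod_nonneg fun p _ => hw2 _ _
  set Good := (univ : Finset (Fin k → Finset ι)).filter (fun A => (∀ i i', i ≠ i' → Disjoint (A i) (A i')) ∧ A j = ∅ ∧ ∑ i, ∑ p ∈ A i, Real.log (q p) ≤ 3/4*Λ) with hGood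
  have n1 : ∀ A : Fin k → Finset ι, 0 ≤ ∑ i, ∑ i', if i ≠ i' then ∑ p, inn p (A i) * inn p (A i') else 0 := fun A =>
    Finset.sum_nonneg fun i _ => Finset.sum_nonneg fun i' _ => by
      split_ifs
      · exact Finset.sum_nonneg fun p _ => mul_nonneg (inn_nonneg _ _) (inn_nonneg _ _)
      · exact le_rfl
  have n2 : ∀ A : Fin k → Finset ι, 0 ≤ ∑ i, ∑ p, inn p (A i) * (k/q p) := fun A =>
    Finset.sum_nonneg fun i _ => Finset.sum_nonneg fun p _ => mul_nonneg (inn_nonneg _ _) (by have := hq0 p; positivity)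
  have n3 : ∀ A : Fin k → Finset ι, 0 ≤ (∑ i, ∑ p ∈ A i, Real.log (q p)) / (3/4*Λ) := fun A =>
    div_nonneg (Finset.sum_nonneg fun i _ => Finset.sum_nonneg fun p _ => hlog p) (by positivity)
  have s1 : ∑ A : Fin k → Finset ι, (∏ i, VV j q γ i (A i)) * br q Λ A ≤ ∑ A ∈ Good, (∏ i, VV j q γ i (A i)) * br q Λ A := by
    rw [← Finset.sum_filter_add_sum_filter_not univ (fun A : Fin k → Finset ι => (∀ i i', i ≠ i' → Disjoint (A i) (A i')) ∧ A j = ∅ ∧ ∑ i, ∑ p ∈ A i, Real.log (q p) ≤ 3/4*Λ)]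
    rw [← hGood]
    refine add_le_of_nonpos_right (Finset.sum_nonpos fun A hA => ?_)
    rw [mem_filter] at hA
    have hA := hA.2
    by_cases hj : A j = ∅
    · refine mul_nonpos_of_nonneg_of_nonpos (hVp A) ?_
      unfold br
      by_cases hd : ∀ i i', i ≠ i' → Disjoint (A i) (A i')
      · have hl : 3/4*Λ < ∑ i, ∑ p ∈ A i, Real.log (q p) := by
          by_contra h; exact hA ⟨hd, hj, not_lt.1 h⟩
        have : 1 ≤ (∑ i, ∑ p ∈ A i, Real.log (q p)) / (3/4*Λ) := by rw [le_div_iff₀ (by positivity)]; linarith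
        linarith [n1 A, n2 A]
      · push Not at hd
        obtain ⟨i, i', hne, hnd⟩ := hd
        obtain ⟨p, h1, h2⟩ := Finset.not_disjoint_iff.1 hnd
        have : (1:ℝ) ≤ ∑ i, ∑ i', if i ≠ i' then ∑ p, inn p (A i) * inn p (A i') else 0 := by
          have hnn : ∀ a b, (0:ℝ) ≤ if a ≠ b then ∑ p, inn p (A a) * inn p (A b) else 0 := fun a b => by
            split_ifs
            · exact Finset.sum_nonneg fun p _ => mul_nonneg (inn_nonneg _ _) (inn_nonneg _ _)
            · exact le_rfl
          calc (1:ℝ) = inn p (A i) * inn p (A i') := by simp [inn, h1, h2]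
            _ ≤ ∑ p, inn p (A i) * inn p (A i') := Finset.single_le_sum (f := fun p => inn p (A i) * inn p (A i')) (fun p _ => mul_nonneg (inn_nonneg _ _) (inn_nonneg _ _)) (mem_univ p)
            _ = if i ≠ i' then ∑ p, inn p (A i) * inn p (A i') else 0 := by rw [if_pos hne]
            _ ≤ ∑ i', if i ≠ i' then ∑ p, inn p (A i) * inn p (A i') else 0 := Finset.single_le_sum (f := fun i' => if i ≠ i' then ∑ p, inn p (A i) * inn p (A i') else 0) (fun b _ => hnn i b) (mem_univ i')
            _ ≤ _ := Finset.single_le_sum (f := fun i => ∑ i', if i ≠ i' then ∑ p, inn p (A i) * inn p (A i') else 0) (fun a _ => Finset.sum_nonneg fun b _ => hnn a b) (mem_univ i)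
        linarith [n2 A, n3 A]
    · have : ∏ i, VV j q γ i (A i) = 0 := Finset.prod_eq_zero (mem_univ j) (by simp [VV, hj])
      rw [this, zero_mul]
  refine le_trans (mul_le_mul_of_nonneg_left s1 (sq_nonneg _)) ?_
  rw [Finset.mul_sum]
  refine sum_le_inj Good univ _ (fun ω : ι → Option (Fin k) => (∏ p, w2' j (q p) (ω p)) * (∑ r : ι → Option (Fin k), aa q Λ γ r * ∏ p, X2' j (q p) (r p) (ω p))^2) ee (fun _ _ => mem_univ _) ?_ ?_ ?_
  · intro A hA B hB h
    rw [hGood, mem_filter] at hA hB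
    funext i
    rw [← cl_ee A hA.2.1, h, cl_ee B hB.2.1]
  · intro ω _; exact mul_nonneg (hwp ω) (sq_nonneg _)
  · intro A hA
    rw [hGood, mem_filter] at hA
    obtain ⟨-, hd, hj, hl⟩ := hA
    have hin := inner2 j q hq Λ γ hγ hanti hsupp A hd hj hl
    set Γ := ∏ i, if i = j then 1 else γ (A i) with hΓ
    set Y := ∑ r : ι → Option (Fin k), aa q Λ γ r * ∏ p, X2' j (q p) (r p) (ee A p) with hY
    set Pi := ∏ p, (if ee A p = none then 1 else (1 + 1/(q p - 1))) with hPi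
    have hΓ0 : 0 ≤ Γ := Finset.prod_nonneg fun i _ => by split_ifs; exact zero_le_one; exact hγ _
    have hsq : (Γ * S1)^2 ≤ (Pi * Y)^2 := pow_le_pow_left₀ (mul_nonneg hΓ0 hS10) hin 2
    have hVe : ∏ i, VV j q γ i (A i) = Γ^2 * ∏ p, (if ee A p = none then 1 else 1/q p) := by
      rw [← prod_cl (ee A) (fun p => 1/q p)]
      simp only [cl_ee A hd]
      rw [hΓ, ← Finset.prod_pow, ← Finset.prod_mul_distrib]
      refine Finset.prod_congr rfl fun i _ => ?_
      unfold VV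
      by_cases h : i = j
      · subst h; simp [hj]
      · simp [h]
    have hbr : br q Λ A ≤ ∏ p, (if ee A p = none then 1 else (1 - k/q p)) := by
      have h1 := one_sub_sum_le univ (fun p => if ee A p = none then 0 else k/q p) (fun p => by have := hq0 p; split_ifs <;> positivity)
        (fun p => by split_ifs; exact zero_le_one; rw [div_le_one (hq0 p)]; exact hk p)
      have h2 : ∑ p, (if ee A p = none then 0 else k/q p) = ∑ i, ∑ p, inn p (A i) * (k/q p) := by
        rw [← sum_cl (ee A) (fun p => k/q p)]
        simp only [cl_ee A hd, inn_sum]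
      have h3 : ∏ p, (1 - (if ee A p = none then 0 else k/q p)) = ∏ p, (if ee A p = none then 1 else (1 - k/q p)) :=
        Finset.prod_congr rfl fun p _ => by split_ifs <;> simp
      rw [h2, h3] at h1
      unfold br
      linarith [n1 A, n3 A]
    have hprod : (∏ p, (if ee A p = none then 1 else 1/q p)) * (∏ p, (if ee A p = none then 1 else (1 - k/q p))) * Pi^2 = ∏ p, w2' j (q p) (ee A p) := by
      rw [hPi, ← Finset.prod_pow, ← Finset.prod_mul_distrib, ← Finset.prod_mul_distrib]
      refine Finset.prod_congr rfl fun p _ => ?_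
      cases h : ee A p with
      | none => simp [w2']
      | some i =>
        have hij : i ≠ j := by
          rintro rfl
          rw [ee_some A hd, hj] at h; simp at h
        have h1 : q p - 1 ≠ 0 := by linarith [hq p]
        have h2 := (hq0 p).ne'
        simp only [w2', reduceCtorEq, if_false, if_neg hij]
        field_simp
        ring
    have hPi0 : 0 < Pi := Finset.prod_pos fun p _ => by
      have : 0 < q p - 1 := by linarith [hq p]
      split_ifs <;> positivity
    have hp1 : 0 ≤ ∏ p, (if ee A p = none then 1 else 1/q p) := Finset.prod_nonneg fun p _ => by
      have := hq0 p; split_ifs <;> positivity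
    have hp2 : 0 ≤ ∏ p, (if ee A p = none then 1 else (1 - k/q p)) := Finset.prod_nonneg fun p _ => by
      have : k/q p ≤ 1 := by rw [div_le_one (hq0 p)]; exact hk p
      split_ifs <;> linarith
    rw [hVe]
    set p1 := ∏ p, (if ee A p = none then 1 else 1/q p)
    set p2 := ∏ p, (if ee A p = none then 1 else (1 - k/q p))
    calc S1^2 * (Γ^2 * p1 * br q Λ A) ≤ S1^2 * (Γ^2 * p1 * p2) := by gcongr
      _ = p1 * p2 * (Γ * S1)^2 := by ring
      _ ≤ p1 * p2 * (Pi * Y)^2 := by gcongr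
      _ = (p1 * p2 * Pi^2) * Y^2 := by ring
      _ = _ := by rw [hprod]
end
end BG

namespace BG
open Finset
section lam
variable {ι : Type} [Fintype ι] [DecidableEq ι]

noncomputable def ps {k : ℕ} (d ω : Option (Fin k)) : ℝ := if d = none then 1 else if d = ω then 1 else 0

noncomputable def Yd {k : ℕ} (p : ℝ) (o d : Option (Fin k)) : ℝ :=
  match o, d with
  | none, none => 1
  | none, some _ => 0
  | some _, none => 1/(p-1)
  | some i, some i' => if i = i' then -1 else 0

lemma XX_eq {k : ℕ} (p : ℝ) (o ω : Option (Fin k)) : XX p o ω = ∑ d, Yd p o d * ps d ω := by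
  rw [Fintype.sum_option]
  cases o with
  | none => simp [XX, Yd, ps]
  | some i =>
    simp only [XX, Yd, ps]
    have : ∀ i' : Fin k, ((if i = i' then (-1:ℝ) else 0) * if (some i' : Option (Fin k)) = none then 1 else if some i' = ω then 1 else 0)
       = if i = i' then (if ω = some i then -1 else 0) else 0 := by
      intro i'
      split_ifs <;> simp_all
    rw [Finset.sum_congr rfl fun i' _ => this i', Finset.sum_ite_eq]
    simp
    split_ifs <;> ring

noncomputable def la {k : ℕ} (q : ι → ℝ) (a : (ι → Option (Fin k)) → ℝ) (d : ι → Option (Fin k)) : ℝ :=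
  ∑ r, a r * ∏ p, Yd (q p) (r p) (d p)

noncomputable def ZZ {k : ℕ} (q : ι → ℝ) (a : (ι → Option (Fin k)) → ℝ) (ω : ι → Option (Fin k)) : ℝ :=
  ∑ r : ι → Option (Fin k), a r * ∏ p, XX (q p) (r p) (ω p)

def sp {k : ℕ} (d : ι → Option (Fin k)) : Finset ι := univ.filter (fun p => d p ≠ none)

set_option linter.unusedSectionVars false in
lemma mem_sp {k : ℕ} (d : ι → Option (Fin k)) (p : ι) : p ∈ sp d ↔ d p ≠ none := by simp [sp]

lemma prod_sum' {O : Type} [Fintype O] [DecidableEq O] (f : ι → O → ℝ) : ∏ p, ∑ o, f p o = ∑ r : ι → O, ∏ p, f p (r p) := by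
  rw [Finset.prod_univ_sum, Fintype.piFinset_univ]

lemma ZZ_eq {k : ℕ} (q : ι → ℝ) (a : (ι → Option (Fin k)) → ℝ) (ω : ι → Option (Fin k)) :
    ZZ q a ω = ∑ d, la q a d * ∏ p, ps (d p) (ω p) := by
  unfold ZZ la
  simp_rw [XX_eq, prod_sum', Finset.prod_mul_distrib, Finset.mul_sum, Finset.sum_mul]
  rw [Finset.sum_comm]
  refine Finset.sum_congr rfl fun d _ => Finset.sum_congr rfl fun r _ => by ring

lemma la_zero {k : ℕ} (q : ι → ℝ) (hq : ∀ p, 3 ≤ q p) (a : (ι → Option (Fin k)) → ℝ) (Λ : ℝ)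
    (h0 : ∀ r, a r ≠ 0 → ∑ p ∈ sp r, Real.log (q p) ≤ Λ) (d : ι → Option (Fin k)) (hd : la q a d ≠ 0) :
    ∑ p ∈ sp d, Real.log (q p) ≤ Λ := by
  obtain ⟨r, _, hr⟩ := Finset.exists_ne_zero_of_sum_ne_zero hd
  have h1 := left_ne_zero_of_mul hr
  have h2 := right_ne_zero_of_mul hr
  rw [Finset.prod_ne_zero_iff] at h2
  refine le_trans (Finset.sum_le_sum_of_subset_of_nonneg ?_ ?_) (h0 r h1)
  · intro p hp
    rw [mem_sp] at *
    intro hn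
    have := h2 p (mem_univ p)
    rw [hn] at this
    cases h : d p with
    | none => exact hp h
    | some i => rw [h] at this; exact this rfl
  · intro p _ _
    exact Real.log_nonneg (by linarith [hq p])

lemma la_bound {k : ℕ} (q : ι → ℝ) (hq : ∀ p, 3 ≤ q p) (a : (ι → Option (Fin k)) → ℝ) (Λ M : ℝ)
    (h0 : ∀ r, a r ≠ 0 → ∑ p ∈ sp r, Real.log (q p) ≤ Λ) (hM : ∀ r, |a r| ≤ M) (d : ι → Option (Fin k)) :
    |la q a d| ≤ M * ∑ B ∈ univ.filter (fun B : Finset ι => ∑ p ∈ B, Real.log (q p) ≤ Λ), ∏ p ∈ B, ((2*k:ℕ):ℝ) / q p := by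
  have hM0 : 0 ≤ M := (abs_nonneg _).trans (hM (fun _ => none))
  set g : Finset ι → ι → Option (Fin k) → ℝ := fun B p o => if p ∈ B then (if d p = none ∧ o ≠ none then 1/(q p - 1) else 0) else (if o = d p then 1 else 0) with hg
  have hg0 : ∀ B p o, 0 ≤ g B p o := by
    intro B p o
    have : 0 ≤ 1/(q p - 1) := by have := hq p; apply div_nonneg <;> linarith
    simp only [hg]; split_ifs <;> first | exact this | norm_num
  have key : ∀ r, |a r * ∏ p, Yd (q p) (r p) (d p)| ≤ M * ∑ B ∈ univ.filter (fun B : Finset ι => ∑ p ∈ B, Real.log (q p) ≤ Λ), ∏ p, g B p (r p) := by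
    intro r
    by_cases hr : a r * ∏ p, Yd (q p) (r p) (d p) = 0
    · rw [hr, abs_zero]
      exact mul_nonneg hM0 (Finset.sum_nonneg fun B _ => Finset.prod_nonneg fun p _ => hg0 _ _ _)
    have h1 := left_ne_zero_of_mul hr
    have h2 := right_ne_zero_of_mul hr
    rw [Finset.prod_ne_zero_iff] at h2
    rw [abs_mul]
    refine mul_le_mul (hM r) ?_ (abs_nonneg _) hM0
    refine le_trans ?_ (Finset.single_le_sum (f := fun B => ∏ p, g B p (r p)) (fun B _ => Finset.prod_nonneg fun p _ => hg0 _ _ _) (a := sp r \ sp d) ?_)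
    · rw [Finset.abs_prod]
      refine Finset.prod_le_prod (fun p _ => abs_nonneg _) fun p _ => ?_
      have h3 := h2 p (mem_univ p)
      have h4 : 0 ≤ 1/(q p - 1) := by have := hq p; apply div_nonneg <;> linarith
      simp only [hg, mem_sdiff, mem_sp]
      cases hd : d p with
      | none =>
        cases hr' : r p with
        | none => simp [Yd]
        | some i => 
          simp only [Yd]
          rw [abs_of_nonneg h4]; simp
      | some i =>
        rw [hd] at h3
        cases hr' : r p with
        | none => rw [hr'] at h3; exact absurd rfl h3
        | some i' =>
          rw [hr'] at h3
          simp only [Yd] at h3 ⊢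
          by_cases hii : i' = i
          · simp [hii]
          · rw [if_neg hii] at h3; exact absurd rfl h3
    · rw [mem_filter]
      refine ⟨mem_univ _, le_trans (Finset.sum_le_sum_of_subset_of_nonneg sdiff_subset ?_) (h0 r h1)⟩
      intro p _ _
      exact Real.log_nonneg (by linarith [hq p])
  unfold la
  calc _ ≤ ∑ r, |a r * ∏ p, Yd (q p) (r p) (d p)| := Finset.abs_sum_le_sum_abs _ _
    _ ≤ ∑ r : ι → Option (Fin k), M * ∑ B ∈ univ.filter (fun B : Finset ι => ∑ p ∈ B, Real.log (q p) ≤ Λ), ∏ p, g B p (r p) := Finset.sum_le_sum fun r _ => key r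
    _ = M * ∑ B ∈ univ.filter (fun B : Finset ι => ∑ p ∈ B, Real.log (q p) ≤ Λ), ∏ p, ∑ o, g B p o := by
        rw [← Finset.mul_sum, Finset.sum_comm]
        simp_rw [prod_sum']
    _ ≤ _ := by
        refine mul_le_mul_of_nonneg_left (Finset.sum_le_sum fun B _ => ?_) hM0
        calc _ ≤ ∏ p, (if p ∈ B then ((2*k:ℕ):ℝ) / q p else 1) := by
              refine Finset.prod_le_prod (fun p _ => Finset.sum_nonneg fun o _ => hg0 _ _ _) fun p _ => ?_
              have h3 := hq p
              simp only [hg]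
              split_ifs with h
              · rw [Fintype.sum_option]
                simp only [ne_eq, not_true_eq_false, and_false, if_false, reduceCtorEq, not_false_eq_true, and_true, zero_add, Finset.sum_const, card_univ, Fintype.card_fin, nsmul_eq_mul]
                have : (k:ℝ) * (1/(q p - 1)) ≤ ((2*k:ℕ):ℝ) / q p := by
                  rw [mul_one_div, div_le_div_iff₀ (by linarith) (by linarith)]
                  push_cast
                  have : (0:ℝ) ≤ k := by positivity
                  nlinarith
                split_ifs
                · exact this
                · rw [mul_zero]; apply div_nonneg (by positivity) (by linarith)
              · simp
          _ = _ := by rw [Finset.prod_ite_mem, univ_inter]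

lemma count_pairs {k : ℕ} (A : Finset ι) :
    ∑ d : ι → Option (Fin k), ∑ d' : ι → Option (Fin k), (if sp d ∪ sp d' = A then (1:ℝ) else 0) ≤ (((k+1)^2:ℕ):ℝ)^A.card := by
  set g : ι → Option (Fin k) → ℝ := fun p o => if p ∈ A then 1 else if o = none then 1 else 0 with hg
  have hs : ∑ d : ι → Option (Fin k), ∏ p, g p (d p) = ((k+1:ℕ):ℝ)^A.card := by
    rw [← prod_sum']
    have : ∀ p, ∑ o, g p o = if p ∈ A then ((k+1:ℕ):ℝ) else 1 := by
      intro p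
      simp only [hg]
      split_ifs with h
      · simp
      · simp
    rw [Finset.prod_congr rfl fun p _ => this p, Finset.prod_ite_mem, univ_inter, Finset.prod_const]
  have hg0 : ∀ p o, 0 ≤ g p o := by intro p o; simp only [hg]; split_ifs <;> norm_num
  calc _ ≤ ∑ d : ι → Option (Fin k), ∑ d' : ι → Option (Fin k), (∏ p, g p (d p)) * (∏ p, g p (d' p)) := by
        refine Finset.sum_le_sum fun d _ => Finset.sum_le_sum fun d' _ => ?_
        split_ifs with h
        · have h1 : ∀ d : ι → Option (Fin k), sp d ⊆ A → ∏ p, g p (d p) = 1 := by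
            intro d hd
            refine Finset.prod_eq_one fun p _ => ?_
            simp only [hg]
            split_ifs with h3 h4
            · rfl
            · rfl
            · exact absurd (hd ((mem_sp _ _).2 h4)) h3
          rw [h1 d (h ▸ subset_union_left), h1 d' (h ▸ subset_union_right), mul_one]
        · exact mul_nonneg (Finset.prod_nonneg fun p _ => hg0 _ _) (Finset.prod_nonneg fun p _ => hg0 _ _)
    _ = (∑ d : ι → Option (Fin k), ∏ p, g p (d p)) * ∑ d' : ι → Option (Fin k), ∏ p, g p (d' p) := by
        rw [Finset.sum_mul_sum]
    _ = _ := by rw [hs, Nat.cast_pow, ← mul_pow, sq]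

lemma ps_mul {k : ℕ} (d d' ω : Option (Fin k)) : ps d ω * ps d' ω = if d = none ∨ d' = none ∨ d = d' then ps (if d = none then d' else d) ω else 0 := by
  unfold ps
  by_cases h1 : d = none
  · simp [h1]
  · by_cases h2 : d' = none
    · simp [h1, h2]
    · by_cases h3 : d = d'
      · subst h3; simp [h1]
      · simp only [h1, h2, h3, if_false, false_or]
        split_ifs <;> simp_all

lemma comparison {k : ℕ} {ν : Type} (T : Finset ν) (v : ν → ℝ) (ω : ν → ι → Option (Fin k)) (w : ι → Option (Fin k) → ℝ)
    (hw : ∀ p, ∑ o, w p o = 1) (c : ℝ) (q : ι → ℝ) (hq : ∀ p, 3 ≤ q p) (a : (ι → Option (Fin k)) → ℝ) (Λ M : ℝ)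
    (h0 : ∀ r, a r ≠ 0 → ∑ p ∈ sp r, Real.log (q p) ≤ Λ) (hM : ∀ d, |la q a d| ≤ M) (Err : Finset ι → ℝ) (hE : ∀ A, 0 ≤ Err A)
    (herr : ∀ e : ι → Option (Fin k), ∑ p ∈ sp e, Real.log (q p) ≤ 2*Λ →
      |∑ n ∈ T, v n * ∏ p, ps (e p) (ω n p) - c * ∏ p, (if e p = none then 1 else w p (e p))| ≤ Err (sp e)) :
    |∑ n ∈ T, v n * (ZZ q a (ω n))^2 - c * ∑ σ : ι → Option (Fin k), (∏ p, w p (σ p)) * (ZZ q a σ)^2| ≤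
      M^2 * ∑ A ∈ univ.filter (fun A : Finset ι => ∑ p ∈ A, Real.log (q p) ≤ 2*Λ), (((k+1)^2:ℕ):ℝ)^A.card * Err A := by
  have hM0 : 0 ≤ M := (abs_nonneg _).trans (hM (fun _ => none))
  have hl0 : ∀ p, 0 ≤ Real.log (q p) := fun p => Real.log_nonneg (by linarith [hq p])
  have hsq : ∀ σ : ι → Option (Fin k), (ZZ q a σ)^2 = ∑ d, ∑ d', la q a d * la q a d' * ∏ p, (ps (d p) (σ p) * ps (d' p) (σ p)) := by
    intro σ
    rw [ZZ_eq, sq, Finset.sum_mul_sum]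
    refine Finset.sum_congr rfl fun d _ => Finset.sum_congr rfl fun d' _ => ?_
    rw [Finset.prod_mul_distrib]; ring
  have hwps : ∀ e : ι → Option (Fin k), ∑ σ : ι → Option (Fin k), (∏ p, w p (σ p)) * ∏ p, ps (e p) (σ p) = ∏ p, (if e p = none then 1 else w p (e p)) := by
    intro e
    simp_rw [← Finset.prod_mul_distrib]
    rw [← prod_sum' (fun p o => w p o * ps (e p) o)]
    refine Finset.prod_congr rfl fun p _ => ?_
    unfold ps
    split_ifs with h
    · simp [hw]
    · simp
  set D : (ι → Option (Fin k)) → (ι → Option (Fin k)) → ℝ := fun d d' => ∑ n ∈ T, v n * ∏ p, (ps (d p) (ω n p) * ps (d' p) (ω n p)) 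
     - c * ∑ σ : ι → Option (Fin k), (∏ p, w p (σ p)) * ∏ p, (ps (d p) (σ p) * ps (d' p) (σ p)) with hD
  have e1 : ∑ n ∈ T, v n * (ZZ q a (ω n))^2 - c * ∑ σ : ι → Option (Fin k), (∏ p, w p (σ p)) * (ZZ q a σ)^2
      = ∑ d, ∑ d', la q a d * la q a d' * D d d' := by
    simp only [hD, hsq, mul_sub, Finset.sum_sub_distrib, Finset.mul_sum]
    congr 1
    · rw [Finset.sum_comm]
      refine Finset.sum_congr rfl fun d _ => ?_
      rw [Finset.sum_comm]
      refine Finset.sum_congr rfl fun d' _ => Finset.sum_congr rfl fun n _ => by ring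
    · rw [Finset.sum_comm]
      refine Finset.sum_congr rfl fun d _ => ?_
      rw [Finset.sum_comm]
      refine Finset.sum_congr rfl fun d' _ => Finset.sum_congr rfl fun n _ => by ring
  have hDb : ∀ d d', ∑ p ∈ sp d ∪ sp d', Real.log (q p) ≤ 2*Λ → |D d d'| ≤ Err (sp d ∪ sp d') := by
    intro d d' hdd
    by_cases hc : ∀ p, d p = none ∨ d' p = none ∨ d p = d' p
    · have hp : ∀ σ : ι → Option (Fin k), ∏ p, (ps (d p) (σ p) * ps (d' p) (σ p)) = ∏ p, ps (if d p = none then d' p else d p) (σ p) := by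
        intro σ
        refine Finset.prod_congr rfl fun p _ => ?_
        rw [ps_mul, if_pos (hc p)]
      have hs : sp (fun p => if d p = none then d' p else d p) = sp d ∪ sp d' := by
        ext p
        rw [mem_union, mem_sp, mem_sp, mem_sp]
        by_cases h : d p = none <;> simp [h]
      have := herr (fun p => if d p = none then d' p else d p) (by rw [hs]; exact hdd)
      rw [hs] at this
      simp only [hD, hp]
      rw [hwps (fun p => if d p = none then d' p else d p)]
      exact this
    · push Not at hc
      obtain ⟨p, hp1, hp2, hp3⟩ := hc
      have hp : ∀ σ : ι → Option (Fin k), ∏ p, (ps (d p) (σ p) * ps (d' p) (σ p)) = 0 := by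
        intro σ
        apply Finset.prod_eq_zero (mem_univ p)
        rw [ps_mul, if_neg (by tauto)]
      simp only [hD, hp]
      simpa using hE _
  rw [e1]
  set G := univ.filter (fun A : Finset ι => ∑ p ∈ A, Real.log (q p) ≤ 2*Λ) with hG
  calc _ ≤ ∑ d, ∑ d', |la q a d * la q a d' * D d d'| := (Finset.abs_sum_le_sum_abs _ _).trans (Finset.sum_le_sum fun d _ => Finset.abs_sum_le_sum_abs _ _)
    _ ≤ ∑ d : ι → Option (Fin k), ∑ d' : ι → Option (Fin k), ∑ A ∈ G, M^2 * (Err A * if sp d ∪ sp d' = A then (1:ℝ) else 0) := by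
        refine Finset.sum_le_sum fun d _ => Finset.sum_le_sum fun d' _ => ?_
        have hnn : ∀ A, 0 ≤ M^2 * (Err A * if sp d ∪ sp d' = A then (1:ℝ) else 0) := by
          intro A
          have := hE A
          split_ifs <;> positivity
        by_cases hz : la q a d * la q a d' = 0
        · rw [hz, zero_mul, abs_zero]
          exact Finset.sum_nonneg fun A _ => hnn A
        have z1 := la_zero q hq a Λ h0 d (left_ne_zero_of_mul hz)
        have z2 := la_zero q hq a Λ h0 d' (right_ne_zero_of_mul hz)
        have z3 : ∑ p ∈ sp d ∪ sp d', Real.log (q p) ≤ 2*Λ := by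
          have := Finset.sum_union_inter (s₁ := sp d) (s₂ := sp d') (f := fun p => Real.log (q p))
          have h4 : 0 ≤ ∑ p ∈ sp d ∩ sp d', Real.log (q p) := Finset.sum_nonneg fun p _ => hl0 p
          linarith
        refine le_trans ?_ (Finset.single_le_sum (fun A _ => hnn A) (a := sp d ∪ sp d') (by rw [hG, mem_filter]; exact ⟨mem_univ _, z3⟩))
        rw [if_pos rfl, mul_one, abs_mul, abs_mul, sq]
        have h5 := hDb d d' z3
        gcongr
        · exact hM d
        · exact hM d'
    _ = M^2 * ∑ A ∈ G, (∑ d : ι → Option (Fin k), ∑ d' : ι → Option (Fin k), (if sp d ∪ sp d' = A then (1:ℝ) else 0)) * Err A := by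
        rw [Finset.mul_sum]
        simp_rw [Finset.sum_mul, Finset.mul_sum]
        rw [Finset.sum_congr rfl fun d _ => Finset.sum_comm, Finset.sum_comm]
        refine Finset.sum_congr rfl fun A _ => Finset.sum_congr rfl fun d _ => Finset.sum_congr rfl fun d' _ => by ring
    _ ≤ _ := by
        refine mul_le_mul_of_nonneg_left (Finset.sum_le_sum fun A _ => ?_) (by positivity)
        exact mul_le_mul_of_nonneg_right (count_pairs A) (hE A)

end lam
end BG

namespace BG
open Finset

noncomputable def cpf (W n : ℕ) : ℝ := if W.Coprime n then 1/(n:ℝ) else 0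

lemma cpf_nonneg (W n : ℕ) : 0 ≤ cpf W n := by unfold cpf; split_ifs <;> positivity

lemma block_sum (W j : ℕ) (c : ℝ) : ∑ n ∈ Ico (1+W*j) (1+W*(j+1)), (if W.Coprime n then c else 0) = W.totient * c := by
  rw [← Finset.sum_filter, Finset.sum_const, show 1+W*(j+1) = (1+W*j)+W by ring, Nat.filter_coprime_Ico_eq_totient, nsmul_eq_mul]

lemma block_ge (W j : ℕ) (hW : 0 < W) : (W.totient:ℝ)/W * (1/((j+1:ℕ):ℝ)) ≤ ∑ n ∈ Ico (1+W*j) (1+W*(j+1)), cpf W n := by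
  have := block_sum W j (1/((W:ℝ)*((j+1:ℕ):ℝ)))
  have hW' : (0:ℝ) < W := by exact_mod_cast hW
  calc _ = (W.totient:ℝ) * (1/((W:ℝ)*((j+1:ℕ):ℝ))) := by field_simp
    _ = _ := this.symm
    _ ≤ _ := by
      refine Finset.sum_le_sum fun n hn => ?_
      rw [mem_Ico] at hn
      unfold cpf
      split_ifs
      · apply one_div_le_one_div_of_le
        · have : 0 < n := by omega
          exact_mod_cast this
        · have : n ≤ W*(j+1) := by omega
          exact_mod_cast this
      · exact le_rfl

lemma block_le (W j : ℕ) (hW : 0 < W) (hj : 0 < j) : ∑ n ∈ Ico (1+W*j) (1+W*(j+1)), cpf W n ≤ (W.totient:ℝ)/W * (1/(j:ℝ)) := by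
  have := block_sum W j (1/((W:ℝ)*(j:ℝ)))
  have hW' : (0:ℝ) < W := by exact_mod_cast hW
  have hj' : (0:ℝ) < j := by exact_mod_cast hj
  calc _ ≤ _ := by
          refine Finset.sum_le_sum (g := fun n => if W.Coprime n then (1/((W:ℝ)*(j:ℝ))) else 0) fun n hn => ?_
          rw [mem_Ico] at hn
          unfold cpf
          split_ifs
          · apply one_div_le_one_div_of_le (by positivity)
            have : W*j ≤ n := by omega
            exact_mod_cast this
          · exact le_rfl
    _ = _ := this
    _ = (W.totient:ℝ)/W * (1/(j:ℝ)) := by field_simp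

lemma cp_ge (W : ℕ) (hW : 0 < W) (J : ℕ) : (W.totient:ℝ)/W * (harmonic J : ℚ) ≤ ∑ n ∈ Ico 1 (1+W*J), cpf W n := by
  induction J with
  | zero => simp
  | succ J ih =>
    rw [← Finset.sum_Ico_consecutive (m := 1) (n := 1+W*J) (k := 1+W*(J+1)) _ (by omega) (by rw [mul_add]; omega), harmonic_succ]
    have := block_ge W J hW
    rw [one_div] at this
    push_cast at *
    rw [mul_add]
    linarith

lemma cp_le (W : ℕ) (hW : 0 < W) (J : ℕ) : ∑ n ∈ Ico 1 (1+W*(J+1)), cpf W n ≤ W + (W.totient:ℝ)/W * (harmonic J : ℚ) := by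
  induction J with
  | zero => 
    simp only [harmonic_zero, Rat.cast_zero, mul_zero, add_zero, zero_add, mul_one]
    calc _ ≤ ∑ n ∈ Ico 1 (1+W), (1:ℝ) := by
          refine Finset.sum_le_sum fun n hn => ?_
          rw [mem_Ico] at hn
          unfold cpf
          split_ifs
          · rw [div_le_one] <;> norm_cast <;> omega
          · norm_num
      _ = W := by simp
  | succ J ih =>
    rw [← Finset.sum_Ico_consecutive (m := 1) (n := 1+W*(J+1)) (k := 1+W*(J+1+1)) _ (by omega) (by rw [mul_add W (J+1)]; omega), harmonic_succ]
    have := block_le W (J+1) hW (by omega)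
    rw [one_div] at this
    push_cast at *
    rw [mul_add ((W.totient:ℝ)/W)]
    linarith

noncomputable def PP (W : ℕ) (R : ℝ) : Finset ℕ := (Icc 1 ⌊R⌋₊).filter (fun p => p.Prime ∧ ¬ p ∣ W)

lemma mem_PP {W : ℕ} {R : ℝ} {p : ℕ} (hR : 0 ≤ R) : p ∈ PP W R ↔ p.Prime ∧ ¬ p ∣ W ∧ (p:ℝ) ≤ R := by
  unfold PP
  rw [mem_filter, mem_Icc, Nat.le_floor_iff hR]
  constructor
  · rintro ⟨⟨_, h⟩, h1, h2⟩; exact ⟨h1, h2, h⟩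
  · rintro ⟨h1, h2, h⟩; exact ⟨⟨h1.pos, h⟩, h1, h2⟩

noncomputable def LL (P : Finset ℕ) (x : ℝ) : ℝ := ∑ A ∈ sub P x, 1 / ((∏ p ∈ A, p : ℕ) : ℝ)

lemma LL_le (W : ℕ) (hW : 0 < W) (P : Finset ℕ) (hP : ∀ p ∈ P, p.Prime ∧ ¬ p ∣ W) (x : ℝ) (hx : 1 ≤ x)
    (hx2 : (W + 1 : ℝ) * W ≤ Real.log x) : LL P x ≤ 2 * ((W.totient:ℝ)/W) * Real.log x := by
  have hW' : (1:ℝ) ≤ W := by exact_mod_cast hW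
  have hφ : (1:ℝ) ≤ W.totient := by exact_mod_cast Nat.totient_pos.2 hW
  have h1 := cp_le W hW (⌊x⌋₊/W)
  have h2 := harmonic_le_one_add_log (⌊x⌋₊/W)
  have hl : 0 ≤ Real.log x := Real.log_nonneg hx
  have h3 : Real.log ((⌊x⌋₊/W : ℕ):ℝ) ≤ Real.log x := by
    rcases Nat.eq_zero_or_pos (⌊x⌋₊/W) with h | h
    · rw [h]; simpa using hl
    · apply Real.log_le_log (by exact_mod_cast h)
      calc ((⌊x⌋₊/W : ℕ):ℝ) ≤ (⌊x⌋₊ : ℝ) := by exact_mod_cast Nat.div_le_self _ _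
        _ ≤ x := Nat.floor_le (by linarith)
  have h4 : LL P x ≤ ∑ n ∈ Ico 1 (1+W*(⌊x⌋₊/W+1)), cpf W n := by
    unfold LL
    refine sum_le_inj _ _ _ _ (fun A => ∏ p ∈ A, p) ?_ ?_ ?_ ?_
    · intro A hA
      rw [mem_sub] at hA
      rw [mem_Ico]
      refine ⟨prod_pos' (fun p hp => (hP p hp).1) hA.1, ?_⟩
      have := Nat.le_floor hA.2
      have := Nat.lt_mul_div_succ ⌊x⌋₊ hW
      omega
    · intro A hA B hB h
      rw [mem_sub] at hA hB
      exact prod_inj (fun p hp => (hP p hp).1) hA.1 hB.1 h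
    · intro n _; exact cpf_nonneg W n
    · intro A hA
      rw [mem_sub] at hA
      unfold cpf
      rw [if_pos]
      apply Nat.Coprime.prod_right
      intro p hp
      have := hP p (hA.1 hp)
      exact ((Nat.Prime.coprime_iff_not_dvd this.1).2 this.2).symm
  set κ : ℝ := (W.totient:ℝ)/W with hκ
  have hκ0 : 0 < κ := by positivity
  have hκ1 : κ ≤ 1 := by
    rw [hκ, div_le_one (by linarith)]; exact_mod_cast Nat.totient_le W
  have h5 : κ * W ≥ 1 := by rw [hκ, div_mul_cancel₀ _ (by linarith)]; exact hφ
  have h6 : κ * ((W+1)*W) ≤ κ * Real.log x := mul_le_mul_of_nonneg_left hx2 hκ0.le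
  have h7 : κ * (harmonic (⌊x⌋₊/W) : ℚ) ≤ κ * (1 + Real.log x) := mul_le_mul_of_nonneg_left (by linarith) hκ0.le
  nlinarith

lemma LL_ge (W : ℕ) (hW : 0 < W) (R : ℝ) (x : ℝ) (hx : 1 ≤ x) (hxR : x ≤ R)
    (hx2 : 2 * Real.log W ≤ Real.log x) : ((W.totient:ℝ)/W) * Real.log x / 4 ≤ LL (PP W R) x := by
  have hW' : (1:ℝ) ≤ W := by exact_mod_cast hW
  have h1 := cp_ge W hW (⌊x⌋₊/W)
  have h2 := log_add_one_le_harmonic (⌊x⌋₊/W)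
  have h3 : Real.log x - Real.log W ≤ Real.log ((⌊x⌋₊/W + 1 : ℕ):ℝ) := by
    rw [← Real.log_div (by linarith) (by linarith)]
    apply Real.log_le_log (by positivity)
    rw [div_le_iff₀ (by linarith)]
    have := Nat.lt_mul_div_succ ⌊x⌋₊ hW
    calc x ≤ ((⌊x⌋₊+1 : ℕ):ℝ) := by push_cast; exact (Nat.lt_floor_add_one x).le
      _ ≤ ((W * (⌊x⌋₊/W + 1) : ℕ):ℝ) := by exact_mod_cast this
      _ = _ := by push_cast; ring
  set κ : ℝ := (W.totient:ℝ)/W with hκ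
  have hκ0 : 0 ≤ κ := by positivity
  have h4 : κ * (Real.log x / 2) ≤ κ * (harmonic (⌊x⌋₊/W) : ℚ) := mul_le_mul_of_nonneg_left (by linarith) hκ0
  have h5 : ∑ n ∈ Ico 1 (1+W*(⌊x⌋₊/W)), cpf W n ≤ LL (PP W R) x * 2 := by
    have hb : ∑ b ∈ Ioo 0 (⌊x⌋₊+1), ((b:ℝ)^2)⁻¹ ≤ 2 := by simpa using sum_Ioo_inv_sq_le (α := ℝ) 0 (⌊x⌋₊+1)
    have hL0 : 0 ≤ LL (PP W R) x := Finset.sum_nonneg fun _ _ => by positivity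
    refine le_trans ?_ (mul_le_mul_of_nonneg_left hb hL0)
    unfold LL
    rw [Finset.sum_mul_sum, ← Finset.sum_product']
    choose a b hab hsq using Nat.sq_mul_squarefree
    rw [show ∑ n ∈ Ico 1 (1+W*(⌊x⌋₊/W)), cpf W n = ∑ n ∈ (Ico 1 (1+W*(⌊x⌋₊/W))).filter (fun n => W.Coprime n), 1/(n:ℝ) by rw [Finset.sum_filter]; rfl]
    refine sum_le_inj _ _ _ _ (fun n => ((a n).primeFactors, b n)) ?_ ?_ ?_ ?_
    · intro n hn
      rw [mem_filter, mem_Ico] at hn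
      have hnx : n ≤ ⌊x⌋₊ := by have := Nat.mul_div_le ⌊x⌋₊ W; omega
      have ha : a n ∣ n := Dvd.intro_left _ (hab n)
      have han : a n ≤ n := Nat.le_of_dvd (by omega) ha
      have hb0 : 0 < b n := by
        rcases Nat.eq_zero_or_pos (b n) with h | h
        · have := hab n; rw [h] at this; simp at this; omega
        · exact h
      have ha0 : 0 < a n := Nat.pos_of_dvd_of_pos ha (by omega)
      have hbn : b n ≤ n := by
        calc b n ≤ b n * (b n * a n) := Nat.le_mul_of_pos_right _ (by positivity)
          _ = n := by rw [← mul_assoc, ← sq]; exact hab n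
      have hnx' : (n:ℝ) ≤ x := (Nat.le_floor_iff (by linarith)).1 hnx
      rw [mem_product, mem_sub]
      refine ⟨⟨?_, ?_⟩, ?_⟩
      · intro p hp
        rw [mem_PP (by linarith)]
        have hpp := Nat.prime_of_mem_primeFactors hp
        have hpd := Nat.dvd_of_mem_primeFactors hp
        refine ⟨hpp, ?_, ?_⟩
        · intro hpW
          have := Nat.dvd_gcd hpW (hpd.trans ha)
          rw [hn.2] at this
          exact hpp.one_lt.ne' (Nat.dvd_one.1 this)
        · have : p ≤ n := (Nat.le_of_dvd ha0 hpd).trans han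
          have : (p:ℝ) ≤ n := by exact_mod_cast this
          linarith
      · rw [Nat.prod_primeFactors_of_squarefree (hsq n)]
        have : (a n:ℝ) ≤ n := by exact_mod_cast han
        linarith
      · rw [mem_Ioo]; dsimp only; omega
    · intro n _ m _ h
      rw [Prod.mk.injEq] at h
      have h1 : a n = a m := by
        rw [← Nat.prod_primeFactors_of_squarefree (hsq n), ← Nat.prod_primeFactors_of_squarefree (hsq m), h.1]
      rw [← hab n, ← hab m, h1, h.2]
    · intro z _; positivity
    · intro n _
      dsimp only
      rw [Nat.prod_primeFactors_of_squarefree (hsq n)]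
      conv_lhs => rw [← hab n]
      push_cast
      rw [one_div, mul_inv, one_div, mul_comm]
  nlinarith

end BG

namespace BG
open Finset

noncomputable def ga (J : ℕ) (Λ t : ℝ) : ℝ := ∑ j ∈ range (J+1), 2^j * (if t ≤ Λ/(4*2^j) then (1:ℝ) else 0)

lemma ga_nonneg (J : ℕ) (Λ t : ℝ) : 0 ≤ ga J Λ t := Finset.sum_nonneg fun j _ => by split_ifs <;> positivity

lemma ga_anti (J : ℕ) (Λ : ℝ) {t s : ℝ} (h : t ≤ s) : ga J Λ s ≤ ga J Λ t := by
  refine Finset.sum_le_sum fun j _ => mul_le_mul_of_nonneg_left ?_ (by positivity)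
  split_ifs with h1 h2
  · exact le_rfl
  · linarith
  · norm_num
  · exact le_rfl

lemma ga_le (J : ℕ) (Λ t : ℝ) : ga J Λ t ≤ 2^(J+1) := by
  calc ga J Λ t ≤ ∑ j ∈ range (J+1), (2:ℝ)^j := Finset.sum_le_sum fun j _ => by
          split_ifs
          · rw [mul_one]
          · rw [mul_zero]; positivity
    _ = 2^(J+1) - 1 := by rw [geom_sum_eq (by norm_num)]; norm_num
    _ ≤ _ := by linarith

lemma ga_supp (J : ℕ) (Λ t : ℝ) (hΛ : 0 ≤ Λ) (h : ga J Λ t ≠ 0) : t ≤ Λ/4 := by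
  by_contra hc
  push Not at hc
  apply h
  refine Finset.sum_eq_zero fun j _ => ?_
  rw [if_neg, mul_zero]
  push Not
  refine lt_of_le_of_lt ?_ hc
  apply div_le_div_of_nonneg_left hΛ (by norm_num)
  have : (1:ℝ) ≤ 2^j := one_le_pow₀ (by norm_num)
  linarith

lemma ga_sq (J : ℕ) (Λ t : ℝ) : (ga J Λ t)^2 ≤ 4 * ∑ j ∈ range (J+1), 4^j * (if t ≤ Λ/(4*2^j) then (1:ℝ) else 0) := by
  induction J with
  | zero => simp [ga]; split_ifs <;> norm_num
  | succ J ih =>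
    by_cases h : t ≤ Λ/(4*2^(J+1))
    · rw [Finset.sum_range_succ, if_pos h, mul_one]
      have h1 := ga_le (J+1) Λ t
      have h0 := ga_nonneg (J+1) Λ t
      have h2 : 0 ≤ ∑ j ∈ range (J+1), 4^j * (if t ≤ Λ/(4*2^j) then (1:ℝ) else 0) := Finset.sum_nonneg fun j _ => by split_ifs <;> positivity
      calc _ ≤ ((2:ℝ)^(J+1+1))^2 := by gcongr
        _ = 4 * 4^(J+1) := by rw [← pow_mul, mul_comm, pow_mul]; norm_num [pow_succ]; ring
        _ ≤ _ := by linarith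
    · have : ga (J+1) Λ t = ga J Λ t := by
        unfold ga
        rw [Finset.sum_range_succ _ (J+1), if_neg h, mul_zero, add_zero]
      rw [this, Finset.sum_range_succ _ (J+1), if_neg h, mul_zero, add_zero]
      exact ih

lemma ga_mul (J : ℕ) (Λ t : ℝ) (ht : 0 ≤ t) (hΛ : 0 ≤ Λ) : ga J Λ t * t ≤ Λ/2 := by
  induction J with
  | zero =>
    simp only [ga, zero_add, range_one, sum_singleton, pow_zero, one_mul, mul_one]
    split_ifs <;> linarith
  | succ J ih =>
    by_cases h : t ≤ Λ/(4*2^(J+1))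
    · have h1 := ga_le (J+1) Λ t
      calc _ ≤ (2:ℝ)^(J+1+1) * (Λ/(4*2^(J+1))) := by gcongr
        _ = _ := by rw [pow_succ _ (J+1)]; field_simp; norm_num; ring
    · have : ga (J+1) Λ t = ga J Λ t := by
        unfold ga
        rw [Finset.sum_range_succ _ (J+1), if_neg h, mul_zero, add_zero]
      rw [this]; exact ih

lemma sum_log_prod {P : Finset ℕ} (hP : ∀ p ∈ P, p.Prime) (A : Finset ↥P) :
    ∑ p ∈ A, Real.log ((p:ℕ):ℝ) = Real.log ((∏ p ∈ A.map (Function.Embedding.subtype _), p : ℕ) : ℝ) := by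
  rw [Finset.prod_map]
  push_cast
  rw [Real.log_prod]
  · rfl
  · intro p _
    have := (hP p p.2).pos
    simp only [Function.Embedding.subtype_apply]
    positivity

lemma conv_gen {P : Finset ℕ} (hP : ∀ p ∈ P, p.Prime) (y : ℝ) (G : Finset ℕ → ℝ) :
    ∑ A ∈ univ.filter (fun A : Finset ↥P => ∑ p ∈ A, Real.log ((p:ℕ):ℝ) ≤ y), G (A.map (Function.Embedding.subtype _)) = ∑ A ∈ sub P (Real.exp y), G A := by
  refine Finset.sum_bij (fun A _ => A.map (Function.Embedding.subtype _)) ?_ ?_ ?_ ?_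
  · intro A hA
    rw [mem_filter, sum_log_prod hP] at hA
    have hs : A.map (Function.Embedding.subtype _) ⊆ P := by
      intro p hp
      rw [mem_map] at hp
      obtain ⟨x, _, rfl⟩ := hp
      exact x.2
    rw [mem_sub]
    refine ⟨hs, ?_⟩
    have := prod_pos' hP hs
    rw [← Real.log_le_iff_le_exp (by exact_mod_cast this)]
    exact hA.2
  · intro A _ B _ h
    exact Finset.map_injective _ h
  · intro B hB
    rw [mem_sub] at hB
    have hm : (B.subtype (· ∈ P)).map (Function.Embedding.subtype _) = B := Finset.subtype_map_of_mem fun x hx => hB.1 hx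
    refine ⟨B.subtype (· ∈ P), ?_, hm⟩
    rw [mem_filter, sum_log_prod hP, hm]
    have := prod_pos' hP hB.1
    refine ⟨mem_univ _, ?_⟩
    rw [Real.log_le_iff_le_exp (by exact_mod_cast this)]
    exact hB.2
  · intro A _; rfl

lemma prod_inv_map {P : Finset ℕ} (A : Finset ↥P) : ∏ p ∈ A, (1/((p:ℕ):ℝ)) = 1 / ((∏ p ∈ A.map (Function.Embedding.subtype _), p : ℕ) : ℝ) := by
  rw [Finset.prod_map]
  push_cast
  rw [Finset.prod_div_distrib, Finset.prod_const_one]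
  rfl

lemma conv_LL {P : Finset ℕ} (hP : ∀ p ∈ P, p.Prime) (y : ℝ) :
    ∑ A : Finset ↥P, (if ∑ p ∈ A, Real.log ((p:ℕ):ℝ) ≤ y then (1:ℝ) else 0) * ∏ p ∈ A, (1/((p:ℕ):ℝ)) = LL P (Real.exp y) := by
  unfold LL
  rw [← conv_gen hP y (fun A => 1 / ((∏ p ∈ A, p : ℕ) : ℝ)), Finset.sum_filter]
  refine Finset.sum_congr rfl fun A _ => ?_
  rw [prod_inv_map]
  split_ifs <;> simp

noncomputable def gm (J : ℕ) (Λ : ℝ) (P : Finset ℕ) (A : Finset ↥P) : ℝ := ga J Λ (∑ p ∈ A, Real.log ((p:ℕ):ℝ))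

lemma gsums (W : ℕ) (hW : 0 < W) (J : ℕ) (Λ : ℝ) (hΛ : (W + 1 : ℝ) * W ≤ Λ/(4*2^J)) (P : Finset ℕ) (hPP : P = PP W (Real.exp Λ)) :
    ((J:ℝ)+1)*((W.totient:ℝ)/W)*Λ/16 ≤ ∑ A, gm J Λ P A * ∏ p ∈ A, (1/((p:ℕ):ℝ)) ∧
    ∑ A, gm J Λ P A ^2 * ∏ p ∈ A, (1/((p:ℕ):ℝ)) ≤ 4*2^J*((W.totient:ℝ)/W)*Λ ∧
    ∑ A, (gm J Λ P A ^2 * ∏ p ∈ A, (1/((p:ℕ):ℝ))) * ∑ p ∈ A, Real.log ((p:ℕ):ℝ) ≤ (4*((J:ℝ)+1)*Λ/2^J) * ∑ A, gm J Λ P A ^2 * ∏ p ∈ A, (1/((p:ℕ):ℝ)) ∧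
    1 ≤ ∑ A, gm J Λ P A ^2 * ∏ p ∈ A, (1/((p:ℕ):ℝ)) := by
  have hW' : (1:ℝ) ≤ W := by exact_mod_cast hW
  have hpow : ∀ j ∈ range (J+1), (2:ℝ)^j ≤ 2^J := fun j hj => pow_le_pow_right₀ (by norm_num) (by rw [mem_range] at hj; omega)
  have hy0 : 0 < Λ/(4*2^J) := by nlinarith
  have hΛ0 : 0 < Λ := by
    by_contra h
    push Not at h
    have := div_nonpos_of_nonpos_of_nonneg h (show (0:ℝ) ≤ 4*2^J by positivity)
    linarith
  have hyj : ∀ j ∈ range (J+1), Λ/(4*2^J) ≤ Λ/(4*2^j) := fun j hj => by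
    apply div_le_div_of_nonneg_left hΛ0.le (by positivity)
    linarith [hpow j hj]
  have hyΛ : ∀ j : ℕ, Λ/(4*2^j) ≤ Λ := fun j => by
    apply div_le_self hΛ0.le
    have : (1:ℝ) ≤ 2^j := one_le_pow₀ (by norm_num)
    linarith
  have hPm : ∀ p ∈ P, p.Prime ∧ ¬ p ∣ W := by
    intro p hp
    rw [hPP, mem_PP (Real.exp_pos _).le] at hp
    exact ⟨hp.1, hp.2.1⟩
  have hPr : ∀ p ∈ P, p.Prime := fun p hp => (hPm p hp).1
  have hu : ∀ j ∈ range (J+1), LL P (Real.exp (Λ/(4*2^j))) ≤ 2 * ((W.totient:ℝ)/W) * (Λ/(4*2^j)) := by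
    intro j hj
    have h1 := hyj j hj
    have := LL_le W hW P hPm (Real.exp (Λ/(4*2^j))) (Real.one_le_exp (by linarith)) (by rw [Real.log_exp]; linarith)
    rwa [Real.log_exp] at this
  have hlo : ∀ j ∈ range (J+1), ((W.totient:ℝ)/W) * (Λ/(4*2^j)) / 4 ≤ LL P (Real.exp (Λ/(4*2^j))) := by
    intro j hj
    have h1 := hyj j hj
    have h2 : Real.log W ≤ W - 1 := Real.log_le_sub_one_of_pos (by linarith)
    have := LL_ge W hW (Real.exp Λ) (Real.exp (Λ/(4*2^j))) (Real.one_le_exp (by linarith)) (Real.exp_le_exp.2 (hyΛ j)) (by rw [Real.log_exp]; nlinarith)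
    rwa [Real.log_exp, ← hPP] at this
  set κ : ℝ := (W.totient:ℝ)/W with hκ
  have hφ : (1:ℝ) ≤ W.totient := by exact_mod_cast Nat.totient_pos.2 hW
  have hκ0 : 0 < κ := by positivity
  have hS1 : ∑ A, gm J Λ P A * ∏ p ∈ A, (1/((p:ℕ):ℝ)) = ∑ j ∈ range (J+1), 2^j * LL P (Real.exp (Λ/(4*2^j))) := by
    simp_rw [← conv_LL hPr, gm, ga, Finset.sum_mul, Finset.mul_sum]
    rw [Finset.sum_comm]
    refine Finset.sum_congr rfl fun j _ => Finset.sum_congr rfl fun A _ => by ring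
  have hw0 : ∀ A : Finset ↥P, 0 ≤ ∏ p ∈ A, (1/((p:ℕ):ℝ)) := fun A => Finset.prod_nonneg fun p _ => by positivity
  have ht0 : ∀ A : Finset ↥P, 0 ≤ ∑ p ∈ A, Real.log ((p:ℕ):ℝ) := fun A => Finset.sum_nonneg fun p _ => Real.log_natCast_nonneg _
  have S1l : ((J:ℝ)+1)*κ*Λ/16 ≤ ∑ A, gm J Λ P A * ∏ p ∈ A, (1/((p:ℕ):ℝ)) := by
    rw [hS1]
    calc _ = ∑ j ∈ range (J+1), κ*Λ/16 := by rw [Finset.sum_const, card_range, nsmul_eq_mul]; push_cast; ring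
      _ ≤ _ := Finset.sum_le_sum fun j hj => by
          have := hlo j hj
          have h2 : (0:ℝ) < 2^j := by positivity
          calc κ*Λ/16 = 2^j * (κ * (Λ/(4*2^j)) / 4) := by field_simp; norm_num
            _ ≤ _ := by gcongr
  have S1u : ∑ A, gm J Λ P A * ∏ p ∈ A, (1/((p:ℕ):ℝ)) ≤ ((J:ℝ)+1)*κ*Λ/2 := by
    rw [hS1]
    calc _ ≤ ∑ j ∈ range (J+1), κ*Λ/2 := Finset.sum_le_sum fun j hj => by
          have := hu j hj
          have h2 : (0:ℝ) < 2^j := by positivity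
          calc _ ≤ 2^j * (2 * κ * (Λ/(4*2^j))) := by gcongr
            _ = _ := by field_simp; norm_num
      _ = _ := by rw [Finset.sum_const, card_range, nsmul_eq_mul]; push_cast; ring
  have S2l : 2^J*κ*Λ/16 ≤ ∑ A, gm J Λ P A ^2 * ∏ p ∈ A, (1/((p:ℕ):ℝ)) := by
    have hJ : J ∈ range (J+1) := by simp
    calc _ = 4^J * (κ * (Λ/(4*2^J)) / 4) := by
          rw [show (4:ℝ)^J = 2^J*2^J by rw [← mul_pow]; norm_num]
          field_simp; norm_num
      _ ≤ 4^J * LL P (Real.exp (Λ/(4*2^J))) := by have := hlo J hJ; gcongr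
      _ ≤ _ := by
          rw [← conv_LL hPr, Finset.mul_sum]
          refine Finset.sum_le_sum fun A _ => ?_
          rw [← mul_assoc]
          refine mul_le_mul_of_nonneg_right ?_ (hw0 A)
          split_ifs with h
          · have : 2^J ≤ gm J Λ P A := by
              unfold gm ga
              refine le_trans ?_ (Finset.single_le_sum (fun j _ => ?_) hJ)
              · rw [if_pos h, mul_one]
              · split_ifs <;> positivity
            rw [mul_one, show (4:ℝ)^J = (2^J)^2 by rw [← pow_mul, mul_comm, pow_mul]; norm_num]
            gcongr
          · rw [mul_zero]; positivity
  have S2u : ∑ A, gm J Λ P A ^2 * ∏ p ∈ A, (1/((p:ℕ):ℝ)) ≤ 4*2^J*κ*Λ := by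
    calc _ ≤ ∑ A : Finset ↥P, (4 * ∑ j ∈ range (J+1), 4^j * (if ∑ p ∈ A, Real.log ((p:ℕ):ℝ) ≤ Λ/(4*2^j) then (1:ℝ) else 0)) * ∏ p ∈ A, (1/((p:ℕ):ℝ)) :=
          Finset.sum_le_sum fun A _ => mul_le_mul_of_nonneg_right (ga_sq _ _ _) (hw0 A)
      _ = ∑ j ∈ range (J+1), 4*4^j * LL P (Real.exp (Λ/(4*2^j))) := by
          simp_rw [← conv_LL hPr, Finset.mul_sum, Finset.sum_mul]
          rw [Finset.sum_comm]
          refine Finset.sum_congr rfl fun j _ => Finset.sum_congr rfl fun A _ => by ring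
      _ ≤ ∑ j ∈ range (J+1), 2*κ*Λ*2^j := Finset.sum_le_sum fun j hj => by
          have := hu j hj
          calc _ ≤ 4*4^j * (2 * κ * (Λ/(4*2^j))) := by gcongr
            _ = _ := by
              rw [show (4:ℝ)^j = 2^j*2^j by rw [← mul_pow]; norm_num]
              field_simp
      _ = 2*κ*Λ*(2^(J+1) - 1) := by rw [← Finset.mul_sum, geom_sum_eq (by norm_num)]; norm_num
      _ ≤ _ := by
          rw [pow_succ]
          have : 0 < κ*Λ := by positivity
          nlinarith
  refine ⟨S1l, S2u, ?_, ?_⟩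
  · calc _ ≤ ∑ A, Λ/2 * (gm J Λ P A * ∏ p ∈ A, (1/((p:ℕ):ℝ))) := Finset.sum_le_sum fun A _ => by
          have h1 := ga_mul J Λ _ (ht0 A) hΛ0.le
          have h2 : 0 ≤ gm J Λ P A := ga_nonneg _ _ _
          have h3 := hw0 A
          calc _ = (gm J Λ P A * ∑ p ∈ A, Real.log ((p:ℕ):ℝ)) * (gm J Λ P A * ∏ p ∈ A, (1/((p:ℕ):ℝ))) := by ring
            _ ≤ _ := mul_le_mul_of_nonneg_right h1 (by positivity)
      _ ≤ Λ/2 * (((J:ℝ)+1)*κ*Λ/2) := by rw [← Finset.mul_sum]; gcongr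
      _ = (4*((J:ℝ)+1)*Λ/2^J) * (2^J*κ*Λ/16) := by field_simp; norm_num
      _ ≤ _ := by gcongr
  · refine le_trans ?_ (Finset.single_le_sum (fun A _ => ?_) (mem_univ ∅))
    · simp only [prod_empty, mul_one]
      have : 1 ≤ gm J Λ P ∅ := by
        unfold gm ga
        refine le_trans ?_ (Finset.single_le_sum (fun j _ => ?_) (show 0 ∈ range (J+1) by simp))
        · rw [sum_empty, if_pos (by positivity)]; norm_num
        · split_ifs <;> positivity
      nlinarith
    · have := hw0 A; positivity

end BG

namespace BG
open Finset
section core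

lemma w1_sum {k : ℕ} (p : ℝ) : ∑ o : Option (Fin k), w1 p o = 1 := by
  rw [Fintype.sum_option]; simp [w1]; ring

lemma w2_sum {k : ℕ} (j : Fin k) (p : ℝ) : ∑ o : Option (Fin k), w2 j p o = 1 := by
  rw [Fintype.sum_option]
  simp only [w2]
  have : ∑ i : Fin k, (if i = j then (0:ℝ) else 1/(p-1)) = (k-1)/(p-1) := by
    have h1 : ∀ i : Fin k, (if i = j then (0:ℝ) else 1/(p-1)) = 1/(p-1) - if i = j then 1/(p-1) else 0 := by
      intro i; split_ifs <;> ring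
    rw [Finset.sum_congr rfl fun i _ => h1 i, Finset.sum_sub_distrib, Finset.sum_ite_eq']
    simp; ring
  rw [this]; ring

lemma w1_nn {k : ℕ} (p : ℝ) (hp : 3 ≤ p) (hk : (k:ℝ) ≤ p) (o : Option (Fin k)) : 0 ≤ w1 p o := by
  cases o with
  | none => simp only [w1]; rw [sub_nonneg, div_le_one (by linarith)]; exact hk
  | some i => simp only [w1]; apply div_nonneg <;> linarith

lemma w1'_nn {k : ℕ} (p : ℝ) (hp : 3 ≤ p) (o : Option (Fin k)) : 0 ≤ w1' p o := by
  cases o with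
  | none => simp only [w1']; positivity
  | some i => simp only [w1']; positivity

lemma w2_nn {k : ℕ} (j : Fin k) (p : ℝ) (hp : 3 ≤ p) (hk : (k:ℝ) ≤ p) (o : Option (Fin k)) : 0 ≤ w2 j p o := by
  cases o with
  | none => simp only [w2]; rw [sub_nonneg, div_le_one (by linarith)]; linarith
  | some i =>
    simp only [w2]
    split_ifs
    · exact le_rfl
    · apply div_nonneg <;> linarith

lemma w2'_nn {k : ℕ} (j : Fin k) (p : ℝ) (hp : 3 ≤ p) (hk : (k:ℝ) ≤ p) (o : Option (Fin k)) : 0 ≤ w2' j p o := by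
  cases o with
  | none => simp only [w2']; norm_num
  | some i =>
    simp only [w2']
    split_ifs
    · exact le_rfl
    · apply mul_nonneg
      · apply div_nonneg <;> linarith
      · rw [sub_nonneg, div_le_one (by linarith)]; linarith

variable (k D0 W J : ℕ) (Λ : ℝ)

noncomputable def qq (P : Finset ℕ) (p : ↥P) : ℝ := ((p:ℕ):ℝ)

noncomputable def ZP (P : Finset ℕ) (ω : ↥P → Option (Fin k)) : ℝ := ZZ (qq P) (aa (qq P) Λ (gm J Λ P)) ω

noncomputable def Mx : ℝ := (2^(J+1))^k * (2+Λ)^(2*k)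

lemma aa_supp (P : Finset ℕ) (r : ↥P → Option (Fin k)) (h : aa (qq P) Λ (gm J Λ P) r ≠ 0) : ∑ p ∈ sp r, Real.log (qq P p) ≤ Λ := by
  unfold aa at h
  split_ifs at h with h1
  · refine le_trans (le_of_eq ?_) h1
    unfold sp
    rw [Finset.sum_filter]
    refine Finset.sum_congr rfl fun p _ => ?_
    split_ifs <;> simp_all
  · exact absurd rfl h

lemma aa_le (P : Finset ℕ) (r : ↥P → Option (Fin k)) : |aa (qq P) Λ (gm J Λ P) r| ≤ ∏ j, gm J Λ P (cl r j) := by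
  have : 0 ≤ ∏ j, gm J Λ P (cl r j) := Finset.prod_nonneg fun j _ => ga_nonneg _ _ _
  unfold aa
  split_ifs
  · rw [abs_of_nonneg this]
  · rw [abs_zero]; exact this

lemma la_P (P : Finset ℕ) (hP : ∀ p ∈ P, p.Prime ∧ 3 ≤ p) (hΛ : 0 ≤ Λ) (d : ↥P → Option (Fin k)) :
    |la (qq P) (aa (qq P) Λ (gm J Λ P)) d| ≤ Mx k J Λ := by
  have h3 : ∀ p : ↥P, 3 ≤ qq P p := fun p => by unfold qq; exact_mod_cast (hP p p.2).2
  refine le_trans (la_bound (qq P) h3 _ Λ ((2^(J+1))^k) (aa_supp k J Λ P) ?_ d) ?_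
  · intro r
    refine (aa_le k J Λ P r).trans ?_
    calc _ ≤ ∏ j : Fin k, (2:ℝ)^(J+1) := Finset.prod_le_prod (fun j _ => ga_nonneg _ _ _) fun j _ => ga_le _ _ _
      _ = _ := by simp
  · unfold Mx
    refine mul_le_mul_of_nonneg_left ?_ (by positivity)
    have h := conv_gen (P := P) (fun p hp => (hP p hp).1) Λ (fun A => ((2*k:ℕ):ℝ)^A.card / ((∏ p ∈ A, p : ℕ) : ℝ))
    have h2 := sub_pow P (fun p hp => (hP p hp).1) (Real.exp Λ) (Real.one_le_exp hΛ) (2*k)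
    rw [Real.log_exp] at h2
    refine le_trans (le_of_eq ?_) (h.le.trans h2)
    refine Finset.sum_congr rfl fun B _ => ?_
    rw [Finset.prod_div_distrib, Finset.prod_const, card_map, Finset.prod_map]
    push_cast
    rfl

lemma cores (hk : 1 ≤ k) (hD : 4*((k+1)^2)^2 ≤ D0) (hkJ : 64*k*(J+1) ≤ 3*2^J) (hW : 0 < W)
    (hΛ : (W + 1 : ℝ) * W ≤ Λ/(4*2^J)) (P : Finset ℕ) (hPP : P = PP W (Real.exp Λ)) (hPD : ∀ p ∈ P, D0 < p) :
    ∃ S1 S2 : ℝ, ((J:ℝ)+1)*((W.totient:ℝ)/W)*Λ/16 ≤ S1 ∧ S2 ≤ 4*2^J*((W.totient:ℝ)/W)*Λ ∧ 1 ≤ S2 ∧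
    ∑ σ : ↥P → Option (Fin k), (∏ p, w1 (qq P p) (σ p)) * (ZP k J Λ P σ)^2 ≤ 2 * S2^k ∧
    ∀ j : Fin k, S1^2 * S2^(k-1) / 2 ≤ ∑ σ : ↥P → Option (Fin k), (∏ p, w2 j (qq P p) (σ p)) * (ZP k J Λ P σ)^2 := by
  obtain ⟨g1, g2, g3, g4⟩ := gsums W hW J Λ hΛ P hPP
  have hW' : (1:ℝ) ≤ W := by exact_mod_cast hW
  have hΛ0 : 0 < Λ := by
    by_contra h
    push Not at h
    have := div_nonpos_of_nonpos_of_nonneg h (show (0:ℝ) ≤ 4*2^J by positivity)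
    nlinarith
  have hD4 : k + 1 ≤ ((k+1)^2)^2 := by rw [← pow_mul]; exact Nat.le_self_pow (by norm_num) _
  have hD3 : 3 ≤ D0 := by omega
  have hDk : k ≤ D0 := by omega
  have hD16 : 16*k^2 ≤ D0 + 1 := by nlinarith [sq_nonneg ((k:ℤ)-1)]
  have h3 : ∀ p : ↥P, 3 ≤ qq P p := fun p => by
    unfold qq; have := hPD p p.2; exact_mod_cast (show 3 ≤ (p:ℕ) by omega)
  have hkq : ∀ p : ↥P, (k:ℝ) ≤ qq P p := fun p => by
    unfold qq; have := hPD p p.2; exact_mod_cast (show k ≤ (p:ℕ) by omega)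
  have hk' : (1:ℝ) ≤ k := by exact_mod_cast hk
  set δ : ℝ := 1/(8*k^2) with hδ
  have hδs : ∑ p : ↥P, 1/(qq P p)^2 ≤ δ := by
    have h1 := sum_Ioo_inv_sq_le (α := ℝ) D0 (⌊Real.exp Λ⌋₊+1)
    have h2 : ∑ p : ↥P, 1/(qq P p)^2 ≤ ∑ i ∈ Ioo D0 (⌊Real.exp Λ⌋₊+1), ((i:ℝ)^2)⁻¹ := by
      refine sum_le_inj _ _ _ _ (fun p => (p:ℕ)) ?_ ?_ ?_ ?_
      · intro p _
        have h5 := hPD p p.2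
        have h4 := p.2
        have h6 : (p:ℕ) ∈ PP W (Real.exp Λ) := by rw [← hPP]; exact h4
        rw [mem_PP (Real.exp_pos _).le] at h6
        have := Nat.le_floor h6.2.2
        rw [mem_Ioo]; omega
      · intro p _ p' _ h; exact Subtype.ext h
      · intro n _; positivity
      · intro p _; unfold qq; rw [one_div]
    refine h2.trans (h1.trans ?_)
    rw [hδ, div_le_div_iff₀ (by positivity) (by positivity)]
    have : (16*(k:ℝ)^2) ≤ D0 + 1 := by exact_mod_cast hD16
    linarith
  have hk2δ : (k:ℝ)^2*δ = 1/8 := by rw [hδ]; field_simp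
  have hδ0 : 0 ≤ δ := by positivity
  have hk2 : (1:ℝ) ≤ (k:ℝ)^2 := one_le_pow₀ hk'
  have hδ1 : δ ≤ 1/8 := by nlinarith
  have hγ : ∀ A, 0 ≤ gm J Λ P A := fun A => ga_nonneg _ _ _
  have hanti : ∀ A B, A ⊆ B → gm J Λ P B ≤ gm J Λ P A := fun A B h => ga_anti _ _
    (Finset.sum_le_sum_of_subset_of_nonneg h fun p _ _ => Real.log_natCast_nonneg _)
  refine ⟨_, _, g1, g2, g4, ?_, ?_⟩
  · have t1 := tensor ↥P (fun p => w1 (k := k) (qq P p)) (fun p => w1' (qq P p)) (fun p o => w1_nn _ (h3 p) (hkq p) o) (fun p o => w1'_nn _ (h3 p) o)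
      (fun p => XX (qq P p)) (fun _ => X1') (fun p c => local1 (qq P p) (h3 p) c) (aa (qq P) Λ (gm J Λ P))
    refine t1.trans ?_
    simp only [diag1]
    refine (E1 k (qq P) (fun p => by linarith [h3 p]) (gm J Λ P) hγ hanti _ (aa_le k J Λ P) δ hδs).trans ?_
    have : Real.exp (δ + 3*(k:ℝ)^2*δ) ≤ 2 := by
      have h1 : δ + 3*(k:ℝ)^2*δ ≤ Real.log 2 := by
        have := Real.log_two_gt_d9
        nlinarith
      calc _ ≤ Real.exp (Real.log 2) := Real.exp_le_exp.2 h1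
        _ = 2 := Real.exp_log (by norm_num)
    refine mul_le_mul_of_nonneg_right this ?_
    exact pow_nonneg (by unfold qq; linarith) _
  · intro j
    have t2 := tensor ↥P (fun p => w2' j (qq P p)) (fun p => w2 (k := k) j (qq P p)) (fun p o => w2'_nn j _ (h3 p) (hkq p) o) (fun p o => w2_nn j _ (h3 p) (hkq p) o)
      (fun p => X2' j (qq P p)) (fun p => XX (qq P p)) (fun p c => local2 j (qq P p) (h3 p) c) (aa (qq P) Λ (gm J Λ P))
    refine le_trans ?_ t2
    have e2 := E2 j (qq P) h3 hkq Λ hΛ0 (gm J Λ P) hγ hanti (fun A h => ga_supp J Λ _ hΛ0.le h) δ (4*((J:ℝ)+1)*Λ/2^J) hδs (by positivity) g3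
    refine le_trans ?_ e2
    have hη : 1/2 ≤ 1 - 2*(k:ℝ)^2*δ - k*(4*((J:ℝ)+1)*Λ/2^J)/(3/4*Λ) := by
      have h1 : k*(4*((J:ℝ)+1)*Λ/2^J)/(3/4*Λ) = 16*k*((J:ℝ)+1)/(3*2^J) := by field_simp; norm_num
      have h2 : 16*k*((J:ℝ)+1)/(3*2^J) ≤ 1/4 := by
        rw [div_le_div_iff₀ (by positivity) (by norm_num)]
        have : (64*(k:ℝ)*(J+1)) ≤ 3*2^J := by exact_mod_cast hkJ
        linarith
      rw [h1]; nlinarith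
    have hS1 : ∑ A, gm J Λ P A * ∏ p ∈ A, (1/((p:ℕ):ℝ)) ≤ ∑ B, gm J Λ P B * ∏ p ∈ B, (1/(qq P p - 1)) := by
      refine Finset.sum_le_sum fun A _ => mul_le_mul_of_nonneg_left ?_ (hγ A)
      refine Finset.prod_le_prod (fun p _ => by positivity) fun p _ => ?_
      have := h3 p
      unfold qq at *
      apply one_div_le_one_div_of_le <;> linarith
    have hS10 : 0 ≤ ∑ A, gm J Λ P A * ∏ p ∈ A, (1/((p:ℕ):ℝ)) := Finset.sum_nonneg fun A _ => mul_nonneg (hγ A) (Finset.prod_nonneg fun p _ => by positivity)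
    have hS2 : 0 ≤ (∑ A, gm J Λ P A ^2 * ∏ p ∈ A, (1/((p:ℕ):ℝ)))^(k-1) := by positivity
    rw [mul_div_assoc, div_eq_mul_one_div _ (2:ℝ)]
    unfold qq at *
    gcongr

lemma compP (P : Finset ℕ) (hP : ∀ p ∈ P, p.Prime ∧ 3 ≤ p) (hΛ : 0 ≤ Λ) {ν : Type} (T : Finset ν) (v : ν → ℝ) (ω : ν → ↥P → Option (Fin k))
    (w : ↥P → Option (Fin k) → ℝ) (hw : ∀ p, ∑ o, w p o = 1) (c : ℝ) (Err : Finset ℕ → ℝ) (hE : ∀ A, 0 ≤ Err A)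
    (herr : ∀ e : ↥P → Option (Fin k), (sp e).map (Function.Embedding.subtype _) ∈ sub P (Real.exp (2*Λ)) →
      |∑ n ∈ T, v n * ∏ p, ps (e p) (ω n p) - c * ∏ p, (if e p = none then 1 else w p (e p))| ≤ Err ((sp e).map (Function.Embedding.subtype _))) :
    |∑ n ∈ T, v n * (ZP k J Λ P (ω n))^2 - c * ∑ σ : ↥P → Option (Fin k), (∏ p, w p (σ p)) * (ZP k J Λ P σ)^2| ≤
      (Mx k J Λ)^2 * ∑ A ∈ sub P (Real.exp (2*Λ)), (((k+1)^2:ℕ):ℝ)^A.card * Err A := by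
  have hPr : ∀ p ∈ P, p.Prime := fun p hp => (hP p hp).1
  have h3 : ∀ p : ↥P, 3 ≤ qq P p := fun p => by unfold qq; exact_mod_cast (hP p p.2).2
  have := comparison T v ω w hw c (qq P) h3 (aa (qq P) Λ (gm J Λ P)) Λ (Mx k J Λ) (aa_supp k J Λ P) (la_P k J Λ P hP hΛ)
    (fun A => Err (A.map (Function.Embedding.subtype _))) (fun A => hE _) ?_
  · refine this.trans (le_of_eq ?_)
    congr 1
    rw [← conv_gen hPr (2*Λ) (fun A => (((k+1)^2:ℕ):ℝ)^A.card * Err A)]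
    refine Finset.sum_congr rfl fun A _ => ?_
    rw [card_map]
  · intro e he
    apply herr
    have hs : (sp e).map (Function.Embedding.subtype _) ⊆ P := by
      intro p hp
      rw [mem_map] at hp
      obtain ⟨x, _, rfl⟩ := hp
      exact x.2
    rw [mem_sub]
    refine ⟨hs, ?_⟩
    have h5 := sum_log_prod hPr (sp e)
    have h6 := prod_pos' hPr hs
    rw [← Real.log_le_iff_le_exp (by exact_mod_cast h6), ← h5]
    exact he

end core
end BG

namespace BG
open Finset

lemma theta_th (N : ℕ) : Chebyshev.theta (N:ℝ) = ∑ n ∈ Ioc 0 N, th n := by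
  unfold Chebyshev.theta th
  rw [Nat.floor_natCast, Finset.sum_filter]

lemma block_theta : ∃ i0 : ℕ, ∀ i ≥ i0, (4:ℝ)^i ≤ ∑ n ∈ Ioc (4^i) (4^(i+1)), th n := by
  have ht := tendsto_pow_const_div_const_pow_of_one_lt 1 (show (1:ℝ) < 2 by norm_num)
  have hev := ht.eventually (gt_mem_nhds (show (0:ℝ) < 1/100 by norm_num))
  obtain ⟨i0, hi0⟩ := Filter.eventually_atTop.1 hev
  refine ⟨i0, fun i hi => ?_⟩
  have h1 := hi0 (i+1) (by omega)
  rw [pow_one, div_lt_iff₀ (by positivity)] at h1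
  have hsplit : ∑ n ∈ Ioc 0 (4^i), th n + ∑ n ∈ Ioc (4^i) (4^(i+1)), th n = ∑ n ∈ Ioc 0 (4^(i+1)), th n :=
    Finset.sum_Ioc_consecutive _ (Nat.zero_le _) (Nat.pow_le_pow_right (by norm_num) (by omega))
  rw [← theta_th, ← theta_th] at hsplit
  have hu := Chebyshev.theta_le_log4_mul_x (x := ((4^i:ℕ):ℝ)) (by positivity)
  have hl := Chebyshev.theta_ge (4^(i+1))
  have hs : √((4^(i+1):ℕ):ℝ) = 2^(i+1) := by
    rw [show ((4^(i+1):ℕ):ℝ) = ((2:ℝ)^(i+1))^2 by push_cast; rw [← pow_mul, mul_comm, pow_mul]; norm_num]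
    exact Real.sqrt_sq (by positivity)
  rw [hs] at hl
  have l2 := Real.log_two_gt_d9
  have l2' := Real.log_two_lt_d9
  have l4 : Real.log 4 = 2 * Real.log 2 := by
    rw [show (4:ℝ) = 2^2 by norm_num, Real.log_pow]; norm_num
  have lN : Real.log ((4^(i+1):ℕ):ℝ) = ((i+1:ℕ):ℝ) * Real.log 4 := by push_cast; rw [Real.log_pow]; push_cast; ring
  have lN1 : Real.log (((4^(i+1):ℕ):ℝ)+1) ≤ 2 * (((i+1:ℕ):ℝ) * Real.log 4) := by
    have h4 : (4:ℝ) ≤ ((4^(i+1):ℕ):ℝ) := by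
      push_cast; calc (4:ℝ) = 4^1 := by norm_num
        _ ≤ _ := pow_le_pow_right₀ (by norm_num) (by omega)
    rw [← lN, show (2:ℝ) * Real.log ((4^(i+1):ℕ):ℝ) = Real.log (((4^(i+1):ℕ):ℝ)^2) by rw [Real.log_pow]; norm_num]
    apply Real.log_le_log (by positivity)
    nlinarith
  rw [lN] at hl
  set n : ℝ := ((i+1:ℕ):ℝ) with hn
  have hn0 : 0 ≤ n := by positivity
  set t : ℝ := (2:ℝ)^(i+1) with htt
  have ht1 : 1 ≤ t := one_le_pow₀ (by norm_num)
  have hN : ((4^(i+1):ℕ):ℝ) = t^2 := by push_cast; rw [htt, ← pow_mul, mul_comm, pow_mul]; norm_num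
  have hN4 : ((4^i:ℕ):ℝ) = t^2/4 := by rw [← hN]; push_cast; rw [pow_succ]; ring
  have h4i : (4:ℝ)^i = t^2/4 := by rw [← hN4]; push_cast; rfl
  rw [hN] at hl hsplit lN1
  rw [hN4] at hu hsplit
  rw [h4i]
  have e1 : n * t ≤ 1/100 * t * t := mul_le_mul_of_nonneg_right h1.le (by linarith)
  have e2 : n ≤ n * t := by nlinarith
  have e3 : n * Real.log 4 ≤ n * 1.4 := mul_le_mul_of_nonneg_left (by linarith) hn0
  have e4 : 2 * t * (n * Real.log 4) ≤ 2 * t * (n * 1.4) := mul_le_mul_of_nonneg_left e3 (by linarith)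
  have e5 : t^2 * Real.log 2 ≥ t^2 * 0.69 := mul_le_mul_of_nonneg_left (by linarith) (by positivity)
  rw [l4] at hu
  nlinarith

lemma mertens_lower (i0 a b : ℕ) (ha : i0 ≤ a) (h : ∀ i ≥ i0, (4:ℝ)^i ≤ ∑ n ∈ Ioc (4^i) (4^(i+1)), th n) :
    ((b:ℝ))/4 ≤ ∑ n ∈ Ioc (4^a) (4^(a+b)), th n / n := by
  induction b with
  | zero => simp
  | succ b ih =>
    rw [← Finset.sum_Ioc_consecutive (m := 4^a) (n := 4^(a+b)) (k := 4^(a+(b+1))) _ (Nat.pow_le_pow_right (by norm_num) (by omega)) (Nat.pow_le_pow_right (by norm_num) (by omega))]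
    have h1 := h (a+b) (by omega)
    have h2 : 1/4 ≤ ∑ n ∈ Ioc (4^(a+b)) (4^(a+(b+1))), th n / n := by
      calc (1/4:ℝ) = 4^(a+b) / 4^(a+b+1) := by rw [pow_succ]; field_simp
        _ ≤ (∑ n ∈ Ioc (4^(a+b)) (4^(a+b+1)), th n) / 4^(a+b+1) := by gcongr
        _ = ∑ n ∈ Ioc (4^(a+b)) (4^(a+b+1)), th n / 4^(a+b+1) := by rw [Finset.sum_div]
        _ ≤ _ := by
          refine Finset.sum_le_sum fun n hn => ?_
          rw [mem_Ioc] at hn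
          apply div_le_div_of_nonneg_left (th_nonneg n)
          · have : 0 < n := by omega
            exact_mod_cast this
          · exact_mod_cast hn.2
    push_cast
    linarith

lemma ML_lower : ∃ L : ℝ, ∀ ℓ ≥ L, ℓ/100 ≤ ML ℓ := by
  obtain ⟨i0, hi0⟩ := block_theta
  refine ⟨max 200 (16*(i0+1)), fun ℓ hℓ => ?_⟩
  have hℓ1 : 200 ≤ ℓ := (le_max_left _ _).trans hℓ
  have hℓ2 : 16*((i0:ℝ)+1) ≤ ℓ := (le_max_right _ _).trans hℓ
  have l2 := Real.log_two_gt_d9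
  have l2' := Real.log_two_lt_d9
  have l4 : Real.log 4 = 2 * Real.log 2 := by
    rw [show (4:ℝ) = 2^2 by norm_num, Real.log_pow]; norm_num
  set g4 := Real.log 4 with hl4
  have hp4 : 0 < g4 := by linarith
  set a := ⌈11*ℓ/(16*g4)⌉₊ with ha
  set b := ⌊13*ℓ/(16*g4)⌋₊ with hb
  have ha1 : 11*ℓ/(16*g4) ≤ a := Nat.le_ceil _
  have ha2 : (a:ℝ) < 11*ℓ/(16*g4) + 1 := Nat.ceil_lt_add_one (by positivity)
  have hb1 : (b:ℝ) ≤ 13*ℓ/(16*g4) := Nat.floor_le (by positivity)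
  have hb2 : 13*ℓ/(16*g4) < b + 1 := Nat.lt_floor_add_one _
  have hdiff : 13*ℓ/(16*g4) - 11*ℓ/(16*g4) = ℓ/(8*g4) := by field_simp; ring
  have hd2 : ℓ/12 ≤ ℓ/(8*g4) := by apply div_le_div_of_nonneg_left <;> linarith
  have hab : a ≤ b := by
    have : (a:ℝ) ≤ b := by linarith
    exact_mod_cast this
  obtain ⟨c, hc⟩ := Nat.exists_eq_add_of_le hab
  have hcr : (c:ℝ) = b - a := by rw [hc]; push_cast; ring
  have hai : i0 ≤ a := by
    have : (i0:ℝ) ≤ 11*ℓ/(16*g4) := by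
      rw [le_div_iff₀ (by positivity)]
      nlinarith
    exact_mod_cast this.trans ha1
  have hm := mertens_lower i0 a c hai hi0
  rw [← hc] at hm
  have h4e : ∀ m : ℕ, ((4^m:ℕ):ℝ) = Real.exp (m*g4) := by
    intro m
    push_cast
    rw [hl4, mul_comm, Real.exp_mul, Real.exp_log (by norm_num), Real.rpow_natCast]
  have hle : ∑ n ∈ Ioc (4^a) (4^b), th n / n ≤ ML ℓ := by
    unfold ML
    refine sum_le_inj _ _ _ _ id ?_ ?_ ?_ ?_
    all_goals try intro n hn
    · rw [mem_Ioc] at hn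
      rw [id, mem_range]
      unfold NL
      refine Nat.lt_succ_of_le (Nat.le_floor ?_)
      calc (n:ℝ) ≤ ((4^b:ℕ):ℝ) := by exact_mod_cast hn.2
        _ = _ := h4e b
        _ ≤ _ := Real.exp_le_exp.2 (by
          rw [le_div_iff₀ (by positivity)] at hb1
          nlinarith)
    · intro m _ h; exact h
    · exact mul_nonneg (th_nonneg n) (uu_nonneg ℓ n)
    · rw [mem_Ioc] at hn
      have hn0 : 0 < n := lt_of_le_of_lt (Nat.zero_le _) hn.1
      have hn0' : (0:ℝ) < n := by exact_mod_cast hn0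
      rw [div_eq_mul_inv]
      refine mul_le_mul_of_nonneg_left (le_of_eq ?_) (th_nonneg n)
      unfold uu
      have l1 : Real.log n ≤ b * g4 := by
        rw [Real.log_le_iff_le_exp hn0', ← h4e]; exact_mod_cast hn.2
      have l3 : a * g4 ≤ Real.log n := by
        rw [Real.le_log_iff_exp_le hn0', ← h4e]; exact_mod_cast hn.1.le
      rw [le_div_iff₀ (by positivity)] at hb1
      rw [div_le_iff₀ (by positivity)] at ha1
      rw [bmp.one_of_mem_closedBall, id, one_div]
      rw [Metric.mem_closedBall, Real.dist_eq, abs_le]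
      show -(1/16:ℝ) ≤ _ ∧ _ ≤ (1/16:ℝ)
      have u1 : 11/16 ≤ Real.log n / ℓ := by rw [le_div_iff₀ (by linarith)]; nlinarith
      have u2 : Real.log n / ℓ ≤ 13/16 := by rw [div_le_iff₀ (by linarith)]; nlinarith
      simp only [id]
      constructor <;> linarith
  linarith

end BG

namespace BG
open Finset

lemma sum_range_blocks (q M : ℕ) (F : ℕ → ℝ) :
    ∑ t ∈ range (M*q), F t = ∑ j ∈ range M, ∑ s ∈ range q, F (s + j*q) := by
  induction M with
  | zero => simp
  | succ M ih =>
    rw [Nat.succ_mul, sum_range_add, ih, Finset.sum_range_succ]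
    congr 1
    exact Finset.sum_congr rfl fun s _ => by rw [add_comm]

lemma ap_sum (q : ℕ) (hq : 0 < q) (G : ℕ → ℝ) (hG : Antitone G) (hG0 : ∀ t, 0 ≤ G t) (M : ℕ) (hGM : ∀ t, M ≤ t → G t = 0) (r : ℕ) :
    |∑ t ∈ (range M).filter (fun t => t ≡ r [MOD q]), G t - (1/(q:ℝ)) * ∑ t ∈ range M, G t| ≤ G 0 := by
  have hM : M ≤ M*q := Nat.le_mul_of_pos_right M hq
  have ext : ∀ F : ℕ → ℝ, (∀ t, M ≤ t → F t = 0) → ∑ t ∈ range M, F t = ∑ t ∈ range (M*q), F t := by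
    intro F hF
    refine Finset.sum_subset (range_subset_range.2 hM) fun t _ ht => hF t ?_
    simpa using ht
  set S : ℕ → ℝ := fun s => ∑ j ∈ range M, G (s + j*q) with hS
  have hSa : Antitone S := fun a b hab => Finset.sum_le_sum fun j _ => hG (by omega)
  have htel : S 0 - S q ≤ G 0 := by
    have : S 0 - S q = G 0 - G (M*q) := by
      simp only [hS, ← Finset.sum_sub_distrib]
      have := Finset.sum_range_sub' (fun j => G (j*q)) M
      simp only [zero_mul] at this
      rw [← this]
      refine Finset.sum_congr rfl fun j _ => ?_
      rw [zero_add, add_mul, one_mul, add_comm q]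
    rw [this]; have := hG0 (M*q); linarith
  have h1 : ∑ t ∈ (range M).filter (fun t => t ≡ r [MOD q]), G t = S (r % q) := by
    rw [Finset.sum_filter, ext _ (fun t ht => by rw [hGM t ht]; simp), sum_range_blocks]
    refine Finset.sum_congr rfl fun j _ => ?_
    rw [Finset.sum_eq_single (r % q)]
    · rw [if_pos]
      unfold Nat.ModEq; simp
    · intro s hs hne
      rw [if_neg]
      unfold Nat.ModEq
      rw [Nat.add_mul_mod_self_right, Nat.mod_eq_of_lt (mem_range.1 hs)]
      exact hne
    · intro h; exact absurd (mem_range.2 (Nat.mod_lt _ hq)) h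
  have h2 : ∑ t ∈ range M, G t = ∑ s ∈ range q, S s := by
    rw [ext _ hGM, sum_range_blocks, Finset.sum_comm]
  rw [h1, h2]
  have hqr : (0:ℝ) < q := by exact_mod_cast hq
  have hu : (1/(q:ℝ)) * ∑ s ∈ range q, S s ≤ S 0 := by
    rw [one_div, inv_mul_le_iff₀ hqr]
    calc _ ≤ ∑ s ∈ range q, S 0 := Finset.sum_le_sum fun s _ => hSa (Nat.zero_le _)
      _ = _ := by simp
  have hl : S q ≤ (1/(q:ℝ)) * ∑ s ∈ range q, S s := by
    rw [one_div, le_inv_mul_iff₀ hqr]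
    calc _ = ∑ s ∈ range q, S q := by simp
      _ ≤ _ := Finset.sum_le_sum fun s hs => hSa (mem_range.1 hs).le
  have a1 := hSa (Nat.zero_le (r % q))
  have a2 := hSa (Nat.mod_lt r hq).le
  rw [abs_le]; constructor <;> linarith

noncomputable def col (k W : ℕ) (P : Finset ℕ) (n : ℤ) (p : ↥P) : Option (Fin k) := by
  classical
  exact if h : ∃ i : Fin k, ((p:ℕ):ℤ) ∣ n + (i:ℕ)*(W:ℤ) then some h.choose else none

lemma fin_eq_of_dvd {k W p : ℕ} (hp : p.Prime) (hpW : ¬ p ∣ W) (hk : k ≤ p) (i j : Fin k)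
    (h : (p:ℤ) ∣ ((i:ℕ):ℤ)*W - ((j:ℕ):ℤ)*W) : i = j := by
  have h1 : (p:ℤ) ∣ (((i:ℕ):ℤ) - (j:ℕ)) * W := by convert h using 1; ring
  rcases (Nat.prime_iff_prime_int.1 hp).dvd_or_dvd h1 with h2 | h2
  · have h3 := Int.eq_zero_of_abs_lt_dvd h2 (by
      have := i.2; have := j.2
      rw [abs_lt]; constructor <;> omega)
    ext; omega
  · exact absurd (Int.natCast_dvd_natCast.1 h2) hpW

lemma col_spec {k W : ℕ} {P : Finset ℕ} (n : ℤ) (p : ↥P) (hp : (p:ℕ).Prime) (hpW : ¬ (p:ℕ) ∣ W) (hk : k ≤ p) (i : Fin k) :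
    some i = col k W P n p ↔ ((p:ℕ):ℤ) ∣ n + (i:ℕ)*(W:ℤ) := by
  unfold col
  constructor
  · intro h
    split_ifs at h with h1
    rw [Option.some.inj h]; exact h1.choose_spec
  · intro h
    have h1 : ∃ i : Fin k, ((p:ℕ):ℤ) ∣ n + (i:ℕ)*(W:ℤ) := ⟨i, h⟩
    rw [dif_pos h1]
    congr 1
    apply fin_eq_of_dvd hp hpW hk
    have := dvd_sub h h1.choose_spec
    rwa [add_sub_add_left_eq_sub] at this

open Classical in
lemma ps_prod {k W : ℕ} {P : Finset ℕ} (hP : ∀ p ∈ P, p.Prime ∧ ¬ p ∣ W ∧ k ≤ p) (n : ℤ) (e : ↥P → Option (Fin k)) :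
    ∏ p, ps (e p) (col k W P n p) = if (∀ p i, e p = some i → ((p:ℕ):ℤ) ∣ n + (i:ℕ)*(W:ℤ)) then 1 else 0 := by
  split_ifs with h
  · refine Finset.prod_eq_one fun p _ => ?_
    unfold ps
    split_ifs with h1 h2
    · rfl
    · rfl
    · exfalso
      obtain ⟨i, hi⟩ := Option.ne_none_iff_exists'.1 h1
      have := hP p p.2
      exact h2 (by rw [hi]; exact (col_spec n p this.1 this.2.1 this.2.2 i).2 (h p i hi))
  · push Not at h
    obtain ⟨p, i, hi, hd⟩ := h
    refine Finset.prod_eq_zero (mem_univ p) ?_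
    have := hP p p.2
    unfold ps
    rw [if_neg (by rw [hi]; simp), if_neg]
    rw [hi]; intro h; exact hd ((col_spec n p this.1 this.2.1 this.2.2 i).1 h)

lemma crt0 (W : ℕ) (w0 : ℕ) (A : Finset ℕ) (hA : ∀ p ∈ A, p.Prime ∧ ¬ p ∣ W) (r : ℕ → ℕ) :
    ∃ b : ℕ, ∀ m : ℕ, (m ≡ w0 [MOD W] ∧ ∀ p ∈ A, m ≡ r p [MOD p]) ↔ m ≡ b [MOD W * ∏ p ∈ A, p] := by
  induction A using Finset.induction_on with
  | empty => exact ⟨w0, fun m => by simp⟩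
  | insert p A hpA ih =>
    have hp := hA p (mem_insert_self _ _)
    have hA' : ∀ p ∈ A, p.Prime ∧ ¬ p ∣ W := fun q hq => hA q (mem_insert_of_mem hq)
    obtain ⟨b, hb⟩ := ih hA'
    have hc := cop_prod A hA' p hp.1 hp.2 hpA
    obtain ⟨b', hb1, hb2⟩ := Nat.chineseRemainder hc (r p) b
    refine ⟨b', fun m => ?_⟩
    rw [prod_insert hpA, show W * (p * ∏ q ∈ A, q) = p * (W * ∏ q ∈ A, q) by ring, ← Nat.modEq_and_modEq_iff_modEq_mul hc]
    rw [Finset.forall_mem_insert]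
    constructor
    · rintro ⟨h1, h2, h3⟩
      exact ⟨h2.trans hb1.symm, ((hb m).1 ⟨h1, h3⟩).trans hb2.symm⟩
    · rintro ⟨h1, h2⟩
      have := (hb m).2 (h2.trans hb2)
      exact ⟨this.1, h1.trans hb1, this.2⟩

lemma int_res (p : ℕ) (hp : 0 < p) (c : ℤ) (m : ℕ) : (p:ℤ) ∣ (m:ℤ) + c ↔ m ≡ ((-c) % p).toNat [MOD p] := by
  have h0 : (((-c) % p).toNat : ℤ) = (-c) % p := Int.toNat_of_nonneg (Int.emod_nonneg _ (by omega))
  rw [← Int.natCast_modEq_iff, h0]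
  have h1 : (-c) % (p:ℤ) ≡ -c [ZMOD p] := Int.mod_modEq _ _
  constructor
  · intro h
    refine Int.ModEq.trans ?_ h1.symm
    refine (Int.modEq_iff_dvd.2 ?_).symm
    convert h using 1; ring
  · intro h
    have := Int.modEq_iff_dvd.1 (h.trans h1).symm
    convert this using 1; ring

lemma crt1 {k : ℕ} (W : ℕ) (hW : 0 < W) (P : Finset ℕ) (hP : ∀ p ∈ P, p.Prime ∧ ¬ p ∣ W) (e : ↥P → Option (Fin k)) (s : ℤ) :
    ∃ b : ℕ, ∀ m : ℕ, ((W:ℤ) ∣ (m:ℤ) + (s - 1) ∧ ∀ p i, e p = some i → ((p:ℕ):ℤ) ∣ ((m:ℤ) + s) + (i:ℕ)*(W:ℤ)) ↔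
      m ≡ b [MOD W * ∏ p ∈ (sp e).map (Function.Embedding.subtype _), p] := by
  classical
  set A := (sp e).map (Function.Embedding.subtype (fun x => x ∈ P)) with hA
  have hAP : ∀ p ∈ A, p ∈ P := by
    intro p hp; rw [hA, mem_map] at hp
    obtain ⟨q, _, rfl⟩ := hp; exact q.2
  obtain ⟨b, hb⟩ := crt0 W ((-(s-1)) % W).toNat A (fun p hp => hP p (hAP p hp))
    (fun p => if h : p ∈ P then ((-(s + (((e ⟨p,h⟩).elim 0 (fun i => (i:ℕ)) : ℕ):ℤ) * W)) % p).toNat else 0)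
  refine ⟨b, fun m => ?_⟩
  rw [← hb, int_res W hW]
  refine and_congr_right fun _ => ?_
  constructor
  · intro h p hp
    have hpP := hAP p hp
    rw [dif_pos hpP, ← int_res p (hP p hpP).1.pos]
    have hne : e ⟨p, hpP⟩ ≠ none := by
      rw [hA, mem_map] at hp
      obtain ⟨q, hq, hqp⟩ := hp
      have : q = ⟨p, hpP⟩ := Subtype.ext hqp
      rw [← this]; exact (mem_sp e q).1 hq
    obtain ⟨i, hi⟩ := Option.ne_none_iff_exists'.1 hne
    have := h ⟨p, hpP⟩ i hi
    rw [hi]; convert this using 1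
    simp only [Option.elim]; ring
  · intro h p i hi
    have hpA : (p:ℕ) ∈ A := by
      rw [hA, mem_map]; exact ⟨p, (mem_sp e p).2 (by rw [hi]; simp), rfl⟩
    have := h p hpA
    rw [dif_pos p.2, ← int_res p (hP p p.2).1.pos] at this
    convert this using 1
    rw [show (⟨(p:ℕ), p.2⟩ : ↥P) = p from rfl, hi]
    simp only [Option.elim]; ring

end BG

namespace BG
open Finset

lemma prod_sp {k : ℕ} {P : Finset ℕ} (e : ↥P → Option (Fin k)) (g : ↥P → Option (Fin k) → ℝ) (h : ℕ → ℝ)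
    (hg : ∀ p, e p ≠ none → g p (e p) = h p) :
    ∏ p, (if e p = none then 1 else g p (e p)) = ∏ p ∈ (sp e).map (Function.Embedding.subtype (fun x => x ∈ P)), h p := by
  rw [Finset.prod_map]
  unfold sp
  rw [Finset.prod_filter]
  refine Finset.prod_congr rfl fun p _ => ?_
  by_cases h1 : e p = none
  · simp [h1]
  · rw [if_neg h1, if_pos h1, hg p h1]; rfl

lemma s1_comp (k J W X M : ℕ) (Λ : ℝ) (P : Finset ℕ) (hΛ : 0 ≤ Λ) (hW : 0 < W) (hX : 1 ≤ X)
    (hP : ∀ p ∈ P, p.Prime ∧ ¬ p ∣ W ∧ k ≤ p ∧ 3 ≤ p) :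
    |∑ t ∈ (range M).filter (fun t : ℕ => (W:ℤ) ∣ (t:ℤ) + ((X:ℤ)-1)), (1/((X+t:ℕ):ℝ)) * (ZP k J Λ P (col k W P ((t:ℤ)+X)))^2
      - ((1/(W:ℝ)) * ∑ t ∈ range M, 1/((X+t:ℕ):ℝ)) * ∑ σ : ↥P → Option (Fin k), (∏ p, w1 (qq P p) (σ p)) * (ZP k J Λ P σ)^2|
    ≤ (Mx k J Λ)^2 * ∑ A ∈ sub P (Real.exp (2*Λ)), (((k+1)^2:ℕ):ℝ)^A.card * (1/(X:ℝ)) := by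
  classical
  have hX0 : (0:ℝ) < X := by exact_mod_cast hX
  refine compP k J Λ P (fun p hp => ⟨(hP p hp).1, (hP p hp).2.2.2⟩) hΛ _ (fun t : ℕ => 1/((X+t:ℕ):ℝ))
    (fun t : ℕ => col k W P ((t:ℤ)+X)) (fun p o => w1 (qq P p) o) (fun p => w1_sum _) _ (fun _ => 1/(X:ℝ)) (fun _ => by positivity) ?_
  intro e he
  obtain ⟨b, hb⟩ := crt1 W hW P (fun p hp => ⟨(hP p hp).1, (hP p hp).2.1⟩) e (X:ℤ)
  set A := (sp e).map (Function.Embedding.subtype (fun x => x ∈ P)) with hA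
  have hAP : ∀ p ∈ A, p ∈ P := by
    intro p hp; rw [hA, mem_map] at hp
    obtain ⟨q, _, rfl⟩ := hp; exact q.2
  have hApos : 0 < ∏ p ∈ A, p := Finset.prod_pos fun p hp => (hP p (hAP p hp)).1.pos
  have hq : 0 < W * ∏ p ∈ A, p := Nat.mul_pos hW hApos
  set G : ℕ → ℝ := fun t => if t < M then 1/((X+t:ℕ):ℝ) else 0 with hG
  have hGn : ∀ t, 0 ≤ G t := by intro t; simp only [hG]; split_ifs <;> positivity
  have hGa : Antitone G := by
    intro a c hac
    by_cases hc : c < M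
    · simp only [hG]
      rw [if_pos hc, if_pos (lt_of_le_of_lt hac hc)]
      refine one_div_le_one_div_of_le (by positivity) ?_
      exact_mod_cast (by omega : X + a ≤ X + c)
    · have : G c = 0 := by simp only [hG]; rw [if_neg hc]
      rw [this]; exact hGn a
  have key := ap_sum (W * ∏ p ∈ A, p) hq G hGa hGn M (fun t ht => by simp only [hG]; rw [if_neg (by omega)]) b
  have e0 : G 0 ≤ 1/(X:ℝ) := by
    simp only [hG]; split_ifs
    · simp
    · positivity
  have e1 : ∑ t ∈ range M, G t = ∑ t ∈ range M, 1/((X+t:ℕ):ℝ) :=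
    Finset.sum_congr rfl fun t ht => by simp only [hG]; rw [if_pos (mem_range.1 ht)]
  have e2 : ∑ t ∈ (range M).filter (fun t => t ≡ b [MOD W * ∏ p ∈ A, p]), G t
      = ∑ t ∈ (range M).filter (fun t : ℕ => (W:ℤ) ∣ (t:ℤ) + ((X:ℤ)-1)), (1/((X+t:ℕ):ℝ)) * ∏ p, ps (e p) (col k W P ((t:ℤ)+X) p) := by
    rw [Finset.sum_filter, Finset.sum_filter]
    refine Finset.sum_congr rfl fun t ht => ?_
    rw [ps_prod (fun p hp => ⟨(hP p hp).1, (hP p hp).2.1, (hP p hp).2.2.1⟩)]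
    have hb := hb t
    simp only [hG]
    rw [if_pos (mem_range.1 ht)]
    by_cases h1 : (W:ℤ) ∣ (t:ℤ) + ((X:ℤ)-1)
    · by_cases h2 : ∀ p i, e p = some i → ((p:ℕ):ℤ) ∣ ((t:ℤ) + X) + (i:ℕ)*(W:ℤ)
      · rw [if_pos (hb.1 ⟨h1, h2⟩), if_pos h1, if_pos h2, mul_one]
      · rw [if_neg (fun h => h2 (hb.2 h).2), if_pos h1, if_neg h2, mul_zero]
    · rw [if_neg (fun h => h1 (hb.2 h).1), if_neg h1]
  have e3 : ∏ p, (if e p = none then 1 else w1 (qq P p) (e p)) = ∏ p ∈ A, (1/(p:ℝ)) := by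
    refine prod_sp e (fun p o => w1 (qq P p) o) (fun p => 1/(p:ℝ)) ?_
    intro p hp
    obtain ⟨i, hi⟩ := Option.ne_none_iff_exists'.1 hp
    rw [hi]; rfl
  rw [e1, e2] at key
  rw [e3]
  refine le_trans (le_of_eq ?_) (key.trans e0)
  congr 2
  rw [Finset.prod_div_distrib, Finset.prod_const_one]
  push_cast
  have : ((∏ p ∈ A, (p:ℝ))) ≠ 0 := by
    have : (0:ℝ) < ((∏ p ∈ A, p : ℕ):ℝ) := by exact_mod_cast hApos
    push_cast at this; exact this.ne'
  field_simp

lemma tot_prod {W : ℕ} (A : Finset ℕ) (hA : ∀ p ∈ A, p.Prime ∧ ¬ p ∣ W) :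
    ((W * ∏ p ∈ A, p).totient : ℝ) = W.totient * ∏ p ∈ A, ((p:ℝ)-1) := by
  induction A using Finset.induction_on with
  | empty => simp
  | insert p A hpA ih =>
    have hp := hA p (mem_insert_self _ _)
    have hA' : ∀ p ∈ A, p.Prime ∧ ¬ p ∣ W := fun q hq => hA q (mem_insert_of_mem hq)
    rw [prod_insert hpA, prod_insert hpA, show W * (p * ∏ q ∈ A, q) = p * (W * ∏ q ∈ A, q) by ring, Nat.totient_mul (cop_prod A hA' p hp.1 hp.2 hpA), Nat.totient_prime hp.1]
    rw [Nat.cast_mul, ih hA', Nat.cast_sub hp.1.one_le]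
    push_cast; ring

lemma s2_comp (k J W : ℕ) (ℓ : ℝ) (P : Finset ℕ) (hℓ : 20 ≤ ℓ) (hW : 0 < W) (hWℓ : (W:ℝ) ≤ Real.exp (ℓ/4))
    (hP : ∀ p ∈ P, p.Prime ∧ ¬ p ∣ W ∧ k ≤ p ∧ 3 ≤ p) (hPR : ∀ p ∈ P, (p:ℝ) ≤ Real.exp (ℓ/50)) (j : Fin k) :
    |∑ m ∈ (range (NL ℓ)).filter (fun m : ℕ => (W:ℤ) ∣ (m:ℤ) + (-((j:ℕ):ℤ)*W-1)), (th m * uu ℓ m) * (ZP k J (ℓ/50) P (col k W P ((m:ℤ)+ -((j:ℕ):ℤ)*W)))^2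
      - (ML ℓ / W.totient) * ∑ σ : ↥P → Option (Fin k), (∏ p, w2 j (qq P p) (σ p)) * (ZP k J (ℓ/50) P σ)^2|
    ≤ (Mx k J (ℓ/50))^2 * ∑ A ∈ sub P (Real.exp (2*(ℓ/50))), (((k+1)^2:ℕ):ℝ)^A.card * EB ℓ (W * ∏ p ∈ A, p) := by
  classical
  refine compP k J (ℓ/50) P (fun p hp => ⟨(hP p hp).1, (hP p hp).2.2.2⟩) (by linarith) _ (fun m : ℕ => th m * uu ℓ m)
    (fun m : ℕ => col k W P ((m:ℤ)+ -((j:ℕ):ℤ)*W)) (fun p o => w2 j (qq P p) o) (fun p => w2_sum _ _) _ (fun A => EB ℓ (W * ∏ p ∈ A, p)) (fun _ => EB_nonneg _ _) ?_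
  intro e he
  obtain ⟨b, hb⟩ := crt1 W hW P (fun p hp => ⟨(hP p hp).1, (hP p hp).2.1⟩) e (-((j:ℕ):ℤ)*W)
  set A := (sp e).map (Function.Embedding.subtype (fun x => x ∈ P)) with hA
  have hAP : ∀ p ∈ A, p ∈ P := by
    intro p hp; rw [hA, mem_map] at hp
    obtain ⟨q, _, rfl⟩ := hp; exact q.2
  have hApos : 0 < ∏ p ∈ A, p := Finset.prod_pos fun p hp => (hP p (hAP p hp)).1.pos
  have hq : 0 < W * ∏ p ∈ A, p := Nat.mul_pos hW hApos
  have e2 : ∑ m ∈ (range (NL ℓ)).filter (fun m => m ≡ b [MOD W * ∏ p ∈ A, p]), th m * uu ℓ m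
      = ∑ m ∈ (range (NL ℓ)).filter (fun m : ℕ => (W:ℤ) ∣ (m:ℤ) + (-((j:ℕ):ℤ)*W-1)), (th m * uu ℓ m) * ∏ p, ps (e p) (col k W P ((m:ℤ)+ -((j:ℕ):ℤ)*W) p) := by
    rw [Finset.sum_filter, Finset.sum_filter]
    refine Finset.sum_congr rfl fun t ht => ?_
    rw [ps_prod (fun p hp => ⟨(hP p hp).1, (hP p hp).2.1, (hP p hp).2.2.1⟩)]
    have hb := hb t
    by_cases h1 : (W:ℤ) ∣ (t:ℤ) + (-((j:ℕ):ℤ)*W-1)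
    · by_cases h2 : ∀ p i, e p = some i → ((p:ℕ):ℤ) ∣ ((t:ℤ) + -((j:ℕ):ℤ)*W) + (i:ℕ)*(W:ℤ)
      · rw [if_pos (hb.1 ⟨h1, h2⟩), if_pos h1, if_pos h2, mul_one]
      · rw [if_neg (fun h => h2 (hb.2 h).2), if_pos h1, if_neg h2, mul_zero]
    · rw [if_neg (fun h => h1 (hb.2 h).1), if_neg h1]
  rw [← e2]
  by_cases hj : ∃ p, e p = some j
  · obtain ⟨p, hp⟩ := hj
    have z1 : ∑ m ∈ (range (NL ℓ)).filter (fun m => m ≡ b [MOD W * ∏ p ∈ A, p]), th m * uu ℓ m = 0 := by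
      refine Finset.sum_eq_zero fun m hm => ?_
      rw [mem_filter] at hm
      have := ((hb m).2 hm.2).2 p j hp
      have hd : (p:ℕ) ∣ m := by
        apply Int.natCast_dvd_natCast.1
        convert this using 1; ring
      by_contra hne
      have hu := uu_ne_zero_exp (by linarith) (right_ne_zero_of_mul hne)
      have ht := left_ne_zero_of_mul hne
      have hpm : m.Prime := by
        by_contra h; apply ht; unfold th; rw [if_neg h]
      have hpp := (hP p p.2).1
      have heq := (Nat.prime_dvd_prime_iff_eq hpp hpm).1 hd
      have h3 := hPR p p.2
      rw [heq] at h3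
      have h4 : Real.exp (ℓ/50) ≤ Real.exp (5*ℓ/8) := Real.exp_le_exp.2 (by linarith)
      linarith [hu.1]
    have z2 : ∏ p, (if e p = none then 1 else w2 j (qq P p) (e p)) = 0 := by
      refine Finset.prod_eq_zero (mem_univ p) ?_
      rw [hp]; simp [w2]
    rw [z1, z2]; simpa using EB_nonneg _ _
  · push Not at hj
    have e3 : ∏ p, (if e p = none then 1 else w2 j (qq P p) (e p)) = ∏ p ∈ A, (1/((p:ℝ)-1)) := by
      refine prod_sp e (fun p o => w2 j (qq P p) o) (fun p => 1/((p:ℝ)-1)) ?_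
      intro p hp
      obtain ⟨i, hi⟩ := Option.ne_none_iff_exists'.1 hp
      have hij : i ≠ j := by rintro rfl; exact hj p hi
      rw [hi]; simp only [w2, if_neg hij]; rfl
    have hcop : b.Coprime (W * ∏ p ∈ A, p) := by
      have hbb := (hb b).2 (Nat.ModEq.refl b)
      refine Nat.Coprime.mul_right ?_ (Nat.Coprime.prod_right fun p hp => ?_)
      · refine Nat.isCoprime_iff_coprime.1 ?_
        obtain ⟨c, hc⟩ := hbb.1
        refine ⟨1, -(c + (j:ℕ)), ?_⟩
        linear_combination hc
      · have hpP := hAP p hp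
        have hpp := (hP p hpP)
        refine ((Nat.Prime.coprime_iff_not_dvd hpp.1).2 fun hd => ?_).symm
        have hne : e ⟨p, hpP⟩ ≠ none := by
          rw [hA, mem_map] at hp
          obtain ⟨q, hq, hqp⟩ := hp
          have : q = ⟨p, hpP⟩ := Subtype.ext hqp
          rw [← this]; exact (mem_sp e q).1 hq
        obtain ⟨i, hi⟩ := Option.ne_none_iff_exists'.1 hne
        have h1 := hbb.2 ⟨p, hpP⟩ i hi
        have h2 : (p:ℤ) ∣ ((i:ℕ):ℤ)*W - ((j:ℕ):ℤ)*W := by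
          change (p:ℤ) ∣ _ at h1
          obtain ⟨c1, hc1⟩ := h1
          obtain ⟨c2, hc2⟩ := Int.natCast_dvd_natCast.2 hd
          exact ⟨c1 - c2, by linear_combination hc1 - hc2⟩
        have := fin_eq_of_dvd hpp.1 hpp.2.1 hpp.2.2.1 i j h2
        rw [this] at hi; exact hj _ hi
    have hqx : ((W * ∏ p ∈ A, p : ℕ):ℝ) ≤ Real.exp (ℓ/2) := by
      have h1 := (mem_sub.1 he).2
      rw [Nat.cast_mul]
      calc (W:ℝ) * ((∏ p ∈ A, p : ℕ):ℝ) ≤ Real.exp (ℓ/4) * Real.exp (2*(ℓ/50)) := by gcongr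
        _ = Real.exp (ℓ/4 + 2*(ℓ/50)) := (Real.exp_add _ _).symm
        _ ≤ _ := Real.exp_le_exp.2 (by linarith)
    have key := EB_spec (W * ∏ p ∈ A, p) hq ℓ hℓ hqx b hcop
    rw [tot_prod A (fun p hp => ⟨(hP p (hAP p hp)).1, (hP p (hAP p hp)).2.1⟩)] at key
    rw [e3]
    refine le_trans (le_of_eq ?_) key
    congr 2
    rw [Finset.prod_div_distrib, Finset.prod_const_one]
    rw [div_mul_div_comm, mul_one]

end BG

namespace BG
open Finset

lemma arith (ℓ W φ S1 S2 s B j1 m kr M c1 Q1 : ℝ) (hℓ : 20 ≤ ℓ) (hW : 0 < W) (hφ : 0 < φ) (hS2 : 1 ≤ S2) (hs : 1 ≤ s)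
    (hB : 0 < B) (hm : 0 ≤ m) (hkr : 1 ≤ kr) (hj : 0 < j1) (h1 : j1 * (φ/W) * (ℓ/50)/16 ≤ S1) (h2 : S2 ≤ 4*B*(φ/W)*(ℓ/50))
    (hQ0 : 0 ≤ c1) (hQ1 : Q1 ≤ 2*(s*S2)) (hc1 : c1 ≤ 2*ℓ/W) (hM : ℓ/100 ≤ M) (hBk : B ≤ 64*kr*j1)
    (hjm : 8*655360000*(m+1) ≤ j1) (hWℓ : W*(kr+1) ≤ ℓ) :
    m*ℓ*(c1*Q1+1) < kr*(M/φ*(S1^2*s/2) - 1) := by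
  have hℓ0 : 0 < ℓ := by linarith
  set u := φ/W with hu
  have hu0 : 0 < u := by positivity
  have a1 : (j1*u*ℓ/800)^2 ≤ S1^2 := by
    apply pow_le_pow_left₀ (by positivity); linarith
  have b1 : S2*50/(4*B) ≤ u*ℓ := by
    rw [div_le_iff₀ (by positivity)]; linarith
  have b2 : j1^2*u*ℓ/640000*(S2*50/(4*B)) ≤ S1^2 := by
    refine le_trans ?_ a1
    calc j1^2*u*ℓ/640000*(S2*50/(4*B)) ≤ j1^2*u*ℓ/640000*(u*ℓ) := by gcongr
      _ = _ := by ring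
  have c2 : kr*((ℓ/100)/φ*((j1^2*u*ℓ/640000*(S2*50/(4*B)))*s/2)) ≤ kr*(M/φ*(S1^2*s/2)) := by
    have : 0 ≤ M/φ := div_nonneg (by linarith) hφ.le
    gcongr
  have c3 : kr*((ℓ/100)/φ*((j1^2*u*ℓ/640000*(S2*50/(4*B)))*s/2)) = (kr*j1/B)*j1*(ℓ*(ℓ/W)*(s*S2))/10240000 := by
    rw [hu]; field_simp; ring
  have c4 : 1/64 ≤ kr*j1/B := by
    rw [le_div_iff₀ hB]; linarith
  set Y := ℓ*(ℓ/W)*(s*S2) with hY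
  have hss : 1 ≤ s*S2 := by nlinarith
  have hY0 : 0 < Y := by positivity
  have c5 : 8*(m+1)*Y ≤ (kr*j1/B)*j1*Y/10240000 := by
    calc 8*(m+1)*Y = (1/64)*(8*655360000*(m+1))*Y/10240000 := by ring
      _ ≤ _ := by gcongr
  have d1 : m*ℓ*(c1*Q1) ≤ 4*m*Y := by
    calc m*ℓ*(c1*Q1) ≤ m*ℓ*(c1*(2*(s*S2))) := by gcongr
      _ ≤ m*ℓ*((2*ℓ/W)*(2*(s*S2))) := by gcongr
      _ = _ := by rw [hY]; ring
  have e1 : kr+1 ≤ ℓ/W := by rw [le_div_iff₀ hW]; linarith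
  have e2 : ℓ*(kr+1) ≤ Y := by
    calc ℓ*(kr+1) = ℓ*(kr+1)*1 := by ring
      _ ≤ ℓ*(ℓ/W)*(s*S2) := by gcongr
  have e3 : kr + ℓ ≤ ℓ*(kr+1) := by nlinarith
  have e4 : m*ℓ ≤ m*Y := by apply mul_le_mul_of_nonneg_left _ hm; linarith
  have e5 : 0 ≤ m*Y := by positivity
  nlinarith

lemma Mx_le (k J : ℕ) (ℓ : ℝ) (hℓ : 20 ≤ ℓ) : (Mx k J (ℓ/50))^2 ≤ (((2:ℝ)^(J+1))^k)^2 * ℓ^(4*k) := by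
  unfold Mx
  have : (2+ℓ/50)^(2*k) ≤ ℓ^(2*k) := by gcongr; linarith
  calc _ ≤ (((2:ℝ)^(J+1))^k * ℓ^(2*k))^2 := by gcongr
    _ = _ := by rw [mul_pow, ← pow_mul ℓ]; congr 2; ring

lemma err1 (k J : ℕ) : ∃ L : ℝ, ∀ ℓ ≥ L, 20 ≤ ℓ → ∀ P : Finset ℕ, (∀ p ∈ P, p.Prime) → ∀ X : ℕ, Real.exp (ℓ/2) ≤ X →
    (Mx k J (ℓ/50))^2 * ∑ A ∈ sub P (Real.exp (2*(ℓ/50))), (((k+1)^2:ℕ):ℝ)^A.card * (1/(X:ℝ)) ≤ 1 := by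
  obtain ⟨L, hL⟩ := exp_decay ((((2:ℝ)^(J+1))^k)^2) (4*k+(k+1)^2) (1/4) (by norm_num)
  refine ⟨L, fun ℓ hl h20 P hP X hX => ?_⟩
  refine le_trans ?_ (hL ℓ hl)
  have hX0 : (0:ℝ) < X := (Real.exp_pos _).trans_le hX
  set x := Real.exp (2*(ℓ/50)) with hx
  have hx1 : 1 ≤ x := Real.one_le_exp (by linarith)
  have h1 := sub_pow P hP x hx1 ((k+1)^2)
  rw [hx, Real.log_exp, ← hx] at h1
  have h2 : ∑ A ∈ sub P x, (((k+1)^2:ℕ):ℝ)^A.card * (1/(X:ℝ)) ≤ (x/X) * ∑ A ∈ sub P x, (((k+1)^2:ℕ):ℝ)^A.card/((∏ p ∈ A, p : ℕ):ℝ) := by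
    rw [Finset.mul_sum]
    refine Finset.sum_le_sum fun A hA => ?_
    rw [mem_sub] at hA
    have hp : (0:ℝ) < ((∏ p ∈ A, p : ℕ):ℝ) := by
      exact_mod_cast Finset.prod_pos fun p hp => (hP p (hA.1 hp)).pos
    rw [div_mul_div_comm, mul_one_div, div_le_div_iff₀ hX0 (by positivity)]
    calc (((k+1)^2:ℕ):ℝ)^A.card * (X * ((∏ p ∈ A, p : ℕ):ℝ)) ≤ (((k+1)^2:ℕ):ℝ)^A.card * (X * x) := by gcongr; exact hA.2
      _ = _ := by ring
  have h3 : x / X ≤ Real.exp (-(1/4*ℓ)) := by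
    rw [div_le_iff₀ hX0]
    calc x ≤ Real.exp (-(1/4*ℓ)) * Real.exp (ℓ/2) := by
          rw [hx, ← Real.exp_add]; exact Real.exp_le_exp.2 (by linarith)
      _ ≤ _ := by gcongr
  have h4 : (2 + 2*(ℓ/50))^((k+1)^2) ≤ ℓ^((k+1)^2) := by gcongr; linarith
  calc _ ≤ ((((2:ℝ)^(J+1))^k)^2 * ℓ^(4*k)) * (Real.exp (-(1/4*ℓ)) * ℓ^((k+1)^2)) := by
        refine mul_le_mul (Mx_le k J ℓ h20) ?_ ?_ (by positivity)
        · refine h2.trans (mul_le_mul h3 (h1.trans h4) ?_ (Real.exp_pos _).le)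
          positivity
        · positivity
    _ = _ := by rw [pow_add]; ring

lemma mass_le (ℓ : ℝ) (hℓ : 20 ≤ ℓ) (X : ℕ) (hX1 : 1 ≤ X) (hX : (X:ℝ) ≤ Real.exp (5*ℓ/8)) :
    ∑ t ∈ range (NL ℓ), 1/((X+t:ℕ):ℝ) ≤ 2*ℓ := by
  have h := sum_inv_le X (X + NL ℓ) hX1
  rw [Finset.sum_Ico_eq_sum_range, Nat.add_sub_cancel_left] at h
  refine h.trans ?_
  have h1 : ((X + NL ℓ : ℕ):ℝ) ≤ Real.exp (ℓ + 2) := by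
    unfold NL
    have h3 := Nat.floor_le (Real.exp_pos ℓ).le
    have h4 : Real.exp (5*ℓ/8) ≤ Real.exp ℓ := Real.exp_le_exp.2 (by linarith)
    have h5 := Real.add_one_le_exp ℓ
    have h6 := Real.add_one_le_exp (2:ℝ)
    push_cast
    rw [Real.exp_add]
    nlinarith
  have h2 : Real.log ((X + NL ℓ : ℕ):ℝ) ≤ ℓ + 2 := by
    rw [Real.log_le_iff_le_exp]
    · exact h1
    · exact_mod_cast (by omega : 0 < X + NL ℓ)
  linarith

lemma thuu_le {ℓ : ℝ} (hℓ : 20 ≤ ℓ) (n m : ℕ) (hn : 1 ≤ n) (hnm : n ≤ m) : th m * uu ℓ m ≤ if m.Prime then ℓ*(1/(n:ℝ)) else 0 := by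
  have hn0 : (0:ℝ) < n := by exact_mod_cast hn
  have hm0 : (0:ℝ) < m := by exact_mod_cast (by omega : 0 < m)
  have hnm' : (n:ℝ) ≤ m := by exact_mod_cast hnm
  by_cases hp : m.Prime
  · rw [if_pos hp]
    by_cases hu : uu ℓ m = 0
    · rw [hu, mul_zero]; positivity
    · have h1 := (uu_ne_zero_log (by linarith) hu).2
      have h2 : th m ≤ ℓ := by unfold th; rw [if_pos hp]; linarith
      have h3 : uu ℓ m ≤ 1/(n:ℝ) := by
        unfold uu
        exact div_le_div₀ zero_le_one bmp.le_one hn0 hnm'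
      exact mul_le_mul h2 h3 (uu_nonneg _ _) (by linarith)
  · rw [if_neg hp]; unfold th; rw [if_neg hp, zero_mul]

lemma thuu_sum {ℓ : ℝ} (hℓ : 20 ≤ ℓ) (k W n m : ℕ) (hW : 0 < W) (hn : 1 ≤ n)
    (hc : ((Icc n (n+k*W)).filter Nat.Prime).card ≤ m) :
    ∑ j : Fin k, th (n+j*W) * uu ℓ (n+j*W) ≤ m*ℓ*(1/(n:ℝ)) := by
  classical
  calc _ ≤ ∑ j : Fin k, if (n+j*W).Prime then ℓ*(1/(n:ℝ)) else 0 :=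
        Finset.sum_le_sum fun j _ => thuu_le hℓ n _ hn (by omega)
    _ = ((univ.filter (fun j : Fin k => (n+j*W).Prime)).card : ℝ) * (ℓ*(1/(n:ℝ))) := by
        rw [← Finset.sum_filter, Finset.sum_const, nsmul_eq_mul]
    _ ≤ m * (ℓ*(1/(n:ℝ))) := by
        refine mul_le_mul_of_nonneg_right ?_ (by positivity)
        have : (univ.filter (fun j : Fin k => (n+j*W).Prime)).card ≤ ((Icc n (n+k*W)).filter Nat.Prime).card := by
          refine Finset.card_le_card_of_injOn (fun j => n + j*W) ?_ ?_
          · intro j hj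
            simp only [coe_filter, mem_univ, true_and, Set.mem_ofPred_eq, mem_Icc] at hj ⊢
            refine ⟨⟨by omega, ?_⟩, hj⟩
            have := Nat.mul_le_mul_right W j.2.le
            omega
          · intro i _ j _ hij
            have : (i:ℕ)*W = j*W := by simpa using hij
            exact Fin.ext (Nat.eq_of_mul_eq_mul_right hW this)
        exact_mod_cast this.trans hc
    _ = _ := by ring

lemma shift_sum (k W X : ℕ) (ℓ : ℝ) (hℓ : 20 ≤ ℓ) (j : Fin k) (hX : ((X + k*W : ℕ):ℝ) ≤ Real.exp (5*ℓ/8)) (Z : ℤ → ℝ) (hZ : ∀ n, 0 ≤ Z n) :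
    ∑ m ∈ (range (NL ℓ)).filter (fun m : ℕ => (W:ℤ) ∣ (m:ℤ) + (-((j:ℕ):ℤ)*W-1)), (th m * uu ℓ m) * Z ((m:ℤ)+ -((j:ℕ):ℤ)*W)
    ≤ ∑ t ∈ (range (NL ℓ)).filter (fun t : ℕ => (W:ℤ) ∣ (t:ℤ) + ((X:ℤ)-1)), (th (X+t+j*W) * uu ℓ (X+t+j*W)) * Z ((t:ℤ)+X) := by
  classical
  set T := (range (NL ℓ)).filter (fun m : ℕ => (W:ℤ) ∣ (m:ℤ) + (-((j:ℕ):ℤ)*W-1)) with hT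
  have hbig : ∀ m ∈ T.filter (fun m => uu ℓ m ≠ 0), X + j*W ≤ m := by
    intro m hm
    rw [mem_filter] at hm
    have h1 := (uu_ne_zero_exp (by linarith) hm.2).1
    have h2 : X + k*W ≤ m := by exact_mod_cast hX.trans h1.le
    have := Nat.mul_le_mul_right W j.2.le
    omega
  have h0 : ∑ m ∈ T, (th m * uu ℓ m) * Z ((m:ℤ)+ -((j:ℕ):ℤ)*W) = ∑ m ∈ T.filter (fun m => uu ℓ m ≠ 0), (th m * uu ℓ m) * Z ((m:ℤ)+ -((j:ℕ):ℤ)*W) := by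
    symm
    refine Finset.sum_filter_of_ne fun m _ hne => ?_
    exact right_ne_zero_of_mul (left_ne_zero_of_mul hne)
  rw [h0]
  refine sum_le_inj _ _ _ _ (fun m => m - (X + j*W)) ?_ ?_ ?_ ?_
  · intro m hm
    have hb := hbig m hm
    obtain ⟨t, rfl⟩ := Nat.exists_eq_add_of_le hb
    rw [mem_filter, hT, mem_filter, mem_range] at hm
    simp only [Nat.add_sub_cancel_left]
    rw [mem_filter, mem_range]
    refine ⟨by omega, ?_⟩
    have := hm.1.2
    convert this using 1; push_cast; ring
  · intro m hm n hn h
    have := hbig m hm; have := hbig n hn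
    omega
  · intro t _
    exact mul_nonneg (mul_nonneg (th_nonneg _) (uu_nonneg _ _)) (hZ _)
  · intro m hm
    have hb := hbig m hm
    obtain ⟨t, rfl⟩ := Nat.exists_eq_add_of_le hb
    simp only [Nat.add_sub_cancel_left]
    rw [show X + j*W + t = X + t + j*W by ring]
    refine le_of_eq ?_
    congr 2; push_cast; ring

end BG

namespace BG
open Finset

lemma pow_ge (J : ℕ) (hJ : 9 ≤ J) : 32*(J+1) ≤ 2^J := by
  induction J, hJ using Nat.le_induction with
  | base => norm_num
  | succ n hn ih => rw [pow_succ]; omega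

lemma choose_k (J : ℕ) (hJ : 9 ≤ J) : ∃ k : ℕ, 1 ≤ k ∧ 64*k*(J+1) ≤ 3*2^J ∧ 2^J ≤ 64*k*(J+1) := by
  have h := pow_ge J hJ
  set B := 2^J
  have hp : 0 < 32*(J+1) := by omega
  refine ⟨B/(32*(J+1)), ?_, ?_, ?_⟩
  · exact (Nat.one_le_div_iff hp).2 h
  · have := Nat.div_mul_le_self B (32*(J+1))
    nlinarith
  · have h1 := Nat.lt_div_mul_add (a := B) hp
    have h2 : 1 ≤ B/(32*(J+1)) := (Nat.one_le_div_iff hp).2 h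
    nlinarith

lemma primorial_dvd_of (D p : ℕ) (hp : p.Prime) (h : ¬ p ∣ primorial D) : D < p := by
  by_contra hle
  push Not at hle
  apply h
  unfold primorial
  exact Finset.dvd_prod_of_mem (fun p => p) (by simp [hp]; omega)

lemma aux_D (k : ℕ) : k + 3 ≤ 4*((k+1)^2)^2 := by
  have h1 : k + 1 ≤ (k+1)^2 := Nat.le_self_pow (by norm_num) _
  have h2 : (k+1)^2 ≤ ((k+1)^2)^2 := Nat.le_self_pow (by norm_num) _
  omega

lemma aux_X (X E F l kW : ℝ) (hX : X < E + 1) (hE : 1 ≤ E) (hF : l + 1 ≤ F) (h : kW + 1 ≤ l) (h0 : 0 ≤ kW) : X + kW ≤ E * F := by nlinarith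

lemma aux_W (k W : ℝ) (h : 1 ≤ k) (hW : 1 ≤ W) : W ≤ k*W := by nlinarith

theorem maynard (m : ℕ) : ∃ H : ℕ, ∀ N : ℕ, ∃ n ≥ N, m ≤ ((Finset.Icc n (n+H)).filter Nat.Prime).card := by
  obtain ⟨J, hJm, hJ9⟩ : ∃ J : ℕ, 8*655360000*(m+1) ≤ J + 1 ∧ 9 ≤ J :=
    ⟨8*655360000*(m+1) + 9, by omega, by omega⟩
  obtain ⟨k, hk, hkJ, hBk⟩ := choose_k J hJ9
  obtain ⟨D0, hD0⟩ : ∃ D0 : ℕ, D0 = 4*((k+1)^2)^2 := ⟨_, rfl⟩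
  obtain ⟨W, hWd⟩ : ∃ W : ℕ, W = primorial D0 := ⟨_, rfl⟩
  have hW : 0 < W := hWd ▸ primorial_pos D0
  have hWr : (0:ℝ) < W := by exact_mod_cast hW
  have hW1 : (1:ℝ) ≤ W := by exact_mod_cast hW
  have hkr : (1:ℝ) ≤ k := by exact_mod_cast hk
  refine ⟨k*W, fun N => ?_⟩
  by_contra hcon
  push Not at hcon
  obtain ⟨L1, hL1⟩ := err1 k J
  obtain ⟨L2, hL2⟩ := ML_lower
  set C : ℝ := (((2:ℝ)^(J+1))^k)^2 with hC
  have hC0 : 0 < C := by positivity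
  set L0 : ℝ := |L1| + |L2| + C + 2*N + 50*(4*2^J)*((W+1)*W) + 8*(k*W+1) + W*(k+1) with hL0
  have p1 : 0 ≤ |L1| := abs_nonneg _
  have p2 : 0 ≤ |L2| := abs_nonneg _
  have p3 : (0:ℝ) ≤ 2*N := by positivity
  have p4 : (0:ℝ) ≤ 50*(4*2^J)*((W+1)*W) := by positivity
  have p5 : (0:ℝ) ≤ 8*(k*W+1) := by positivity
  have p6 : (0:ℝ) ≤ W*(k+1) := by positivity
  have p7 := le_abs_self L1
  have p8 := le_abs_self L2
  obtain ⟨ℓ, hℓL, h20, hEH⟩ := EH ((k+1)^2) D0 W (Nat.one_le_pow _ _ (by omega)) hD0.ge hW (4*k+1) L0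
  have hℓ0 : 0 < ℓ := by linarith
  set P := PP W (Real.exp (ℓ/50)) with hPd
  have hPm : ∀ p ∈ P, p.Prime ∧ ¬ p ∣ W ∧ (p:ℝ) ≤ Real.exp (ℓ/50) := by
    intro p hp; exact (mem_PP (Real.exp_pos _).le).1 hp
  have hPD : ∀ p ∈ P, D0 < p := by
    intro p hp
    have := hPm p hp
    exact primorial_dvd_of D0 p this.1 (hWd ▸ this.2.1)
  have hDk : k + 3 ≤ D0 := by
    rw [hD0]; exact aux_D k
  have hP4 : ∀ p ∈ P, p.Prime ∧ ¬ p ∣ W ∧ k ≤ p ∧ 3 ≤ p := by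
    intro p hp
    have h1 := hPm p hp
    have h2 := hPD p hp
    exact ⟨h1.1, h1.2.1, by omega, by omega⟩
  obtain ⟨S1, S2, hS1, hS2, hS21, hQ1, hQ2⟩ := cores k D0 W J (ℓ/50) hk hD0.ge hkJ hW
    (by rw [le_div_iff₀ (by positivity)]; linarith) P hPd hPD
  set X := ⌈Real.exp (ℓ/2)⌉₊ with hX
  have hXge : Real.exp (ℓ/2) ≤ X := Nat.le_ceil _
  have hXle : (X:ℝ) < Real.exp (ℓ/2) + 1 := Nat.ceil_lt_add_one (Real.exp_pos _).le
  have hexp := Real.add_one_le_exp (ℓ/2)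
  have hX1 : 1 ≤ X := by
    have : (1:ℝ) ≤ X := by linarith
    exact_mod_cast this
  have hXN : N ≤ X := by
    have : (N:ℝ) ≤ X := by linarith
    exact_mod_cast this
  have hXk : ((X + k*W : ℕ):ℝ) ≤ Real.exp (5*ℓ/8) := by
    have h1 : Real.exp (5*ℓ/8) = Real.exp (ℓ/2) * Real.exp (ℓ/8) := by rw [← Real.exp_add]; congr 1; ring
    have h2 := Real.add_one_le_exp (ℓ/8)
    have h3 : (1:ℝ) ≤ Real.exp (ℓ/2) := by linarith
    push_cast
    rw [h1]
    have h4 : (k:ℝ)*W+1 ≤ ℓ/8 := by linarith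
    exact aux_X _ _ _ _ _ hXle h3 h2 h4 (by positivity)
  have hXX : (X:ℝ) ≤ Real.exp (5*ℓ/8) := by
    refine le_trans ?_ hXk
    exact_mod_cast (by omega : X ≤ X + k*W)
  have hWexp : (W:ℝ) ≤ Real.exp (ℓ/4) := by
    have h1 := Real.add_one_le_exp (ℓ/4)
    have h2 : (W:ℝ) ≤ k*W := aux_W _ _ hkr hW1
    linarith
  -- first moment
  have A1 := s1_comp k J W X (NL ℓ) (ℓ/50) P (by linarith) hW hX1 hP4
  have A2 := A1.trans (hL1 ℓ (by linarith) h20 P (fun p hp => (hPm p hp).1) X hXge)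
  set Q1 := ∑ σ : ↥P → Option (Fin k), (∏ p, w1 (qq P p) (σ p)) * (ZP k J (ℓ/50) P σ)^2 with hQ1d
  set c1 := (1/(W:ℝ)) * ∑ t ∈ range (NL ℓ), 1/((X+t:ℕ):ℝ) with hc1
  have hc1le : c1 ≤ 2*ℓ/W := by
    rw [hc1, one_div, inv_mul_eq_div]
    gcongr
    exact mass_le ℓ h20 X hX1 hXX
  have hc10 : 0 ≤ c1 := by positivity
  set T := (range (NL ℓ)).filter (fun t : ℕ => (W:ℤ) ∣ (t:ℤ) + ((X:ℤ)-1)) with hT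
  set Z : ℤ → ℝ := fun n => (ZP k J (ℓ/50) P (col k W P n))^2 with hZ
  have hZ0 : ∀ n, 0 ≤ Z n := fun n => sq_nonneg _
  have A3 : ∑ t ∈ T, (1/((X+t:ℕ):ℝ)) * Z ((t:ℤ)+X) ≤ c1*Q1 + 1 := by
    have := (abs_le.1 A2).2
    simp only [hZ]; linarith
  -- second moment
  have hE := hEH P (fun p hp => ⟨(hPm p hp).1, hPD p hp, (hPm p hp).2.1⟩)
  have hErr : (Mx k J (ℓ/50))^2 * ∑ A ∈ sub P (Real.exp (2*(ℓ/50))), (((k+1)^2:ℕ):ℝ)^A.card * EB ℓ (W * ∏ p ∈ A, p) ≤ 1 := by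
    rw [show 2*(ℓ/50) = ℓ/25 by ring]
    set E := ∑ A ∈ sub P (Real.exp (ℓ/25)), (((k+1)^2:ℕ):ℝ)^A.card * EB ℓ (W * ∏ p ∈ A, p) with hEd
    have hE0 : 0 ≤ E := Finset.sum_nonneg fun A _ => mul_nonneg (by positivity) (EB_nonneg _ _)
    calc (Mx k J (ℓ/50))^2 * E ≤ (C * ℓ^(4*k)) * E := mul_le_mul_of_nonneg_right (Mx_le k J ℓ h20) hE0
      _ ≤ (ℓ * ℓ^(4*k)) * E := by gcongr; linarith
      _ = E * ℓ^(4*k+1) := by ring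
      _ ≤ 1 := hE
  have B1 : ∀ j : Fin k, ML ℓ / W.totient * (S1^2*S2^(k-1)/2) - 1 ≤
      ∑ t ∈ T, (th (X+t+j*W) * uu ℓ (X+t+j*W)) * Z ((t:ℤ)+X) := by
    intro j
    have h1 := (s2_comp k J W ℓ P h20 hW hWexp hP4 (fun p hp => (hPm p hp).2.2) j).trans hErr
    have h2 := (abs_le.1 h1).1
    have h3 := shift_sum k W X ℓ h20 j hXk Z hZ0
    have hML0 : 0 ≤ ML ℓ / W.totient := by
      have := hL2 ℓ (by linarith)
      apply div_nonneg
      · linarith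
      · positivity
    have h4 := mul_le_mul_of_nonneg_left (hQ2 j) hML0
    simp only [hZ] at h3 ⊢
    linarith
  have B2 : k * (ML ℓ / W.totient * (S1^2*S2^(k-1)/2) - 1) ≤ m*ℓ*(c1*Q1+1) := by
    calc k * (ML ℓ / W.totient * (S1^2*S2^(k-1)/2) - 1)
        = ∑ j : Fin k, (ML ℓ / W.totient * (S1^2*S2^(k-1)/2) - 1) := by
          rw [Finset.sum_const, Finset.card_univ, Fintype.card_fin, nsmul_eq_mul]
      _ ≤ ∑ j : Fin k, ∑ t ∈ T, (th (X+t+j*W) * uu ℓ (X+t+j*W)) * Z ((t:ℤ)+X) := Finset.sum_le_sum fun j _ => B1 j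
      _ = ∑ t ∈ T, (∑ j : Fin k, th (X+t+j*W) * uu ℓ (X+t+j*W)) * Z ((t:ℤ)+X) := by
          rw [Finset.sum_comm]
          exact Finset.sum_congr rfl fun t _ => (Finset.sum_mul _ _ _).symm
      _ ≤ ∑ t ∈ T, (m*ℓ*(1/((X+t:ℕ):ℝ))) * Z ((t:ℤ)+X) := by
          refine Finset.sum_le_sum fun t _ => mul_le_mul_of_nonneg_right ?_ (hZ0 _)
          exact thuu_sum h20 k W (X+t) m hW (by omega) (hcon (X+t) (by omega)).le
      _ = m*ℓ*∑ t ∈ T, (1/((X+t:ℕ):ℝ)) * Z ((t:ℤ)+X) := by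
          rw [Finset.mul_sum]; exact Finset.sum_congr rfl fun t _ => by ring
      _ ≤ _ := by gcongr
  have hS2k : S2^k = S2^(k-1)*S2 := by
    rw [← pow_succ]; congr 1; omega
  have hfin := arith ℓ W W.totient S1 S2 (S2^(k-1)) (2^J) (J+1) m k (ML ℓ) c1 Q1 h20 hWr
    (by exact_mod_cast Nat.totient_pos.2 hW) hS21 (one_le_pow₀ hS21) (by positivity) (by positivity) hkr (by positivity)
    hS1 hS2 hc10 (by rw [← hS2k]; exact hQ1) hc1le (hL2 ℓ (by linarith)) (by exact_mod_cast hBk) (by exact_mod_cast hJm)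
    (by linarith)
  linarith

end BG

namespace BG

lemma factorizationType_sum (f : Polynomial ℤ) (hm : f.Monic) (p : ℕ) (hp : p.Prime) :
    (factorizationType f p hp).sum = f.natDegree := by
  haveI : Fact p.Prime := ⟨hp⟩
  have hfm : (f.map (Int.castRingHom (ZMod p))).Monic := hm.map _
  have h0 : f.map (Int.castRingHom (ZMod p)) ≠ 0 := hfm.ne_zero
  have h1 := UniqueFactorizationMonoid.prod_normalizedFactors_eq h0
  rw [hfm.normalize_eq_self] at h1
  unfold factorizationType
  rw [← Polynomial.natDegree_multiset_prod _ (UniqueFactorizationMonoid.zero_notMem_normalizedFactors _), h1,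
    hm.natDegree_map]

lemma factorizationType_pos (f : Polynomial ℤ) (hm : f.Monic) (p : ℕ) (hp : p.Prime) :
    ∀ i ∈ factorizationType f p hp, 0 < i := by
  haveI : Fact p.Prime := ⟨hp⟩
  intro i hi
  unfold factorizationType at hi
  obtain ⟨g, hg, rfl⟩ := Multiset.mem_map.1 hi
  exact (UniqueFactorizationMonoid.irreducible_of_normalized_factor g hg).natDegree_pos

lemma final_of_maynard
    (may : ∀ m : ℕ, ∃ H : ℕ, ∀ N : ℕ, ∃ n ≥ N, m ≤ ((Finset.Icc n (n+H)).filter Nat.Prime).card)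
    (f : Polynomial ℤ) (hmonic : f.Monic) :
    ∃ c : ℝ, 1 < c ∧
      {pq : ℕ × ℕ | ∃ (h1 : pq.1.Prime) (h2 : pq.2.Prime), pq.1 ≠ pq.2 ∧
        |(pq.1 : ℝ) - (pq.2 : ℝ)| ≤ c ∧
        factorizationType f pq.1 h1 = factorizationType f pq.2 h2}.Infinite := by
  classical
  obtain ⟨H, hH⟩ := may (Fintype.card (Nat.Partition f.natDegree) + 1)
  refine ⟨H + 2, by have : (0:ℝ) ≤ H := by positivity
                    linarith, ?_⟩
  have key : ∀ N : ℕ, ∃ pq : ℕ × ℕ, N ≤ pq.1 ∧ ∃ (h1 : pq.1.Prime) (h2 : pq.2.Prime), pq.1 ≠ pq.2 ∧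
        |(pq.1 : ℝ) - (pq.2 : ℝ)| ≤ H + 2 ∧
        factorizationType f pq.1 h1 = factorizationType f pq.2 h2 := by
    intro N
    obtain ⟨n, hn, hc⟩ := hH N
    let g : ℕ → Nat.Partition f.natDegree := fun p =>
      if hp : p.Prime then ⟨factorizationType f p hp, fun hi => factorizationType_pos f hmonic p hp _ hi,
        factorizationType_sum f hmonic p hp⟩ else Nat.Partition.indiscrete _
    obtain ⟨p, hp, q, hq, hne, hpq⟩ := Finset.exists_ne_map_eq_of_card_lt_of_maps_to
      (s := (Finset.Icc n (n+H)).filter Nat.Prime) (t := (Finset.univ : Finset (Nat.Partition f.natDegree)))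
      (by rw [Finset.card_univ]; omega) (f := g) (fun _ _ => Finset.mem_coe.2 (Finset.mem_univ _))
    rw [Finset.mem_filter, Finset.mem_Icc] at hp hq
    refine ⟨(p, q), by simp; omega, hp.2, hq.2, hne, ?_, ?_⟩
    · have a1 : (n:ℝ) ≤ p := by exact_mod_cast hp.1.1
      have a2 : (p:ℝ) ≤ n + H := by exact_mod_cast hp.1.2
      have a3 : (n:ℝ) ≤ q := by exact_mod_cast hq.1.1
      have a4 : (q:ℝ) ≤ n + H := by exact_mod_cast hq.1.2
      rw [abs_le]; constructor <;> simp <;> linarith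
    · have := congrArg Nat.Partition.parts hpq
      simpa [g, hp.2, hq.2] using this
  intro hfin
  obtain ⟨B, hB⟩ := (hfin.image Prod.fst).bddAbove
  obtain ⟨pq, h1, h2⟩ := key (B+1)
  have := hB ⟨pq, h2, rfl⟩
  omega

end BG

theorem bounded_gaps_same_factorization_type
    (f : Polynomial ℤ) (hmonic : f.Monic)
    (hirr : Irreducible (f.map (Int.castRingHom ℚ))) :
    ∃ c : ℝ, 1 < c ∧
      {pq : ℕ × ℕ | ∃ (h1 : pq.1.Prime) (h2 : pq.2.Prime), pq.1 ≠ pq.2 ∧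
        |(pq.1 : ℝ) - (pq.2 : ℝ)| ≤ c ∧
        factorizationType f pq.1 h1 = factorizationType f pq.2 h2}.Infinite := by
  exact BG.final_of_maynard BG.maynard f hmonic
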